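/- Let f be a nonconstant real analytic function on 𝕋 and consider on ℓ²(ℤ^d) the operator H_ω = Δ + λV with potential V_n = λ f(n·ω), n ∈ ℤ^d, ω ∈ ℝ^d, where Δ is the lattice Laplacian. For every ε > 0 there exists λ₀ = λ₀(f,ε) such that for every λ > λ₀ there is a set Ω = Ω(λ,f) ⊂ 𝕋^d of Lebesgue measure less than ε such that for every ω ∉ Ω the operator H_ω exhibits Anderson localization. -/

import Mathlib

open MeasureTheory Filter

noncomputable section

/-- The eigenvalue equation `(Δψ)(n) + V_n ψ(n) = E ψ(n)` on `ℤ^d`, where `Δ` is the lattice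
Laplacian (adjacency operator of the `ℓ¹`-nearest-neighbor graph). -/
def LatticeEigenEq (d : ℕ) (V : (Fin d → ℤ) → ℝ) (ψ : (Fin d → ℤ) → ℂ) (E : ℝ) : Prop :=
  ∀ n : Fin d → ℤ,
    (∑ i : Fin d, (ψ (Function.update n i (n i + 1)) + ψ (Function.update n i (n i - 1))))
      + ((V n : ℝ) : ℂ) * ψ n = (E : ℂ) * ψ n

/-- `ψ : ℤ^d → ℂ` decays exponentially. -/
def ExpDecayLattice (d : ℕ) (ψ : (Fin d → ℤ) → ℂ) : Prop :=
  ∃ C : ℝ, 0 < C ∧ ∃ α : ℝ, 0 < α ∧ ∀ n : Fin d → ℤ,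
    ‖ψ n‖ ≤ C * Real.exp (-α * (∑ i, |(n i : ℝ)|))

namespace AL
open Metric in
/-- Dividing out the zeros in the disc of radius `1/2` by Blaschke factors. -/
lemma exists_blaschke_factorization (M : ℝ) (N : ℕ) : ∀ (g : ℂ → ℂ),
    DifferentiableOn ℂ g (ball 0 2) → (∀ z, ‖z‖ = 1 → ‖g z‖ ≤ Real.exp M) →
    Real.exp M < 2 ^ N * ‖g 0‖ →
    ∃ (m : ℕ) (a : Fin m → ℂ) (h : ℂ → ℂ), m ≤ N ∧ (∀ i, ‖a i‖ ≤ 1 / 2) ∧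
      DifferentiableOn ℂ h (ball 0 2) ∧ (∀ z, ‖z‖ = 1 → ‖h z‖ ≤ Real.exp M) ∧
      ‖g 0‖ ≤ ‖h 0‖ ∧ (∀ z, ‖z‖ ≤ 1 / 2 → h z ≠ 0) ∧
      ∀ z, ‖z‖ ≤ 1 / 2 → ‖h z‖ * ∏ i, (‖z - a i‖ / 2) ≤ ‖g z‖ := by
  induction N with
  | zero =>
    intro g hg hb h0
    exfalso
    have h1 : ‖g 0‖ ≤ Real.exp M := by
      refine Complex.norm_le_of_forall_mem_frontier_norm_le (U := ball (0:ℂ) 1) isBounded_ball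
        (DifferentiableOn.diffContOnCl ?_) ?_ (by simp [closure_ball])
      · rw [closure_ball _ (by norm_num)]
        exact hg.mono (closedBall_subset_ball (by norm_num))
      · intro z hz
        rw [frontier_ball _ (by norm_num)] at hz
        exact hb z (by simpa using hz)
    simp at h0; linarith
  | succ N ih =>
    intro g hg hb h0
    by_cases hz : ∀ z, ‖z‖ ≤ 1 / 2 → g z ≠ 0
    · exact ⟨0, Fin.elim0, g, by simp, fun i => i.elim0, hg, hb, le_rfl, hz, by simp⟩
    push Not at hz
    obtain ⟨a, ha, hga⟩ := hz
    have ha2 : ball (0:ℂ) 2 ∈ nhds a :=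
      isOpen_ball.mem_nhds (by simp; linarith)
    have key : ∀ z, g z = (z - a) * dslope g a z := by
      intro z
      have := sub_smul_dslope g a z
      rw [hga, sub_zero, smul_eq_mul] at this
      exact this.symm
    have hbl : ∀ z : ℂ, ‖z‖ ≤ 1 → ‖1 - starRingEnd ℂ a * z‖ ≤ 2 := by
      intro z hz
      calc ‖1 - starRingEnd ℂ a * z‖ ≤ ‖(1:ℂ)‖ + ‖starRingEnd ℂ a * z‖ := norm_sub_le _ _
        _ = 1 + ‖a‖ * ‖z‖ := by simp
        _ ≤ 2 := by nlinarith [norm_nonneg a, norm_nonneg z]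
    have hbl1 : ∀ z : ℂ, ‖z‖ = 1 → ‖1 - starRingEnd ℂ a * z‖ = ‖z - a‖ := by
      intro z hz
      have hzz : z * starRingEnd ℂ z = 1 := by
        rw [Complex.mul_conj, Complex.normSq_eq_norm_sq, hz]; simp
      have : 1 - starRingEnd ℂ a * z = z * starRingEnd ℂ (z - a) := by
        rw [map_sub, mul_sub, hzz]; ring
      rw [this, norm_mul, hz, one_mul, RCLike.norm_conj]
    have hg1 : DifferentiableOn ℂ (fun z => dslope g a z * (1 - starRingEnd ℂ a * z)) (ball 0 2) := by
      refine ((Complex.differentiableOn_dslope ha2).2 hg).mul ?_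
      fun_prop
    have hb1 : ∀ z, ‖z‖ = 1 → ‖dslope g a z * (1 - starRingEnd ℂ a * z)‖ ≤ Real.exp M := by
      intro z hz
      rw [norm_mul, hbl1 z hz, mul_comm, ← norm_mul, ← key]
      exact hb z hz
    have h01 : 2 * ‖g 0‖ ≤ ‖dslope g a 0 * (1 - starRingEnd ℂ a * 0)‖ := by
      have := key 0
      rw [this]
      simp only [zero_sub, norm_mul, norm_neg, mul_zero, sub_zero, mul_one]
      nlinarith [norm_nonneg (dslope g a 0)]
    obtain ⟨m, b, h, hm, hbb, hh, hhb, hh0, hhz, hprod⟩ := ih _ hg1 hb1 (by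
      rw [pow_succ] at h0
      have : (0:ℝ) < 2 ^ N := by positivity
      nlinarith)
    refine ⟨m + 1, Fin.cons a b, h, by omega, ?_, hh, hhb, ?_, hhz, ?_⟩
    · intro i
      refine Fin.cases ?_ (fun j => ?_) i
      · simpa using ha
      · simpa using hbb j
    · nlinarith [norm_nonneg (g 0)]
    · intro z hz
      rw [Fin.prod_univ_succ]
      simp only [Fin.cons_zero, Fin.cons_succ]
      calc ‖h z‖ * (‖z - a‖ / 2 * ∏ i, (‖z - b i‖ / 2))
          = (‖h z‖ * ∏ i, (‖z - b i‖ / 2)) * (‖z - a‖ / 2) := by ring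
        _ ≤ ‖dslope g a z * (1 - starRingEnd ℂ a * z)‖ * (‖z - a‖ / 2) := by
            gcongr; exact hprod z hz
        _ ≤ (‖dslope g a z‖ * 2) * (‖z - a‖ / 2) := by
            rw [norm_mul]; gcongr; exact hbl z (by linarith)
        _ = ‖g z‖ := by rw [key z, norm_mul]; ring

open Metric in
/-- A nonvanishing holomorphic function, bounded above and not too small at the centre, is not too
small on a smaller disc. -/
lemma nonvanishing_lower_bound (h : ℂ → ℂ) (M : ℝ) (hM : 0 < M)
    (hh : DifferentiableOn ℂ h (ball 0 (1/2))) (hb : ∀ z ∈ ball (0:ℂ) (1/2), ‖h z‖ ≤ Real.exp M)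
    (h0 : Real.exp (-M) ≤ ‖h 0‖) (hz : ∀ z ∈ ball (0:ℂ) (1/2), h z ≠ 0) (z : ℂ) (hz4 : ‖z‖ ≤ 1 / 4) :
    Real.exp (-(5 * M)) ≤ ‖h z‖ := by
  have hd : DifferentiableOn ℂ (fun z => deriv h z / h z) (ball 0 (1/2)) :=
    (hh.deriv isOpen_ball).div hh hz
  obtain ⟨φ0, hφ0⟩ := hd.isExactOn_ball
  set φ : ℂ → ℂ := fun z => φ0 z - φ0 0
  have hφ : ∀ z ∈ ball (0:ℂ) (1/2), HasDerivAt φ (deriv h z / h z) z := fun z hz =>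
    (hφ0 z hz).sub_const _
  have hφz : φ 0 = 0 := by simp [φ]
  have hexp : ∀ z ∈ ball (0:ℂ) (1/2), h z = h 0 * Complex.exp (φ z) := by
    have hconst : ∀ z ∈ ball (0:ℂ) (1/2), HasDerivAt (fun z => h z * Complex.exp (-φ z)) 0 z := by
      intro z hzz
      have h1 : HasDerivAt h (deriv h z) z :=
        (hh.differentiableAt (isOpen_ball.mem_nhds hzz)).hasDerivAt
      have h2 := h1.mul ((hφ z hzz).neg.cexp)
      have e : deriv h z * Complex.exp ((-φ) z) +
          h z * (Complex.exp ((-φ) z) * -(deriv h z / h z)) = 0 := by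
        have e : deriv h z = h z * (deriv h z / h z) := by
          rw [mul_div_cancel₀ _ (hz z hzz)]
        linear_combination Complex.exp ((-φ) z) * e
      rw [e] at h2
      exact h2
    intro z hzz
    have := (convex_ball (0:ℂ) (1/2)).is_const_of_fderivWithin_eq_zero (𝕜 := ℂ)
      (f := fun z => h z * Complex.exp (-φ z))
      (fun w hw => (hconst w hw).differentiableAt.differentiableWithinAt)
      (fun w hw => by
        rw [fderivWithin_of_isOpen isOpen_ball hw]
        ext; simp [(hconst w hw).deriv]) hzz (by simp : (0:ℂ) ∈ ball (0:ℂ) (1/2))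
    simp only [hφz, neg_zero, Complex.exp_zero, mul_one] at this
    rw [← this, mul_assoc, ← Complex.exp_add]; simp
  have h0p : 0 < ‖h 0‖ := lt_of_lt_of_le (Real.exp_pos _) h0
  have hre : ∀ w ∈ ball (0:ℂ) (1/2), ‖h w‖ = ‖h 0‖ * Real.exp (φ w).re := by
    intro w hw; rw [hexp w hw, norm_mul, Complex.norm_exp]
  have hmap : Set.MapsTo φ (ball 0 (1/2)) {z | z.re ≤ 2 * M} := by
    intro w hw
    have h1 := hb w hw
    rw [hre w hw] at h1
    have h2 : Real.exp (-M) * Real.exp (φ w).re ≤ Real.exp M :=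
      (mul_le_mul_of_nonneg_right h0 (Real.exp_pos _).le).trans h1
    rw [← Real.exp_add, Real.exp_le_exp] at h2
    show (φ w).re ≤ 2 * M; linarith
  have hzb : z ∈ ball (0:ℂ) (1/2) := by simp; linarith
  have hBC := Complex.borelCaratheodory (M := 2 * M) (by linarith)
    (fun w hw => (hφ w hw).differentiableAt.differentiableWithinAt) hmap (by norm_num) hzb
  rw [hφz, norm_zero, zero_mul, zero_div, add_zero] at hBC
  have hbd : ‖φ z‖ ≤ 4 * M := by
    refine hBC.trans ?_
    rw [div_le_iff₀ (by linarith)]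
    nlinarith [norm_nonneg z]
  have hre2 : -(4 * M) ≤ (φ z).re := by
    have := Complex.abs_re_le_norm (φ z)
    have := abs_le.1 (this.trans hbd)
    exact this.1
  rw [hre z hzb]
  calc Real.exp (-(5 * M)) = Real.exp (-M) * Real.exp (-(4 * M)) := by
        rw [← Real.exp_add]; ring_nf
    _ ≤ _ := by gcongr

lemma lintegral_inv_sqrt_le (b : ℝ) (hb : |b| ≤ 1 / 2) :
    ∫⁻ x in Set.Icc (-(1/4) : ℝ) (1/4), ENNReal.ofReal (|x - b| ^ (-(1/2) : ℝ)) ≤ 4 := by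
  have h1 : ∫⁻ x in Set.Icc (-(1/4) : ℝ) (1/4), ENNReal.ofReal (|x - b| ^ (-(1/2) : ℝ))
      ≤ ∫⁻ x in Set.Icc (-1 : ℝ) 1, ENNReal.ofReal (|x| ^ (-(1/2) : ℝ)) := by
    rw [← lintegral_indicator measurableSet_Icc, ← lintegral_indicator measurableSet_Icc,
      ← lintegral_sub_right_eq_self ((Set.Icc (-1 : ℝ) 1).indicator
        fun x : ℝ => ENNReal.ofReal (|x| ^ (-(1/2) : ℝ))) b]
    refine lintegral_mono fun x => ?_
    by_cases hx : x ∈ Set.Icc (-(1/4) : ℝ) (1/4)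
    · have : x - b ∈ Set.Icc (-1 : ℝ) 1 := by
        have := abs_le.1 hb
        constructor <;> linarith [hx.1, hx.2]
      simp only [Set.indicator_of_mem hx, Set.indicator_of_mem this]
      exact le_rfl
    · rw [Set.indicator_of_notMem hx]; exact zero_le
  refine h1.trans ?_
  have h2 : ∫⁻ x in Set.Ioc (0 : ℝ) 1, ENNReal.ofReal (|x| ^ (-(1/2) : ℝ)) = 2 := by
    have hi : IntervalIntegrable (fun x : ℝ => x ^ (-(1/2) : ℝ)) volume 0 1 :=
      intervalIntegral.intervalIntegrable_rpow' (by norm_num)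
    have h3 : ∫ x in (0:ℝ)..1, x ^ (-(1/2) : ℝ) = 2 := by
      rw [integral_rpow (Or.inl (by norm_num))]; norm_num
    rw [intervalIntegral.integral_of_le zero_le_one] at h3
    rw [intervalIntegrable_iff_integrableOn_Ioc_of_le zero_le_one] at hi
    have h4 := ofReal_integral_eq_lintegral_ofReal hi (by
      refine (ae_restrict_mem measurableSet_Ioc).mono fun x hx => ?_
      exact Real.rpow_nonneg hx.1.le _)
    rw [h3] at h4
    rw [← ENNReal.ofReal_ofNat, h4]
    refine setLIntegral_congr_fun measurableSet_Ioc fun x hx => ?_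
    simp only [abs_of_pos hx.1]
  have h5 : ∫⁻ x in Set.Ico (-1 : ℝ) 0, ENNReal.ofReal (|x| ^ (-(1/2) : ℝ)) = 2 := by
    rw [← h2, ← lintegral_indicator measurableSet_Ioc, ← lintegral_indicator measurableSet_Ico,
      ← lintegral_neg_eq_self]
    refine lintegral_congr fun x => ?_
    by_cases hx : x ∈ Set.Ioc (0 : ℝ) 1
    · have : -x ∈ Set.Ico (-1 : ℝ) 0 := ⟨by linarith [hx.2], by linarith [hx.1]⟩
      simp only [Set.indicator_of_mem hx, Set.indicator_of_mem this, abs_neg]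
    · have : -x ∉ Set.Ico (-1 : ℝ) 0 := fun h => hx ⟨by linarith [h.2], by linarith [h.1]⟩
      simp only [Set.indicator_of_notMem hx, Set.indicator_of_notMem this]
  have h6 : Set.Icc (-1 : ℝ) 1 ⊆ Set.Ico (-1 : ℝ) 0 ∪ ({0} ∪ Set.Ioc (0 : ℝ) 1) := by
    intro x hx
    rcases lt_trichotomy x 0 with h | h | h
    · exact Or.inl ⟨hx.1, h⟩
    · exact Or.inr (Or.inl h)
    · exact Or.inr (Or.inr ⟨h, hx.2⟩)
  calc _ ≤ ∫⁻ x in Set.Ico (-1 : ℝ) 0 ∪ ({0} ∪ Set.Ioc (0 : ℝ) 1),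
        ENNReal.ofReal (|x| ^ (-(1/2) : ℝ)) := lintegral_mono_set h6
    _ ≤ _ := lintegral_union_le _ _ _
    _ ≤ 2 + (0 + 2) := by
        gcongr
        · exact h5.le
        · refine (lintegral_union_le _ _ _).trans ?_
          rw [h2]; gcongr; simp
    _ = 4 := by norm_num

/-- Measure estimate for the sublevel sets of a monic-type product. -/
lemma volume_prod_small_le (m : ℕ) (a : Fin m → ℂ) (ha : ∀ i, ‖a i‖ ≤ 1 / 2) (M T : ℝ) (hM : 1 ≤ M)
    (hm : (m : ℝ) ≤ 4 * M) (hT : 0 ≤ T) :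
    volume {x : ℝ | |x| ≤ 1 / 4 ∧ ∏ i, (‖(x : ℂ) - a i‖ / 2) < Real.exp (-(T * M))} ≤
      ENNReal.ofReal (8 * Real.exp (-(T / 8))) := by
  rcases Nat.eq_zero_or_pos m with rfl | hmp
  · have : {x : ℝ | |x| ≤ 1 / 4 ∧ ∏ i, (‖(x : ℂ) - a i‖ / 2) < Real.exp (-(T * M))} = ∅ := by
      ext x
      simp only [Finset.univ_eq_empty, Finset.prod_empty, Set.mem_empty_iff_false, iff_false]
      rintro ⟨-, h⟩
      have : Real.exp (-(T * M)) ≤ 1 := Real.exp_le_one_iff.2 (by nlinarith)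
      linarith
    rw [this]; simp
  have hmp' : (0:ℝ) < m := by exact_mod_cast hmp
  set F : ℝ → ENNReal := fun x => ∑ i, ENNReal.ofReal (2 / m * |x - (a i).re| ^ (-(1/2) : ℝ))
  have hFm : Measurable F := by
    refine Finset.measurable_sum _ fun i _ => ?_
    fun_prop
  have hFint : ∫⁻ x in Set.Icc (-(1/4) : ℝ) (1/4), F x ≤ 8 := by
    rw [lintegral_finsetSum _ (fun i _ => by fun_prop)]
    calc _ ≤ ∑ i : Fin m, ENNReal.ofReal (2 / m) * 4 := by
          refine Finset.sum_le_sum fun i _ => ?_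
          simp_rw [ENNReal.ofReal_mul (show (0:ℝ) ≤ 2 / m by positivity)]
          rw [lintegral_const_mul _ (by fun_prop)]
          gcongr
          exact lintegral_inv_sqrt_le _ ((Complex.abs_re_le_norm _).trans (ha i))
      _ = 8 := by
          rw [Finset.sum_const, Finset.card_univ, Fintype.card_fin, nsmul_eq_mul, ← mul_assoc,
            ← ENNReal.ofReal_natCast, ← ENNReal.ofReal_mul (by positivity),
            mul_div_cancel₀ _ hmp'.ne']
          norm_num
  have hsub : {x : ℝ | |x| ≤ 1 / 4 ∧ ∏ i, (‖(x : ℂ) - a i‖ / 2) < Real.exp (-(T * M))} ⊆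
      Set.range (fun i => (a i).re) ∪
        {x | ENNReal.ofReal (Real.exp (T / 8)) ≤ F x} ∩ Set.Icc (-(1/4) : ℝ) (1/4) := by
    rintro x ⟨hx, hP⟩
    by_cases hxr : x ∈ Set.range (fun i => (a i).re)
    · exact Or.inl hxr
    refine Or.inr ⟨?_, abs_le.1 hx⟩
    have hpos : ∀ i, 0 < |x - (a i).re| := fun i =>
      abs_pos.2 (sub_ne_zero.2 fun h => hxr ⟨i, h.symm⟩)
    have hge : ∀ i, |x - (a i).re| ≤ ‖(x : ℂ) - a i‖ := fun i => by
      simpa using Complex.abs_re_le_norm ((x : ℂ) - a i)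
    have hpos' : ∀ i, 0 < ‖(x : ℂ) - a i‖ / 2 := fun i => by linarith [hpos i, hge i]
    have hamgm := Real.geom_mean_le_arith_mean_weighted Finset.univ (fun _ : Fin m => 1 / (m : ℝ))
      (fun i => (‖(x : ℂ) - a i‖ / 2) ^ (-(1/2) : ℝ)) (fun _ _ => by positivity)
      (by simp [hmp'.ne']) (fun i _ => Real.rpow_nonneg (hpos' i).le _)
    have hprod : Real.exp (T / 8) ≤
        ∏ i, ((‖(x : ℂ) - a i‖ / 2) ^ (-(1/2) : ℝ)) ^ (1 / (m : ℝ)) := by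
      rw [Real.finsetProd_rpow _ _ (fun i _ => Real.rpow_nonneg (hpos' i).le _),
        Real.finsetProd_rpow _ _ (fun i _ => (hpos' i).le),
        ← Real.rpow_mul (Finset.prod_nonneg fun i _ => (hpos' i).le)]
      have hPp : 0 < ∏ i, (‖(x : ℂ) - a i‖ / 2) := Finset.prod_pos fun i _ => hpos' i
      rw [Real.rpow_def_of_pos hPp, Real.exp_le_exp]
      have hl : Real.log (∏ i, (‖(x : ℂ) - a i‖ / 2)) < -(T * M) := by
        rw [← Real.log_exp (-(T * M))]; exact Real.log_lt_log hPp hP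
      have : T / 8 ≤ (T * M) * (1 / (2 * m)) := by
        rw [mul_one_div, div_le_div_iff₀ (by norm_num) (by positivity)]
        nlinarith
      have h2 : (0:ℝ) < 1 / (2 * m) := by positivity
      have h3 : -(1/2 : ℝ) * (1 / (m:ℝ)) = -(1 / (2 * m)) := by field_simp
      rw [h3]
      nlinarith
    have hle : (∑ i, 1 / (m : ℝ) * (‖(x : ℂ) - a i‖ / 2) ^ (-(1/2) : ℝ)) ≤
        ∑ i, 2 / m * |x - (a i).re| ^ (-(1/2) : ℝ) := by
      refine Finset.sum_le_sum fun i _ => ?_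
      have h1 : (‖(x : ℂ) - a i‖ / 2) ^ (-(1/2) : ℝ) ≤ (|x - (a i).re| / 4) ^ (-(1/2) : ℝ) :=
        Real.rpow_le_rpow_of_nonpos (by linarith [hpos i]) (by linarith [hpos i, hge i])
          (by norm_num)
      rw [Real.div_rpow (abs_nonneg _) (by norm_num)] at h1
      have h4 : (4:ℝ) ^ (-(1/2) : ℝ) = 1 / 2 := by
        rw [show (4:ℝ) = 2 ^ (2:ℝ) by norm_num, ← Real.rpow_mul (by norm_num)]
        norm_num
      rw [h4] at h1
      calc _ ≤ 1 / (m:ℝ) * (|x - (a i).re| ^ (-(1/2) : ℝ) / (1/2)) := by gcongr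
        _ = _ := by ring
    show ENNReal.ofReal (Real.exp (T / 8)) ≤ F x
    simp only [F]
    rw [← ENNReal.ofReal_sum_of_nonneg (fun i _ => by positivity)]
    exact ENNReal.ofReal_le_ofReal (hprod.trans (hamgm.trans hle))
  refine (measure_mono hsub).trans ((measure_union_le _ _).trans ?_)
  rw [(Set.finite_range _).measure_zero, zero_add, ← Measure.restrict_apply' measurableSet_Icc]
  have hmk := (mul_meas_ge_le_lintegral (μ := volume.restrict (Set.Icc (-(1/4) : ℝ) (1/4))) hFm
    (ENNReal.ofReal (Real.exp (T / 8)))).trans hFint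
  rw [mul_comm 8, ENNReal.ofReal_mul (Real.exp_pos _).le, Real.exp_neg,
    ENNReal.ofReal_inv_of_pos (Real.exp_pos _), ENNReal.ofReal_ofNat]
  rw [← ENNReal.div_eq_inv_mul, ENNReal.le_div_iff_mul_le (by simp [Real.exp_pos]) (by simp),
    mul_comm]
  exact hmk

open Metric in
/-- **Cartan's estimate** for a bounded holomorphic function. -/
lemma cartan_estimate (g : ℂ → ℂ) (M : ℝ) (hM : 1 ≤ M) (hg : DifferentiableOn ℂ g (ball 0 2))
    (hb : ∀ z, ‖z‖ = 1 → ‖g z‖ ≤ Real.exp M) (h0 : Real.exp (-M) ≤ ‖g 0‖) (S : ℝ) :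
    volume {x : ℝ | |x| ≤ 1 / 4 ∧ ‖g x‖ < Real.exp (-(S * M))} ≤
      ENNReal.ofReal (8 * Real.exp (-((S - 5) / 8))) := by
  rcases lt_or_ge S 5 with hS | hS
  · calc _ ≤ volume (Set.Icc (-(1/4) : ℝ) (1/4)) := measure_mono fun x hx => abs_le.1 hx.1
      _ ≤ _ := by
        rw [Real.volume_Icc]
        refine ENNReal.ofReal_le_ofReal ?_
        have : 1 ≤ Real.exp (-((S - 5) / 8)) := Real.one_le_exp (by linarith)
        linarith
  obtain ⟨m, a, h, hm, ha, hh, hhb, hh0, hhz, hprod⟩ :=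
    exists_blaschke_factorization M ⌊4 * M⌋₊ g hg hb (by
      have h1 : 3 * M ≤ (⌊4 * M⌋₊ : ℝ) := by
        have := Nat.lt_floor_add_one (4 * M)
        linarith
      have h2 : Real.exp (2 * M) < 2 ^ ⌊4 * M⌋₊ := by
        rw [← Real.rpow_natCast, Real.rpow_def_of_pos (by norm_num), Real.exp_lt_exp]
        have := Real.log_two_gt_d9
        nlinarith
      calc Real.exp M = Real.exp (2 * M) * Real.exp (-M) := by rw [← Real.exp_add]; ring_nf
        _ < 2 ^ ⌊4 * M⌋₊ * Real.exp (-M) := by gcongr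
        _ ≤ _ := by gcongr)
  have hhb1 : ∀ z ∈ ball (0:ℂ) (1/2), ‖h z‖ ≤ Real.exp M := by
    intro z hz
    refine Complex.norm_le_of_forall_mem_frontier_norm_le (U := ball (0:ℂ) 1) isBounded_ball
      (DifferentiableOn.diffContOnCl ?_) ?_ (subset_closure (ball_subset_ball (by norm_num) hz))
    · rw [closure_ball _ (by norm_num)]
      exact hh.mono (closedBall_subset_ball (by norm_num))
    · intro z hz
      rw [frontier_ball _ (by norm_num)] at hz
      exact hhb z (by simpa using hz)
  have hlow := nonvanishing_lower_bound h M (by linarith)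
    (hh.mono (ball_subset_ball (by norm_num))) hhb1 (h0.trans hh0)
    (fun z hz => hhz z (by simp at hz; norm_num; linarith))
  refine le_trans (measure_mono ?_) (volume_prod_small_le m a ha M (S - 5) hM ?_ (by linarith))
  · rintro x ⟨hx, hgx⟩
    refine ⟨hx, ?_⟩
    have hxn : ‖(x : ℂ)‖ ≤ 1 / 4 := by simpa using hx
    have h1 := hlow x hxn
    have h2 := (hprod x (by linarith)).trans_lt hgx
    have h3 : Real.exp (-(5 * M)) * ∏ i, (‖(x : ℂ) - a i‖ / 2) < Real.exp (-(S * M)) :=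
      lt_of_le_of_lt (by gcongr) h2
    have h4 : Real.exp (-(S * M)) = Real.exp (-(5 * M)) * Real.exp (-((S - 5) * M)) := by
      rw [← Real.exp_add]; ring_nf
    rw [h4] at h3
    exact lt_of_mul_lt_mul_left h3 (Real.exp_pos _).le
  · calc (m : ℝ) ≤ (⌊4 * M⌋₊ : ℝ) := by exact_mod_cast hm
      _ ≤ _ := Nat.floor_le (by linarith)

/-- The character `t ↦ exp (2π i j t)`. -/
def ech (j : ℤ) (t : ℝ) : ℂ := Complex.exp (2 * Real.pi * Complex.I * j * t)

lemma ech_add (j k : ℤ) (t : ℝ) : ech (j + k) t = ech j t * ech k t := by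
  rw [ech, ech, ech, ← Complex.exp_add]; push_cast; ring_nf

lemma ech_add_right (j : ℤ) (s t : ℝ) : ech j (s + t) = ech j s * ech j t := by
  rw [ech, ech, ech, ← Complex.exp_add]; push_cast; ring_nf

lemma ech_mul_int (j k : ℤ) (t : ℝ) : ech j (k * t) = ech (j * k) t := by
  rw [ech, ech]; push_cast; ring_nf

lemma ech_zero (t : ℝ) : ech 0 t = 1 := by simp [ech]

lemma ech_conj (j : ℤ) (t : ℝ) : starRingEnd ℂ (ech j t) = ech (-j) t := by
  rw [ech, ech, ← Complex.exp_conj]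
  congr 1
  simp [Complex.conj_ofNat]

lemma ech_one_pow (j : ℕ) (t : ℝ) : ech j t = ech 1 t ^ j := by
  rw [ech, ech, ← Complex.exp_nat_mul]; push_cast; ring_nf

lemma ech_ne_zero (j : ℤ) (t : ℝ) : ech j t ≠ 0 := Complex.exp_ne_zero _

lemma ech_one_inj {s t : ℝ} (hs : s ∈ Set.Ico (0:ℝ) 1) (ht : t ∈ Set.Ico (0:ℝ) 1)
    (h : ech 1 s = ech 1 t) : s = t := by
  rw [ech, ech, Complex.exp_eq_exp_iff_exists_int] at h
  obtain ⟨n, hn⟩ := h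
  have hpi : (2 * Real.pi * Complex.I : ℂ) ≠ 0 := by
    simp [Real.pi_ne_zero]
  have h2 : (s : ℂ) = t + n := by
    have : (2 * Real.pi * Complex.I : ℂ) * s = (2 * Real.pi * Complex.I : ℂ) * (t + n) := by
      push_cast at hn; linear_combination hn
    exact mul_left_cancel₀ hpi this
  have h3 : s = t + n := by exact_mod_cast h2
  have h4 : (n : ℝ) < 1 := by linarith [hs.2, ht.1]
  have h5 : (-1 : ℝ) < n := by linarith [hs.1, ht.2]
  have h6 : n < 1 := by exact_mod_cast h4
  have h7 : -1 < n := by exact_mod_cast h5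
  have : n = 0 := by omega
  rw [this] at h3; simpa using h3

/-- Trigonometric polynomials of degree at most `m`. -/
def TrigPoly (m : ℕ) : Submodule ℂ (ℝ → ℂ) := Submodule.span ℂ (ech '' {j : ℤ | j.natAbs ≤ m})

lemma TrigPoly.mono {m m' : ℕ} (h : m ≤ m') : TrigPoly m ≤ TrigPoly m' :=
  Submodule.span_mono (Set.image_mono fun _ hj => le_trans hj h)

lemma TrigPoly.ech_mem {m : ℕ} {j : ℤ} (hj : j.natAbs ≤ m) : ech j ∈ TrigPoly m :=
  Submodule.subset_span ⟨j, hj, rfl⟩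

lemma TrigPoly.const_mem (m : ℕ) (c : ℂ) : (fun _ => c) ∈ TrigPoly m := by
  have : (fun _ : ℝ => c) = c • ech 0 := by ext t; simp [ech_zero]
  rw [this]
  exact Submodule.smul_mem _ _ (TrigPoly.ech_mem (by simp))

lemma TrigPoly.mul_mem {m m' : ℕ} {g g' : ℝ → ℂ} (hg : g ∈ TrigPoly m) (hg' : g' ∈ TrigPoly m') :
    (fun t => g t * g' t) ∈ TrigPoly (m + m') := by
  induction hg using Submodule.span_induction with
  | mem x hx =>
    obtain ⟨j, hj, rfl⟩ := hx
    induction hg' using Submodule.span_induction with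
    | mem y hy =>
      obtain ⟨k, hk, rfl⟩ := hy
      have : (fun t => ech j t * ech k t) = ech (j + k) := by ext t; rw [ech_add]
      rw [this]
      refine TrigPoly.ech_mem ?_
      have h1 : j.natAbs ≤ m := hj
      have h2 : k.natAbs ≤ m' := hk
      omega
    | zero => simpa using TrigPoly.const_mem (m + m') 0
    | add x y _ _ hx hy => simpa [mul_add, Pi.add_def] using Submodule.add_mem _ hx hy
    | smul a x _ hx =>
      have := Submodule.smul_mem _ a hx
      convert this using 1
      ext t; simp; ring
  | zero => simpa using TrigPoly.const_mem (m + m') 0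
  | add x y _ _ hx hy => simpa [add_mul, Pi.add_def] using Submodule.add_mem _ hx hy
  | smul a x _ hx =>
    have := Submodule.smul_mem _ a hx
    convert this using 1
    ext t; simp; ring

lemma TrigPoly.prod_mem {ι : Type*} (s : Finset ι) {m : ℕ} {g : ι → ℝ → ℂ}
    (hg : ∀ i ∈ s, g i ∈ TrigPoly m) : (fun t => ∏ i ∈ s, g i t) ∈ TrigPoly (s.card * m) := by
  classical
  induction s using Finset.induction_on with
  | empty => simpa using TrigPoly.const_mem _ 1
  | insert a s ha ih =>
    simp only [Finset.prod_insert ha, Finset.card_insert_of_notMem ha]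
    have := TrigPoly.mul_mem (hg a (by simp)) (ih fun i hi => hg i (by simp [hi]))
    exact TrigPoly.mono (by ring_nf; omega) this

lemma TrigPoly.sum_mem {ι : Type*} (s : Finset ι) {m : ℕ} {g : ι → ℝ → ℂ}
    (hg : ∀ i ∈ s, g i ∈ TrigPoly m) : (fun t => ∑ i ∈ s, g i t) ∈ TrigPoly m := by
  have : (fun t => ∑ i ∈ s, g i t) = ∑ i ∈ s, g i := by ext t; simp
  rw [this]
  exact Submodule.sum_mem _ hg

lemma TrigPoly.comp_affine {m : ℕ} {g : ℝ → ℂ} (hg : g ∈ TrigPoly m) (n : ℤ) (c : ℝ) :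
    (fun t => g (c + n * t)) ∈ TrigPoly (n.natAbs * m) := by
  induction hg using Submodule.span_induction with
  | mem x hx =>
    obtain ⟨j, hj, rfl⟩ := hx
    have : (fun t => ech j (c + n * t)) = ech j c • ech (j * n) := by
      ext t; simp [ech_add_right, ech_mul_int]
    rw [this]
    refine Submodule.smul_mem _ _ (TrigPoly.ech_mem ?_)
    rw [Int.natAbs_mul, mul_comm]
    exact Nat.mul_le_mul_left _ hj
  | zero => simpa using TrigPoly.const_mem _ 0
  | add x y _ _ hx hy => simpa [Pi.add_def] using Submodule.add_mem _ hx hy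
  | smul a x _ hx => exact Submodule.smul_mem _ a hx

lemma TrigPoly.comp_add {m : ℕ} {g : ℝ → ℂ} (hg : g ∈ TrigPoly m) (c : ℝ) :
    (fun t => g (t + c)) ∈ TrigPoly m := by
  have := TrigPoly.comp_affine hg 1 c
  simpa [add_comm] using this

lemma TrigPoly.conj_mem {m : ℕ} {g : ℝ → ℂ} (hg : g ∈ TrigPoly m) :
    (fun t => starRingEnd ℂ (g t)) ∈ TrigPoly m := by
  induction hg using Submodule.span_induction with
  | mem x hx =>
    obtain ⟨j, hj, rfl⟩ := hx
    have : (fun t => starRingEnd ℂ (ech j t)) = ech (-j) := by ext t; rw [ech_conj]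
    rw [this]
    exact TrigPoly.ech_mem (by simpa using hj)
  | zero => simpa using TrigPoly.const_mem _ 0
  | add x y _ _ hx hy => simpa [Pi.add_def] using Submodule.add_mem _ hx hy
  | smul a x _ hx =>
    have := Submodule.smul_mem _ (starRingEnd ℂ a) hx
    convert this using 1
    ext t; simp

lemma TrigPoly.det_mem {ι : Type*} [Fintype ι] [DecidableEq ι] {m : ℕ} {A : ℝ → Matrix ι ι ℂ}
    (hA : ∀ i j, (fun t => A t i j) ∈ TrigPoly m) :
    (fun t => (A t).det) ∈ TrigPoly (Fintype.card ι * m) := by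
  simp only [Matrix.det_apply']
  refine TrigPoly.sum_mem _ fun σ _ => ?_
  have h1 : (fun t => ∏ i, A t (σ i) i) ∈ TrigPoly (Fintype.card ι * m) := by
    have := TrigPoly.prod_mem Finset.univ (g := fun i t => A t (σ i) i) (fun i _ => hA (σ i) i)
    simpa using this
  exact Submodule.smul_mem _ _ h1

lemma TrigPoly.adjugate_mem {ι : Type*} [Fintype ι] [DecidableEq ι] {m : ℕ}
    {A : ℝ → Matrix ι ι ℂ} (hA : ∀ i j, (fun t => A t i j) ∈ TrigPoly m) (a b : ι) :
    (fun t => (A t).adjugate a b) ∈ TrigPoly (Fintype.card ι * m) := by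
  simp only [Matrix.adjugate_apply]
  refine TrigPoly.det_mem fun i j => ?_
  by_cases h : i = b
  · subst h
    simp only [Matrix.updateRow_self]
    exact TrigPoly.const_mem _ _
  · simp only [Matrix.updateRow_ne h]
    exact hA i j

lemma TrigPoly.continuous {m : ℕ} {g : ℝ → ℂ} (hg : g ∈ TrigPoly m) : Continuous g := by
  induction hg using Submodule.span_induction with
  | mem x hx =>
    obtain ⟨j, hj, rfl⟩ := hx
    unfold ech; fun_prop
  | zero => exact continuous_const
  | add x y _ _ hx hy => exact hx.add hy
  | smul a x _ hx => exact hx.const_smul a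

open Polynomial in
lemma TrigPoly.exists_polynomial {m : ℕ} {g : ℝ → ℂ} (hg : g ∈ TrigPoly m) :
    ∃ p : ℂ[X], p.natDegree ≤ 2 * m ∧ ∀ t, ech m t * g t = p.eval (ech 1 t) := by
  induction hg using Submodule.span_induction with
  | mem x hx =>
    obtain ⟨j, hj, rfl⟩ := hx
    have hj' : j.natAbs ≤ m := hj
    refine ⟨X ^ (m + j).toNat, by rw [natDegree_X_pow]; omega, fun t => ?_⟩
    rw [← ech_add, eval_pow, eval_X, ← ech_one_pow]
    congr 1
    omega
  | zero => exact ⟨0, by simp, by simp⟩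
  | add x y _ _ hx hy =>
    obtain ⟨p, hp, hp'⟩ := hx
    obtain ⟨q, hq, hq'⟩ := hy
    refine ⟨p + q, (natDegree_add_le _ _).trans (max_le hp hq), fun t => ?_⟩
    rw [eval_add, ← hp', ← hq', Pi.add_apply, mul_add]
  | smul a x _ hx =>
    obtain ⟨p, hp, hp'⟩ := hx
    refine ⟨C a * p, (natDegree_C_mul_le _ _).trans hp, fun t => ?_⟩
    rw [eval_mul, eval_C, ← hp', Pi.smul_apply, smul_eq_mul]; ring

/-- A nonzero trigonometric polynomial of degree `m` has at most `2 m` zeros on the circle. -/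
lemma TrigPoly.card_zeros_le {m : ℕ} {g : ℝ → ℂ} (hg : g ∈ TrigPoly m) (hne : ∃ t, g t ≠ 0)
    (Z : Finset ℝ) (hZ : ∀ t ∈ Z, t ∈ Set.Ico (0:ℝ) 1 ∧ g t = 0) : Z.card ≤ 2 * m := by
  classical
  obtain ⟨p, hp, hp'⟩ := TrigPoly.exists_polynomial hg
  have hp0 : p ≠ 0 := by
    rintro rfl
    obtain ⟨t, ht⟩ := hne
    have := hp' t
    simp [ech_ne_zero, ht] at this
  rw [← Finset.card_image_of_injOn (f := ech 1) (s := Z)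
    (fun s hs t ht h => ech_one_inj (hZ s hs).1 (hZ t ht).1 h)]
  calc (Z.image (ech 1)).card ≤ p.roots.toFinset.card := by
        refine Finset.card_le_card fun z hz => ?_
        obtain ⟨t, ht, rfl⟩ := Finset.mem_image.1 hz
        rw [Multiset.mem_toFinset, Polynomial.mem_roots hp0, Polynomial.IsRoot, ← hp',
          (hZ t ht).2, mul_zero]
    _ ≤ Multiset.card p.roots := Multiset.toFinset_card_le _
    _ ≤ p.natDegree := p.card_roots'
    _ ≤ _ := hp

/-- Points of a superlevel set of small measure which are separated are not numerous, when the
function has few zeros. -/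
lemma card_separated_le (g : ℝ → ℝ) (hg : Continuous g) (m : ℕ) (η : ℝ) {α β : ℝ} (hα : 0 ≤ α)
    (hβ : β ≤ 1)
    (hz : ∀ Z : Finset ℝ, (∀ t ∈ Z, t ∈ Set.Ico (0:ℝ) 1 ∧ g t = 0) → Z.card ≤ m)
    (hv : volume {y ∈ Set.Icc α β | 0 ≤ g y} < ENNReal.ofReal η)
    (Y : Finset ℝ) (hY : ∀ y ∈ Y, y ∈ Set.Icc α β ∧ 0 ≤ g y)
    (hsep : ∀ y ∈ Y, ∀ y' ∈ Y, y < y' → η ≤ y' - y) : Y.card ≤ m + 1 := by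
  classical
  rcases Y.eq_empty_or_nonempty with rfl | hne
  · simp
  set M := Y.max' hne
  have hnext : ∀ y ∈ Y.erase M, ∃ z, g z = 0 ∧ y ≤ z ∧ z < 1 ∧ ∀ y' ∈ Y, y < y' → z < y' := by
    intro y hy
    have hyY := Finset.mem_of_mem_erase hy
    have hyM : y < M := lt_of_le_of_ne (Y.le_max' y hyY) (Finset.ne_of_mem_erase hy)
    have hne' : (Y.filter (y < ·)).Nonempty := ⟨M, by simp [hyM, M, Finset.max'_mem]⟩
    set y' := (Y.filter (y < ·)).min' hne'
    have hy' : y' ∈ Y.filter (y < ·) := Finset.min'_mem _ _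
    rw [Finset.mem_filter] at hy'
    obtain ⟨w, hw, hgw⟩ : ∃ w ∈ Set.Ico y y', g w < 0 := by
      by_contra! hcon
      have hsub : Set.Ico y y' ⊆ {y ∈ Set.Icc α β | 0 ≤ g y} := fun w hw =>
        ⟨⟨(hY y hyY).1.1.trans hw.1, hw.2.le.trans (hY y' hy'.1).1.2⟩, hcon w hw⟩
      have h1 := (measure_mono hsub).trans_lt hv
      rw [Real.volume_Ico] at h1
      have h2 := hsep y hyY y' hy'.1 hy'.2
      exact absurd h1 (not_lt.2 (ENNReal.ofReal_le_ofReal h2))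
    obtain ⟨z, hz, hgz⟩ := intermediate_value_Icc' hw.1 hg.continuousOn
      (⟨hgw.le, (hY y hyY).2⟩ : (0:ℝ) ∈ Set.Icc (g w) (g y))
    have hzy' : z < y' := hz.2.trans_lt hw.2
    refine ⟨z, hgz, hz.1, (hzy'.trans_le (hY y' hy'.1).1.2).trans_le hβ, fun u hu hyu => ?_⟩
    exact hzy'.trans_le (Finset.min'_le _ _ (by simp [hu, hyu]))
  choose! z hgz hyz hz1 hzlt using hnext
  have hinj : Set.InjOn z (Y.erase M) := by
    intro a ha b hb hab
    by_contra hne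
    rcases lt_or_gt_of_ne hne with h | h
    · have := hzlt a ha b (Finset.mem_of_mem_erase hb) h
      linarith [hyz b hb]
    · have := hzlt b hb a (Finset.mem_of_mem_erase ha) h
      linarith [hyz a ha]
  have h1 := hz ((Y.erase M).image z) (by
    intro t ht
    obtain ⟨y, hy, rfl⟩ := Finset.mem_image.1 ht
    exact ⟨⟨(hα.trans (hY y (Finset.mem_of_mem_erase hy)).1.1).trans (hyz y hy), hz1 y hy⟩, hgz y hy⟩)
  rw [Finset.card_image_of_injOn hinj, Finset.card_erase_of_mem (Y.max'_mem hne)] at h1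
  omega

open Metric in
/-- A real analytic function extends locally to a holomorphic function. -/
lemma exists_local_complexification (f : ℝ → ℝ) (x : ℝ) (hf : AnalyticAt ℝ f x) :
    ∃ r > 0, ∃ G : ℂ → ℂ, DifferentiableOn ℂ G (ball (x : ℂ) r) ∧
      ∀ y : ℝ, y ∈ ball x r → G y = f y := by
  obtain ⟨p, R, hp⟩ := hf
  obtain ⟨r, hr0, hrR⟩ := ENNReal.lt_iff_exists_nnreal_btwn.1 hp.r_pos
  set Q : FormalMultilinearSeries ℂ ℂ ℂ := FormalMultilinearSeries.ofScalars ℂ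
    (fun n => (p.coeff n : ℂ))
  have hQr : (r : ENNReal) ≤ Q.radius := by
    obtain ⟨C, -, hC⟩ := p.norm_mul_pow_le_of_lt_radius (hrR.trans_le hp.r_le)
    refine Q.le_radius_of_bound C fun n => ?_
    rw [FormalMultilinearSeries.norm_apply_eq_norm_coef,
      FormalMultilinearSeries.coeff_ofScalars, Complex.norm_real,
      ← FormalMultilinearSeries.norm_apply_eq_norm_coef]
    exact hC n
  have hQ := (Q.hasFPowerSeriesOnBall (hr0.trans_le hQr)).mono hr0 hQr
  refine ⟨r, by exact_mod_cast hr0, fun z => Q.sum (z - x), ?_, ?_⟩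
  · have h1 := hQ.differentiableOn
    rw [eball_coe] at h1
    refine h1.comp (by fun_prop) fun z hz => ?_
    simpa [dist_eq_norm] using hz
  · intro y hy
    have hy' : y - x ∈ eball (0:ℝ) R := by
      refine eball_subset_eball hrR.le ?_
      rw [eball_coe]; simpa [dist_eq_norm] using hy
    have h1 := (hp.hasSum hy')
    have hy2 : ((y - x : ℝ) : ℂ) ∈ eball (0:ℂ) r := by
      rw [eball_coe, mem_ball_zero_iff, Complex.norm_real]
      simpa [dist_eq_norm] using hy
    have h2 := hQ.hasSum hy2
    rw [add_sub_cancel] at h1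
    rw [zero_add] at h2
    have h3 := Complex.hasSum_ofReal.2 h1
    have h4 : ∀ n, (Q n fun _ => ((y - x : ℝ) : ℂ)) = (((p n fun _ => y - x) : ℝ) : ℂ) := by
      intro n
      rw [FormalMultilinearSeries.apply_eq_pow_smul_coeff,
        FormalMultilinearSeries.apply_eq_pow_smul_coeff, FormalMultilinearSeries.coeff_ofScalars]
      simp
    simp only [h4] at h2
    have := h2.unique h3
    push_cast at this
    exact this

/-- The open strip of half-width `ρ` around the real axis. -/
def strip (ρ : ℝ) : Set ℂ := {z | |z.im| < ρ}

lemma isOpen_strip (ρ : ℝ) : IsOpen (strip ρ) :=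
  isOpen_lt (by fun_prop) continuous_const

lemma convex_strip (ρ : ℝ) : Convex ℝ (strip ρ) := by
  have : strip ρ = Complex.imLm ⁻¹' (Metric.ball 0 ρ) := by
    ext z; simp [strip]
  rw [this]
  exact (convex_ball _ _).linear_preimage _

open Metric in
/-- Holomorphic functions on a ball centred on the real axis which agree at real points agree. -/
lemma eqOn_of_eq_real (G G' : ℂ → ℂ) (U : Set ℂ) (hU : IsOpen U) (hUc : Convex ℝ U) (x : ℝ)
    (hx : (x : ℂ) ∈ U) (hG : DifferentiableOn ℂ G U) (hG' : DifferentiableOn ℂ G' U)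
    (h : ∀ᶠ y : ℝ in nhds x, G y = G' y) : Set.EqOn G G' U := by
  refine (hG.analyticOnNhd hU).eqOn_of_preconnected_of_frequently_eq (hG'.analyticOnNhd hU)
    hUc.isPreconnected hx ?_
  have h1 : Tendsto (fun y : ℝ => (y : ℂ)) (nhdsWithin x {x}ᶜ) (nhdsWithin (x : ℂ) {(x : ℂ)}ᶜ) := by
    refine tendsto_nhdsWithin_iff.2 ⟨?_, ?_⟩
    · exact (Complex.continuous_ofReal.tendsto x).mono_left nhdsWithin_le_nhds
    · filter_upwards [self_mem_nhdsWithin] with y hy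
      simpa using hy
  exact h1.frequently ((h.filter_mono nhdsWithin_le_nhds).frequently)

open Metric in
/-- A real analytic periodic function extends to a holomorphic periodic function on a strip, which
is bounded and Lipschitz. -/
lemma exists_strip_extension (f : ℝ → ℝ) (hf : ∀ x, AnalyticAt ℝ f x) (hper : ∀ x, f (x + 1) = f x) :
    ∃ F : ℂ → ℂ, ∃ ρ > 0, ∃ C ≥ 1, DifferentiableOn ℂ F (strip ρ) ∧ (∀ x : ℝ, F x = f x) ∧
      (∀ z, F (z + 1) = F z) ∧ (∀ z ∈ strip ρ, ‖F z‖ ≤ C) ∧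
      (∀ z ∈ strip ρ, ∀ w ∈ strip ρ, ‖F z - F w‖ ≤ C * ‖z - w‖) := by
  have hloc := fun x => exists_local_complexification f x (hf x)
  choose r hr G hG hGf using hloc
  obtain ⟨δ, hδ, hball⟩ := lebesgue_number_lemma_of_metric (s := Set.Icc (0:ℝ) 1)
    (c := fun x => ball x (r x)) isCompact_Icc (fun _ => isOpen_ball)
    (fun x _ => Set.mem_iUnion.2 ⟨x, mem_ball_self (hr x)⟩)
  have hperz : ∀ (n : ℤ) x, f (x - n) = f x := by
    have : Function.Periodic f 1 := hper
    intro n x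
    simpa using this.sub_int_mul_eq (x := x) n
  have hloc2 : ∀ x : ℝ, ∃ G' : ℂ → ℂ, x ∈ Set.Icc (0:ℝ) 1 →
      DifferentiableOn ℂ G' (ball (x : ℂ) δ) ∧ ∀ y : ℝ, y ∈ ball x δ → G' y = f y := by
    intro x
    by_cases hx : x ∈ Set.Icc (0:ℝ) 1
    · obtain ⟨i, hi⟩ := hball x hx
      refine ⟨G i, fun _ => ⟨(hG i).mono ?_, fun y hy => hGf i y (hi hy)⟩⟩
      have h1 : δ + dist x i ≤ r i := by
        by_contra! hlt
        rcases le_total i x with h | h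
        · rw [Real.dist_eq, abs_of_nonneg (by linarith)] at hlt
          have h2 : x + max 0 (r i - (x - i)) ∈ ball x δ := by
            rw [mem_ball, Real.dist_eq, add_sub_cancel_left, abs_of_nonneg (le_max_left _ _)]
            exact max_lt hδ (by linarith)
          have h3 := hi h2
          rw [mem_ball, Real.dist_eq] at h3
          have := (le_abs_self _).trans_lt h3
          linarith [le_max_right 0 (r i - (x - i))]
        · rw [Real.dist_eq, abs_of_nonpos (by linarith)] at hlt
          have h2 : x - max 0 (r i - (i - x)) ∈ ball x δ := by
            rw [mem_ball, Real.dist_eq, abs_sub_comm, sub_sub_cancel, abs_of_nonneg (le_max_left _ _)]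
            exact max_lt hδ (by linarith)
          have h3 := hi h2
          rw [mem_ball, Real.dist_eq] at h3
          have := (neg_le_abs _).trans_lt h3
          linarith [le_max_right 0 (r i - (i - x))]
      refine ball_subset_ball' ?_
      rwa [Complex.dist_of_im_eq (by simp), Complex.ofReal_re, Complex.ofReal_re]
    · exact ⟨0, fun h => absurd h hx⟩
  choose G' hG' using hloc2
  set K : ℝ → ℂ → ℂ := fun x z => G' (Int.fract x) (z - ⌊x⌋)
  have hfr : ∀ x : ℝ, Int.fract x ∈ Set.Icc (0:ℝ) 1 := fun x =>
    ⟨Int.fract_nonneg x, (Int.fract_lt_one x).le⟩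
  have hK : ∀ x : ℝ, DifferentiableOn ℂ (K x) (ball (x : ℂ) δ) := by
    intro x
    refine (hG' _ (hfr x)).1.comp (by fun_prop) fun z hz => ?_
    rw [mem_ball, dist_eq_norm] at hz ⊢
    convert hz using 2
    rw [← Int.self_sub_floor]; push_cast; ring
  have hKf : ∀ x y : ℝ, y ∈ ball x δ → K x y = f y := by
    intro x y hy
    have := (hG' _ (hfr x)).2 (y - ⌊x⌋) (by
      rw [mem_ball, dist_eq_norm] at hy ⊢
      convert hy using 2
      rw [← Int.self_sub_floor]; ring)
    rw [hperz] at this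
    rw [← this]; simp [K]
  set F : ℂ → ℂ := fun z => K z.re z
  have hFK : ∀ (x : ℝ) (z : ℂ), z ∈ ball (x : ℂ) (δ / 2) → F z = K x z := by
    intro x z hz
    rw [mem_ball, dist_eq_norm] at hz
    have him : |z.im| < δ / 2 := by
      have := Complex.abs_im_le_norm (z - x)
      simp at this; linarith
    have hre : |z.re - x| < δ / 2 := by
      have := Complex.abs_re_le_norm (z - x)
      simp at this; linarith
    refine eqOn_of_eq_real (K z.re) (K x) (ball ((z.re : ℝ) : ℂ) δ ∩ ball (x : ℂ) δ)
      (isOpen_ball.inter isOpen_ball) ((convex_ball _ _).inter (convex_ball _ _)) z.re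
      ⟨mem_ball_self hδ, ?_⟩ ((hK _).mono Set.inter_subset_left) ((hK _).mono Set.inter_subset_right)
      ?_ ⟨?_, ?_⟩
    · rw [mem_ball, Complex.dist_of_im_eq (by simp), Complex.ofReal_re, Complex.ofReal_re,
        Real.dist_eq]; linarith
    · have h1 : ball z.re δ ∩ ball x δ ∈ nhds z.re :=
        (isOpen_ball.inter isOpen_ball).mem_nhds ⟨mem_ball_self hδ, by
          rw [mem_ball, Real.dist_eq]; linarith⟩
      filter_upwards [h1] with y hy
      rw [hKf _ y hy.1, hKf _ y hy.2]
    · rw [mem_ball, Complex.dist_of_re_eq (by simp)]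
      simp; linarith
    · rw [mem_ball, dist_eq_norm]; linarith
  have hFd : DifferentiableOn ℂ F (strip (δ / 2)) := by
    intro z hz
    have hz' : |z.im| < δ / 2 := hz
    have hzb : z ∈ ball ((z.re : ℝ) : ℂ) (δ / 2) := by
      rw [mem_ball, Complex.dist_of_re_eq (by simp)]
      simpa using hz'
    have h1 : DifferentiableAt ℂ (K z.re) z :=
      (hK z.re).differentiableAt (isOpen_ball.mem_nhds (ball_subset_ball (by linarith) hzb))
    refine (h1.congr_of_eventuallyEq ?_).differentiableWithinAt
    filter_upwards [isOpen_ball.mem_nhds hzb] with w hw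
    exact hFK _ w hw
  have hFf : ∀ x : ℝ, F x = f x := fun x => by
    simp only [F, Complex.ofReal_re]; exact hKf x x (mem_ball_self hδ)
  have hFper : ∀ z, F (z + 1) = F z := by
    intro z
    simp only [F, K, Complex.add_re, Complex.one_re, Int.fract_add_one, Int.floor_add_one]
    congr 1; push_cast; ring
  have hdper : ∀ z, deriv F (z + 1) = deriv F z := by
    intro z
    rw [← deriv_comp_add_const]
    congr 1; ext w; exact hFper w
  have hperint : ∀ (H : ℂ → ℂ), (∀ z, H (z + 1) = H z) → ∀ z, ∃ w, H w = H z ∧ w.im = z.im ∧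
      w.re ∈ Set.Icc (0:ℝ) 1 := by
    intro H hH z
    have hp : Function.Periodic H 1 := hH
    refine ⟨z - ⌊z.re⌋, by simpa using hp.sub_int_mul_eq (x := z) ⌊z.re⌋, by simp, ?_⟩
    simp only [Complex.sub_re, Complex.intCast_re, Int.self_sub_floor]
    exact hfr _
  have hcomp : IsCompact (Set.Icc (0:ℝ) 1 ×ℂ Set.Icc (-(δ/4)) (δ/4)) :=
    IsCompact.reProdIm isCompact_Icc isCompact_Icc
  have hsubK : (Set.Icc (0:ℝ) 1 ×ℂ Set.Icc (-(δ/4)) (δ/4)) ⊆ strip (δ / 2) := by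
    intro z hz
    have := abs_le.2 hz.2
    show |z.im| < δ / 2
    linarith
  have hbound : ∀ H : ℂ → ℂ, ContinuousOn H (strip (δ / 2)) → (∀ z, H (z + 1) = H z) →
      ∃ C, ∀ z ∈ strip (δ / 4), ‖H z‖ ≤ C := by
    intro H hc hH
    obtain ⟨C, hC⟩ := hcomp.exists_bound_of_continuousOn (hc.mono hsubK)
    refine ⟨C, fun z hz => ?_⟩
    obtain ⟨w, hw, hw1, hw2⟩ := hperint H hH z
    rw [← hw]
    refine hC w ⟨hw2, ?_⟩
    show w.im ∈ Set.Icc (-(δ/4)) (δ/4)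
    rw [hw1]
    exact abs_le.1 (le_of_lt hz)
  obtain ⟨C₁, hC₁⟩ := hbound F hFd.continuousOn hFper
  obtain ⟨C₂, hC₂⟩ := hbound (deriv F) (hFd.deriv (isOpen_strip _)).continuousOn hdper
  have hss : strip (δ / 4) ⊆ strip (δ / 2) := fun z hz => by
    have : |z.im| < δ / 4 := hz
    show |z.im| < δ / 2; linarith
  refine ⟨F, δ / 4, by positivity, max 1 (max C₁ C₂), le_max_left _ _, hFd.mono hss, hFf, hFper,
    fun z hz => (hC₁ z hz).trans ((le_max_left _ _).trans (le_max_right _ _)), ?_⟩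
  intro z hz w hw
  refine Convex.norm_image_sub_le_of_norm_deriv_le (𝕜 := ℂ) (f := F) (s := strip (δ / 4))
    (fun u hu => hFd.differentiableAt ((isOpen_strip _).mem_nhds (hss hu)))
    (fun u hu => (hC₂ u hu).trans ((le_max_right _ _).trans (le_max_right _ _)))
    (convex_strip _) hw hz

lemma norm_fourier_integral_le (F : ℂ → ℂ) (ρ C : ℝ) (hρ : 0 < ρ)
    (hF : DifferentiableOn ℂ F (strip ρ)) (hper : ∀ z, F (z + 1) = F z)
    (hb : ∀ z ∈ strip ρ, ‖F z‖ ≤ C) (j : ℤ) :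
    ‖∫ x in (0:ℝ)..1, ech (-j) x * F x‖ ≤ C * Real.exp (-(Real.pi * ρ * |(j:ℝ)|)) := by
  obtain ⟨s, hs, hsj⟩ : ∃ s : ℝ, |s| = 1 ∧ s * j = -|(j:ℝ)| := by
    rcases le_total 0 (j:ℝ) with h | h
    · exact ⟨-1, by simp, by rw [abs_of_nonneg h]; ring⟩
    · exact ⟨1, by simp, by rw [abs_of_nonpos h]; ring⟩
  set H : ℂ → ℂ := fun z => Complex.exp (-(2 * Real.pi * Complex.I * j * z)) * F z
  have hHd : DifferentiableOn ℂ H (strip ρ) := by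
    refine DifferentiableOn.mul ?_ hF
    exact (Differentiable.cexp (by fun_prop)).differentiableOn
  have hHp : ∀ z, H (z + 1) = H z := by
    intro z
    simp only [H, hper]
    congr 1
    rw [show -(2 * Real.pi * Complex.I * j * (z + 1)) =
      -(2 * Real.pi * Complex.I * j * z) + ((-j : ℤ) : ℂ) * (2 * Real.pi * Complex.I) by
        push_cast; ring, Complex.exp_add, Complex.exp_int_mul_two_pi_mul_I, mul_one]
  have hrect := Complex.integral_boundary_rect_eq_zero_of_differentiableOn H 0 (1 + (s * (ρ / 2) : ℝ) * Complex.I)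
    (hHd.mono (by
      intro z hz
      have h1 := hz.2
      simp only [Complex.zero_im, Complex.add_im, Complex.one_im, Complex.mul_im, Complex.ofReal_re,
        Complex.I_im, Complex.ofReal_im, Complex.I_re, mul_one, mul_zero, zero_add, add_zero] at h1
      show |z.im| < ρ
      have h2 := Set.abs_sub_left_of_mem_uIcc h1
      rw [sub_zero, sub_zero, abs_mul, hs, one_mul, abs_of_pos (show 0 < ρ / 2 by linarith)] at h2
      linarith))
  simp only [Complex.zero_re, Complex.zero_im, Complex.add_re, Complex.one_re, Complex.mul_re,
    Complex.ofReal_re, Complex.I_re, Complex.ofReal_im, Complex.I_im, Complex.add_im, Complex.one_im,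
    Complex.mul_im, mul_zero, mul_one, zero_mul, sub_zero, add_zero, zero_add, Complex.ofReal_zero,
    Complex.ofReal_one] at hrect
  have hside : ∀ y : ℝ, H (1 + y * Complex.I) = H (y * Complex.I) := fun y => by
    rw [add_comm, hHp]
  simp only [hside] at hrect
  have heq : ∫ x in (0:ℝ)..1, ech (-j) x * F x =
      ∫ x in (0:ℝ)..1, H (x + (s * (ρ / 2) : ℝ) * Complex.I) := by
    have h1 : ∀ x : ℝ, ech (-j) x * F x = H x := by
      intro x; simp only [H, ech]; congr 2; push_cast; ring
    simp only [h1]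
    linear_combination hrect
  rw [heq]
  have hle : ∀ x ∈ Set.uIoc (0:ℝ) 1, ‖H (x + (s * (ρ / 2) : ℝ) * Complex.I)‖ ≤
      C * Real.exp (-(Real.pi * ρ * |(j:ℝ)|)) := by
    intro x _
    simp only [H, norm_mul, Complex.norm_exp]
    rw [mul_comm]
    gcongr
    · refine (norm_nonneg _).trans (hb 0 ?_)
      show |(0:ℂ).im| < ρ
      simpa using hρ
    · refine hb _ ?_
      show |(_ : ℂ).im| < ρ
      simp only [Complex.add_im, Complex.ofReal_im, Complex.mul_im, Complex.ofReal_re, Complex.I_im,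
        mul_one, Complex.I_re, mul_zero, add_zero, zero_add]
      rw [abs_mul, hs, one_mul, abs_of_pos (show 0 < ρ / 2 by linarith)]; linarith
    · simp
      have : Real.pi * ρ * |(j:ℝ)| = - (Real.pi * ρ * (s * j)) := by rw [hsj]; ring
      rw [this]
      apply le_of_eq; ring
  have := intervalIntegral.norm_integral_le_of_norm_le_const hle
  simpa using this

lemma summable_exp_neg_abs_int (a : ℝ) (ha : 0 < a) :
    Summable (fun j : ℤ => Real.exp (-(a * |(j:ℝ)|))) := by
  have h : Summable fun n : ℕ => Real.exp (-(a * n)) := by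
    have := Real.summable_exp_nat_mul_iff (a := -a) |>.2 (by linarith)
    refine this.congr fun n => by ring_nf
  refine Summable.of_nat_of_neg ?_ ?_
  · simpa using h
  · simpa using h

/-- Approximation of a real analytic periodic function by real trigonometric polynomials. -/
lemma exists_trig_approx (f : ℝ → ℝ) (F : ℂ → ℂ) (ρ C : ℝ) (hρ : 0 < ρ)
    (hfc : Continuous f) (hfper : ∀ x, f (x + 1) = f x)
    (hF : DifferentiableOn ℂ F (strip ρ)) (hFf : ∀ x : ℝ, F x = f x) (hper : ∀ z, F (z + 1) = F z)
    (hb : ∀ z ∈ strip ρ, ‖F z‖ ≤ C) :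
    ∃ C' > 0, ∃ a > 0, ∀ N : ℕ, ∃ T : ℝ → ℝ, (fun t => (T t : ℂ)) ∈ TrigPoly N ∧
      ∀ x, |f x - T x| ≤ C' * Real.exp (-(a * N)) := by
  have hper1 : Function.Periodic (fun x => (f x : ℂ)) 1 := fun x => by simp [hfper]
  let g : C(AddCircle (1:ℝ), ℂ) := ⟨hper1.lift, by
    refine continuous_coinduced_dom.2 ?_
    exact Complex.continuous_ofReal.comp hfc⟩
  have hg : ∀ x : ℝ, g (x : AddCircle (1:ℝ)) = f x := fun x => rfl
  have hcoef : ∀ j : ℤ, fourierCoeff g j = ∫ x in (0:ℝ)..1, ech (-j) x * F x := by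
    intro j
    rw [fourierCoeff_eq_intervalIntegral g j 0]
    simp only [zero_add, div_one, one_smul, smul_eq_mul]
    refine intervalIntegral.integral_congr fun x _ => ?_
    simp only [hg, hFf]
    congr 1
    rw [fourier_coe_apply, ech]; push_cast; congr 1; ring
  set a := Real.pi * ρ / 2
  have ha : 0 < a := by positivity
  have hC : 0 ≤ C := (norm_nonneg _).trans (hb 0 (by show |(0:ℂ).im| < ρ; simpa using hρ))
  have hcb : ∀ j : ℤ, ‖fourierCoeff g j‖ ≤ C * Real.exp (-(2 * a * |(j:ℝ)|)) := by
    intro j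
    rw [hcoef j]
    convert norm_fourier_integral_le F ρ C hρ hF hper hb j using 4
    simp only [a]; ring
  have hsum := summable_exp_neg_abs_int a ha
  have hsummable : Summable (fourierCoeff g) := by
    refine Summable.of_norm_bounded ((hsum.mul_left C)) fun j => (hcb j).trans ?_
    gcongr
    nlinarith [abs_nonneg (j:ℝ)]
  set S := ∑' j : ℤ, Real.exp (-(a * |(j:ℝ)|))
  have hS : 0 ≤ S := tsum_nonneg fun _ => (Real.exp_pos _).le
  refine ⟨C * S + 1, by positivity, a, ha, fun N => ?_⟩
  set P : ℝ → ℂ := fun t => ∑ j ∈ Finset.Icc (-(N:ℤ)) N, fourierCoeff g j * ech j t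
  have hP : P ∈ TrigPoly N := by
    refine TrigPoly.sum_mem _ fun j hj => Submodule.smul_mem _ _ (TrigPoly.ech_mem ?_)
    rw [Finset.mem_Icc] at hj; omega
  have hfP : ∀ x : ℝ, ‖(f x : ℂ) - P x‖ ≤ C * S * Real.exp (-(a * N)) := by
    intro x
    have h1 := has_pointwise_sum_fourier_series_of_summable hsummable (x : AddCircle (1:ℝ))
    have h2 := hasSum_sum_of_ne_finset_zero (L := SummationFilter.unconditional ℤ)
      (s := Finset.Icc (-(N:ℤ)) N)
      (f := fun j => if j ∈ Finset.Icc (-(N:ℤ)) N then fourierCoeff g j * ech j x else 0)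
      (fun j hj => by simp only [hj, if_false])
    rw [Finset.sum_congr rfl (fun j hj => if_pos hj)] at h2
    have h3 := h1.sub h2
    rw [hg] at h3
    have h4 : HasSum (fun j : ℤ => C * Real.exp (-(a * N)) * Real.exp (-(a * |(j:ℝ)|)))
        (C * Real.exp (-(a * N)) * S) := hsum.hasSum.mul_left _
    have h5 := h3.norm_le_of_bounded h4 (fun j => ?_)
    · refine h5.trans (le_of_eq ?_); ring
    · by_cases hj : j ∈ Finset.Icc (-(N:ℤ)) N
      · simp only [hj, if_true]
        have : fourierCoeff g j • fourier j (x : AddCircle (1:ℝ)) - fourierCoeff g j * ech j x = 0 := by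
          rw [fourier_coe_apply, ech, smul_eq_mul, sub_eq_zero]
          push_cast; congr 2; ring
        rw [this, norm_zero]; positivity
      · simp only [hj, if_false, sub_zero, norm_smul]
        have h6 : ‖fourier j (x : AddCircle (1:ℝ))‖ = 1 := by
          rw [fourier_apply]; exact Circle.norm_coe _
        rw [h6, mul_one]
        refine (hcb j).trans ?_
        rw [mul_assoc C, ← Real.exp_add]
        gcongr
        have h7 : (N:ℝ) ≤ |(j:ℝ)| := by
          rw [Finset.mem_Icc] at hj
          have : (N:ℤ) ≤ |j| := by
            by_contra! hlt
            exact hj ⟨by linarith [neg_abs_le j], by linarith [le_abs_self j]⟩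
          exact_mod_cast this
        nlinarith
  refine ⟨fun t => (P t).re, ?_, fun x => ?_⟩
  · have : (fun t => (((P t).re : ℝ) : ℂ)) = (1 / 2 : ℂ) • (P + fun t => starRingEnd ℂ (P t)) := by
      ext t
      simp only [Pi.smul_apply, Pi.add_apply, smul_eq_mul, Complex.add_conj]
      push_cast; ring
    rw [this]
    exact Submodule.smul_mem _ _ (Submodule.add_mem _ hP (TrigPoly.conj_mem hP))
  · have h1 : |f x - (P x).re| ≤ ‖(f x : ℂ) - P x‖ := by
      have := Complex.abs_re_le_norm ((f x : ℂ) - P x)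
      simpa using this
    refine h1.trans ((hfP x).trans ?_)
    gcongr; linarith

variable {d : ℕ}

/-- The sup distance on the lattice. -/
def sd (n k : Fin d → ℤ) : ℕ := Finset.univ.sup fun i => (n i - k i).natAbs

lemma sd_le_iff {n k : Fin d → ℤ} {r : ℕ} : sd n k ≤ r ↔ ∀ i, (n i - k i).natAbs ≤ r := by
  simp [sd, Finset.sup_le_iff]

lemma natAbs_le_sd (n k : Fin d → ℤ) (i : Fin d) : (n i - k i).natAbs ≤ sd n k :=
  sd_le_iff.1 le_rfl i

lemma lt_sd_iff {n k : Fin d → ℤ} {r : ℕ} : r < sd n k ↔ ∃ i, r < (n i - k i).natAbs := by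
  rw [← not_le, sd_le_iff]; push Not; rfl

lemma sd_comm (n k : Fin d → ℤ) : sd n k = sd k n := by
  unfold sd; congr 1; ext i; omega

lemma sd_self (n : Fin d → ℤ) : sd n n = 0 := by
  rw [← Nat.le_zero, sd_le_iff]; simp

lemma sd_triangle (n k m : Fin d → ℤ) : sd n m ≤ sd n k + sd k m := by
  rw [sd_le_iff]; intro i
  have := natAbs_le_sd n k i
  have := natAbs_le_sd k m i
  omega

lemma sd_add_right (n k a : Fin d → ℤ) : sd (n + a) (k + a) = sd n k := by
  unfold sd; congr 1; ext i; simp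

/-- The nearest neighbour hopping term. -/
def hop (n k : Fin d → ℤ) : ℝ := if ∑ i, (n i - k i).natAbs = 1 then 1 else 0

lemma hop_nonneg (n k : Fin d → ℤ) : 0 ≤ hop n k := by unfold hop; split_ifs <;> norm_num

lemma hop_le_one (n k : Fin d → ℤ) : hop n k ≤ 1 := by unfold hop; split_ifs <;> norm_num

lemma hop_comm (n k : Fin d → ℤ) : hop n k = hop k n := by
  unfold hop
  have : ∀ i, (n i - k i).natAbs = (k i - n i).natAbs := fun i => by omega
  simp only [this]

lemma hop_add_right (n k a : Fin d → ℤ) : hop (n + a) (k + a) = hop n k := by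
  unfold hop; simp

lemma sd_le_one_of_hop {n k : Fin d → ℤ} (h : hop n k ≠ 0) : sd n k ≤ 1 := by
  unfold hop at h
  split_ifs at h with h1
  · rw [sd_le_iff]; intro i
    rw [← h1]
    exact Finset.single_le_sum (f := fun i => (n i - k i).natAbs) (fun _ _ => Nat.zero_le _)
      (Finset.mem_univ i)
  · exact absurd rfl h

/-- The cube of radius `r` centred at `m`. -/
def Q (m : Fin d → ℤ) (r : ℕ) : Finset (Fin d → ℤ) :=
  Finset.Icc (fun i => m i - r) (fun i => m i + r)

lemma mem_Q {m n : Fin d → ℤ} {r : ℕ} : n ∈ Q m r ↔ sd n m ≤ r := by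
  rw [Q, Finset.mem_Icc, sd_le_iff, Pi.le_def, Pi.le_def]
  constructor
  · rintro ⟨h1, h2⟩ i; have := h1 i; have := h2 i; omega
  · intro h; exact ⟨fun i => by have := h i; omega, fun i => by have := h i; omega⟩

lemma card_Q (m : Fin d → ℤ) (r : ℕ) : (Q m r).card = (2 * r + 1) ^ d := by
  rw [Q, Pi.card_Icc]
  simp only [Int.card_Icc]
  rw [Finset.prod_congr rfl (g := fun _ => 2 * r + 1) (fun i _ => by omega)]
  simp

lemma sum_hop_le (s : Finset (Fin d → ℤ)) (n : Fin d → ℤ) : ∑ k ∈ s, hop n k ≤ 3 ^ d := by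
  classical
  calc ∑ k ∈ s, hop n k ≤ ∑ k ∈ s, (if k ∈ Q n 1 then (1:ℝ) else 0) := by
        refine Finset.sum_le_sum fun k _ => ?_
        split_ifs with h
        · exact hop_le_one n k
        · have : hop n k = 0 := by
            by_contra h0
            exact h (mem_Q.2 ((sd_comm k n).le.trans (sd_le_one_of_hop h0)))
          rw [this]
    _ = ((s.filter (· ∈ Q n 1)).card : ℝ) := by rw [Finset.sum_ite]; simp
    _ ≤ ((Q n 1).card : ℝ) := by
        gcongr
        intro k hk
        exact (Finset.mem_filter.1 hk).2
    _ = 3 ^ d := by rw [card_Q]; norm_num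

lemma sum_hop_le' (s : Finset (Fin d → ℤ)) (n : Fin d → ℤ) : ∑ k ∈ s, hop k n ≤ 3 ^ d := by
  simp_rw [fun k => hop_comm k n]; exact sum_hop_le s n

/-- The restriction of the operator to a finite set of sites. -/
def mat (δ : ℝ) (v : (Fin d → ℤ) → ℂ) (Λ : Finset (Fin d → ℤ)) : Matrix Λ Λ ℂ :=
  Matrix.of fun n k => ((δ * hop n.1 k.1 : ℝ) : ℂ) + if n = k then v n.1 else 0

lemma mat_mulVec (δ : ℝ) (v : (Fin d → ℤ) → ℂ) (Λ : Finset (Fin d → ℤ)) (φ : (Fin d → ℤ) → ℂ)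
    (n : Λ) : (mat δ v Λ).mulVec (fun k => φ k.1) n =
      ∑ k ∈ Λ, ((δ * hop n.1 k : ℝ) : ℂ) * φ k + v n.1 * φ n.1 := by
  simp only [Matrix.mulVec, dotProduct, mat, Matrix.of_apply, add_mul, Finset.sum_add_distrib]
  congr 1
  · exact Finset.sum_coe_sort Λ (fun k => ((δ * hop n.1 k : ℝ) : ℂ) * φ k)
  · simp

/-- Invertibility of a finite volume restriction, with bounds for the entries of the inverse. -/
def Inv (δ : ℝ) (v : (Fin d → ℤ) → ℂ) (Λ : Finset (Fin d → ℤ))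
    (b : (Fin d → ℤ) → (Fin d → ℤ) → ℝ) : Prop :=
  (mat δ v Λ).det ≠ 0 ∧ ∀ n k : Λ, ‖(mat δ v Λ)⁻¹ n k‖ ≤ b n.1 k.1

lemma Inv.mono {δ : ℝ} {v : (Fin d → ℤ) → ℂ} {Λ : Finset (Fin d → ℤ)}
    {b b' : (Fin d → ℤ) → (Fin d → ℤ) → ℝ} (h : Inv δ v Λ b)
    (hb : ∀ n ∈ Λ, ∀ k ∈ Λ, b n k ≤ b' n k) : Inv δ v Λ b' :=
  ⟨h.1, fun n k => (h.2 n k).trans (hb n.1 n.2 k.1 k.2)⟩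

/-- The equation `(H_Λ + v) φ = η` at the site `n`. -/
def Eqn (δ : ℝ) (v : (Fin d → ℤ) → ℂ) (Λ : Finset (Fin d → ℤ)) (φ η : (Fin d → ℤ) → ℂ)
    (n : Fin d → ℤ) : Prop :=
  ∑ k ∈ Λ, ((δ * hop n k : ℝ) : ℂ) * φ k + v n * φ n = η n

/-- Bounding a solution of the equation by the Green function of a subset. -/
lemma Inv.norm_le {δ : ℝ} {v : (Fin d → ℤ) → ℂ} {Λ S : Finset (Fin d → ℤ)}
    {b : (Fin d → ℤ) → (Fin d → ℤ) → ℝ} (h : Inv δ v S b) (hδ : 0 ≤ δ) (hS : S ⊆ Λ)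
    {φ η : (Fin d → ℤ) → ℂ} (heq : ∀ n ∈ S, Eqn δ v Λ φ η n) {n : Fin d → ℤ} (hn : n ∈ S) :
    ‖φ n‖ ≤ ∑ k ∈ S, b n k * (‖η k‖ + δ * ∑ k' ∈ Λ \ S, hop k k' * ‖φ k'‖) := by
  classical
  set A := mat δ v S
  have hA : A⁻¹ * A = 1 := Matrix.nonsing_inv_mul _ (isUnit_iff_ne_zero.2 h.1)
  have h1 : (fun k : S => φ k.1) = A⁻¹.mulVec (A.mulVec fun k : S => φ k.1) := by
    rw [Matrix.mulVec_mulVec, hA, Matrix.one_mulVec]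
  have h2 : φ n = ∑ k : S, A⁻¹ ⟨n, hn⟩ k * (A.mulVec fun k : S => φ k.1) k :=
    congrFun h1 ⟨n, hn⟩
  rw [h2, ← Finset.sum_coe_sort S]
  refine (norm_sum_le _ _).trans (Finset.sum_le_sum fun k _ => ?_)
  rw [norm_mul]
  have hbk := h.2 ⟨n, hn⟩ k
  refine mul_le_mul hbk ?_ (norm_nonneg _) ((norm_nonneg _).trans hbk)
  have h3 : A.mulVec (fun k : S => φ k.1) k =
      η k.1 - ∑ k' ∈ Λ \ S, ((δ * hop k.1 k' : ℝ) : ℂ) * φ k' := by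
    rw [mat_mulVec]
    have := heq k.1 k.2
    rw [Eqn, ← Finset.sum_sdiff hS] at this
    rw [← this]; ring
  rw [h3]
  refine (norm_sub_le _ _).trans ?_
  gcongr
  refine (norm_sum_le _ _).trans (le_of_eq ?_)
  rw [Finset.mul_sum]
  refine Finset.sum_congr rfl fun k' _ => ?_
  rw [norm_mul, Complex.norm_real, Real.norm_of_nonneg (mul_nonneg hδ (hop_nonneg _ _)), mul_assoc]

/-- Invertibility with bounds from a priori estimates. -/
lemma inv_of_apriori {δ : ℝ} {v : (Fin d → ℤ) → ℂ} {Λ : Finset (Fin d → ℤ)}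
    {b : (Fin d → ℤ) → (Fin d → ℤ) → ℝ}
    (h : ∀ k ∈ Λ, ∀ (φ : (Fin d → ℤ) → ℂ) (c : ℂ),
      (∀ n ∈ Λ, Eqn δ v Λ φ (fun n => if n = k then c else 0) n) → ∀ n ∈ Λ, ‖φ n‖ ≤ b n k * ‖c‖) :
    Inv δ v Λ b := by
  classical
  have hext : ∀ u : Λ → ℂ, ∃ φ : (Fin d → ℤ) → ℂ, u = fun k => φ k.1 := fun u =>
    ⟨fun k => if hk : k ∈ Λ then u ⟨k, hk⟩ else 0, by ext k; simp⟩
  have hdet : (mat δ v Λ).det ≠ 0 := by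
    intro h0
    obtain ⟨u, hu0, hu⟩ := Matrix.exists_mulVec_eq_zero_iff.2 h0
    apply hu0
    obtain ⟨φ, rfl⟩ := hext u
    ext n
    have := h n.1 n.2 φ 0 (fun m hm => by
      have := congrFun hu ⟨m, hm⟩
      rw [mat_mulVec] at this
      rw [Eqn, this]; simp) n.1 n.2
    simpa using this
  refine ⟨hdet, fun n k => ?_⟩
  obtain ⟨φ, hφ⟩ := hext (fun n => (mat δ v Λ)⁻¹ n k)
  have h1 : (mat δ v Λ) * (mat δ v Λ)⁻¹ = 1 :=
    Matrix.mul_nonsing_inv _ (isUnit_iff_ne_zero.2 hdet)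
  have := h k.1 k.2 φ 1 (fun m hm => by
    have h2 := congrFun (congrFun h1 ⟨m, hm⟩) k
    have h3 : ((mat δ v Λ) * (mat δ v Λ)⁻¹) ⟨m, hm⟩ k =
        (mat δ v Λ).mulVec (fun n => (mat δ v Λ)⁻¹ n k) ⟨m, hm⟩ := rfl
    rw [h3, hφ, mat_mulVec] at h2
    rw [Eqn, h2, Matrix.one_apply]
    congr 1
    simp [Subtype.ext_iff]) n.1 n.2
  rw [congrFun hφ n]
  simpa using this

/-- Stability of invertibility under small diagonal perturbations. -/
lemma Inv.perturb {δ : ℝ} {v v' : (Fin d → ℤ) → ℂ} {Λ : Finset (Fin d → ℤ)}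
    {b : (Fin d → ℤ) → (Fin d → ℤ) → ℝ} {P e : ℝ} (hδ : 0 ≤ δ) (h : Inv δ v Λ b)
    (hb : ∀ n ∈ Λ, ∀ k ∈ Λ, b n k ≤ P) (hP : 0 ≤ P)
    (hv : ∀ n ∈ Λ, ‖v' n - v n‖ ≤ e) (he : e * (Λ.card * P) ≤ 1 / 2) :
    Inv δ v' Λ (fun n k => b n k + 2 * Λ.card * P ^ 2 * e) := by
  classical
  refine inv_of_apriori fun k hk φ c hφ => ?_
  have hne : Λ.Nonempty := ⟨k, hk⟩
  have he0 : 0 ≤ e := (norm_nonneg _).trans (hv k hk)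
  obtain ⟨m, hm, hmax⟩ := Λ.exists_max_image (fun n => ‖φ n‖) hne
  have heq : ∀ n ∈ Λ, Eqn δ v Λ φ (fun n => (if n = k then c else 0) - (v' n - v n) * φ n) n := by
    intro n hn
    have := hφ n hn
    rw [Eqn] at this ⊢
    rw [← this]; ring
  have key : ∀ n ∈ Λ, ‖φ n‖ ≤ b n k * ‖c‖ + Λ.card * P * e * ‖φ m‖ := by
    intro n hn
    refine (h.norm_le hδ le_rfl heq hn).trans ?_
    simp only [Finset.sdiff_self, Finset.sum_empty, mul_zero, add_zero]
    calc ∑ j ∈ Λ, b n j * ‖(if j = k then c else 0) - (v' j - v j) * φ j‖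
        ≤ ∑ j ∈ Λ, ((if j = k then b n k * ‖c‖ else 0) + P * (e * ‖φ m‖)) := by
          refine Finset.sum_le_sum fun j hj => ?_
          have hbn : 0 ≤ b n j := (norm_nonneg _).trans (h.2 ⟨n, hn⟩ ⟨j, hj⟩)
          have h1 : ‖(if j = k then c else 0) - (v' j - v j) * φ j‖ ≤
              (if j = k then ‖c‖ else 0) + e * ‖φ m‖ := by
            refine (norm_sub_le _ _).trans (add_le_add ?_ ?_)
            · split_ifs <;> simp
            · rw [norm_mul]; exact mul_le_mul (hv j hj) (hmax j hj) (norm_nonneg _) he0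
          calc _ ≤ b n j * ((if j = k then ‖c‖ else 0) + e * ‖φ m‖) := by gcongr
            _ = b n j * (if j = k then ‖c‖ else 0) + b n j * (e * ‖φ m‖) := by ring
            _ ≤ _ := by
              refine add_le_add (le_of_eq ?_) ?_
              · split_ifs with hjk
                · rw [hjk]
                · simp
              · exact mul_le_mul_of_nonneg_right (hb n hn j hj) (by positivity)
      _ = _ := by
          rw [Finset.sum_add_distrib, Finset.sum_ite_eq' Λ k, if_pos hk, Finset.sum_const,
            nsmul_eq_mul]; ring
  have hbk : 0 ≤ b m k := (norm_nonneg _).trans (h.2 ⟨m, hm⟩ ⟨k, hk⟩)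
  have hmb : ‖φ m‖ ≤ 2 * P * ‖c‖ := by
    have h1 := key m hm
    have h2 : Λ.card * P * e * ‖φ m‖ ≤ 1 / 2 * ‖φ m‖ := by
      gcongr; linarith
    have h3 : b m k * ‖c‖ ≤ P * ‖c‖ := by gcongr; exact hb m hm k hk
    linarith
  intro n hn
  calc ‖φ n‖ ≤ b n k * ‖c‖ + Λ.card * P * e * ‖φ m‖ := key n hn
    _ ≤ b n k * ‖c‖ + Λ.card * P * e * (2 * P * ‖c‖) := by gcongr
    _ = _ := by ring

/-- A weighted maximum principle. -/
lemma weighted_max_principle (Λ R : Finset (Fin d → ℤ)) (φ a w : (Fin d → ℤ) → ℝ)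
    (T : (Fin d → ℤ) → (Fin d → ℤ) → ℝ) (B : ℝ) (hφ0 : ∀ n ∈ Λ, 0 ≤ φ n)
    (hw : ∀ n ∈ Λ, 0 < w n) (hT0 : ∀ n ∈ R, ∀ k ∈ Λ, 0 ≤ T n k)
    (hφ : ∀ n ∈ R, n ∈ Λ → φ n ≤ a n + ∑ k ∈ Λ, T n k * φ k)
    (hT : ∀ n ∈ R, n ∈ Λ → ∑ k ∈ Λ, T n k * (w n / w k) ≤ 1 / 2)
    (ha : ∀ n ∈ R, n ∈ Λ → a n * w n ≤ B / 2) (hB : ∀ n ∈ Λ, n ∉ R → φ n * w n ≤ B) :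
    ∀ n ∈ Λ, φ n * w n ≤ B := by
  intro n0 hn0
  obtain ⟨m, hm, hmax⟩ := Λ.exists_max_image (fun n => φ n * w n) ⟨n0, hn0⟩
  refine (hmax n0 hn0).trans ?_
  by_cases hmR : m ∈ R
  · have h1 : φ m * w m ≤ a m * w m + (∑ k ∈ Λ, T m k * (w m / w k)) * (φ m * w m) := by
      calc φ m * w m ≤ (a m + ∑ k ∈ Λ, T m k * φ k) * w m :=
            mul_le_mul_of_nonneg_right (hφ m hmR hm) (hw m hm).le
        _ = a m * w m + ∑ k ∈ Λ, T m k * (w m / w k) * (φ k * w k) := by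
            rw [add_mul, Finset.sum_mul]
            congr 1
            refine Finset.sum_congr rfl fun k hk => ?_
            have := (hw k hk).ne'
            field_simp
        _ ≤ a m * w m + ∑ k ∈ Λ, T m k * (w m / w k) * (φ m * w m) := by
            exact add_le_add le_rfl (Finset.sum_le_sum fun k hk =>
              mul_le_mul_of_nonneg_left (hmax k hk)
                (mul_nonneg (hT0 m hmR k hk) (div_nonneg (hw m hm).le (hw k hk).le)))
        _ = _ := by rw [Finset.sum_mul]
    have h2 := hT m hmR hm
    have h3 := ha m hmR hm
    have h4 : 0 ≤ φ m * w m := mul_nonneg (hφ0 m hm) (hw m hm).le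
    have h5 : (∑ k ∈ Λ, T m k * (w m / w k)) * (φ m * w m) ≤ 1 / 2 * (φ m * w m) :=
      mul_le_mul_of_nonneg_right h2 h4
    linarith
  · exact hB m hm hmR

lemma Inv.translate {δ : ℝ} {v : (Fin d → ℤ) → ℂ} {Λ Λ' : Finset (Fin d → ℤ)}
    {b : (Fin d → ℤ) → (Fin d → ℤ) → ℝ} (a : Fin d → ℤ) (hΛ : ∀ n, n ∈ Λ ↔ n + a ∈ Λ')
    (h : Inv δ v Λ' b) : Inv δ (fun n => v (n + a)) Λ (fun n k => b (n + a) (k + a)) := by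
  classical
  let e : Λ ≃ Λ' :=
    { toFun := fun n => ⟨n.1 + a, (hΛ n.1).1 n.2⟩
      invFun := fun n => ⟨n.1 - a, (hΛ _).2 (by simp)⟩
      left_inv := fun n => by simp
      right_inv := fun n => by simp }
  have hM : mat δ (fun n => v (n + a)) Λ = (mat δ v Λ').submatrix e e := by
    ext n k
    have h1 : (e n = e k) ↔ n = k := e.apply_eq_iff_eq
    have h2 : (e n).1 = n.1 + a := rfl
    have h3 : (e k).1 = k.1 + a := rfl
    simp only [mat, Matrix.of_apply, Matrix.submatrix_apply, h1, h2, h3, hop_add_right]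
  refine ⟨?_, fun n k => ?_⟩
  · rw [hM, Matrix.det_submatrix_equiv_self]; exact h.1
  · rw [hM, Matrix.inv_submatrix_equiv]
    exact h.2 (e n) (e k)

lemma Inv.translate_Q {δ : ℝ} {v : (Fin d → ℤ) → ℂ} {r : ℕ} {σ κ : ℝ} (a : Fin d → ℤ)
    (h : Inv δ (fun n => v (n + a)) (Q 0 r) (fun n k => Real.exp (σ - κ * sd n k))) :
    Inv δ v (Q a r) (fun n k => Real.exp (σ - κ * sd n k)) := by
  have := Inv.translate (Λ := Q a r) (Λ' := Q 0 r) (-a) (fun n => by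
    rw [mem_Q, mem_Q, ← sd_add_right n a (-a)]; simp) h
  simpa [sd_add_right] using this

/-- Bounding a solution in terms of the source and the values just outside of a subset. -/
lemma Inv.norm_le_exit {δ : ℝ} {v : (Fin d → ℤ) → ℂ} {Λ S : Finset (Fin d → ℤ)} {σ κ : ℝ}
    (h : Inv δ v S (fun n k => Real.exp (σ - κ * sd n k))) (hδ : 0 ≤ δ) (hδ1 : δ * 3 ^ d ≤ 1)
    (hκ : 0 ≤ κ) (hκ2 : κ ≤ 2) (hS : S ⊆ Λ)
    {φ η : (Fin d → ℤ) → ℂ} (heq : ∀ n ∈ S, Eqn δ v Λ φ η n) {n : Fin d → ℤ} (hn : n ∈ S)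
    (X : Finset (Fin d → ℤ)) (hX : ∀ k' ∈ Λ, k' ∉ S → (∃ k ∈ S, sd k k' ≤ 1) → k' ∈ X) :
    ‖φ n‖ ≤ ∑ k ∈ S, Real.exp (σ - κ * sd n k) * ‖η k‖ +
      ∑ k' ∈ X, Real.exp (σ + 2 - κ * sd n k') * ‖φ k'‖ := by
  classical
  refine (h.norm_le hδ hS heq hn).trans ?_
  simp only [mul_add, Finset.sum_add_distrib]
  refine add_le_add le_rfl ?_
  have e1 : ∀ k ∈ S, Real.exp (σ - κ * sd n k) * (δ * ∑ k' ∈ Λ \ S, hop k k' * ‖φ k'‖) ≤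
      ∑ k' ∈ X, δ * hop k k' * (Real.exp (σ + 2 - κ * sd n k') * ‖φ k'‖) := by
    intro k hk
    have e2 : ∑ k' ∈ Λ \ S, hop k k' * ‖φ k'‖ =
        ∑ k' ∈ (Λ \ S).filter (· ∈ X), hop k k' * ‖φ k'‖ := by
      refine (Finset.sum_filter_of_ne fun k' hk' hne => ?_).symm
      rw [Finset.mem_sdiff] at hk'
      exact hX k' hk'.1 hk'.2 ⟨k, hk, sd_le_one_of_hop (left_ne_zero_of_mul hne)⟩
    rw [e2, Finset.mul_sum, Finset.mul_sum]
    refine (Finset.sum_le_sum fun k' _ => ?_).trans (Finset.sum_le_sum_of_subset_of_nonneg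
      (t := X) (fun k' hk' => (Finset.mem_filter.1 hk').2) fun k' _ _ => by
        have := hop_nonneg k k'; positivity)
    by_cases h0 : hop k k' = 0
    · simp [h0]
    have h1 := sd_le_one_of_hop h0
    have h2 : (sd n k' : ℝ) ≤ sd n k + 1 := by
      exact_mod_cast (sd_triangle n k k').trans (by omega)
    have h3 : Real.exp (σ - κ * sd n k) ≤ Real.exp (σ + 2 - κ * sd n k') := by
      rw [Real.exp_le_exp]; nlinarith
    have h4 := hop_nonneg k k'
    calc _ = δ * hop k k' * (Real.exp (σ - κ * sd n k) * ‖φ k'‖) := by ring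
      _ ≤ _ := by gcongr
  refine (Finset.sum_le_sum e1).trans ?_
  rw [Finset.sum_comm]
  refine Finset.sum_le_sum fun k' _ => ?_
  rw [← Finset.sum_mul, ← Finset.mul_sum]
  have : δ * ∑ k ∈ S, hop k k' ≤ 1 :=
    (mul_le_mul_of_nonneg_left (sum_hop_le' S k') hδ).trans hδ1
  exact mul_le_of_le_one_left (by positivity) this

/-- Adding an imaginary part on the bad set restores invertibility. -/
lemma inv_add_I {δ : ℝ} {v : (Fin d → ℤ) → ℝ} {Λ : Finset (Fin d → ℤ)} {B : Set (Fin d → ℤ)}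
    {σ κ P : ℝ} {ℓ : ℕ} (hδ : 0 ≤ δ) (hδ1 : δ * 3 ^ d ≤ 1) (hκ : 0 ≤ κ) (hκ2 : κ ≤ 2)
    (hP : 1 ≤ P) (hP' : Λ.card * Real.exp σ ≤ P)
    (hex : Λ.card * Real.exp (σ + 2 - κ * (ℓ + 1)) ≤ 1 / 2)
    (hgood : ∀ n ∈ Λ, n ∉ B → ∃ S ⊆ Λ, n ∈ S ∧
      Inv δ (fun n => (v n : ℂ)) S (fun n k => Real.exp (σ - κ * sd n k)) ∧
      ∀ k' ∈ Λ, k' ∉ S → ℓ + 1 ≤ sd n k') :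
    Inv δ (fun n => (v n : ℂ) + B.indicator (fun _ => Complex.I) n) Λ (fun _ _ => 8 * P ^ 2) := by
  classical
  refine inv_of_apriori fun k0 hk0 u c hu n0 hn0 => ?_
  obtain ⟨p, hp, hmax⟩ := Λ.exists_max_image (fun n => ‖u n‖) ⟨k0, hk0⟩
  set m := ‖u p‖
  have hm0 : 0 ≤ m := norm_nonneg _
  have hc0 : 0 ≤ ‖c‖ := norm_nonneg _
  refine (hmax n0 hn0).trans ?_
  -- the imaginary part
  have him : ∑ n ∈ Λ, B.indicator (fun n => ‖u n‖ ^ 2) n ≤ ‖c‖ * m := by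
    have h1 : ∑ n ∈ Λ, (starRingEnd ℂ) (u n) * (∑ k ∈ Λ, ((δ * hop n k : ℝ) : ℂ) * u k +
        ((v n : ℂ) + B.indicator (fun _ => Complex.I) n) * u n) =
        (starRingEnd ℂ) (u k0) * c := by
      rw [Finset.sum_congr rfl fun n hn => congrArg _ (hu n hn)]
      simp [hk0]
    have h2 : (∑ n ∈ Λ, (starRingEnd ℂ) (u n) * ∑ k ∈ Λ, ((δ * hop n k : ℝ) : ℂ) * u k).im
        = 0 := by
      rw [← Complex.conj_eq_iff_im]
      simp only [map_sum, map_mul, Complex.conj_conj, Complex.conj_ofReal, Finset.mul_sum]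
      rw [Finset.sum_comm]
      refine Finset.sum_congr rfl fun n _ => Finset.sum_congr rfl fun k _ => ?_
      rw [hop_comm k n]; ring
    have h3 : ∀ n ∈ Λ, ((starRingEnd ℂ) (u n) * (((v n : ℂ) +
        B.indicator (fun _ => Complex.I) n) * u n)).im = B.indicator (fun n => ‖u n‖ ^ 2) n := by
      intro n _
      have : (starRingEnd ℂ) (u n) * (((v n : ℂ) + B.indicator (fun _ => Complex.I) n) * u n) =
        ((v n : ℂ) + B.indicator (fun _ => Complex.I) n) * ((‖u n‖ ^ 2 : ℝ) : ℂ) := by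
        rw [Complex.ofReal_pow, ← Complex.conj_mul']; ring
      rw [this, Complex.im_mul_ofReal]
      by_cases hB : n ∈ B <;> simp [hB]
    have h1' : ∑ n ∈ Λ, (starRingEnd ℂ) (u n) * ∑ k ∈ Λ, ((δ * hop n k : ℝ) : ℂ) * u k +
        ∑ n ∈ Λ, (starRingEnd ℂ) (u n) * (((v n : ℂ) + B.indicator (fun _ => Complex.I) n) * u n) =
        (starRingEnd ℂ) (u k0) * c := by
      rw [← h1, ← Finset.sum_add_distrib]
      exact Finset.sum_congr rfl fun n _ => (mul_add _ _ _).symm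
    have h4 := congrArg Complex.im h1'
    rw [Complex.add_im, h2, zero_add] at h4
    rw [Complex.im_sum, Finset.sum_congr rfl h3] at h4
    rw [h4]
    refine (Complex.abs_im_le_norm _ |> (le_abs_self _).trans).trans ?_
    rw [norm_mul, RCLike.norm_conj, mul_comm]
    exact mul_le_mul_of_nonneg_left (hmax k0 hk0) hc0
  have hB : ∀ n ∈ Λ, n ∈ B → ‖u n‖ ≤ Real.sqrt (‖c‖ * m) := by
    intro n hn hnB
    refine Real.le_sqrt_of_sq_le (le_trans ?_ him)
    have := Finset.single_le_sum (f := fun n => B.indicator (fun n => ‖u n‖ ^ 2) n)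
      (fun i _ => Set.indicator_nonneg (fun _ _ => by positivity) i) hn
    simpa [hnB] using this
  set q := Real.sqrt (‖c‖ * m)
  have hq0 : 0 ≤ q := Real.sqrt_nonneg _
  have hq : q ^ 2 = ‖c‖ * m := Real.sq_sqrt (by positivity)
  have hPc : ‖c‖ ≤ 8 * P ^ 2 * ‖c‖ := by
    have : 1 ≤ P ^ 2 := one_le_pow₀ hP
    nlinarith
  by_cases hpB : p ∈ B
  · have h1 : m ≤ q := hB p hp hpB
    have : m ^ 2 ≤ ‖c‖ * m := by rw [← hq]; gcongr
    by_contra hcon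
    nlinarith
  · obtain ⟨S, hSΛ, hpS, hinv, hfar⟩ := hgood p hp hpB
    have hle := hinv.norm_le_exit (Λ := Λ) hδ hδ1 hκ hκ2 hSΛ (φ := u)
      (η := fun n => (if n = k0 then c else 0) - B.indicator (fun _ => Complex.I) n * u n)
      (fun n hn => by
        have := hu n (hSΛ hn)
        rw [Eqn] at this ⊢
        rw [← this]; ring) hpS (Λ \ S)
      (fun k' h1 h2 _ => Finset.mem_sdiff.2 ⟨h1, h2⟩)
    have hE1 : ∑ k ∈ S, Real.exp (σ - κ * sd p k) *
        ‖(if k = k0 then c else 0) - B.indicator (fun _ => Complex.I) k * u k‖ ≤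
        P * ‖c‖ + P * q := by
      calc _ ≤ ∑ k ∈ S, (Real.exp σ * (if k = k0 then ‖c‖ else 0) + Real.exp σ * q) := by
            refine Finset.sum_le_sum fun k hk => ?_
            rw [← mul_add]
            refine mul_le_mul (Real.exp_le_exp.2 ?_) ?_ (norm_nonneg _) (Real.exp_nonneg _)
            · have : 0 ≤ κ * sd p k := by positivity
              linarith
            · refine (norm_sub_le _ _).trans (add_le_add ?_ ?_)
              · split_ifs <;> simp
              · by_cases hkB : k ∈ B
                · simpa [hkB] using hB k (hSΛ hk) hkB
                · simpa [hkB] using hq0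
        _ ≤ ∑ k ∈ Λ, (Real.exp σ * (if k = k0 then ‖c‖ else 0) + Real.exp σ * q) :=
            Finset.sum_le_sum_of_subset_of_nonneg hSΛ fun k _ _ => by
              split_ifs <;> positivity
        _ = Real.exp σ * ‖c‖ + Λ.card * Real.exp σ * q := by
            rw [Finset.sum_add_distrib, ← Finset.mul_sum, Finset.sum_ite_eq' Λ k0, if_pos hk0]
            simp; ring
        _ ≤ P * ‖c‖ + P * q := by
            have hcard : (1:ℝ) ≤ Λ.card := by
              exact_mod_cast Finset.card_pos.2 ⟨k0, hk0⟩
            have : Real.exp σ ≤ P := by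
              have := Real.exp_pos σ
              nlinarith
            gcongr
    have hE2 : ∑ k' ∈ Λ \ S, Real.exp (σ + 2 - κ * sd p k') * ‖u k'‖ ≤ 1 / 2 * m := by
      calc _ ≤ ∑ k' ∈ Λ \ S, Real.exp (σ + 2 - κ * (ℓ + 1)) * m := by
            refine Finset.sum_le_sum fun k' hk' => ?_
            rw [Finset.mem_sdiff] at hk'
            have h1 : ((ℓ : ℝ) + 1) ≤ sd p k' := by exact_mod_cast hfar k' hk'.1 hk'.2
            have h2 := hmax k' hk'.1
            gcongr
        _ ≤ ∑ k' ∈ Λ, Real.exp (σ + 2 - κ * (ℓ + 1)) * m :=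
            Finset.sum_le_sum_of_subset_of_nonneg Finset.sdiff_subset fun _ _ _ => by positivity
        _ = (Λ.card * Real.exp (σ + 2 - κ * (ℓ + 1))) * m := by simp; ring
        _ ≤ _ := by gcongr
    have h1 : m ≤ P * ‖c‖ + P * q + 1 / 2 * m := by linarith
    -- `2 P q ≤ 2 P^2 |c| + m / 2`
    have h2 : 2 * P * q ≤ 2 * P ^ 2 * ‖c‖ + m / 2 := by
      by_contra hcon
      push Not at hcon
      have h3 : (2 * P ^ 2 * ‖c‖ + m / 2) ^ 2 < (2 * P * q) ^ 2 := by gcongr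
      nlinarith [sq_nonneg (2 * P ^ 2 * ‖c‖ - m / 2)]
    nlinarith [mul_nonneg (sub_nonneg.2 hP) hc0]

/-- Green's function bounds for a dominating diagonal. -/
lemma inv_of_large_diag {δ η : ℝ} {v : (Fin d → ℤ) → ℂ} {Λ : Finset (Fin d → ℤ)} (hδ : 0 ≤ δ)
    (hη : 0 < η) (hv : ∀ n ∈ Λ, η ≤ ‖v n‖) (hδη : δ * 3 ^ d * Real.exp 2 ≤ η / 2) :
    Inv δ v Λ (fun n k => 2 / η * Real.exp (-(2 * sd n k))) := by
  refine inv_of_apriori fun k0 hk0 u c hu n0 hn0 => ?_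
  have hmain := weighted_max_principle Λ Λ (fun n => ‖u n‖) (fun n => if n = k0 then ‖c‖ / η else 0)
    (fun n => Real.exp (2 * sd n k0)) (fun n k => δ / η * hop n k) (2 * ‖c‖ / η)
    (fun n _ => norm_nonneg _) (fun n _ => Real.exp_pos _)
    (fun n _ k _ => mul_nonneg (by positivity) (hop_nonneg _ _))
    (fun n hn _ => ?_) (fun n hn _ => ?_) (fun n _ _ => ?_) (fun n hn h => absurd hn h) n0 hn0
  · have h1 : Real.exp (-(2 * sd n0 k0)) * Real.exp (2 * sd n0 k0) = 1 := by
      rw [← Real.exp_add]; simp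
    calc ‖u n0‖ = (‖u n0‖ * Real.exp (2 * sd n0 k0)) * Real.exp (-(2 * sd n0 k0)) := by
          rw [mul_assoc, mul_comm (Real.exp (2 * _)), h1, mul_one]
      _ ≤ 2 * ‖c‖ / η * Real.exp (-(2 * sd n0 k0)) := by gcongr
      _ = _ := by ring
  · have h1 := hu n hn
    rw [Eqn] at h1
    have h2 : v n * u n = (if n = k0 then c else 0) -
        ∑ k ∈ Λ, ((δ * hop n k : ℝ) : ℂ) * u k := by rw [← h1]; ring
    have h3 : η * ‖u n‖ ≤ (if n = k0 then ‖c‖ else 0) + ∑ k ∈ Λ, δ * hop n k * ‖u k‖ := by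
      calc η * ‖u n‖ ≤ ‖v n‖ * ‖u n‖ := by gcongr; exact hv n hn
        _ = ‖v n * u n‖ := (norm_mul _ _).symm
        _ ≤ _ := by
          rw [h2]
          refine (norm_sub_le _ _).trans (add_le_add ?_ ((norm_sum_le _ _).trans ?_))
          · split_ifs <;> simp
          · refine Finset.sum_le_sum fun k _ => ?_
            rw [norm_mul, Complex.norm_real, Real.norm_of_nonneg (mul_nonneg hδ (hop_nonneg _ _))]
    have h4 : ‖u n‖ ≤ ((if n = k0 then ‖c‖ else 0) + ∑ k ∈ Λ, δ * hop n k * ‖u k‖) / η := by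
      rw [le_div_iff₀ hη]; linarith
    refine h4.trans (le_of_eq ?_)
    rw [add_div, Finset.sum_div]
    congr 1
    · split_ifs <;> simp
    · refine Finset.sum_congr rfl fun k _ => by ring
  · calc ∑ k ∈ Λ, δ / η * hop n k * (Real.exp (2 * sd n k0) / Real.exp (2 * sd k k0))
        ≤ ∑ k ∈ Λ, δ / η * Real.exp 2 * hop n k := by
          refine Finset.sum_le_sum fun k _ => ?_
          by_cases h0 : hop n k = 0
          · simp [h0]
          have h1 : (sd n k0 : ℝ) ≤ 1 + sd k k0 := by
            exact_mod_cast (sd_triangle n k k0).trans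
              (Nat.add_le_add_right (sd_le_one_of_hop h0) _)
          have h2 : Real.exp (2 * sd n k0) / Real.exp (2 * sd k k0) ≤ Real.exp 2 := by
            rw [← Real.exp_sub, Real.exp_le_exp]; linarith
          have h3 := hop_nonneg n k
          calc _ ≤ δ / η * hop n k * Real.exp 2 := by gcongr
            _ = _ := by ring
      _ = δ / η * Real.exp 2 * ∑ k ∈ Λ, hop n k := by rw [Finset.mul_sum]
      _ ≤ δ / η * Real.exp 2 * 3 ^ d := by gcongr; exact sum_hop_le _ _
      _ = (δ * 3 ^ d * Real.exp 2) / η := by ring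
      _ ≤ (η / 2) / η := by gcongr
      _ = 1 / 2 := by field_simp
  · by_cases h0 : n = k0
    · subst h0; simp only [if_true, sd_self]; simp; apply le_of_eq; ring
    · simp only [h0, if_false]; simp; positivity

section Matrix

variable {α β : Type*} [Fintype α] [DecidableEq α] [Fintype β] [DecidableEq β]

/-- The coordinate inclusion matrix. -/
def incl (g : β → α) : Matrix α β ℂ := Matrix.of fun n m => if n = g m then 1 else 0

lemma transpose_incl_mul_mul_incl {α β : Type*} [Fintype α] [DecidableEq α] (A : Matrix α α ℂ) (g : β → α) :
    (incl g).transpose * (A * incl g) = A.submatrix g g := by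
  ext i j
  simp [incl, Matrix.mul_apply]

lemma det_add_incl (N : Matrix α α ℂ) (hN : N.det ≠ 0) (g : β → α) (s : ℂ) :
    (N + s • (incl g * (incl g).transpose)).det =
      N.det * (1 + s • N⁻¹.submatrix g g).det := by
  have hu : IsUnit N.det := isUnit_iff_ne_zero.2 hN
  have h1 : N + s • (incl g * (incl g).transpose) =
      N * (1 + (N⁻¹ * incl g) * (s • (incl g).transpose)) := by
    rw [mul_add, mul_one, ← Matrix.mul_assoc, ← Matrix.mul_assoc, Matrix.mul_nonsing_inv _ hu,
      Matrix.one_mul, Matrix.mul_smul]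
  rw [h1, Matrix.det_mul, Matrix.det_one_add_mul_comm, Matrix.smul_mul,
    transpose_incl_mul_mul_incl]

lemma norm_det_le_of_entries (W : Matrix β β ℂ) {c : ℝ} (h : ∀ i j, ‖W i j‖ ≤ c) :
    ‖W.det‖ ≤ (Fintype.card β).factorial * c ^ Fintype.card β := by
  have := Matrix.det_le (A := W) (abv := (NormedField.toAbsoluteValue ℂ)) (x := c) h
  rw [nsmul_eq_mul] at this
  exact this

lemma norm_one_add_smul_le {β : Type*} [DecidableEq β] (A : Matrix β β ℂ) {s : ℂ} (hs : ‖s‖ = 1) {P : ℝ}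
    (hA : ∀ i j, ‖A i j‖ ≤ P) (i j : β) : ‖(1 + s • A) i j‖ ≤ 1 + P := by
  rw [Matrix.add_apply, Matrix.smul_apply, smul_eq_mul]
  refine (norm_add_le _ _).trans (add_le_add ?_ ?_)
  · rw [Matrix.one_apply]; split_ifs <;> simp
  · rw [norm_mul, hs, one_mul]; exact hA i j

lemma norm_inv_entry_le (W : Matrix β β ℂ) {c w : ℝ} (hc : 1 ≤ c) (h : ∀ i j, ‖W i j‖ ≤ c)
    (hw : 0 < w) (hdet : w ≤ ‖W.det‖) (i j : β) :
    ‖W⁻¹ i j‖ ≤ (Fintype.card β).factorial * c ^ Fintype.card β / w := by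
  rw [Matrix.inv_def, Matrix.smul_apply, smul_eq_mul, Ring.inverse_eq_inv', norm_mul, norm_inv,
    mul_comm, ← div_eq_mul_inv, Matrix.adjugate_apply]
  have : ‖(W.updateRow j (Pi.single i 1)).det‖ ≤
      (Fintype.card β).factorial * c ^ Fintype.card β := by
    refine norm_det_le_of_entries _ fun a b => ?_
    rw [Matrix.updateRow_apply]
    split_ifs
    · rw [Pi.single_apply]; split_ifs <;> simp <;> linarith
    · exact h a b
  gcongr

lemma norm_inv_add_incl_le (N : Matrix α α ℂ) (hN : N.det ≠ 0) (g : β → α) {s : ℂ} (hs : ‖s‖ = 1)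
    {P w : ℝ} (hP : ∀ i j, ‖N⁻¹ i j‖ ≤ P) (hP0 : 0 ≤ P) (hw : 0 < w)
    (hdet : w ≤ ‖(1 + s • N⁻¹.submatrix g g).det‖) (i j : α) :
    ‖(N + s • (incl g * (incl g).transpose))⁻¹ i j‖ ≤
      P + (Fintype.card β) ^ 2 *
        (P * ((Fintype.card β).factorial * (1 + P) ^ Fintype.card β / w) * P) := by
  set W := 1 + s • N⁻¹.submatrix g g with hW
  have hu : IsUnit N.det := isUnit_iff_ne_zero.2 hN
  have hWu : IsUnit W.det := isUnit_iff_ne_zero.2 fun h => by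
    rw [h, norm_zero] at hdet; linarith
  have hinv : (N + s • (incl g * (incl g).transpose))⁻¹ =
      N⁻¹ - s • (N⁻¹ * incl g * (W⁻¹ * ((incl g).transpose * N⁻¹))) := by
    refine Matrix.inv_eq_right_inv ?_
    have h1 : W = 1 + s • ((incl g).transpose * (N⁻¹ * incl g)) := by
      rw [transpose_incl_mul_mul_incl]
    have h2 : s • ((incl g).transpose * (N⁻¹ * incl g)) = W - 1 := by rw [h1]; abel
    have h3 : W * W⁻¹ = 1 := Matrix.mul_nonsing_inv _ hWu
    have h4 : N * N⁻¹ = 1 := Matrix.mul_nonsing_inv _ hu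
    have e1 : N * (N⁻¹ * incl g * (W⁻¹ * ((incl g).transpose * N⁻¹))) =
        incl g * (W⁻¹ * ((incl g).transpose * N⁻¹)) := by
      rw [← Matrix.mul_assoc N, ← Matrix.mul_assoc N, h4, Matrix.one_mul]
    have e2 : s • (incl g * (incl g).transpose * (N⁻¹ * incl g * (W⁻¹ *
        ((incl g).transpose * N⁻¹)))) = incl g * ((W - 1) * (W⁻¹ * ((incl g).transpose * N⁻¹))) := by
      rw [← h2]
      simp only [Matrix.mul_assoc, Matrix.smul_mul, Matrix.mul_smul]
    have e3 : (W - 1) * (W⁻¹ * ((incl g).transpose * N⁻¹)) = (incl g).transpose * N⁻¹ -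
        W⁻¹ * ((incl g).transpose * N⁻¹) := by
      rw [Matrix.sub_mul, ← Matrix.mul_assoc W, h3, Matrix.one_mul, Matrix.one_mul]
    rw [add_mul, mul_sub, mul_sub, h4, Matrix.mul_smul, e1, Matrix.smul_mul,
      Matrix.smul_mul, Matrix.mul_smul, e2, e3, Matrix.mul_sub, Matrix.mul_assoc (incl g)]
    rw [smul_sub]
    abel
  rw [hinv, Matrix.sub_apply, Matrix.smul_apply, smul_eq_mul]
  refine (norm_sub_le _ _).trans (add_le_add (hP i j) ?_)
  rw [norm_mul, hs, one_mul]
  have e1 : ∀ b, (N⁻¹ * incl g) i b = N⁻¹ i (g b) := fun b => by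
    simp [Matrix.mul_apply, incl]
  have e2 : ∀ b, ((incl g).transpose * N⁻¹) b j = N⁻¹ (g b) j := fun b => by
    simp [Matrix.mul_apply, incl]
  have hc := norm_inv_entry_le W (c := 1 + P) (by linarith)
    (norm_one_add_smul_le _ hs fun a b => by rw [Matrix.submatrix_apply]; exact hP _ _) hw hdet
  rw [Matrix.mul_apply]
  calc _ ≤ ∑ b : β, ‖(N⁻¹ * incl g) i b * (W⁻¹ * ((incl g).transpose * N⁻¹)) b j‖ :=
        norm_sum_le _ _
    _ ≤ ∑ _b : β, ∑ _b' : β,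
        P * ((Fintype.card β).factorial * (1 + P) ^ Fintype.card β / w) * P := by
        refine Finset.sum_le_sum fun b _ => ?_
        rw [norm_mul, e1, Matrix.mul_apply]
        refine (mul_le_mul (hP _ _) (norm_sum_le _ _) (norm_nonneg _) hP0).trans ?_
        rw [Finset.mul_sum]
        refine Finset.sum_le_sum fun b' _ => ?_
        rw [norm_mul, e2, mul_assoc]
        exact mul_le_mul_of_nonneg_left (mul_le_mul (hc _ _) (hP _ _) (norm_nonneg _)
          (by positivity)) hP0
    _ = _ := by simp; ring

end Matrix

/-- A holomorphic extension of a periodic function to a strip, with bounds. -/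
structure Ext (f : ℝ → ℝ) where
  F : ℂ → ℂ
  ρ : ℝ
  C : ℝ
  hρ : 0 < ρ
  hC : 1 ≤ C
  diff : DifferentiableOn ℂ F (strip ρ)
  real : ∀ x : ℝ, F x = f x
  bdd : ∀ z ∈ strip ρ, ‖F z‖ ≤ C
  lip : ∀ z ∈ strip ρ, ∀ w ∈ strip ρ, ‖F z - F w‖ ≤ C * ‖z - w‖

/-- The phase `n·ω`. -/
def dotw (ω : Fin d → ℝ) (n : Fin d → ℤ) : ℝ := ∑ j, (n j : ℝ) * ω j

lemma dotw_add (ω : Fin d → ℝ) (n k : Fin d → ℤ) : dotw ω (n + k) = dotw ω n + dotw ω k := by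
  simp [dotw, add_mul, Finset.sum_add_distrib]

lemma dotw_sub (ω : Fin d → ℝ) (n k : Fin d → ℤ) : dotw ω (n - k) = dotw ω n - dotw ω k := by
  simp [dotw, sub_mul, Finset.sum_sub_distrib]

lemma volume_affine (x0 : ℝ) {r : ℝ} (hr : 0 < r) (T : Set ℝ) :
    volume {x : ℝ | (x - x0) / r ∈ T} = ENNReal.ofReal r * volume T := by
  have h : {x : ℝ | (x - x0) / r ∈ T} = (fun x => x - x0) ⁻¹' ((fun x => r⁻¹ * x) ⁻¹' T) := by
    ext x
    show (x - x0) / r ∈ T ↔ r⁻¹ * (x - x0) ∈ T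
    rw [div_eq_inv_mul]
  simp only [sub_eq_add_neg] at h ⊢
  rw [h, measure_preimage_add_right, Real.volume_preimage_mul_left (inv_ne_zero hr.ne'), inv_inv,
    abs_of_pos hr]

lemma mat_add_indicator (δ : ℝ) (v : (Fin d → ℤ) → ℂ) (Λ : Finset (Fin d → ℤ))
    (B : Set (Fin d → ℤ)) (s : ℂ) [DecidablePred (fun n : Λ => n.1 ∈ B)] :
    mat δ (fun n => v n + B.indicator (fun _ => s) n) Λ = mat δ v Λ +
      s • (incl (fun m : {n : Λ // n.1 ∈ B} => m.1) *
        (incl (fun m : {n : Λ // n.1 ∈ B} => m.1)).transpose) := by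
  classical
  ext n k
  have h : (incl (fun m : {n : Λ // n.1 ∈ B} => m.1) *
        (incl (fun m : {n : Λ // n.1 ∈ B} => m.1)).transpose) n k =
        if n = k ∧ n.1 ∈ B then 1 else 0 := by
    simp only [Matrix.mul_apply, incl, Matrix.transpose_apply, Matrix.of_apply]
    split_ifs with h
    · obtain ⟨rfl, hB⟩ := h
      rw [Finset.sum_eq_single ⟨n, hB⟩]
      · simp
      · intro m _ hm
        have : n ≠ m.1 := fun h => hm (Subtype.ext h.symm)
        simp [this]
      · simp
    · refine Finset.sum_eq_zero fun m _ => ?_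
      by_cases h1 : n = m.1
      · by_cases h2 : k = m.1
        · exact absurd ⟨h1.trans h2.symm, h1 ▸ m.2⟩ h
        · simp [h2]
      · simp [h1]
  rw [Matrix.add_apply, Matrix.smul_apply, h]
  simp only [mat, Matrix.of_apply, smul_eq_mul]
  by_cases h1 : n = k
  · by_cases h2 : n.1 ∈ B
    · simp [h1, h1 ▸ h2]; ring
    · have h3 : k.1 ∉ B := h1 ▸ h2
      simp [h1, h3]
  · simp [h1]

lemma differentiableOn_det {α : Type*} [Fintype α] [DecidableEq α] {A : ℂ → Matrix α α ℂ}
    {U : Set ℂ} (h : ∀ i j, DifferentiableOn ℂ (fun z => A z i j) U) :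
    DifferentiableOn ℂ (fun z => (A z).det) U := by
  simp only [Matrix.det_apply]
  refine DifferentiableOn.fun_sum fun σ _ => ?_
  refine DifferentiableOn.const_smul ?_ _
  exact DifferentiableOn.fun_finsetProd fun i _ => h _ _

/-- Invertibility with a good bound outside of a small subset of a disc, from invertibility with
a bad bound at its center. -/
lemma cartan_disc {f : ℝ → ℝ} (X : Ext f) {δ : ℝ} (hδ : 0 ≤ δ) (ω : Fin d → ℝ) (E x0 r : ℝ)
    (hr : 0 < r) (hrρ : 2 * r ≤ X.ρ) (Λ : Finset (Fin d → ℤ)) (B : Set (Fin d → ℤ))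
    {P P1 M : ℝ} (hP : 1 ≤ P)
    (hN : Inv δ (fun n => ((f (x0 + dotw ω n) - E : ℝ) : ℂ) +
      B.indicator (fun _ => Complex.I) n) Λ (fun _ _ => P))
    (hrP : X.C * (2 * r) * (Λ.card * P) ≤ 1 / 2)
    (hA : Inv δ (fun n => ((f (x0 + dotw ω n) - E : ℝ) : ℂ)) Λ (fun _ _ => P1))
    (b : ℕ) (hb : {n : Λ | n.1 ∈ B}.ncard = b) (hM : 1 ≤ M)
    (hbM : b.factorial * (1 + 2 * P) ^ b ≤ Real.exp M)
    (hbM1 : b.factorial * (1 + P1) ^ b ≤ Real.exp M) (S : ℝ) :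
    volume {x : ℝ | |x - x0| ≤ r / 4 ∧ ¬ Inv δ (fun n => ((f (x + dotw ω n) - E : ℝ) : ℂ)) Λ
      (fun _ _ => 2 * P + b ^ 2 * (2 * P * (Real.exp M * Real.exp (S * M)) * (2 * P)))} ≤
      ENNReal.ofReal (8 * r * Real.exp (-((S - 5) / 8))) := by
  classical
  set β := {n : Λ // n.1 ∈ B}
  have hcard : Fintype.card β = b := by
    rw [← hb, ← Nat.card_coe_set_eq, Nat.card_eq_fintype_card]; rfl
  set g : β → Λ := fun m => m.1
  -- complexified potentials
  let V : ℂ → (Fin d → ℤ) → ℂ := fun z n => X.F (x0 + r * z + dotw ω n) - E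
  let VN : ℂ → (Fin d → ℤ) → ℂ := fun z n => V z n + B.indicator (fun _ => Complex.I) n
  have hstrip : ∀ z ∈ Metric.ball (0:ℂ) 2, ∀ n, ((x0 : ℂ) + r * z + dotw ω n) ∈ strip X.ρ := by
    intro z hz n
    show |((x0 : ℂ) + r * z + dotw ω n).im| < X.ρ
    have h1 : ((x0 : ℂ) + r * z + dotw ω n).im = r * z.im := by simp
    rw [h1, abs_mul, abs_of_pos hr]
    have h2 := Complex.abs_im_le_norm z
    have h3 : ‖z‖ < 2 := by simpa using hz
    nlinarith
  have hstrip0 : ∀ x : ℝ, (x : ℂ) ∈ strip X.ρ := fun x => by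
    show |(x : ℂ).im| < X.ρ
    simpa using X.hρ
  have hVreal : ∀ (y : ℝ) n, V y n = ((f (x0 + r * y + dotw ω n) - E : ℝ) : ℂ) := by
    intro y n
    have := X.real (x0 + r * y + dotw ω n)
    push_cast at this ⊢
    show X.F _ - E = _
    rw [this]
  have hINV : ∀ z ∈ Metric.ball (0:ℂ) 2, Inv δ (VN z) Λ (fun _ _ => 2 * P) := by
    intro z hz
    have h3 : ‖z‖ < 2 := by simpa using hz
    refine (hN.perturb (v' := VN z) (P := P) (e := X.C * (2 * r)) hδ (fun _ _ _ _ => le_rfl)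
      (by linarith) (fun n _ => ?_) hrP).mono fun n _ k _ => ?_
    · have h1 := hVreal 0 n
      simp only [Complex.ofReal_zero, mul_zero, add_zero] at h1
      have h2 : VN z n - (((f (x0 + dotw ω n) - E : ℝ) : ℂ) +
          B.indicator (fun _ => Complex.I) n) = X.F (x0 + r * z + dotw ω n) -
          X.F ((x0 + dotw ω n : ℝ) : ℂ) := by
        rw [X.real]; simp only [VN, V]; push_cast; ring
      rw [h2]
      refine (X.lip _ (hstrip z hz n) _ (hstrip0 _)).trans ?_
      have h4 : ((x0 : ℂ) + r * z + dotw ω n) - ((x0 + dotw ω n : ℝ) : ℂ) = r * z := by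
        push_cast; ring
      rw [h4, norm_mul, Complex.norm_real, Real.norm_of_nonneg hr.le]
      have := X.hC
      have h5 : r * ‖z‖ ≤ 2 * r := by nlinarith
      gcongr
    · have h1 : 2 * (Λ.card : ℝ) * P ^ 2 * (X.C * (2 * r)) =
        2 * P * (X.C * (2 * r) * (Λ.card * P)) := by ring
      rw [h1]; nlinarith
  let D : ℂ → ℂ := fun z => (mat δ (V z) Λ).det / (mat δ (VN z) Λ).det
  have hVN : ∀ z, mat δ (VN z) Λ = mat δ (V z) Λ + Complex.I • (incl g * (incl g).transpose) :=
    fun z => mat_add_indicator δ (V z) Λ B Complex.I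
  have hV : ∀ z, mat δ (V z) Λ =
      mat δ (VN z) Λ + (-Complex.I) • (incl g * (incl g).transpose) := fun z => by
    rw [hVN z, neg_smul]; abel
  have hD : ∀ z ∈ Metric.ball (0:ℂ) 2, D z =
      (1 + (-Complex.I) • (mat δ (VN z) Λ)⁻¹.submatrix g g).det := by
    intro z hz
    simp only [D]
    rw [hV z, det_add_incl _ (hINV z hz).1, mul_div_cancel_left₀ _ (hINV z hz).1]
  have hVdiff : ∀ n, DifferentiableOn ℂ (fun z => V z n) (Metric.ball 0 2) := by
    intro n
    refine DifferentiableOn.sub_const ?_ _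
    exact X.diff.comp (g := X.F) (f := fun z => (x0 : ℂ) + r * z + dotw ω n)
      (by fun_prop) (fun z hz => hstrip z hz n)
  have hDdiff : DifferentiableOn ℂ D (Metric.ball 0 2) := by
    refine DifferentiableOn.div ?_ ?_ (fun z hz => (hINV z hz).1)
    · refine differentiableOn_det fun i j => ?_
      simp only [mat, Matrix.of_apply]
      split_ifs
      · exact (hVdiff _).const_add _
      · exact differentiableOn_const _
    · refine differentiableOn_det fun i j => ?_
      simp only [mat, Matrix.of_apply]
      split_ifs
      · exact ((hVdiff _).add_const _).const_add _
      · exact differentiableOn_const _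
  have hDb : ∀ z, ‖z‖ = 1 → ‖D z‖ ≤ Real.exp M := by
    intro z hz
    have hzb : z ∈ Metric.ball (0:ℂ) 2 := by simp [hz]
    rw [hD z hzb]
    refine (norm_det_le_of_entries _ (c := 1 + 2 * P)
      (norm_one_add_smul_le _ (by simp) fun i j => ?_)).trans (by rw [hcard]; exact hbM)
    rw [Matrix.submatrix_apply]; exact (hINV z hzb).2 _ _
  have hA0 : Inv δ (V 0) Λ (fun _ _ => P1) := by
    have : V 0 = fun n => ((f (x0 + dotw ω n) - E : ℝ) : ℂ) := by
      ext n; have := hVreal 0 n; simpa using this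
    rw [this]; exact hA
  have hD0 : Real.exp (-M) ≤ ‖D 0‖ := by
    have h0 : (0:ℂ) ∈ Metric.ball (0:ℂ) 2 := by simp
    have h1 : (mat δ (VN 0) Λ).det = (mat δ (V 0) Λ).det *
        (1 + Complex.I • (mat δ (V 0) Λ)⁻¹.submatrix g g).det := by
      rw [hVN 0, det_add_incl _ hA0.1]
    have h2 : ‖(1 + Complex.I • (mat δ (V 0) Λ)⁻¹.submatrix g g).det‖ ≤ Real.exp M := by
      refine (norm_det_le_of_entries _ (c := 1 + P1)
        (norm_one_add_smul_le _ (by simp) fun i j => ?_)).trans (by rw [hcard]; exact hbM1)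
      rw [Matrix.submatrix_apply]; exact hA0.2 _ _
    have h3 : D 0 * (1 + Complex.I • (mat δ (V 0) Λ)⁻¹.submatrix g g).det = 1 := by
      simp only [D]
      rw [div_mul_eq_mul_div, ← h1, div_self (hINV 0 h0).1]
    have h4 := congrArg norm h3
    rw [norm_mul, norm_one] at h4
    rw [Real.exp_neg, inv_le_iff_one_le_mul₀ (Real.exp_pos _)]
    exact h4.ge.trans (mul_le_mul_of_nonneg_left h2 (norm_nonneg _))
  have hcart := cartan_estimate D M hM hDdiff hDb hD0 S
  refine (measure_mono (t := {x : ℝ | (x - x0) / r ∈ {y : ℝ | |y| ≤ 1 / 4 ∧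
    ‖D y‖ < Real.exp (-(S * M))}}) fun x hx => ?_).trans ?_
  · obtain ⟨hx1, hx2⟩ := hx
    set y := (x - x0) / r with hy
    have hxy : x = x0 + r * y := by rw [hy]; field_simp; ring
    have hy1 : |y| ≤ 1 / 4 := by
      rw [hy, abs_div, abs_of_pos hr, div_le_iff₀ hr]; linarith
    refine ⟨hy1, ?_⟩
    by_contra hcon
    rw [not_lt] at hcon
    have hyb : (y : ℂ) ∈ Metric.ball (0:ℂ) 2 := by
      simp only [Metric.mem_ball, dist_zero_right, Complex.norm_real, Real.norm_eq_abs]; linarith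
    have hVy : V y = fun n => ((f (x + dotw ω n) - E : ℝ) : ℂ) := by
      ext n; rw [hVreal, hxy]
    apply hx2
    rw [← hVy]
    have hDy := hD y hyb
    rw [hDy] at hcon
    have hpos := Real.exp_pos (-(S * M))
    refine ⟨?_, fun i j => ?_⟩
    · rw [hV, det_add_incl _ (hINV y hyb).1]
      refine mul_ne_zero (hINV y hyb).1 fun h => ?_
      rw [h, norm_zero] at hcon; linarith
    · rw [hV]
      refine (norm_inv_add_incl_le _ (hINV y hyb).1 g (by simp) (hINV y hyb).2 (by linarith)
        hpos hcon i j).trans ?_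
      rw [hcard]
      have h6 : Real.exp (-(S * M)) * Real.exp (S * M) = 1 := by rw [← Real.exp_add]; simp
      have h7 : b.factorial * (1 + 2 * P) ^ b / Real.exp (-(S * M)) ≤
          Real.exp M * Real.exp (S * M) := by
        rw [div_le_iff₀ hpos, mul_assoc, mul_comm (Real.exp (S * M)), h6, mul_one]; exact hbM
      beta_reduce
      gcongr
  · rw [volume_affine x0 hr]
    refine (mul_le_mul_right hcart _).trans ?_
    rw [← ENNReal.ofReal_mul hr.le]
    apply le_of_eq; congr 1; ring

lemma exists_grid (r : ℝ) (hr : 0 < r) (hr1 : r ≤ 1) : ∃ N : ℕ, 0 < N ∧ (N : ℝ) * r ≤ 9 ∧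
    (1:ℝ) / N ≤ r / 8 ∧ Set.Icc (0:ℝ) 1 ⊆ ⋃ j ∈ Finset.range N, Set.Icc ((j:ℝ) / N) ((j + 1) / N) := by
  refine ⟨⌈8 / r⌉₊, Nat.ceil_pos.2 (by positivity), ?_, ?_, ?_⟩
  · have := (Nat.ceil_lt_add_one (by positivity : 0 ≤ 8 / r)).le
    calc _ ≤ (8 / r + 1) * r := by gcongr
      _ = 8 + r := by field_simp
      _ ≤ 9 := by linarith
  · have h := Nat.le_ceil (8 / r)
    rw [div_le_div_iff₀ (lt_of_lt_of_le (by positivity) h) (by norm_num)]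
    rw [div_le_iff₀ hr] at h
    linarith
  · intro x hx
    set N := ⌈8 / r⌉₊ with hN
    have hN0 : 0 < N := Nat.ceil_pos.2 (by positivity)
    have hNr : (0:ℝ) < N := by exact_mod_cast hN0
    rcases eq_or_lt_of_le hx.2 with h1 | h1
    · refine Set.mem_biUnion (x := N - 1) (Finset.mem_coe.2 (Finset.mem_range.2 (by omega))) ?_
      have h2 : (((N - 1 : ℕ) : ℝ)) = N - 1 := by rw [Nat.cast_sub hN0]; simp
      rw [h2, h1]
      constructor
      · rw [div_le_one hNr]; linarith
      · rw [sub_add_cancel, div_self hNr.ne']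
    · refine Set.mem_biUnion (x := ⌊x * N⌋₊) (Finset.mem_coe.2 (Finset.mem_range.2 ?_)) ?_
      · rw [Nat.floor_lt (mul_nonneg hx.1 hNr.le)]; nlinarith
      · constructor
        · rw [div_le_iff₀ hNr]; exact Nat.floor_le (mul_nonneg hx.1 hNr.le)
        · rw [le_div_iff₀ hNr]; exact (Nat.lt_floor_add_one _).le

/-- If small intervals contain enough good points, the bad set is small. -/
lemma volume_le_of_grid {r c : ℝ} (hr : 0 < r) (hr1 : r ≤ 1) (hc : 0 ≤ c) (X0 bad : Set ℝ)
    (hX0 : volume (Set.Icc 0 1 \ X0) < ENNReal.ofReal (r / 9))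
    (h : ∀ x0 ∈ X0, volume {x : ℝ | |x - x0| ≤ r / 4 ∧ x ∈ bad} ≤ ENNReal.ofReal (8 * r * c)) :
    volume {x : ℝ | x ∈ Set.Icc (0:ℝ) 1 ∧ x ∈ bad} ≤ ENNReal.ofReal (100 * c) := by
  obtain ⟨N, hN0, hNr, hN8, hcov⟩ := exists_grid r hr hr1
  have hN' : (0:ℝ) < N := by exact_mod_cast hN0
  have hcell : ∀ j ∈ Finset.range N, volume {x : ℝ | x ∈ Set.Icc ((j:ℝ) / N) ((j + 1) / N) ∧
      x ∈ bad} ≤ ENNReal.ofReal (8 * r * c) := by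
    intro j hj
    have hlen : ((j:ℝ) + 1) / N - j / N = 1 / N := by rw [← sub_div]; ring
    have hx0 : ∃ x0 ∈ X0, x0 ∈ Set.Icc ((j:ℝ) / N) ((j + 1) / N) := by
      by_contra hcon
      push Not at hcon
      have hsub : Set.Icc ((j:ℝ) / N) ((j + 1) / N) ⊆ Set.Icc 0 1 \ X0 := by
        intro x hx
        refine ⟨⟨le_trans (by positivity) hx.1, hx.2.trans ?_⟩, fun h => hcon x h hx⟩
        rw [div_le_one hN']
        exact_mod_cast Finset.mem_range.1 hj
      have h1 := (measure_mono hsub).trans_lt hX0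
      rw [Real.volume_Icc, hlen, ENNReal.ofReal_lt_ofReal_iff (by positivity)] at h1
      rw [div_lt_iff₀ hN'] at h1
      nlinarith
    obtain ⟨x0, hx0, hx0'⟩ := hx0
    refine (measure_mono ?_).trans (h x0 hx0)
    rintro x ⟨hx, hxb⟩
    refine ⟨?_, hxb⟩
    rw [abs_le]
    constructor <;> linarith [hx.1, hx.2, hx0'.1, hx0'.2]
  calc volume {x : ℝ | x ∈ Set.Icc (0:ℝ) 1 ∧ x ∈ bad}
      ≤ volume (⋃ j ∈ Finset.range N, {x : ℝ | x ∈ Set.Icc ((j:ℝ) / N) ((j + 1) / N) ∧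
        x ∈ bad}) := by
        refine measure_mono ?_
        rintro x ⟨hx, hxb⟩
        have := hcov hx
        simp only [Set.mem_iUnion] at this ⊢
        obtain ⟨j, hj, hxj⟩ := this
        exact ⟨j, hj, hxj, hxb⟩
    _ ≤ ∑ j ∈ Finset.range N, ENNReal.ofReal (8 * r * c) :=
        (measure_biUnion_finset_le _ _).trans (Finset.sum_le_sum hcell)
    _ = ENNReal.ofReal (N * (8 * r * c)) := by
        rw [Finset.sum_const, Finset.card_range, nsmul_eq_mul,
          ENNReal.ofReal_mul (p := (N:ℝ)) (by positivity), ENNReal.ofReal_natCast]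
    _ ≤ _ := by
        refine ENNReal.ofReal_le_ofReal ?_
        calc N * (8 * r * c) = 8 * (N * r) * c := by ring
          _ ≤ 8 * 9 * c := by gcongr
          _ ≤ 100 * c := by gcongr; norm_num

/-- The potential at phase `x`. -/
def pot (f : ℝ → ℝ) (ω : Fin d → ℝ) (E x : ℝ) (n : Fin d → ℤ) : ℝ := f (x + dotw ω n) - E

lemma cartan_cover {f : ℝ → ℝ} (X : Ext f) {δ : ℝ} (hδ : 0 ≤ δ) (ω : Fin d → ℝ) (E r : ℝ)
    (hr : 0 < r) (hr1 : r ≤ 1) (hrρ : 2 * r ≤ X.ρ) (Λ : Finset (Fin d → ℤ)) (X0 : Set ℝ)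
    {P P1 M : ℝ} (hP : 1 ≤ P) (hP1 : 0 ≤ P1) (b0 : ℕ)
    (hX0 : volume (Set.Icc 0 1 \ X0) < ENNReal.ofReal (r / 9))
    (hrP : X.C * (2 * r) * (Λ.card * P) ≤ 1 / 2) (hM : 1 ≤ M)
    (hbM : b0.factorial * (1 + 2 * P) ^ b0 ≤ Real.exp M)
    (hbM1 : b0.factorial * (1 + P1) ^ b0 ≤ Real.exp M) (S : ℝ)
    (h : ∀ x0 ∈ X0, ∃ B : Set (Fin d → ℤ), {n : Λ | n.1 ∈ B}.ncard ≤ b0 ∧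
      Inv δ (fun n => (pot f ω E x0 n : ℂ) + B.indicator (fun _ => Complex.I) n) Λ (fun _ _ => P) ∧
      Inv δ (fun n => (pot f ω E x0 n : ℂ)) Λ (fun _ _ => P1)) :
    volume {x : ℝ | x ∈ Set.Icc (0:ℝ) 1 ∧ ¬ Inv δ (fun n => (pot f ω E x n : ℂ)) Λ
      (fun _ _ => 2 * P + b0 ^ 2 * (2 * P * (Real.exp M * Real.exp (S * M)) * (2 * P)))} ≤
      ENNReal.ofReal (100 * Real.exp (-((S - 5) / 8))) := by
  refine volume_le_of_grid hr hr1 (Real.exp_nonneg _) X0 {x | ¬ Inv δ (fun n => (pot f ω E x n : ℂ))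
    Λ (fun _ _ => 2 * P + b0 ^ 2 * (2 * P * (Real.exp M * Real.exp (S * M)) * (2 * P)))} hX0
    fun x0 hx0 => ?_
  obtain ⟨B, hB, hN, hA⟩ := h x0 hx0
  set b := {n : Λ | n.1 ∈ B}.ncard with hb
  have hmono : ∀ c : ℝ, 0 ≤ c → b.factorial * (1 + c) ^ b ≤ b0.factorial * (1 + c) ^ b0 := by
    intro c hc
    have h1 : (b.factorial : ℝ) ≤ b0.factorial := by exact_mod_cast Nat.factorial_le hB
    have h2 : (1 + c) ^ b ≤ (1 + c) ^ b0 := pow_le_pow_right₀ (by linarith) hB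
    gcongr
  refine (measure_mono ?_).trans (cartan_disc X hδ ω E x0 r hr hrρ Λ B hP hN hrP hA b rfl hM
    ((hmono _ (by linarith)).trans hbM) ((hmono _ hP1).trans hbM1) S)
  rintro x ⟨h1, h2⟩
  refine ⟨h1, fun h3 => h2 (h3.mono fun _ _ _ _ => ?_)⟩
  have hb' : (b : ℝ) ≤ b0 := by exact_mod_cast hB
  gcongr

/-- Clamping a site of a box so that the cube around it stays inside the box. -/
def clamp (a b : Fin d → ℤ) (ℓ : ℕ) (n : Fin d → ℤ) : Fin d → ℤ :=
  fun i => max (a i + ℓ) (min (n i) (b i - ℓ))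

section clamp
variable {a b n : Fin d → ℤ} {ℓ : ℕ}

lemma Q_clamp_subset (hab : ∀ i, a i + 2 * ℓ ≤ b i) : Q (clamp a b ℓ n) ℓ ⊆ Finset.Icc a b := by
  intro k hk
  rw [mem_Q, sd_le_iff] at hk
  rw [Finset.mem_Icc, Pi.le_def, Pi.le_def]
  have h (i : Fin d) : a i ≤ k i ∧ k i ≤ b i := by
    have h1 : (k i - max (a i + ℓ) (min (n i) (b i - ℓ))).natAbs ≤ ℓ := hk i
    have h2 := hab i
    omega
  exact ⟨fun i => (h i).1, fun i => (h i).2⟩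

lemma sd_clamp_le (hn : n ∈ Finset.Icc a b) (hab : ∀ i, a i + 2 * ℓ ≤ b i) :
    sd n (clamp a b ℓ n) ≤ ℓ := by
  rw [Finset.mem_Icc, Pi.le_def, Pi.le_def] at hn
  rw [sd_le_iff]; intro i
  have := hn.1 i; have := hn.2 i; have := hab i
  simp only [clamp]; omega

lemma clamp_mem (hab : ∀ i, a i + 2 * ℓ ≤ b i) : clamp a b ℓ n ∈ Finset.Icc a b :=
  Q_clamp_subset hab (n := n) (mem_Q.2 ((sd_self (clamp a b ℓ n)).le.trans (Nat.zero_le _)))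

lemma lt_sd_of_notMem_clamp (hn : n ∈ Finset.Icc a b)
    {k : Fin d → ℤ} (hk : k ∈ Finset.Icc a b) (hkQ : k ∉ Q (clamp a b ℓ n) ℓ) :
    ℓ + 1 ≤ sd n k := by
  rw [mem_Q, not_le, lt_sd_iff] at hkQ
  obtain ⟨i, hi⟩ := hkQ
  rw [Finset.mem_Icc, Pi.le_def, Pi.le_def] at hn hk
  have := hn.1 i; have := hn.2 i; have := hk.1 i; have := hk.2 i
  have h2 := natAbs_le_sd n k i
  simp only [clamp] at hi
  omega

lemma sd_le_of_adj_clamp (hn : n ∈ Finset.Icc a b) (hab : ∀ i, a i + 2 * ℓ ≤ b i)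
    {k k' : Fin d → ℤ} (hk : k ∈ Q (clamp a b ℓ n) ℓ) (hkk' : sd k k' ≤ 1) :
    sd n k' ≤ 2 * ℓ + 1 := by
  have h1 := sd_clamp_le hn hab
  have h2 := mem_Q.1 hk
  have h3 := sd_triangle n (clamp a b ℓ n) k'
  have h4 := sd_triangle (clamp a b ℓ n) k k'
  rw [sd_comm] at h2
  omega

end clamp

/-- The box of size `t ^ 8` at phase `x` has a good Green function. -/
def Good (δ : ℝ) (f : ℝ → ℝ) (ω : Fin d → ℝ) (E : ℝ) (t : ℕ) (s x : ℝ) : Prop :=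
  Inv δ (fun n => (pot f ω E x n : ℂ)) (Q 0 (t ^ 8))
    (fun n k => Real.exp ((t ^ 5 - s) - (1 + 1 / (t : ℝ)) * sd n k))

lemma pot_add (f : ℝ → ℝ) (ω : Fin d → ℝ) (E x : ℝ) (n c : Fin d → ℤ) :
    pot f ω E x (n + c) = pot f ω E (x + dotw ω c) n := by
  simp only [pot, dotw_add]; congr 2; ring

lemma pot_fract {f : ℝ → ℝ} (hf : ∀ x, f (x + 1) = f x) (ω : Fin d → ℝ) (E x : ℝ) :
    pot f ω E (Int.fract x) = pot f ω E x := by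
  ext n
  have : Function.Periodic f 1 := hf
  have h := this.sub_int_mul_eq (x := x + dotw ω n) ⌊x⌋
  simp only [pot]
  rw [← h, Int.fract]; congr 2; ring

lemma good_fract {f : ℝ → ℝ} (hf : ∀ x, f (x + 1) = f x) {δ : ℝ} {ω : Fin d → ℝ} {E : ℝ} {t : ℕ}
    {s x : ℝ} : Good δ f ω E t s (Int.fract x) ↔ Good δ f ω E t s x := by
  unfold Good; rw [pot_fract hf]

lemma Good.inv_Q {f : ℝ → ℝ} {δ : ℝ} {ω : Fin d → ℝ} {E : ℝ} {t : ℕ}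
    {s x : ℝ} {c : Fin d → ℤ} (h : Good δ f ω E t s (x + dotw ω c)) :
    Inv δ (fun n => (pot f ω E x n : ℂ)) (Q c (t ^ 8))
      (fun n k => Real.exp ((t ^ 5 - s) - (1 + 1 / (t : ℝ)) * sd n k)) := by
  refine Inv.translate_Q c ?_
  simp only [pot_add]
  exact h

/-- The frequency satisfies a Diophantine condition for sites of size at most `N`. -/
def Sep (ω : Fin d → ℝ) (N : ℕ) (η : ℝ) : Prop :=
  ∀ n : Fin d → ℤ, n ≠ 0 → sd n 0 ≤ N → ∀ m : ℤ, η ≤ |dotw ω n - m|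

/-- Separated sets of bad phases are small. -/
def LDTc (δ : ℝ) (f : ℝ → ℝ) (ω : Fin d → ℝ) (t K : ℕ) : Prop :=
  ∀ E : ℝ, ∀ Y : Finset ℝ, (∀ y ∈ Y, y ∈ Set.Ico (0:ℝ) 1 ∧ ¬ Good δ f ω E t 0 y) →
    (∀ y ∈ Y, ∀ y' ∈ Y, y < y' → Real.exp (-t) ≤ y' - y) → Y.card ≤ K

/-- The set of bad phases has small measure. -/
def LDTm (δ : ℝ) (f : ℝ → ℝ) (ω : Fin d → ℝ) (t : ℕ) : Prop :=
  ∀ E : ℝ, volume {x : ℝ | x ∈ Set.Icc (0:ℝ) 1 ∧ ¬ Good δ f ω E t 1 x} <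
    ENNReal.ofReal (Real.exp (-t))

lemma Good.mono {f : ℝ → ℝ} {δ : ℝ} {ω : Fin d → ℝ} {E : ℝ} {t : ℕ}
    {s s' x : ℝ} (hs : s' ≤ s) (h : Good δ f ω E t s x) : Good δ f ω E t s' x :=
  Inv.mono h fun _ _ _ _ => Real.exp_le_exp.2 (by linarith)

lemma LDTc.card_sites {f : ℝ → ℝ} (hf : ∀ x, f (x + 1) = f x) {δ : ℝ} {ω : Fin d → ℝ} {t K : ℕ}
    (h : LDTc δ f ω t K) {N : ℕ} (hsep : Sep ω N (Real.exp (-t))) (E x : ℝ)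
    (𝒞 : Finset (Fin d → ℤ)) (hN : ∀ c ∈ 𝒞, ∀ c' ∈ 𝒞, sd c c' ≤ N)
    (hbad : ∀ c ∈ 𝒞, ¬ Good δ f ω E t 0 (x + dotw ω c)) : 𝒞.card ≤ K := by
  classical
  have key : ∀ c ∈ 𝒞, ∀ c' ∈ 𝒞, c ≠ c' →
      Real.exp (-t) ≤ |Int.fract (x + dotw ω c) - Int.fract (x + dotw ω c')| := by
    intro c hc c' hc' hne
    have h1 := hsep (c - c') (sub_ne_zero.2 hne) (by
      have := sd_add_right (c - c') 0 c'
      rw [sub_add_cancel, zero_add] at this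
      rw [← this]; exact hN c hc c' hc') (⌊x + dotw ω c⌋ - ⌊x + dotw ω c'⌋)
    rw [dotw_sub] at h1
    push_cast at h1
    have h2 : Int.fract (x + dotw ω c) - Int.fract (x + dotw ω c') =
        dotw ω c - dotw ω c' - (⌊x + dotw ω c⌋ - ⌊x + dotw ω c'⌋) := by
      rw [Int.fract, Int.fract]; ring
    rw [h2]; exact h1
  have hinj : Set.InjOn (fun c => Int.fract (x + dotw ω c)) 𝒞 := by
    intro c hc c' hc' hcc
    by_contra hne
    have := key c hc c' hc' hne
    simp only at hcc
    rw [hcc, sub_self, abs_zero] at this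
    exact absurd this (not_le.2 (Real.exp_pos _))
  rw [← Finset.card_image_of_injOn hinj]
  refine h E _ (fun y hy => ?_) fun y hy y' hy' hlt => ?_
  · obtain ⟨c, hc, rfl⟩ := Finset.mem_image.1 hy
    exact ⟨⟨Int.fract_nonneg _, Int.fract_lt_one _⟩, by rw [good_fract hf]; exact hbad c hc⟩
  · obtain ⟨c, hc, rfl⟩ := Finset.mem_image.1 hy
    obtain ⟨c', hc', rfl⟩ := Finset.mem_image.1 hy'
    have := key c' hc' c hc (fun h => by subst h; exact lt_irrefl _ hlt)
    rwa [abs_of_pos (sub_pos.2 hlt)] at this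

lemma volume_shift_le {bad : Set ℝ} (hb : ∀ x, x + 1 ∈ bad ↔ x ∈ bad) (c : ℝ) :
    volume {x : ℝ | x ∈ Set.Icc (0:ℝ) 1 ∧ x + c ∈ bad} ≤
      2 * volume {x : ℝ | x ∈ Set.Icc (0:ℝ) 1 ∧ x ∈ bad} := by
  have hbi : ∀ (m : ℤ) (x : ℝ), x + m ∈ bad ↔ x ∈ bad := by
    have hn : ∀ (m : ℕ) (x : ℝ), x + m ∈ bad ↔ x ∈ bad := by
      intro m
      induction m with
      | zero => simp
      | succ m ih => intro x; rw [Nat.cast_succ, ← add_assoc, hb, ih]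
    intro m x
    obtain ⟨k, rfl | rfl⟩ := m.eq_nat_or_neg
    · exact_mod_cast hn k x
    · rw [← hn k (x + _)]; simp
  set T := {x : ℝ | x ∈ Set.Icc (0:ℝ) 1 ∧ x ∈ bad}
  calc volume {x : ℝ | x ∈ Set.Icc (0:ℝ) 1 ∧ x + c ∈ bad}
      ≤ volume ((fun x => x + Int.fract c) ⁻¹' T ∪ (fun x => x + (Int.fract c - 1)) ⁻¹' T) := by
        refine measure_mono ?_
        rintro x ⟨hx, hxb⟩
        have h0 := Int.fract_nonneg c
        have h1 := (Int.fract_lt_one c).le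
        have h2 : x + Int.fract c ∈ bad := by
          rw [← hbi ⌊c⌋]; rw [Int.fract]; convert hxb using 1; ring
        rcases le_or_gt (x + Int.fract c) 1 with h | h
        · exact Or.inl ⟨⟨add_nonneg hx.1 h0, h⟩, h2⟩
        · refine Or.inr ⟨⟨?_, ?_⟩, ?_⟩
          · linarith
          · linarith [hx.2]
          · rw [← hb]; convert h2 using 1; ring
    _ ≤ volume T + volume T := by
        refine (measure_union_le _ _).trans ?_
        rw [measure_preimage_add_right, measure_preimage_add_right]
    _ = _ := (two_mul _).symm

lemma good_add_one {f : ℝ → ℝ} (hf : ∀ x, f (x + 1) = f x) {δ : ℝ} {ω : Fin d → ℝ} {E : ℝ} {t : ℕ}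
    {s x : ℝ} : Good δ f ω E t s (x + 1) ↔ Good δ f ω E t s x := by
  rw [← good_fract hf, Int.fract_add_one, good_fract hf]

lemma sd_le_of_mem_Icc {a b n k : Fin d → ℤ} {L : ℕ} (hL : ∀ i, b i ≤ a i + L)
    (hn : n ∈ Finset.Icc a b) (hk : k ∈ Finset.Icc a b) : sd n k ≤ L := by
  rw [Finset.mem_Icc, Pi.le_def, Pi.le_def] at hn hk
  rw [sd_le_iff]; intro i
  have := hn.1 i; have := hn.2 i; have := hk.1 i; have := hk.2 i; have := hL i
  omega

/-- The Green function of a box with good small cubes. -/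
lemma rect_inv {f : ℝ → ℝ} {δ : ℝ} (hδ : 0 ≤ δ) (hδ1 : δ * 3 ^ d ≤ 1) {ω : Fin d → ℝ} {E x : ℝ}
    {a b : Fin d → ℤ} {t : ℕ} (ht : 1 ≤ t) (hab : ∀ i, a i + 2 * (t ^ 8 : ℕ) ≤ b i) {V : ℝ}
    (hV1 : 1 ≤ V) (hV : ((Finset.Icc a b).card : ℝ) ≤ V)
    (hex : V * Real.exp (t ^ 5 + 2 - (t ^ 8 + 1)) ≤ 1 / 2) {B : Set (Fin d → ℤ)}
    (hB : ∀ n ∈ Finset.Icc a b, n ∉ B →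
      Good δ f ω E t 0 (x + dotw ω (clamp a b (t ^ 8) n))) :
    Inv δ (fun n => (pot f ω E x n : ℂ) + B.indicator (fun _ => Complex.I) n) (Finset.Icc a b)
      (fun _ _ => 8 * (V * Real.exp (t ^ 5)) ^ 2) := by
  have ht' : (1:ℝ) ≤ t := by exact_mod_cast ht
  have ht1 : 1 / (t:ℝ) ≤ 1 := by rw [div_le_one (by linarith)]; exact ht'
  have ht0 : 0 ≤ 1 / (t:ℝ) := by positivity
  refine inv_add_I (σ := t ^ 5) (κ := 1 + 1 / (t:ℝ)) (ℓ := t ^ 8) hδ hδ1 (by positivity)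
    (by linarith) ?_ ?_ ?_ ?_
  · have : 1 ≤ Real.exp ((t:ℝ) ^ 5) := Real.one_le_exp (by positivity)
    nlinarith
  · gcongr
  · refine le_trans ?_ hex
    gcongr
    · push_cast
      have : 0 ≤ 1 / (t:ℝ) * ((t:ℝ) ^ 8 + 1) := by positivity
      nlinarith
  · intro n hn hnB
    refine ⟨_, Q_clamp_subset hab, mem_Q.2 (sd_clamp_le hn hab), ?_, fun k' h1 h2 => ?_⟩
    · have := (hB n hn hnB).inv_Q
      rwa [sub_zero] at this
    · exact lt_sd_of_notMem_clamp hn h1 h2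

lemma ncard_bad_le {f : ℝ → ℝ} (hf : ∀ x, f (x + 1) = f x) {δ : ℝ} {ω : Fin d → ℝ} {E x : ℝ}
    {a b : Fin d → ℤ} {t K L : ℕ} (hab : ∀ i, a i + 2 * (t ^ 8 : ℕ) ≤ b i)
    (hL : ∀ i, b i ≤ a i + L) (hc : LDTc δ f ω t K) (hsep : Sep ω L (Real.exp (-t))) :
    {n : (Finset.Icc a b) | n.1 ∈ {n | ¬ Good δ f ω E t 0 (x + dotw ω (clamp a b (t ^ 8) n))}}.ncard
      ≤ K * (2 * t ^ 8 + 1) ^ d := by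
  classical
  set 𝒞 := (Finset.Icc a b).filter fun c => ¬ Good δ f ω E t 0 (x + dotw ω c)
  have h𝒞 : 𝒞.card ≤ K := hc.card_sites hf hsep E x 𝒞
    (fun c hc c' hc' => sd_le_of_mem_Icc hL (Finset.mem_filter.1 hc).1 (Finset.mem_filter.1 hc').1)
    (fun c hc => (Finset.mem_filter.1 hc).2)
  have hle : (𝒞.biUnion fun c => Q c (t ^ 8)).card ≤ K * (2 * t ^ 8 + 1) ^ d := by
    refine Finset.card_biUnion_le.trans ?_
    simp only [card_Q, Finset.sum_const, smul_eq_mul]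
    gcongr
  refine le_trans ?_ hle
  rw [← Set.ncard_coe_finset, ← Set.ncard_image_of_injective _ Subtype.val_injective]
  refine Set.ncard_le_ncard ?_ (Finset.finite_toSet _)
  rintro _ ⟨n, hn, rfl⟩
  rw [Finset.mem_coe, Finset.mem_biUnion]
  exact ⟨_, Finset.mem_filter.2 ⟨clamp_mem hab, hn⟩, mem_Q.2 (sd_clamp_le n.2 hab)⟩

/-- The measure of the set of phases for which the Green function of a box is large. -/
lemma rect_measure {f : ℝ → ℝ} (hf : ∀ x, f (x + 1) = f x) (X : Ext f) {δ : ℝ} (hδ : 0 ≤ δ)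
    (hδ1 : δ * 3 ^ d ≤ 1) {ω : Fin d → ℝ} (E : ℝ) {a b : Fin d → ℤ} {t0 t1 K L : ℕ}
    (ht0 : 1 ≤ t0) (ht1 : 1 ≤ t1) (hab0 : ∀ i, a i + 2 * (t0 ^ 8 : ℕ) ≤ b i)
    (hab1 : ∀ i, a i + 2 * (t1 ^ 8 : ℕ) ≤ b i)
    (hL : ∀ i, b i ≤ a i + L) (hc : LDTc δ f ω t0 K) (hm : LDTm δ f ω t1)
    (hsep : Sep ω L (Real.exp (-t0))) {V : ℝ} (hV1 : 1 ≤ V)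
    (hV : ((Finset.Icc a b).card : ℝ) ≤ V)
    (hex0 : V * Real.exp (t0 ^ 5 + 2 - (t0 ^ 8 + 1)) ≤ 1 / 2)
    (hex1 : V * Real.exp (t1 ^ 5 + 2 - (t1 ^ 8 + 1)) ≤ 1 / 2)
    {r M S : ℝ} (hr : 0 < r) (hr1 : r ≤ 1) (hrρ : 2 * r ≤ X.ρ)
    (hrP : X.C * (2 * r) * (V * (8 * (V * Real.exp (t0 ^ 5)) ^ 2)) ≤ 1 / 2)
    (hbad : V * (2 * Real.exp (-t1)) < r / 9) (hM : 1 ≤ M)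
    (hbM : (K * (2 * t0 ^ 8 + 1) ^ d).factorial *
      (1 + 2 * (8 * (V * Real.exp (t0 ^ 5)) ^ 2)) ^ (K * (2 * t0 ^ 8 + 1) ^ d) ≤ Real.exp M)
    (hbM1 : (K * (2 * t0 ^ 8 + 1) ^ d).factorial *
      (1 + 8 * (V * Real.exp (t1 ^ 5)) ^ 2) ^ (K * (2 * t0 ^ 8 + 1) ^ d) ≤ Real.exp M) :
    volume {x : ℝ | x ∈ Set.Icc (0:ℝ) 1 ∧ ¬ Inv δ (fun n => (pot f ω E x n : ℂ)) (Finset.Icc a b)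
      (fun _ _ => 2 * (8 * (V * Real.exp (t0 ^ 5)) ^ 2) + (K * (2 * t0 ^ 8 + 1) ^ d : ℕ) ^ 2 *
        (2 * (8 * (V * Real.exp (t0 ^ 5)) ^ 2) * (Real.exp M * Real.exp (S * M)) *
          (2 * (8 * (V * Real.exp (t0 ^ 5)) ^ 2))))} ≤
      ENNReal.ofReal (100 * Real.exp (-((S - 5) / 8))) := by
  classical
  have hP0 : 1 ≤ 8 * (V * Real.exp (t0 ^ 5)) ^ 2 := by
    have h1 : 1 ≤ Real.exp ((t0:ℝ) ^ 5) := Real.one_le_exp (by positivity)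
    have : 1 ≤ V * Real.exp (t0 ^ 5) := by nlinarith
    nlinarith
  refine cartan_cover X hδ ω E r hr hr1 hrρ (Finset.Icc a b)
    {x | ∀ c ∈ Finset.Icc a b, Good δ f ω E t1 1 (x + dotw ω c)} (P := 8 * (V * Real.exp (t0 ^ 5)) ^ 2)
    (P1 := 8 * (V * Real.exp (t1 ^ 5)) ^ 2) hP0 (by positivity) _ ?_ ?_ hM hbM hbM1 S ?_
  · refine lt_of_le_of_lt ?_ ((ENNReal.ofReal_lt_ofReal_iff (by positivity)).2 hbad)
    calc _ ≤ volume (⋃ c ∈ Finset.Icc a b, {x : ℝ | x ∈ Set.Icc (0:ℝ) 1 ∧ x + dotw ω c ∈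
          {x | ¬ Good δ f ω E t1 1 x}}) := by
          refine measure_mono ?_
          rintro x ⟨hx, hx'⟩
          have : ∃ c ∈ Finset.Icc a b, ¬ Good δ f ω E t1 1 (x + dotw ω c) := by
            by_contra hcon
            push Not at hcon
            exact hx' hcon
          obtain ⟨c, hc, hcb⟩ := this
          simp only [Set.mem_iUnion]
          exact ⟨c, hc, hx, hcb⟩
      _ ≤ ∑ c ∈ Finset.Icc a b, 2 * ENNReal.ofReal (Real.exp (-t1)) := by
          refine (measure_biUnion_finset_le _ _).trans (Finset.sum_le_sum fun c _ => ?_)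
          refine (volume_shift_le (fun x => not_congr (good_add_one hf)) _).trans ?_
          gcongr
          exact (hm E).le
      _ = ENNReal.ofReal ((Finset.Icc a b).card * (2 * Real.exp (-t1))) := by
          rw [Finset.sum_const, nsmul_eq_mul, ENNReal.ofReal_mul (by positivity),
            ENNReal.ofReal_mul (by positivity)]
          simp
      _ ≤ _ := by gcongr
  · refine le_trans ?_ hrP
    have := X.hC
    gcongr
  · intro x0 hx0
    refine ⟨{n | ¬ Good δ f ω E t0 0 (x0 + dotw ω (clamp a b (t0 ^ 8) n))},
      ncard_bad_le hf hab0 hL hc hsep, ?_, ?_⟩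
    · exact rect_inv hδ hδ1 ht0 hab0 hV1 hV hex0 fun n _ hnB => not_not.1 hnB
    · have := rect_inv hδ hδ1 (ω := ω) (E := E) (x := x0) ht1 hab1 hV1 hV hex1 (B := ∅)
        (fun n _ _ => (hx0 _ (clamp_mem hab1)).mono zero_le_one) (f := f)
      simpa using this

/-- The number of radii in `[ρ, R)` not in `J`. -/
def freeRadii (J : Finset ℕ) (R ρ : ℕ) : ℕ := (Finset.Ico ρ R \ J).card

lemma freeRadii_le_add (J : Finset ℕ) (R ρ ρ' : ℕ) :
    freeRadii J R ρ ≤ freeRadii J R ρ' + (ρ' - ρ) := by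
  have h : Finset.Ico ρ R \ J ⊆ (Finset.Ico ρ' R \ J) ∪ Finset.Ico ρ ρ' := by
    intro j
    simp only [Finset.mem_union, Finset.mem_sdiff, Finset.mem_Ico]
    by_cases hj : j ∈ J <;> simp [hj]; omega
  simpa [freeRadii] using (Finset.card_le_card h).trans (Finset.card_union_le _ _)

lemma freeRadii_le_of_subset {J : Finset ℕ} (R : ℕ) {ρ ρ' : ℕ}
    (h : ∀ j, ρ ≤ j → j < ρ' → j ∈ J) : freeRadii J R ρ ≤ freeRadii J R ρ' := by
  refine Finset.card_le_card fun j => ?_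
  simp only [Finset.mem_sdiff, Finset.mem_Ico]
  intro hj
  refine ⟨⟨?_, hj.1.2⟩, hj.2⟩
  by_contra hlt
  exact hj.2 (h j hj.1.1 (by omega))

lemma freeRadii_of_le (J : Finset ℕ) {R ρ : ℕ} (h : R ≤ ρ) : freeRadii J R ρ = 0 := by
  simp [freeRadii, Finset.Ico_eq_empty_of_le h]

lemma le_freeRadii_zero (J : Finset ℕ) (R : ℕ) : R ≤ freeRadii J R 0 + J.card := by
  have := Finset.le_card_sdiff J (Finset.Ico 0 R)
  simp only [Nat.card_Ico] at this
  unfold freeRadii; omega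

/-- The truncated proximity `(D - dist(n, F))₊`. -/
def prox (F : Finset (Fin d → ℤ)) (D : ℕ) (n : Fin d → ℤ) : ℕ := F.sup fun m => D - sd n m

lemma prox_le (F : Finset (Fin d → ℤ)) (D : ℕ) (n : Fin d → ℤ) : prox F D n ≤ D :=
  Finset.sup_le fun _ _ => Nat.sub_le _ _

lemma prox_of_mem {F : Finset (Fin d → ℤ)} (D : ℕ) {n : Fin d → ℤ} (h : n ∈ F) :
    prox F D n = D := by
  refine le_antisymm (prox_le F D n) ?_
  have := Finset.le_sup (f := fun m => D - sd n m) h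
  simpa [sd_self, prox] using this

lemma prox_le_add (F : Finset (Fin d → ℤ)) (D : ℕ) (n k : Fin d → ℤ) :
    prox F D n ≤ prox F D k + sd n k := by
  refine Finset.sup_le fun m hm => ?_
  have h1 : D - sd k m ≤ prox F D k := Finset.le_sup (f := fun m => D - sd k m) hm
  have h2 := sd_triangle k n m
  rw [sd_comm k n] at h2
  omega

lemma prox_eq_zero {F : Finset (Fin d → ℤ)} {D : ℕ} {n : Fin d → ℤ} (h : ∀ m ∈ F, D ≤ sd n m) :
    prox F D n = 0 := by
  rw [← Nat.le_zero]
  exact Finset.sup_le fun m hm => by have := h m hm; omega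

lemma card_le_of_sd_le {X : Finset (Fin d → ℤ)} {n : Fin d → ℤ} {r : ℕ} (h : ∀ k ∈ X, sd n k ≤ r) :
    (X.card : ℝ) ≤ (2 * r + 1) ^ d := by
  have : X ⊆ Q n r := fun k hk => mem_Q.2 (by rw [sd_comm]; exact h k hk)
  have := Finset.card_le_card this
  rw [card_Q] at this
  exact_mod_cast this

/-- Exponential decay for a nonnegative function which is dominated by its values on shells,
the shells being crossed with a loss near a sparse set of exceptional sites. -/
lemma decay_of_shells {Λ F : Finset (Fin d → ℤ)} {J : Finset ℕ} {ψ : (Fin d → ℤ) → ℝ} {Mx : ℝ}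
    (hψ : ∀ n ∈ Λ, 0 ≤ ψ n) (hψM : ∀ n ∈ Λ, ψ n ≤ Mx) {z : Fin d → ℤ} (hz : z ∈ Λ)
    {R ℓ r D : ℕ} {σ κ c s τ : ℝ} (hc : 0 ≤ c) (hs : 0 ≤ s)
    (hgood : ∀ n ∈ Λ, sd n z < R → n ∉ F → ∃ X ⊆ Λ, (∀ k ∈ X, ℓ + 1 ≤ sd n k ∧ sd n k ≤ 2 * ℓ + 1) ∧
      ψ n ≤ ∑ k ∈ X, Real.exp (σ - κ * sd n k) * ψ k)
    (hbad : ∀ n ∈ Λ, sd n z < R → n ∈ F → ∃ X ⊆ Λ, (∀ k ∈ X, sd n k ≤ r ∧ ∀ m ∈ F, D ≤ sd k m) ∧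
      (∀ j, sd n z ≤ j → j < sd n z + r → j ∈ J) ∧ ψ n ≤ ∑ k ∈ X, Real.exp τ * ψ k)
    (hκ : 0 ≤ κ - c - s)
    (h1 : (2 * (2 * ℓ + 1 : ℕ) + 1 : ℝ) ^ d * Real.exp (σ - (κ - c - s) * (ℓ + 1)) ≤ 1 / 2)
    (h2 : (2 * r + 1 : ℝ) ^ d * Real.exp (τ - s * D) ≤ 1 / 2) :
    ψ z ≤ Mx * Real.exp (-(c * (R - J.card) - s * D)) := by
  classical
  set W : (Fin d → ℤ) → ℝ := fun n => c * freeRadii J R (sd n z) - s * prox F D n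
  have hX : ∀ n, ∃ X ⊆ Λ, n ∈ Λ → sd n z < R →
      ((n ∉ F → (∀ k ∈ X, ℓ + 1 ≤ sd n k ∧ sd n k ≤ 2 * ℓ + 1) ∧
      ψ n ≤ ∑ k ∈ X, Real.exp (σ - κ * sd n k) * ψ k) ∧ (n ∈ F →
      (∀ k ∈ X, sd n k ≤ r ∧ ∀ m ∈ F, D ≤ sd k m) ∧
      (∀ j, sd n z ≤ j → j < sd n z + r → j ∈ J) ∧ ψ n ≤ ∑ k ∈ X, Real.exp τ * ψ k)) := by
    intro n
    by_cases hn : n ∈ Λ ∧ sd n z < R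
    · by_cases hF : n ∈ F
      · obtain ⟨X, hX, h⟩ := hbad n hn.1 hn.2 hF
        exact ⟨X, hX, fun _ _ => ⟨fun h' => absurd hF h', fun _ => h⟩⟩
      · obtain ⟨X, hX, h⟩ := hgood n hn.1 hn.2 hF
        exact ⟨X, hX, fun _ _ => ⟨fun _ => h, fun h' => absurd h' hF⟩⟩
    · exact ⟨∅, by simp, fun a b => absurd ⟨a, b⟩ hn⟩
  choose X hXΛ hX using hX
  have hMx : 0 ≤ Mx := (hψ z hz).trans (hψM z hz)
  have key := weighted_max_principle Λ (Λ.filter fun n => sd n z < R) ψ 0 (fun n => Real.exp (W n))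
    (fun n k => if k ∈ X n then (if n ∈ F then Real.exp τ else Real.exp (σ - κ * sd n k)) else 0)
    Mx hψ (fun n _ => Real.exp_pos _) (fun n _ k _ => by split_ifs <;> positivity) ?_ ?_
    (fun n _ _ => by simp; linarith) ?_ z hz
  · rw [← le_div_iff₀ (Real.exp_pos _), div_eq_mul_inv, ← Real.exp_neg] at key
    refine key.trans ?_
    gcongr
    have e1 : (R : ℝ) ≤ freeRadii J R (sd z z) + J.card := by
      rw [sd_self]; exact_mod_cast le_freeRadii_zero J R
    have e2 : (prox F D z : ℝ) ≤ D := by exact_mod_cast prox_le F D z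
    have e3 : c * (R - J.card) ≤ c * freeRadii J R (sd z z) :=
      mul_le_mul_of_nonneg_left (by linarith) hc
    have e4 : s * prox F D z ≤ s * D := mul_le_mul_of_nonneg_left e2 hs
    simp only [W]; linarith
  · intro n hn hnΛ
    have hnR := (Finset.mem_filter.1 hn).2
    simp only [Pi.zero_apply, zero_add, ite_mul, zero_mul]
    rw [← Finset.sum_filter, Finset.filter_mem_eq_inter, Finset.inter_eq_right.2 (hXΛ n)]
    by_cases hF : n ∈ F
    · simpa [hF] using ((hX n hnΛ hnR).2 hF).2.2
    · simpa [hF] using ((hX n hnΛ hnR).1 hF).2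
  · intro n hn hnΛ
    have hnR := (Finset.mem_filter.1 hn).2
    simp only [ite_mul, zero_mul]
    rw [← Finset.sum_filter, Finset.filter_mem_eq_inter, Finset.inter_eq_right.2 (hXΛ n)]
    simp only [← Real.exp_sub]
    by_cases hF : n ∈ F
    · obtain ⟨a1, a2, -⟩ := (hX n hnΛ hnR).2 hF
      refine le_trans ?_ h2
      refine (Finset.sum_le_card_nsmul _ _ (Real.exp (τ - s * D)) fun k hk => ?_).trans ?_
      · simp only [hF, if_true]
        rw [← Real.exp_add]
        gcongr
        have e1 : freeRadii J R (sd n z) ≤ freeRadii J R (sd k z) := by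
          refine freeRadii_le_of_subset R fun j h1 h2 => a2 j h1 ?_
          have := sd_triangle k n z; rw [sd_comm k n] at this
          have := (a1 k hk).1
          omega
        have e2 : prox F D k = 0 := prox_eq_zero (a1 k hk).2
        have e3 : c * freeRadii J R (sd n z) ≤ c * freeRadii J R (sd k z) :=
          mul_le_mul_of_nonneg_left (by exact_mod_cast e1) hc
        simp only [W, e2, prox_of_mem D hF]
        push_cast; linarith
      · rw [nsmul_eq_mul]
        gcongr
        exact card_le_of_sd_le fun k hk => (a1 k hk).1
    · obtain ⟨a1, -⟩ := (hX n hnΛ hnR).1 hF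
      refine le_trans ?_ h1
      refine (Finset.sum_le_card_nsmul _ _ (Real.exp (σ - (κ - c - s) * (ℓ + 1))) fun k hk => ?_).trans ?_
      · simp only [hF, if_false]
        rw [← Real.exp_add]
        gcongr
        have e1 : freeRadii J R (sd n z) ≤ freeRadii J R (sd k z) + sd n k := by
          have := freeRadii_le_add J R (sd n z) (sd k z)
          have := sd_triangle k n z; rw [sd_comm k n] at this
          omega
        have e2 : prox F D k ≤ prox F D n + sd n k := by
          have := prox_le_add F D k n; rwa [sd_comm k n] at this
        have e3 : c * freeRadii J R (sd n z) ≤ c * (freeRadii J R (sd k z) + sd n k) :=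
          mul_le_mul_of_nonneg_left (by exact_mod_cast e1) hc
        have e4 : s * prox F D k ≤ s * (prox F D n + sd n k) :=
          mul_le_mul_of_nonneg_left (by exact_mod_cast e2) hs
        have e5 : (κ - c - s) * (ℓ + 1) ≤ (κ - c - s) * sd n k :=
          mul_le_mul_of_nonneg_left (by exact_mod_cast (a1 k hk).1) hκ
        simp only [W]; linarith
      · rw [nsmul_eq_mul]
        gcongr
        exact card_le_of_sd_le fun k hk => (a1 k hk).2
  · intro n hnΛ hn
    have hnR : R ≤ sd n z := by
      by_contra h; exact hn (Finset.mem_filter.2 ⟨hnΛ, by omega⟩)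
    have : W n ≤ 0 := by
      simp only [W, freeRadii_of_le J hnR]
      have : 0 ≤ s * prox F D n := by positivity
      push_cast; linarith
    calc ψ n * Real.exp (W n) ≤ ψ n * 1 :=
          mul_le_mul_of_nonneg_left (Real.exp_le_one_iff.2 this) (hψ n hnΛ)
      _ ≤ _ := by rw [mul_one]; exact hψM n hnΛ

lemma lt_sd_of_notMem_rect {a b n k : Fin d → ℤ} {r : ℕ} (hk : k ∈ Finset.Icc a b)
    (hkr : k ∉ Finset.Icc (a ⊔ fun i => n i - r) (b ⊓ fun i => n i + r)) : r + 1 ≤ sd n k := by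
  by_contra hlt
  apply hkr
  have h1 : sd n k ≤ r := by omega
  rw [sd_le_iff] at h1
  rw [Finset.mem_Icc, Pi.le_def, Pi.le_def] at hk ⊢
  exact ⟨fun i => by
      have := h1 i; have := hk.1 i
      simp only [Pi.sup_apply]; omega, fun i => by
      have := h1 i; have := hk.2 i
      simp only [Pi.inf_apply]; omega⟩

lemma sd_le_of_mem_rect {a b n k : Fin d → ℤ} {r : ℕ}
    (hk : k ∈ Finset.Icc (a ⊔ fun i => n i - r) (b ⊓ fun i => n i + r)) : sd n k ≤ r := by
  rw [Finset.mem_Icc, Pi.le_def, Pi.le_def] at hk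
  rw [sd_le_iff]; intro i
  have h1 := hk.1 i; have h2 := hk.2 i
  simp only [Pi.sup_apply, Pi.inf_apply] at h1 h2
  omega

lemma rect_subset {a b n : Fin d → ℤ} {r : ℕ} :
    Finset.Icc (a ⊔ fun i => n i - r) (b ⊓ fun i => n i + r) ⊆ Finset.Icc a b :=
  Finset.Icc_subset_Icc le_sup_left inf_le_left

lemma mem_rect {a b n : Fin d → ℤ} {r : ℕ} (hn : n ∈ Finset.Icc a b) :
    n ∈ Finset.Icc (a ⊔ fun i => n i - r) (b ⊓ fun i => n i + r) := by
  rw [Finset.mem_Icc] at hn ⊢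
  exact ⟨sup_le hn.1 fun i => by simp, le_inf hn.2 fun i => by simp⟩

/-- Choice of a radius whose shell avoids all neighbourhoods of given points. -/
lemma exists_free_radius (𝒞 : Finset (Fin d → ℤ)) {K : ℕ} (hK : 𝒞.card ≤ K) (n : Fin d → ℤ)
    (r₀ w : ℕ) : ∃ r, r₀ ≤ r ∧ r ≤ r₀ + K * (2 * w + 2) ∧
      ∀ c ∈ 𝒞, sd n c + w < r ∨ r + w < sd n c := by
  classical
  by_contra! hcon
  have h : ∀ j ∈ Finset.range (K + 1), ∃ c ∈ 𝒞, r₀ + j * (2 * w + 2) ≤ sd n c + w ∧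
      sd n c ≤ r₀ + j * (2 * w + 2) + w := fun j hj => by
    refine hcon (r₀ + j * (2 * w + 2)) (by omega) ?_
    have : j ≤ K := by have := Finset.mem_range.1 hj; omega
    have := Nat.mul_le_mul_right (2 * w + 2) this
    omega
  choose! c hc hc1 using h
  have := Finset.card_le_card_of_injOn c hc (s := Finset.range (K + 1)) ?_
  · simp at this; omega
  · intro j hj j' hj' hjj
    have h1 := hc1 j hj
    have h2 := hc1 j' hj'
    rw [hjj] at h1
    rcases lt_trichotomy j j' with h | h | h
    · have := Nat.mul_le_mul_right (2 * w + 2) (show j + 1 ≤ j' from h)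
      rw [add_mul] at this; omega
    · exact h
    · have := Nat.mul_le_mul_right (2 * w + 2) (show j' + 1 ≤ j from h)
      rw [add_mul] at this; omega

/-- The numerical conditions relating the scales `t0` and `t` and the number `K` of bad cubes. -/
structure Scales (d t0 t K : ℕ) : Prop where
  ht0 : 1 ≤ t0
  h4 : 4 * t0 ≤ t
  h1 : (2 * (2 * t0 ^ 8 + 1 : ℕ) + 1 : ℝ) ^ d *
    Real.exp (t0 ^ 5 + 2 - (1 / (2 * t0)) * ((t0 ^ 8 : ℕ) + 1)) ≤ 1 / 2
  h2 : (2 * (2 * t ^ 3 + 1 : ℕ) + 1 : ℝ) ^ d * Real.exp (3 * t ^ 2 + 2 - 4 * t ^ 2) ≤ 1 / 2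
  hK1 : (K + 1) * (2 * (16 * t0 * t ^ 2 + t0 ^ 8) + 2) ≤ t ^ 3
  hK2 : K * (2 * t0 ^ 8 + 2 * t ^ 3 + 2) ≤ t ^ 4

/-- Decay of solutions in a box in the presence of few bad small cubes, when all
intermediate boxes are nonresonant. -/
lemma decay_box {f : ℝ → ℝ} (hf : ∀ x, f (x + 1) = f x) {δ : ℝ} (hδ : 0 ≤ δ) (hδ1 : δ * 3 ^ d ≤ 1)
    {ω : Fin d → ℝ} {E x : ℝ} {t0 t K N R : ℕ} (hsc : Scales d t0 t K) (hc : LDTc δ f ω t0 K)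
    (hsep : Sep ω N (Real.exp (-t0))) (hN : 2 * (R + t ^ 3) ≤ N) {a b : Fin d → ℤ}
    (hab : ∀ i, a i + 2 * (t0 ^ 8 : ℕ) ≤ b i) {φ : (Fin d → ℤ) → ℂ} {Mx : ℝ}
    (hφ : ∀ n ∈ Finset.Icc a b, ‖φ n‖ ≤ Mx) {z : Fin d → ℤ} (hz : z ∈ Finset.Icc a b)
    (heq : ∀ n ∈ Finset.Icc a b, sd n z ≤ R + 2 * t ^ 3 →
      Eqn δ (fun n => (pot f ω E x n : ℂ)) (Finset.Icc a b) φ 0 n)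
    (hrect : ∀ n ∈ Finset.Icc a b, sd n z < R → ∀ r, t ^ 3 ≤ r → r ≤ 2 * t ^ 3 →
      Inv δ (fun n => (pot f ω E x n : ℂ)) (Finset.Icc (a ⊔ fun i => n i - r) (b ⊓ fun i => n i + r))
        (fun _ _ => Real.exp (3 * t ^ 2))) :
    ‖φ z‖ ≤ Mx * Real.exp (-((1 + 1 / t) * (R - t ^ 4) - 4 * t ^ 2)) := by
  classical
  have ht0 : (1:ℝ) ≤ t0 := by exact_mod_cast hsc.ht0
  have h4 : 4 * (t0:ℝ) ≤ t := by exact_mod_cast hsc.h4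
  have hℓ : t0 ^ 8 ≤ t ^ 3 := by
    refine le_trans ?_ hsc.hK1
    rw [add_mul, one_mul]; omega
  set 𝒞 := (Finset.Icc a b).filter fun c => sd c z ≤ R + t ^ 3 ∧
    ¬ Good δ f ω E t0 0 (x + dotw ω c)
  have h𝒞 : 𝒞.card ≤ K := hc.card_sites hf hsep E x 𝒞
    (fun c hc c' hc' => by
      have h1 := (Finset.mem_filter.1 hc).2.1
      have h2 := (Finset.mem_filter.1 hc').2.1
      have := sd_triangle c z c'; rw [sd_comm z] at this
      omega)
    (fun c hc => (Finset.mem_filter.1 hc).2.2)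
  set J := 𝒞.biUnion fun c => Finset.Ico (sd c z - t0 ^ 8) (sd c z + t0 ^ 8 + 2 * t ^ 3 + 1)
  have hJ : J.card ≤ t ^ 4 := by
    refine le_trans (Finset.card_biUnion_le.trans ?_) hsc.hK2
    calc _ ≤ ∑ c ∈ 𝒞, (2 * t0 ^ 8 + 2 * t ^ 3 + 2) := by
          refine Finset.sum_le_sum fun c _ => ?_
          rw [Nat.card_Ico]; omega
      _ ≤ _ := by rw [Finset.sum_const, smul_eq_mul]; gcongr
  have hR : ∀ n ∈ Finset.Icc a b, sd n z < R → sd (clamp a b (t0 ^ 8) n) z ≤ R + t ^ 3 := by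
    intro n hn h
    have := sd_triangle (clamp a b (t0 ^ 8) n) n z
    rw [sd_comm _ n] at this
    have := sd_clamp_le hn hab
    omega
  have ht00 : 0 < 1 / (t0 : ℝ) := by positivity
  have htpos : (0:ℝ) < t := by linarith
  have h4' : 1 / (t:ℝ) ≤ 1 / (4 * t0) := by gcongr
  have hlow : 1 / (2 * (t0:ℝ)) ≤ (1 + 1 / t0) - (1 + 1 / t) - 1 / (4 * t0) := by
    have : 1 / (4 * (t0:ℝ)) = 1 / 4 * (1 / t0) := by field_simp
    have : 1 / (2 * (t0:ℝ)) = 1 / 2 * (1 / t0) := by field_simp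
    linarith
  have main := decay_of_shells (Λ := Finset.Icc a b) (J := J) (ψ := fun n => ‖φ n‖) (Mx := Mx)
    (F := (Finset.Icc a b).filter fun n => clamp a b (t0 ^ 8) n ∈ 𝒞)
    (fun n _ => norm_nonneg _) hφ hz (R := R) (ℓ := t0 ^ 8) (r := 2 * t ^ 3 + 1)
    (D := 16 * t0 * t ^ 2) (σ := t0 ^ 5 + 2) (κ := 1 + 1 / t0) (c := 1 + 1 / t)
    (s := 1 / (4 * t0)) (τ := 3 * t ^ 2 + 2) (by positivity) (by positivity) ?_ ?_ ?_ ?_ ?_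
  · refine main.trans ?_
    have hM : 0 ≤ Mx := (norm_nonneg _).trans (hφ z hz)
    have e1 : 1 / (4 * (t0:ℝ)) * ((16 * t0 * t ^ 2 : ℕ) : ℝ) = 4 * t ^ 2 := by
      push_cast; field_simp; ring
    rw [e1]
    gcongr
    exact_mod_cast hJ
  · intro n hn hnR hnF
    have hgood : Good δ f ω E t0 0 (x + dotw ω (clamp a b (t0 ^ 8) n)) := by
      by_contra hb
      exact hnF (Finset.mem_filter.2 ⟨hn, Finset.mem_filter.2 ⟨clamp_mem hab, hR n hn hnR, hb⟩⟩)
    refine ⟨(Finset.Icc a b).filter fun k => t0 ^ 8 + 1 ≤ sd n k ∧ sd n k ≤ 2 * t0 ^ 8 + 1,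
      Finset.filter_subset _ _, fun k hk => (Finset.mem_filter.1 hk).2, ?_⟩
    have hI := hgood.inv_Q
    rw [sub_zero] at hI
    have := hI.norm_le_exit hδ hδ1 (by positivity) (by
        have : 1 / (t0:ℝ) ≤ 1 := by rw [div_le_one (by linarith)]; exact ht0
        linarith) (Q_clamp_subset hab) (φ := φ) (η := 0) (fun k hk => ?_) (n := n)
        (mem_Q.2 (sd_clamp_le hn hab))
        ((Finset.Icc a b).filter fun k => t0 ^ 8 + 1 ≤ sd n k ∧ sd n k ≤ 2 * t0 ^ 8 + 1) ?_
    · simpa using this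
    · refine heq k (Q_clamp_subset hab hk) ?_
      have := sd_clamp_le hn hab
      have := mem_Q.1 hk
      have := sd_triangle k (clamp a b (t0 ^ 8) n) z
      have := sd_triangle (clamp a b (t0 ^ 8) n) n z
      rw [sd_comm _ n] at this
      omega
    · rintro k' h1 h2 ⟨k, hk, hkk⟩
      exact Finset.mem_filter.2 ⟨h1, lt_sd_of_notMem_clamp hn h1 h2, sd_le_of_adj_clamp hn hab hk hkk⟩
  · intro n hn hnR hnF
    have hcn := (Finset.mem_filter.1 hnF).2
    obtain ⟨r, hr1, hr2, hr3⟩ := exists_free_radius 𝒞 h𝒞 n (t ^ 3 + 1) (16 * t0 * t ^ 2 + t0 ^ 8)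
    have hr4 : r ≤ 2 * t ^ 3 := by
      have := hsc.hK1
      rw [add_mul] at this; omega
    obtain ⟨q, rfl⟩ : ∃ q, r = q + 1 := ⟨r - 1, by omega⟩
    refine ⟨(Finset.Icc a b).filter fun k => sd n k = q + 1, Finset.filter_subset _ _,
      fun k hk => ?_, fun j hj1 hj2 => ?_, ?_⟩
    · have hk2 := (Finset.mem_filter.1 hk).2
      refine ⟨by omega, fun m hm => ?_⟩
      have hm1 := (Finset.mem_filter.1 hm).1
      have := hr3 _ (Finset.mem_filter.1 hm).2
      have := sd_clamp_le hm1 hab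
      have := sd_triangle n k (clamp a b (t0 ^ 8) m)
      have := sd_triangle k m (clamp a b (t0 ^ 8) m)
      have := sd_triangle n (clamp a b (t0 ^ 8) m) k
      have h6 := sd_triangle (clamp a b (t0 ^ 8) m) m k
      rw [sd_comm _ m, sd_comm m k] at h6
      omega
    · refine Finset.mem_biUnion.2 ⟨_, hcn, Finset.mem_Ico.2 ?_⟩
      have := sd_clamp_le hn hab
      have := sd_triangle n (clamp a b (t0 ^ 8) n) z
      have h6 := sd_triangle (clamp a b (t0 ^ 8) n) n z
      rw [sd_comm _ n] at h6
      omega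
    · have hI : Inv δ (fun n => (pot f ω E x n : ℂ))
          (Finset.Icc (a ⊔ fun i => n i - q) (b ⊓ fun i => n i + q))
          (fun n k => Real.exp (3 * t ^ 2 - 0 * sd n k)) := by
        simpa using hrect n hn hnR q (by omega) (by omega)
      have := hI.norm_le_exit hδ hδ1 le_rfl (by norm_num) rect_subset (φ := φ) (η := 0)
        (fun k hk => ?_) (mem_rect hn)
        ((Finset.Icc a b).filter fun k => sd n k = q + 1) ?_
      · simpa using this
      · refine heq k (rect_subset hk) ?_
        have := sd_le_of_mem_rect hk
        have := sd_triangle k n z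
        rw [sd_comm k n] at this
        omega
      · rintro k' h1 h2 ⟨k, hk, hkk⟩
        refine Finset.mem_filter.2 ⟨h1, ?_⟩
        have := lt_sd_of_notMem_rect h1 h2
        have := sd_le_of_mem_rect hk
        have := sd_triangle n k k'
        omega
  · have : 0 < 1 / (2 * (t0:ℝ)) := by positivity
    linarith
  · refine le_trans ?_ hsc.h1
    gcongr
  · refine le_trans (le_of_eq ?_) hsc.h2
    have e1 : 1 / (4 * (t0:ℝ)) * ((16 * t0 * t ^ 2 : ℕ) : ℝ) = 4 * t ^ 2 := by
      push_cast; field_simp; ring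
    rw [e1]

lemma Sep.mono {ω : Fin d → ℝ} {N N' : ℕ} {η η' : ℝ} (h : Sep ω N η) (hN : N' ≤ N) (hη : η' ≤ η) :
    Sep ω N' η' := fun n hn hn' m => hη.trans (h n hn (hn'.trans hN) m)

lemma eqn_inv {δ : ℝ} {v : (Fin d → ℤ) → ℂ} {Λ : Finset (Fin d → ℤ)} (hdet : (mat δ v Λ).det ≠ 0)
    (k : Λ) {n : Fin d → ℤ} (hn : n ∈ Λ) (hnk : n ≠ k.1) :
    Eqn δ v Λ (fun m => if hm : m ∈ Λ then (mat δ v Λ)⁻¹ ⟨m, hm⟩ k else 0) 0 n := by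
  have h1 : mat δ v Λ * (mat δ v Λ)⁻¹ = 1 := Matrix.mul_nonsing_inv _ (isUnit_iff_ne_zero.2 hdet)
  have h2 := congrFun (congrFun h1 ⟨n, hn⟩) k
  rw [Matrix.one_apply_ne (fun h => hnk (congrArg Subtype.val h))] at h2
  unfold Eqn
  rw [← mat_mulVec δ v Λ _ ⟨n, hn⟩, Pi.zero_apply, ← h2, Matrix.mul_apply, Matrix.mulVec, dotProduct]
  exact Finset.sum_congr rfl fun m _ => by rw [dif_pos m.2]

/-- A large cube is good when it and all intermediate boxes are nonresonant. -/
lemma good_of_rects {f : ℝ → ℝ} (hf : ∀ x, f (x + 1) = f x) {δ : ℝ} (hδ : 0 ≤ δ)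
    (hδ1 : δ * 3 ^ d ≤ 1) {ω : Fin d → ℝ} {E x : ℝ} {t0 t K : ℕ} (hsc : Scales d t0 t K)
    (ht : 8 ≤ t) (hc : LDTc δ f ω t0 K) (hsep : Sep ω (t ^ 9) (Real.exp (-t0)))
    (h0 : Inv δ (fun n => (pot f ω E x n : ℂ)) (Q 0 (t ^ 8)) (fun _ _ => Real.exp (t ^ 2)))
    (hrect : ∀ n ∈ Q (0 : Fin d → ℤ) (t ^ 8), ∀ r, t ^ 3 ≤ r → r ≤ 2 * t ^ 3 →
      Inv δ (fun n => (pot f ω E x n : ℂ))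
        (Finset.Icc ((fun i => (0 : Fin d → ℤ) i - (t ^ 8 : ℕ)) ⊔ fun i => n i - r)
          ((fun i => (0 : Fin d → ℤ) i + (t ^ 8 : ℕ)) ⊓ fun i => n i + r))
        (fun _ _ => Real.exp (3 * t ^ 2))) : Good δ f ω E t 1 x := by
  refine ⟨h0.1, fun n k => ?_⟩
  have ht' : (8:ℝ) ≤ t := by exact_mod_cast ht
  have htn : 1 / (t:ℝ) ≤ 1 := by rw [div_le_one (by linarith)]; linarith
  have htn0 : 0 < 1 / (t:ℝ) := by positivity
  have hpow : 6 * t ^ 2 + 4 * t ^ 3 + 2 * t ^ 4 + 4 ≤ (t:ℝ) ^ 5 := by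
    have a2 : (64:ℝ) ≤ t ^ 2 := by nlinarith
    have a3 : 8 * (t:ℝ) ^ 2 ≤ t ^ 3 := by nlinarith
    have a4 : 8 * (t:ℝ) ^ 3 ≤ t ^ 4 := by nlinarith
    have a5 : 8 * (t:ℝ) ^ 4 ≤ t ^ 5 := by nlinarith [pow_pos (by linarith : (0:ℝ) < t) 4]
    linarith
  rcases le_or_gt (sd n.1 k.1) (2 * t ^ 3 + 1) with hle | hgt
  · refine (h0.2 n k).trans (Real.exp_le_exp.2 ?_)
    have e1 : (sd n.1 k.1 : ℝ) ≤ 2 * t ^ 3 + 1 := by exact_mod_cast hle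
    have e2 : (1 + 1 / (t:ℝ)) * sd n.1 k.1 ≤ 2 * (2 * t ^ 3 + 1) := by gcongr; linarith
    have : (0:ℝ) ≤ t ^ 4 := by positivity
    have : (0:ℝ) ≤ t ^ 2 := by positivity
    linarith
  · have h8 : sd n.1 k.1 ≤ 2 * t ^ 8 := by
      have h1 := mem_Q.1 n.2; have h2 := mem_Q.1 k.2
      have := sd_triangle n.1 0 k.1
      rw [sd_comm 0] at this; omega
    have h38 : t ^ 3 ≤ t ^ 8 := Nat.pow_le_pow_right (by omega) (by norm_num)
    have h89 : 8 * t ^ 8 ≤ t ^ 9 := by rw [pow_succ t 8, mul_comm]; gcongr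
    have hT : t0 ^ 8 ≤ t ^ 8 := by
      gcongr; have := hsc.h4; omega
    set φ : (Fin d → ℤ) → ℂ := fun m => if hm : m ∈ Q 0 (t ^ 8) then
        (mat δ (fun n => (pot f ω E x n : ℂ)) (Q 0 (t ^ 8)))⁻¹ ⟨m, hm⟩ k else 0
    have hφ : ∀ m (hm : m ∈ Q 0 (t ^ 8)),
        φ m = (mat δ (fun n => (pot f ω E x n : ℂ)) (Q 0 (t ^ 8)))⁻¹ ⟨m, hm⟩ k :=
      fun m hm => dif_pos hm
    have h := decay_box hf hδ hδ1 (x := x) (E := E) hsc hc hsep (R := sd n.1 k.1 - 1 - 2 * t ^ 3)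
      (by omega) (a := fun i => (0 : Fin d → ℤ) i - (t ^ 8 : ℕ))
      (b := fun i => (0 : Fin d → ℤ) i + (t ^ 8 : ℕ)) (fun i => by simp only [Pi.zero_apply]; omega)
      (φ := φ) (Mx := Real.exp (t ^ 2)) (fun m hm => (hφ m hm).symm ▸ h0.2 ⟨m, hm⟩ k) n.2 (fun m hm hmn => by
        refine eqn_inv h0.1 k hm ?_
        rintro rfl
        rw [sd_comm] at hmn; omega) (fun m hm _ r h1 h2 => hrect m hm r h1 h2)
    rw [hφ n.1 n.2, ← Real.exp_add] at h
    refine h.trans (Real.exp_le_exp.2 ?_)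
    have e1 : ((sd n.1 k.1 - 1 - 2 * t ^ 3 : ℕ) : ℝ) = sd n.1 k.1 - 1 - 2 * t ^ 3 := by
      rw [Nat.cast_sub (by omega), Nat.cast_sub (by omega)]; push_cast; ring
    rw [e1]
    have e2 : (1 + 1 / (t:ℝ)) * (1 + 2 * t ^ 3 + t ^ 4) ≤ 2 * (1 + 2 * t ^ 3 + t ^ 4) := by
      gcongr; linarith
    nlinarith

/-- The numerical conditions for the inductive step of the measure estimate. -/
structure StepScales (d : ℕ) (ρ C : ℝ) (t0 t1 t K : ℕ) : Prop where
  sc : Scales d t0 t K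
  ht : 8 ≤ t
  ht1 : 1 ≤ t1
  h03 : 2 * t0 ^ 8 ≤ t ^ 3
  h13 : 2 * t1 ^ 8 ≤ t ^ 3
  hex0 : (2 * t ^ 8 + 1 : ℝ) ^ d * Real.exp (t0 ^ 5 + 2 - (t0 ^ 8 + 1)) ≤ 1 / 2
  hex1 : (2 * t ^ 8 + 1 : ℝ) ^ d * Real.exp (t1 ^ 5 + 2 - (t1 ^ 8 + 1)) ≤ 1 / 2
  hrρ : 2 * Real.exp (-t0 ^ 6) ≤ ρ
  hrP : C * (2 * Real.exp (-t0 ^ 6)) * ((2 * t ^ 8 + 1 : ℝ) ^ d *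
    (8 * ((2 * t ^ 8 + 1 : ℝ) ^ d * Real.exp (t0 ^ 5)) ^ 2)) ≤ 1 / 2
  hbad : (2 * t ^ 8 + 1 : ℝ) ^ d * (2 * Real.exp (-t1)) < Real.exp (-t0 ^ 6) / 9
  hbM : (K * (2 * t0 ^ 8 + 1) ^ d).factorial *
    (1 + 2 * (8 * ((2 * t ^ 8 + 1 : ℝ) ^ d * Real.exp (t0 ^ 5)) ^ 2)) ^ (K * (2 * t0 ^ 8 + 1) ^ d) ≤
      Real.exp (t1 ^ 6)
  hbM1 : (K * (2 * t0 ^ 8 + 1) ^ d).factorial *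
    (1 + 8 * ((2 * t ^ 8 + 1 : ℝ) ^ d * Real.exp (t1 ^ 5)) ^ 2) ^ (K * (2 * t0 ^ 8 + 1) ^ d) ≤
      Real.exp (t1 ^ 6)
  hconst : 2 * (8 * ((2 * t ^ 8 + 1 : ℝ) ^ d * Real.exp (t0 ^ 5)) ^ 2) +
    (K * (2 * t0 ^ 8 + 1) ^ d : ℕ) ^ 2 *
      (2 * (8 * ((2 * t ^ 8 + 1 : ℝ) ^ d * Real.exp (t0 ^ 5)) ^ 2) *
        (Real.exp (t1 ^ 6) * Real.exp (16 * t * t1 ^ 6)) *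
          (2 * (8 * ((2 * t ^ 8 + 1 : ℝ) ^ d * Real.exp (t0 ^ 5)) ^ 2))) ≤ Real.exp (t ^ 2)
  hfin : (1 + (2 * t ^ 8 + 1 : ℝ) ^ d * (t ^ 3 + 1)) * (100 * Real.exp (-((16 * t - 5) / 8))) <
    Real.exp (-t)

/-- A box inside the cube of radius `t ^ 8` is nonresonant for most phases. -/
lemma rect_measure_scales {f : ℝ → ℝ} (hf : ∀ x, f (x + 1) = f x) (X : Ext f) {δ : ℝ} (hδ : 0 ≤ δ)
    (hδ1 : δ * 3 ^ d ≤ 1) {ω : Fin d → ℝ} (E : ℝ) {t0 t1 t K : ℕ}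
    (hS : StepScales d X.ρ X.C t0 t1 t K) {a b : Fin d → ℤ} (hc : LDTc δ f ω t0 K)
    (hm : LDTm δ f ω t1) (hsep : Sep ω (2 * t ^ 8) (Real.exp (-t0)))
    (hab : ∀ i, a i + t ^ 3 ≤ b i) (hab' : ∀ i, b i ≤ a i + (2 * t ^ 8 : ℕ)) :
    volume {x : ℝ | x ∈ Set.Icc (0:ℝ) 1 ∧ ¬ Inv δ (fun n => (pot f ω E x n : ℂ)) (Finset.Icc a b)
      (fun _ _ => Real.exp (t ^ 2))} ≤ ENNReal.ofReal (100 * Real.exp (-((16 * t - 5) / 8))) := by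
  have hV : ((Finset.Icc a b).card : ℝ) ≤ (2 * t ^ 8 + 1 : ℝ) ^ d := by
    rw [Pi.card_Icc]
    push_cast
    calc ∏ i, ((Finset.Icc (a i) (b i)).card : ℝ) ≤ ∏ i : Fin d, (2 * t ^ 8 + 1 : ℝ) := by
          refine Finset.prod_le_prod (fun _ _ => by positivity) fun i _ => ?_
          rw [Int.card_Icc]
          have : (b i + 1 - a i).toNat ≤ 2 * t ^ 8 + 1 := by have := hab' i; omega
          exact_mod_cast this
      _ = _ := by simp
  have h03 : (2 * t0 ^ 8 : ℤ) ≤ t ^ 3 := by exact_mod_cast hS.h03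
  have h13 : (2 * t1 ^ 8 : ℤ) ≤ t ^ 3 := by exact_mod_cast hS.h13
  have ht1 : (1:ℝ) ≤ t1 := by exact_mod_cast hS.ht1
  have := rect_measure hf X hδ hδ1 (ω := ω) E (a := a) (b := b) hS.sc.ht0 hS.ht1
    (fun i => by have := hab i; push_cast; linarith)
    (fun i => by have := hab i; push_cast; linarith) hab' hc hm hsep
    (V := (2 * t ^ 8 + 1 : ℝ) ^ d) (one_le_pow₀ (by
      have : (0:ℝ) ≤ t ^ 8 := by positivity
      linarith)) hV hS.hex0 hS.hex1 (r := Real.exp (-t0 ^ 6)) (M := t1 ^ 6) (S := 16 * t)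
    (Real.exp_pos _) (Real.exp_le_one_iff.2 (by simp)) hS.hrρ
    hS.hrP hS.hbad (one_le_pow₀ ht1) hS.hbM hS.hbM1
  refine (measure_mono ?_).trans this
  rintro x ⟨hx, hx'⟩
  exact ⟨hx, fun h => hx' (h.mono fun _ _ _ _ => hS.hconst)⟩

/-- The inductive step of the measure estimate. -/
lemma ldtm_step {f : ℝ → ℝ} (hf : ∀ x, f (x + 1) = f x) (X : Ext f) {δ : ℝ} (hδ : 0 ≤ δ)
    (hδ1 : δ * 3 ^ d ≤ 1) {ω : Fin d → ℝ} {t0 t1 t K : ℕ}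
    (hS : StepScales d X.ρ X.C t0 t1 t K) (hc : LDTc δ f ω t0 K)
    (hm : LDTm δ f ω t1) (hsep : Sep ω (t ^ 9) (Real.exp (-t0))) : LDTm δ f ω t := by
  classical
  intro E
  have h89 : 8 * t ^ 8 ≤ t ^ 9 := by rw [pow_succ t 8, mul_comm]; gcongr; exact hS.ht
  have h38 : t ^ 3 ≤ t ^ 8 := Nat.pow_le_pow_right (by have := hS.ht; omega) (by norm_num)
  have hsep' : Sep ω (2 * t ^ 8) (Real.exp (-t0)) := hsep.mono (by omega) le_rfl
  have h38' : (t ^ 3 : ℤ) ≤ t ^ 8 := by exact_mod_cast h38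
  set A : ((Fin d → ℤ) × (Fin d → ℤ)) → Set ℝ := fun p =>
    {x : ℝ | x ∈ Set.Icc (0:ℝ) 1 ∧ ¬ Inv δ (fun n => (pot f ω E x n : ℂ)) (Finset.Icc p.1 p.2)
      (fun _ _ => Real.exp (t ^ 2))}
  set a : Fin d → ℤ := fun i => (0 : Fin d → ℤ) i - (t ^ 8 : ℕ)
  set b : Fin d → ℤ := fun i => (0 : Fin d → ℤ) i + (t ^ 8 : ℕ)
  set 𝓡 := Q (0 : Fin d → ℤ) (t ^ 8) ×ˢ Finset.Icc (t ^ 3) (2 * t ^ 3)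
  have hcard : 𝓡.card = (2 * t ^ 8 + 1) ^ d * (t ^ 3 + 1) := by
    rw [Finset.card_product, card_Q, Nat.card_Icc]; congr 1; omega
  set q : ((Fin d → ℤ) × ℕ) → ((Fin d → ℤ) × (Fin d → ℤ)) := fun p =>
    (a ⊔ fun i => p.1 i - p.2, b ⊓ fun i => p.1 i + p.2)
  have hA : ∀ p ∈ 𝓡, volume (A (q p)) ≤ ENNReal.ofReal (100 * Real.exp (-((16 * t - 5) / 8))) := by
    intro p hp
    obtain ⟨h1, h2⟩ := Finset.mem_product.1 hp
    rw [Finset.mem_Icc] at h2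
    have h2' : (t:ℤ) ^ 3 ≤ p.2 := by exact_mod_cast h2.1
    have h3 := mem_Q.1 h1
    rw [sd_le_iff] at h3
    refine rect_measure_scales hf X hδ hδ1 E hS hc hm hsep' (fun i => ?_) fun i => ?_
    · have h4 := h3 i
      have h5 : (p.1 i).natAbs ≤ t ^ 8 := by simpa using h4
      have h6 : |p.1 i| ≤ (t:ℤ) ^ 8 := by rw [Int.abs_eq_natAbs]; exact_mod_cast h5
      have h7 := abs_le.1 h6
      simp only [q, a, b, Pi.sup_apply, Pi.inf_apply, Pi.zero_apply, ← max_add_add_right, le_inf_iff,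
        max_le_iff]
      push_cast
      refine ⟨⟨?_, ?_⟩, ?_, ?_⟩ <;> linarith
    · simp only [q, a, b, Pi.sup_apply, Pi.inf_apply, Pi.zero_apply]; omega
  have hA0 : volume (A (a, b)) ≤ ENNReal.ofReal (100 * Real.exp (-((16 * t - 5) / 8))) := by
    refine rect_measure_scales hf X hδ hδ1 E hS hc hm hsep' (fun i => ?_) fun i => ?_
    · simp only [a, b, Pi.zero_apply]; push_cast
      have : (0:ℤ) ≤ t ^ 8 := by positivity
      linarith
    · simp only [a, b, Pi.zero_apply]; omega
  calc volume {x : ℝ | x ∈ Set.Icc (0:ℝ) 1 ∧ ¬ Good δ f ω E t 1 x}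
      ≤ volume (A (a, b) ∪ ⋃ p ∈ 𝓡, A (q p)) := by
        refine measure_mono ?_
        rintro x ⟨hx, hx'⟩
        by_contra hcon
        rw [Set.mem_union, not_or] at hcon
        refine hx' (good_of_rects hf hδ hδ1 hS.sc hS.ht hc hsep ?_ fun n hn r h1 h2 => ?_)
        · by_contra h; exact hcon.1 ⟨hx, h⟩
        · have : Inv δ (fun n => (pot f ω E x n : ℂ)) (Finset.Icc (q (n, r)).1 (q (n, r)).2)
              (fun _ _ => Real.exp (t ^ 2)) := by
            by_contra h
            refine hcon.2 (Set.mem_iUnion₂.2 ⟨(n, r), ?_, hx, h⟩)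
            exact Finset.mem_product.2 ⟨hn, Finset.mem_Icc.2 ⟨h1, h2⟩⟩
          refine this.mono fun _ _ _ _ => Real.exp_le_exp.2 ?_
          have : (0:ℝ) ≤ t ^ 2 := by positivity
          linarith
    _ ≤ ENNReal.ofReal (100 * Real.exp (-((16 * t - 5) / 8))) +
        ∑ p ∈ 𝓡, ENNReal.ofReal (100 * Real.exp (-((16 * t - 5) / 8))) :=
        (measure_union_le _ _).trans (add_le_add hA0
          ((measure_biUnion_finset_le _ _).trans (Finset.sum_le_sum hA)))
    _ = ENNReal.ofReal ((1 + (2 * t ^ 8 + 1 : ℝ) ^ d * (t ^ 3 + 1)) *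
          (100 * Real.exp (-((16 * t - 5) / 8)))) := by
        rw [Finset.sum_const, hcard, nsmul_eq_mul, ENNReal.ofReal_mul (p := 1 + _) (by positivity),
          ENNReal.ofReal_add (by norm_num) (by positivity), add_mul, ENNReal.ofReal_one, one_mul,
          ← ENNReal.ofReal_natCast]
        push_cast; rfl
    _ < _ := (ENNReal.ofReal_lt_ofReal_iff (Real.exp_pos _)).2 hS.hfin

section minor
variable {ι : Type*} [Fintype ι] [DecidableEq ι]

/-- The function whose negativity expresses that an entry of the inverse is smaller than `b`. -/
def minorFn (A : Matrix ι ι ℂ) (b : ℝ) (n k : ι) : ℝ := ‖A.adjugate n k‖ ^ 2 - b ^ 2 * ‖A.det‖ ^ 2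

lemma norm_inv_apply (A : Matrix ι ι ℂ) (n k : ι) : ‖A⁻¹ n k‖ = ‖A.det‖⁻¹ * ‖A.adjugate n k‖ := by
  rw [Matrix.inv_def, Matrix.smul_apply, smul_eq_mul, norm_mul, Ring.inverse_eq_inv', norm_inv]

lemma det_ne_zero_of_minorFn_neg {A : Matrix ι ι ℂ} {b : ℝ} {n k : ι} (h : minorFn A b n k < 0) :
    A.det ≠ 0 := by
  intro h0
  simp only [minorFn, h0, norm_zero] at h
  nlinarith [sq_nonneg ‖A.adjugate n k‖]

lemma norm_inv_le_of_minorFn_neg {A : Matrix ι ι ℂ} {b : ℝ} (hb : 0 ≤ b) {n k : ι}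
    (h : minorFn A b n k < 0) : ‖A⁻¹ n k‖ ≤ b := by
  have h1 : 0 < ‖A.det‖ := norm_pos_iff.2 (det_ne_zero_of_minorFn_neg h)
  rw [norm_inv_apply, inv_mul_le_iff₀ h1]
  refine le_of_sq_le_sq ?_ (by positivity)
  unfold minorFn at h
  nlinarith

lemma minorFn_neg {A : Matrix ι ι ℂ} (hA : A.det ≠ 0) {b : ℝ} {n k : ι} (h : ‖A⁻¹ n k‖ < b) :
    minorFn A b n k < 0 := by
  have h1 : 0 < ‖A.det‖ := norm_pos_iff.2 hA
  rw [norm_inv_apply, inv_mul_lt_iff₀ h1] at h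
  unfold minorFn
  nlinarith [norm_nonneg (A.adjugate n k)]

lemma minorFn_mem {m : ℕ} {A : ℝ → Matrix ι ι ℂ} (hA : ∀ i j, (fun t => A t i j) ∈ TrigPoly m)
    (b : ℝ) (n k : ι) :
    (fun t => (minorFn (A t) b n k : ℂ)) ∈ TrigPoly (2 * (Fintype.card ι * m)) := by
  have h1 := TrigPoly.adjugate_mem hA n k
  have h2 := TrigPoly.det_mem hA
  have h3 := TrigPoly.mul_mem h1 (TrigPoly.conj_mem h1)
  have h4 := TrigPoly.mul_mem h2 (TrigPoly.conj_mem h2)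
  rw [two_mul]
  have := Submodule.sub_mem _ h3 (Submodule.smul_mem _ ((b : ℂ) ^ 2) h4)
  convert this using 1
  ext t
  simp only [minorFn, Pi.sub_apply, Pi.smul_apply, smul_eq_mul, Complex.mul_conj']
  push_cast; ring

lemma minorFn_count {m : ℕ} {A : ℝ → Matrix ι ι ℂ} (hA : ∀ i j, (fun t => A t i j) ∈ TrigPoly m)
    {b : ℝ} {n k : ι} {η : ℝ} (hη : η ≤ 1)
    (hv : volume {y ∈ Set.Icc (0:ℝ) 1 | 0 ≤ minorFn (A y) b n k} < ENNReal.ofReal η)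
    (Y : Finset ℝ) (hY : ∀ y ∈ Y, y ∈ Set.Icc (0:ℝ) 1 ∧ 0 ≤ minorFn (A y) b n k)
    (hsep : ∀ y ∈ Y, ∀ y' ∈ Y, y < y' → η ≤ y' - y) :
    Y.card ≤ 4 * (Fintype.card ι * m) + 1 := by
  have hm := minorFn_mem hA b n k
  have hcont : Continuous fun y => minorFn (A y) b n k := by
    have := Complex.continuous_re.comp (TrigPoly.continuous hm)
    simpa [Function.comp_def] using this
  refine card_separated_le _ hcont _ η le_rfl le_rfl (fun Z hZ => ?_) hv Y hY hsep
  have := TrigPoly.card_zeros_le hm ?_ Z fun t ht => ⟨(hZ t ht).1, by simp [(hZ t ht).2]⟩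
  · omega
  · by_contra! hcon
    have : {y ∈ Set.Icc (0:ℝ) 1 | 0 ≤ minorFn (A y) b n k} = Set.Icc 0 1 := by
      ext y
      have : minorFn (A y) b n k = 0 := by exact_mod_cast hcon y
      show _ ∧ _ ↔ _
      rw [this]; simp
    rw [this, Real.volume_Icc] at hv
    exact absurd hv (not_lt.2 (ENNReal.ofReal_le_ofReal (by linarith)))

end minor

lemma card_attach_Q (r : ℕ) : Fintype.card (Q (0 : Fin d → ℤ) r) = (2 * r + 1) ^ d := by
  rw [Fintype.card_coe, card_Q]

/-- The matrix of a box depends on the phase through trigonometric polynomials. -/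
lemma mat_pot_mem {T : ℝ → ℝ} {m : ℕ} (hT : (fun t => (T t : ℂ)) ∈ TrigPoly m) (δ : ℝ)
    (ω : Fin d → ℝ) (E : ℝ) (Λ : Finset (Fin d → ℤ)) (i j : Λ) :
    (fun x => mat δ (fun n => (pot T ω E x n : ℂ)) Λ i j) ∈ TrigPoly m := by
  simp only [mat, Matrix.of_apply]
  refine Submodule.add_mem _ (TrigPoly.const_mem m _) ?_
  by_cases h : i = j
  · simp only [h, if_true, pot]
    push_cast
    exact Submodule.sub_mem _ (TrigPoly.comp_add hT _) (TrigPoly.const_mem m _)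
  · simp only [h, if_false]
    exact TrigPoly.const_mem m 0

/-- The number of separated bad phases is controlled by the measure of the set of bad phases. -/
lemma ldtc_of_ldtm {f : ℝ → ℝ} {δ : ℝ} (hδ : 0 ≤ δ) {ω : Fin d → ℝ} {t K : ℕ} (ht : 1 ≤ t)
    {T : ℝ → ℝ} (hT : (fun t => (T t : ℂ)) ∈ TrigPoly (t ^ 10))
    (hfT : ∀ x, |f x - T x| ≤ Real.exp (-t ^ 9)) (hm : LDTm δ f ω t)
    (hK : ((2 * t ^ 8 + 1) ^ d) ^ 2 * (4 * ((2 * t ^ 8 + 1) ^ d * t ^ 10) + 1) ≤ K)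
    (h1 : Real.exp (-t ^ 9) * ((2 * t ^ 8 + 1 : ℝ) ^ d * Real.exp (t ^ 5)) ≤ 1 / 2)
    (h2 : 2 * (2 * t ^ 8 + 1 : ℝ) ^ d * Real.exp (t ^ 5) ^ 2 * Real.exp (-t ^ 9) <
      1 / 2 * Real.exp (t ^ 5 - 1 - 4 * t ^ 8)) : LDTc δ f ω t K := by
  classical
  intro E Y hY hsep
  have ht' : (1:ℝ) ≤ t := by exact_mod_cast ht
  have htn : 1 / (t:ℝ) ≤ 1 := by rw [div_le_one (by linarith)]; exact ht'
  have htn0 : 0 ≤ 1 / (t:ℝ) := by positivity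
  have hcard : ((Q (0 : Fin d → ℤ) (t ^ 8)).card : ℝ) = (2 * t ^ 8 + 1 : ℝ) ^ d := by
    rw [card_Q]; push_cast; rfl
  set bb : ℝ → (Fin d → ℤ) → (Fin d → ℤ) → ℝ :=
    fun s n k => Real.exp ((t ^ 5 - s) - (1 + 1 / (t : ℝ)) * sd n k)
  have hbP : ∀ s, 0 ≤ s → ∀ n k, bb s n k ≤ Real.exp (t ^ 5) := fun s hs n k => by
    refine Real.exp_le_exp.2 ?_
    have : 0 ≤ (1 + 1 / (t : ℝ)) * sd n k := by positivity
    linarith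
  have hstep : ∀ s, s = 1 ∨ s = 1 / 2 → ∀ n ∈ Q (0 : Fin d → ℤ) (t ^ 8), ∀ k ∈ Q (0 : Fin d → ℤ) (t ^ 8),
      bb s n k + 2 * (Q (0 : Fin d → ℤ) (t ^ 8)).card * Real.exp (t ^ 5) ^ 2 * Real.exp (-t ^ 9) <
        bb (s - 1 / 2) n k := by
    intro s hs n hn k hk
    rw [hcard]
    have e1 : bb (s - 1 / 2) n k = bb s n k * Real.exp (1 / 2) := by
      simp only [bb]; rw [← Real.exp_add]; congr 1; ring
    have e2 : (3 / 2 : ℝ) ≤ Real.exp (1 / 2) := by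
      have := Real.add_one_le_exp (1 / 2 : ℝ); linarith
    have e3 : Real.exp (t ^ 5 - 1 - 4 * t ^ 8) ≤ bb s n k := by
      refine Real.exp_le_exp.2 ?_
      have h8 : sd n k ≤ 2 * t ^ 8 := by
        have h1 := mem_Q.1 hn; have h2 := mem_Q.1 hk
        have := sd_triangle n 0 k
        rw [sd_comm 0] at this; omega
      have h9 : (sd n k : ℝ) ≤ 2 * t ^ 8 := by exact_mod_cast h8
      have h10 : (1 + 1 / (t : ℝ)) * sd n k ≤ 2 * (2 * t ^ 8) := by gcongr; linarith
      rcases hs with rfl | rfl <;> linarith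
    have e4 := mul_le_mul_of_nonneg_left e2 (Real.exp_pos _ : 0 < bb s n k).le
    rw [e1]
    linarith
  set A : ℝ → Matrix (Q (0 : Fin d → ℤ) (t ^ 8)) (Q (0 : Fin d → ℤ) (t ^ 8)) ℂ :=
    fun x => mat δ (fun n => (pot T ω E x n : ℂ)) (Q 0 (t ^ 8))
  have hA : ∀ i j, (fun x => A x i j) ∈ TrigPoly (t ^ 10) := mat_pot_mem hT δ ω E _
  have hpot : ∀ x n, ‖(pot T ω E x n : ℂ) - (pot f ω E x n : ℂ)‖ ≤ Real.exp (-t ^ 9) := by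
    intro x n
    rw [← Complex.ofReal_sub, Complex.norm_real, Real.norm_eq_abs, abs_sub_comm]
    simpa [pot] using hfT (x + dotw ω n)
  have hpot' : ∀ x n, ‖(pot f ω E x n : ℂ) - (pot T ω E x n : ℂ)‖ ≤ Real.exp (-t ^ 9) :=
    fun x n => by rw [norm_sub_rev]; exact hpot x n
  have hsmall : Real.exp (-t ^ 9) * ((Q (0 : Fin d → ℤ) (t ^ 8)).card * Real.exp (t ^ 5)) ≤ 1 / 2 := by
    rw [hcard]; exact h1
  have hstrong : ∀ x, Good δ f ω E t 1 x → ∀ n k, minorFn (A x) (bb (1 / 2) n.1 k.1) n k < 0 := by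
    intro x hx n k
    have := hx.perturb hδ (fun n _ k _ => hbP 1 zero_le_one n k) (Real.exp_pos _).le
      (fun n _ => hpot x n) hsmall
    refine minorFn_neg this.1 ((this.2 n k).trans_lt ?_)
    have h3 := hstep 1 (Or.inl rfl) n.1 n.2 k.1 k.2
    rw [show (1:ℝ) - 1 / 2 = 1 / 2 by norm_num] at h3
    exact h3
  have hweak : ∀ x, (∀ n k, minorFn (A x) (bb (1 / 2) n.1 k.1) n k < 0) → Good δ f ω E t 0 x := by
    intro x hx
    have h0 : (0 : Fin d → ℤ) ∈ Q (0 : Fin d → ℤ) (t ^ 8) := mem_Q.2 (by simp [sd_self])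
    have hI : Inv δ (fun n => (pot T ω E x n : ℂ)) (Q 0 (t ^ 8)) (bb (1 / 2)) :=
      ⟨det_ne_zero_of_minorFn_neg (hx ⟨0, h0⟩ ⟨0, h0⟩), fun n k =>
        norm_inv_le_of_minorFn_neg (Real.exp_pos _).le (hx n k)⟩
    have := hI.perturb hδ (fun n _ k _ => hbP (1 / 2) (by norm_num) n k) (Real.exp_pos _).le
      (fun n _ => hpot' x n) hsmall
    refine this.mono fun n hn k hk => ?_
    have h3 := (hstep (1 / 2) (Or.inr rfl) n hn k hk).le
    rwa [sub_self] at h3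
  set Yp : (Q (0 : Fin d → ℤ) (t ^ 8)) × (Q (0 : Fin d → ℤ) (t ^ 8)) → Finset ℝ := fun p =>
    Y.filter fun y => 0 ≤ minorFn (A y) (bb (1 / 2) p.1.1 p.2.1) p.1 p.2
  have hYp : Y ⊆ Finset.univ.biUnion Yp := by
    intro y hy
    by_contra hcon
    refine (hY y hy).2 (hweak y fun n k => ?_)
    by_contra h
    exact hcon (Finset.mem_biUnion.2 ⟨(n, k), Finset.mem_univ _, Finset.mem_filter.2 ⟨hy, not_lt.1 h⟩⟩)
  refine le_trans ((Finset.card_le_card hYp).trans Finset.card_biUnion_le) (le_trans ?_ hK)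
  calc ∑ p, (Yp p).card ≤ ∑ p : (Q (0 : Fin d → ℤ) (t ^ 8)) × (Q (0 : Fin d → ℤ) (t ^ 8)),
        (4 * ((2 * t ^ 8 + 1) ^ d * t ^ 10) + 1) := by
        refine Finset.sum_le_sum fun p _ => ?_
        have := minorFn_count hA (b := bb (1 / 2) p.1.1 p.2.1) (n := p.1) (k := p.2)
          (η := Real.exp (-t)) (Real.exp_le_one_iff.2 (by simp)) ?_ (Yp p) (fun y hy => ?_)
          (fun y hy y' hy' => hsep y (Finset.mem_filter.1 hy).1 y' (Finset.mem_filter.1 hy').1)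
        · rwa [card_attach_Q] at this
        · refine lt_of_le_of_lt (measure_mono ?_) (hm E)
          rintro y ⟨hy1, hy2⟩
          exact ⟨hy1, fun hg => absurd (hstrong y hg p.1 p.2) (not_lt.2 hy2)⟩
        · obtain ⟨h3, h4⟩ := Finset.mem_filter.1 hy
          exact ⟨Set.Ico_subset_Icc_self (hY y h3).1, h4⟩
    _ = _ := by
        rw [Finset.sum_const, Finset.card_univ, Fintype.card_prod, card_attach_Q, smul_eq_mul, sq]

lemma exists_ne_on_Icc {f : ℝ → ℝ} (hf : ∀ x, AnalyticAt ℝ f x) (hne : ∃ x y, f x ≠ f y)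
    {a b : ℝ} (hab : a < b) : ∃ p ∈ Set.Icc a b, ∃ q ∈ Set.Icc a b, f p ≠ f q := by
  by_contra! h
  obtain ⟨x, y, hxy⟩ := hne
  have h1 : f =ᶠ[nhds ((a + b) / 2)] fun _ => f a := by
    filter_upwards [Icc_mem_nhds (show a < (a + b) / 2 by linarith)
      (show (a + b) / 2 < b by linarith)] with z hz
    exact h z hz a ⟨le_rfl, hab.le⟩
  have hA : AnalyticOnNhd ℝ f Set.univ := fun z _ => hf z
  have hB : AnalyticOnNhd ℝ (fun _ : ℝ => f a) Set.univ := fun z _ => analyticAt_const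
  have := hA.eq_of_eventuallyEq hB h1
  rw [this] at hxy
  exact hxy rfl

/-- Quantitative smallness of the sublevel sets of `f - E`, uniformly in `E`. -/
lemma exists_sublevel {f : ℝ → ℝ} (X : Ext f) (hf : ∀ x, AnalyticAt ℝ f x)
    (hne : ∃ x y, f x ≠ f y) : ∃ M : ℝ, 1 ≤ M ∧ ∀ E S : ℝ, 0 ≤ S →
      volume {x : ℝ | x ∈ Set.Icc (0:ℝ) 1 ∧ |f x - E| < Real.exp (-(S * M))} ≤
        ENNReal.ofReal (100 * Real.exp (-((S - 5) / 8))) := by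
  obtain ⟨r, hr, hr1, hrρ⟩ : ∃ r : ℝ, 0 < r ∧ r ≤ 1 ∧ 2 * r ≤ X.ρ :=
    ⟨min 1 (X.ρ / 2), lt_min one_pos (half_pos X.hρ), min_le_left _ _, by
      have := min_le_right 1 (X.ρ / 2); linarith⟩
  obtain ⟨N, hN0, hNr, hN8, hcov⟩ := exists_grid r hr hr1
  have hN' : (0:ℝ) < N := by exact_mod_cast hN0
  have hcell : ∀ j : ℕ, ∃ p ∈ Set.Icc ((j:ℝ) / N) ((j + 1) / N),
      ∃ q ∈ Set.Icc ((j:ℝ) / N) ((j + 1) / N), f p ≠ f q := fun j =>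
    exists_ne_on_Icc hf hne (by gcongr; linarith)
  choose p hp q hq hpq using hcell
  obtain ⟨c, hc, hcj⟩ : ∃ c > 0, ∀ j ∈ Finset.range N, c ≤ |f (p j) - f (q j)| / 2 := by
    have hne' : (Finset.range N).Nonempty := ⟨0, Finset.mem_range.2 hN0⟩
    refine ⟨(Finset.range N).inf' hne' fun j => |f (p j) - f (q j)| / 2, ?_, fun j hj =>
      Finset.inf'_le _ hj⟩
    rw [gt_iff_lt, Finset.lt_inf'_iff]
    intro j _
    have := abs_pos.2 (sub_ne_zero.2 (hpq j))
    linarith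
  have hfb : ∀ x, |f x| ≤ X.C := fun x => by
    have := X.bdd x (by show |(x:ℂ).im| < X.ρ; simpa using X.hρ)
    rw [X.real, Complex.norm_real] at this
    exact this
  set M : ℝ := max 1 (max (-Real.log c) (2 * X.C + 1)) with hM
  have hM1 : 1 ≤ M := le_max_left _ _
  have hMc : Real.exp (-M) ≤ c := by
    rw [← Real.exp_log hc, Real.exp_le_exp]
    have : -Real.log c ≤ M := (le_max_left _ _).trans (le_max_right _ _)
    linarith
  have hMC : 2 * X.C + 1 ≤ Real.exp M :=
    ((le_max_right _ _).trans (le_max_right _ _)).trans ((by linarith [Real.add_one_le_exp M]))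
  refine ⟨M, hM1, fun E S hS => ?_⟩
  have hexp1 : Real.exp (-(S * M)) ≤ 1 := Real.exp_le_one_iff.2 (by nlinarith)
  by_cases hE : X.C + 1 < |E|
  · have : {x : ℝ | x ∈ Set.Icc (0:ℝ) 1 ∧ |f x - E| < Real.exp (-(S * M))} = ∅ := by
      ext x
      simp only [Set.mem_ofPred_eq, Set.mem_empty_iff_false, iff_false, not_and, not_lt]
      intro _
      have h1 := abs_sub_abs_le_abs_sub E (f x)
      rw [abs_sub_comm] at h1
      linarith [hfb x]
    rw [this, measure_empty]
    exact bot_le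
  push Not at hE
  have hsel : ∀ j ∈ Finset.range N, ∃ x0 ∈ Set.Icc ((j:ℝ) / N) ((j + 1) / N), c ≤ |f x0 - E| := by
    intro j hj
    by_contra! h
    have h1 := h _ (hp j)
    have h2 := h _ (hq j)
    have h3 := hcj j hj
    have h4 := abs_sub_le (f (p j)) E (f (q j))
    rw [abs_sub_comm E] at h4
    linarith
  have hloc : ∀ j ∈ Finset.range N, volume {x : ℝ | x ∈ Set.Icc ((j:ℝ) / N) ((j + 1) / N) ∧
      |f x - E| < Real.exp (-(S * M))} ≤ ENNReal.ofReal (r * (8 * Real.exp (-((S - 5) / 8)))) := by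
    intro j hj
    obtain ⟨x0, hx0, hx0c⟩ := hsel j hj
    have hstrip : ∀ z ∈ Metric.ball (0:ℂ) 2, (x0 : ℂ) + r * z ∈ strip X.ρ := by
      intro z hz
      show |((x0 : ℂ) + r * z).im| < X.ρ
      have h1 : ((x0 : ℂ) + r * z).im = r * z.im := by simp
      rw [h1, abs_mul, abs_of_pos hr]
      have h2 := Complex.abs_im_le_norm z
      have h3 : ‖z‖ < 2 := by simpa using hz
      nlinarith
    have hg := cartan_estimate (fun z => X.F (x0 + r * z) - E) M hM1
      (DifferentiableOn.sub_const (X.diff.comp (by fun_prop) hstrip) _)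
      (fun z hz => by
        have h1 := X.bdd _ (hstrip z (by simp [hz]))
        have h2 := norm_sub_le (X.F (x0 + r * z)) E
        rw [Complex.norm_real, Real.norm_eq_abs] at h2
        linarith)
      (by
        have h1 := X.real x0
        simp only [mul_zero, add_zero]
        rw [h1, ← Complex.ofReal_sub, Complex.norm_real]
        exact hMc.trans hx0c) S
    calc _ ≤ volume {x : ℝ | (x - x0) / r ∈ {x : ℝ | |x| ≤ 1 / 4 ∧
          ‖X.F (x0 + r * x) - E‖ < Real.exp (-(S * M))}} := by
          refine measure_mono ?_
          rintro x ⟨hx, hxE⟩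
          refine ⟨?_, ?_⟩
          · rw [abs_div, abs_of_pos hr, div_le_iff₀ hr]
            have e : ((j:ℝ) + 1) / N = j / N + 1 / N := by ring
            have h1 := hx.1; have h2 := hx.2; have h3 := hx0.1; have h4 := hx0.2
            rw [abs_le]; constructor <;> linarith
          · have e : ((x0:ℂ) + r * ((x - x0) / r : ℝ)) = ((x : ℝ) : ℂ) := by
              have : (r:ℂ) ≠ 0 := by exact_mod_cast hr.ne'
              push_cast; field_simp; ring
            rw [e, X.real, ← Complex.ofReal_sub, Complex.norm_real]
            exact hxE
      _ ≤ _ := by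
          rw [volume_affine x0 hr, ENNReal.ofReal_mul hr.le]
          gcongr
  calc _ ≤ volume (⋃ j ∈ Finset.range N, {x : ℝ | x ∈ Set.Icc ((j:ℝ) / N) ((j + 1) / N) ∧
          |f x - E| < Real.exp (-(S * M))}) := by
        refine measure_mono ?_
        rintro x ⟨hx, hxE⟩
        have := hcov hx
        simp only [Set.mem_iUnion] at this ⊢
        obtain ⟨j, hj, hx⟩ := this
        exact ⟨j, hj, hx, hxE⟩
    _ ≤ ∑ j ∈ Finset.range N, ENNReal.ofReal (r * (8 * Real.exp (-((S - 5) / 8)))) :=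
        (measure_biUnion_finset_le _ _).trans (Finset.sum_le_sum hloc)
    _ = ENNReal.ofReal (N * (r * (8 * Real.exp (-((S - 5) / 8))))) := by
        rw [Finset.sum_const, Finset.card_range, nsmul_eq_mul,
          ENNReal.ofReal_mul (Nat.cast_nonneg N), ENNReal.ofReal_natCast]
    _ ≤ _ := by
        refine ENNReal.ofReal_le_ofReal ?_
        have := Real.exp_nonneg (-((S - 5) / 8))
        nlinarith

/-- The initial scale: the large deviation estimate for weak hopping. -/
lemma ldtm_base {f : ℝ → ℝ} (hf : ∀ x, f (x + 1) = f x) {M : ℝ} (hM : 1 ≤ M)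
    (hsub : ∀ E S : ℝ, 0 ≤ S →
      volume {x : ℝ | x ∈ Set.Icc (0:ℝ) 1 ∧ |f x - E| < Real.exp (-(S * M))} ≤
        ENNReal.ofReal (100 * Real.exp (-((S - 5) / 8)))) {t : ℕ} (ht : 3 ≤ t) {δ : ℝ} (hδ : 0 ≤ δ)
    (hδt : δ * 3 ^ d * Real.exp 2 ≤ Real.exp (-(t ^ 2)) / 2)
    (hnum : (2 * (t : ℝ) ^ 8 + 1) ^ d * (2 * (100 * Real.exp (-((t ^ 2 / M - 5) / 8)))) <
      Real.exp (-t)) (ω : Fin d → ℝ) : LDTm δ f ω t := by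
  intro E
  have ht' : (3:ℝ) ≤ t := by exact_mod_cast ht
  set bad : Set ℝ := {x | |f x - E| < Real.exp (-(t ^ 2))}
  have hbad1 : volume {x : ℝ | x ∈ Set.Icc (0:ℝ) 1 ∧ x ∈ bad} ≤
      ENNReal.ofReal (100 * Real.exp (-((t ^ 2 / M - 5) / 8))) := by
    have := hsub E (t ^ 2 / M) (by positivity)
    rwa [div_mul_cancel₀ _ (by linarith : M ≠ 0)] at this
  have hper : ∀ x, x + 1 ∈ bad ↔ x ∈ bad := fun x => by
    show |f (x + 1) - E| < _ ↔ |f x - E| < _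
    rw [hf]
  calc _ ≤ volume (⋃ n ∈ Q (0 : Fin d → ℤ) (t ^ 8),
          {x : ℝ | x ∈ Set.Icc (0:ℝ) 1 ∧ x + dotw ω n ∈ bad}) := by
        refine measure_mono ?_
        rintro x ⟨hx, hxE⟩
        by_contra hcon
        simp only [Set.mem_iUnion, not_exists] at hcon
        apply hxE
        have hlow : ∀ n ∈ Q (0 : Fin d → ℤ) (t ^ 8), Real.exp (-(t ^ 2)) ≤ ‖(pot f ω E x n : ℂ)‖ := by
          intro n hn
          rw [Complex.norm_real]
          by_contra! h
          exact hcon n hn ⟨hx, h⟩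
        refine (inv_of_large_diag hδ (Real.exp_pos _) hlow hδt).mono fun n _ k _ => ?_
        rw [Real.exp_neg, div_inv_eq_mul]
        have h2 : (2:ℝ) ≤ Real.exp 1 := by linarith [Real.add_one_le_exp 1]
        calc _ ≤ Real.exp 1 * Real.exp (t ^ 2) * Real.exp (-(2 * sd n k)) := by gcongr
          _ = Real.exp (1 + t ^ 2 - 2 * sd n k) := by
              rw [← Real.exp_add, ← Real.exp_add]; ring_nf
          _ ≤ _ := by
              rw [Real.exp_le_exp]
              have h3 : 1 / (t:ℝ) ≤ 1 := by rw [div_le_one (by linarith)]; linarith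
              have h4 : (0:ℝ) ≤ sd n k := Nat.cast_nonneg _
              have h5 : (2:ℝ) + t ^ 2 ≤ t ^ 5 := by
                have h6 : (t:ℝ) ^ 5 = t ^ 2 * t ^ 3 := by ring
                have h7 : (3:ℝ) ^ 3 ≤ t ^ 3 := by gcongr
                have h8 : (3:ℝ) ^ 2 ≤ t ^ 2 := by gcongr
                nlinarith
              nlinarith
    _ ≤ ∑ n ∈ Q (0 : Fin d → ℤ) (t ^ 8), 2 * ENNReal.ofReal (100 * Real.exp (-((t ^ 2 / M - 5) / 8))) := by
        refine (measure_biUnion_finset_le _ _).trans (Finset.sum_le_sum fun n _ => ?_)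
        exact (volume_shift_le hper _).trans (by gcongr)
    _ = ENNReal.ofReal ((2 * (t : ℝ) ^ 8 + 1) ^ d * (2 * (100 * Real.exp (-((t ^ 2 / M - 5) / 8))))) := by
        rw [Finset.sum_const, card_Q, nsmul_eq_mul,
          ENNReal.ofReal_mul (show 0 ≤ (2 * (t : ℝ) ^ 8 + 1) ^ d by positivity),
          ENNReal.ofReal_mul (show (0:ℝ) ≤ 2 by norm_num)]
        congr 1
        · rw [← ENNReal.ofReal_natCast]; push_cast; rfl
        · simp
    _ < _ := (ENNReal.ofReal_lt_ofReal_iff (Real.exp_pos _)).2 hnum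

set_option maxHeartbeats 1000000 in
lemma stepScales_of {ρ C : ℝ} {t0 t1 t A : ℕ} (hA : 100 * (d + 1) ≤ A) (ht0 : 100 ≤ t0)
    (ht1 : t1 = t0 ^ A) (ht : t = t1 ^ A) (hC : C ≤ Real.exp t0)
    (hρ : 2 * Real.exp (-t0 ^ 6) ≤ ρ) (hE : (t : ℝ) ^ (10 * (d + 2)) ≤ Real.exp t0) :
    StepScales d ρ C t0 t1 t (t0 ^ (27 * d + 11)) := by
  have h1 : 1 ≤ t0 := by omega
  have htA : t = t0 ^ (A * A) := by rw [ht, ht1, pow_mul]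
  have hpw : ∀ {m n : ℕ}, m ≤ n → t0 ^ m ≤ t0 ^ n := fun h => Nat.pow_le_pow_right h1 h
  have hAA : 100 * A ≤ A * A := Nat.mul_le_mul_right _ (by omega)
  obtain ⟨K, hK⟩ : ∃ K, K = t0 ^ (27 * d + 11) := ⟨_, rfl⟩
  obtain ⟨b0, hb0⟩ : ∃ b0, b0 = K * (2 * t0 ^ 8 + 1) ^ d := ⟨_, rfl⟩
  obtain ⟨s, hs⟩ : ∃ s : ℝ, s = t0 := ⟨_, rfl⟩
  obtain ⟨p, hp⟩ : ∃ p : ℝ, p = t1 := ⟨_, rfl⟩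
  obtain ⟨V, hV⟩ : ∃ V : ℝ, V = (2 * (t : ℝ) ^ 8 + 1) ^ d := ⟨_, rfl⟩
  rw [← hs] at hC hρ hE
  rw [← hK]
  have hs100 : (100 : ℝ) ≤ s := by rw [hs]; exact_mod_cast ht0
  have hs1 : (1:ℝ) ≤ s := by linarith
  have hrpw : ∀ {m n : ℕ}, m ≤ n → s ^ m ≤ s ^ n := fun h => pow_le_pow_right₀ hs1 h
  have htr : (t : ℝ) = s ^ (A * A) := by rw [htA, hs]; push_cast; rfl
  have hpr : p = s ^ A := by rw [hp, ht1, hs]; push_cast; rfl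
  have hst : s ^ 100 ≤ t := htr ▸ hrpw (by omega)
  have hsp : s ^ 100 ≤ p := hpr ▸ hrpw (by omega)
  have hpt : p ^ 100 ≤ t := by rw [htr, hpr, ← pow_mul]; exact hrpw (by omega)
  have hs2 : s ^ 2 = s * s := by ring
  have hsm : ∀ {m n : ℕ}, m ≤ n → ∀ c : ℝ, c ≤ 100 → c * s ^ m ≤ s ^ (n + 1) := by
    intro m n h c hc
    calc c * s ^ m ≤ s * s ^ n := by gcongr; exact hc.trans hs100
      _ = _ := by ring
  have hsp' : s ^ 1 ≤ s ^ 100 := hrpw (by norm_num)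
  have hp1 : (1:ℝ) ≤ p := by linarith
  have ht1' : (1:ℝ) ≤ t := by linarith
  have hV1 : 1 ≤ V := hV ▸ one_le_pow₀ (by nlinarith only [hp1, pow_nonneg (zero_le_one.trans ht1') 8])
  have ht3 : (3:ℝ) ≤ t := by linarith
  have h9 : 2 * (t:ℝ) ^ 8 + 1 ≤ t ^ 9 := by
    have : (1:ℝ) ≤ t ^ 8 := one_le_pow₀ ht1'
    calc _ ≤ 3 * (t:ℝ) ^ 8 := by linarith
      _ ≤ t * t ^ 8 := by gcongr
      _ = _ := by ring
  have hVs : V ≤ Real.exp s := by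
    refine le_trans ?_ hE
    calc V ≤ ((t:ℝ) ^ 9) ^ d := by rw [hV]; gcongr
      _ = t ^ (9 * d) := by rw [← pow_mul]
      _ ≤ _ := pow_le_pow_right₀ ht1' (by omega)
  have hexp1 : Real.exp (-1) ≤ 1 / 2 := by
    rw [Real.exp_neg, one_div]
    exact inv_anti₀ two_pos (by linarith [Real.add_one_le_exp 1])
  have hnum : ∀ c : ℝ, c ≤ 101 → c ≤ Real.exp s := fun c hc => by
    linarith [Real.add_one_le_exp s]
  have hhalf : ∀ y : ℝ, s + y ≤ -1 → V * Real.exp y ≤ 1 / 2 := fun y hy => by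
    calc V * Real.exp y ≤ Real.exp s * Real.exp y := by gcongr
      _ = Real.exp (s + y) := by rw [Real.exp_add]
      _ ≤ _ := (Real.exp_le_exp.2 hy).trans hexp1
  have e5 : ∀ c : ℝ, c ≤ 100 → c * s ≤ s ^ 5 := fun c hc => by
    have := hsm (m := 1) (n := 4) (by norm_num) c hc; simpa using this
  have e56 : 100 * s ^ 5 ≤ s ^ 6 := hsm le_rfl 100 le_rfl
  have e57 : 100 * s ^ 6 ≤ s ^ 7 := hsm le_rfl 100 le_rfl
  have e58 : 100 * s ^ 7 ≤ s ^ 8 := hsm le_rfl 100 le_rfl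
  have e01 : s ≤ s ^ 5 := by simpa using e5 1 (by norm_num)
  have e9 := hrpw (show 9 ≤ 100 by norm_num)
  have e89 : 100 * s ^ 8 ≤ s ^ 9 := hsm le_rfl 100 le_rfl
  have hpp : 100 * p ^ 5 ≤ p ^ 6 := by
    calc 100 * p ^ 5 ≤ p * p ^ 5 := by gcongr; linarith
      _ = _ := by ring
  have hpp8 : 100 * p ^ 6 ≤ p ^ 8 := by
    calc 100 * p ^ 6 ≤ (p * p) * p ^ 6 := by gcongr; nlinarith only [hp1, hs100, hsp, hsp']
      _ = _ := by ring
  have hsp5 : p ≤ p ^ 5 := le_self_pow₀ hp1 (by norm_num)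
  -- prefactors
  have hP : ∀ y : ℝ, 8 * (V * Real.exp y) ^ 2 ≤ Real.exp (3 * s + 2 * y) := by
    intro y
    calc 8 * (V * Real.exp y) ^ 2 ≤ Real.exp s * (Real.exp s * Real.exp y) ^ 2 := by
          gcongr; exact hnum 8 (by norm_num)
      _ = _ := by rw [← Real.exp_add, ← Real.exp_nat_mul, ← Real.exp_add]; push_cast; ring_nf
  have hb0s : (b0 : ℝ) ≤ s ^ (36 * d + 11) := by
    have : (2 * s ^ 8 + 1) ^ d ≤ (s ^ 9) ^ d := by gcongr; linarith [hrpw (show 0 ≤ 8 by norm_num)]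
    calc (b0 : ℝ) = s ^ (27 * d + 11) * (2 * s ^ 8 + 1) ^ d := by rw [hb0, hK, hs]; push_cast; rfl
      _ ≤ s ^ (27 * d + 11) * (s ^ 9) ^ d := by gcongr
      _ = _ := by rw [← pow_mul, ← pow_add]; congr 1; ring
  have hb0e : (b0 : ℝ) ≤ Real.exp s := by
    refine hb0s.trans (le_trans ?_ hE)
    calc s ^ (36 * d + 11) ≤ t := htr ▸ hrpw (by omega)
      _ ≤ _ := le_self_pow₀ ht1' (by omega)
  have hfac : ∀ y w : ℝ, 1 + w ≤ Real.exp y → 0 ≤ w → (b0.factorial : ℝ) * (1 + w) ^ b0 ≤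
      Real.exp (b0 * (s + y)) := by
    intro y w hw hw0
    calc (b0.factorial : ℝ) * (1 + w) ^ b0 ≤ (b0 : ℝ) ^ b0 * (1 + w) ^ b0 := by
          gcongr; exact_mod_cast Nat.factorial_le_pow b0
      _ ≤ (Real.exp s) ^ b0 * (Real.exp y) ^ b0 := by gcongr
      _ = _ := by rw [← Real.exp_nat_mul, ← Real.exp_nat_mul, ← Real.exp_add]; ring_nf
  have hone : ∀ y : ℝ, 0 ≤ y → 1 + 2 * Real.exp y ≤ Real.exp (s + y) := fun y hy => by
    have h1 : 1 ≤ Real.exp y := Real.one_le_exp hy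
    rw [Real.exp_add]; nlinarith only [hnum 3 (by norm_num), h1]
  have hb05 : (b0 : ℝ) * s ^ 5 * 100 ≤ p := by
    calc (b0 : ℝ) * s ^ 5 * 100 ≤ s ^ (36 * d + 11) * s ^ 5 * s := by gcongr
      _ = s ^ (36 * d + 17) := by rw [← pow_add, ← pow_succ]
      _ ≤ p := hpr ▸ hrpw (by omega)
  have hb0p : (b0 : ℝ) * 100 ≤ p := by
    refine le_trans ?_ hb05
    have : (1:ℝ) ≤ s ^ 5 := one_le_pow₀ hs1
    have hb : (0:ℝ) ≤ b0 := Nat.cast_nonneg _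
    nlinarith only [this, hb]
  have hbp : (b0 : ℝ) * p ^ 5 * 100 ≤ p ^ 6 := by
    calc (b0 : ℝ) * p ^ 5 * 100 = (b0 * 100) * p ^ 5 := by ring
      _ ≤ p * p ^ 5 := by gcongr
      _ = _ := by ring
  have hpp6 : p ≤ p ^ 6 := le_self_pow₀ hp1 (by norm_num)
  have hp6t : 100 * p ^ 6 ≤ t := by
    calc 100 * p ^ 6 ≤ p * p ^ 6 := by gcongr; linarith
      _ = p ^ 7 := by ring
      _ ≤ p ^ 100 := pow_le_pow_right₀ hp1 (by norm_num)
      _ ≤ t := hpt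
  have hKn : ∀ m, K * t0 ^ m = t0 ^ (27 * d + 11 + m) := fun m => by rw [hK, ← pow_add]
  have hn8 : t0 ^ 8 ≤ t0 ^ 100 := hpw (by norm_num)
  have htn : ∀ m, m ≤ A * A → t0 ^ m ≤ t := fun m hm => htA ▸ hpw hm
  have ht1n : 1 ≤ t := by exact_mod_cast ht1'
  have ht23 : t ≤ t ^ 2 := Nat.le_self_pow (by norm_num) t
  have ht2 : t ^ 2 ≤ t ^ 3 := Nat.pow_le_pow_right ht1n (by norm_num)
  refine ⟨⟨h1, ?_, ?_, ?_, ?_, ?_⟩, ?_, ?_, ?_, ?_, ?_, ?_, ?_, ?_, ?_, ?_, ?_, ?_, ?_⟩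
  all_goals try simp only [← hs, ← hp, ← hV, ← hb0]
  · calc 4 * t0 ≤ t0 * t0 := by gcongr; omega
      _ = t0 ^ 2 := by ring
      _ ≤ t := htn _ (by omega)
  · have h8 : 2 * (2 * s ^ 8 + 1) + 1 ≤ 2 * (t:ℝ) ^ 8 + 1 := by
      have : (t:ℝ) ≤ t ^ 8 := le_self_pow₀ ht1' (by norm_num)
      linarith
    have : s ^ 5 + 2 - (1 / (2 * s)) * (s ^ 8 + 1) ≤ s ^ 5 + 2 - s ^ 7 / 2 := by
      have : s ^ 7 / 2 = (1 / (2 * s)) * s ^ 8 := by field_simp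
      rw [this]
      have : 0 ≤ 1 / (2 * s) := by positivity
      nlinarith only [this]
    push_cast
    rw [← hs]
    refine le_trans ?_ (hhalf (s ^ 5 + 2 - s ^ 7 / 2) (by linarith))
    rw [hV]
    gcongr
  · have h8 : 2 * (2 * (t:ℝ) ^ 3 + 1) + 1 ≤ 2 * (t:ℝ) ^ 8 + 1 := by
      have a1 : (t:ℝ) ^ 4 ≤ t ^ 8 := pow_le_pow_right₀ ht1' (by norm_num)
      have a2 : 3 * (t:ℝ) ^ 3 ≤ t * t ^ 3 := by gcongr
      have a3 : (t:ℝ) ^ 4 = t * t ^ 3 := by ring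
      have a4 : (1:ℝ) ≤ t ^ 3 := one_le_pow₀ ht1'
      linarith
    push_cast
    refine le_trans ?_ (hhalf (3 * t ^ 2 + 2 - 4 * t ^ 2) ?_)
    · rw [hV]; gcongr
    · have : (t:ℝ) ≤ t * t := le_mul_of_one_le_left (by linarith) ht1'
      have h5 : s ^ 1 ≤ s ^ 100 := hrpw (by norm_num)
      have : s * 3 ≤ t := by
        have := hsm (m := 1) (n := 99) (by norm_num) 3 (by norm_num)
        linarith
      have : (t:ℝ) ^ 2 = t * t := by ring
      linarith
  · have hKt : K * (100 * t0 * t0) ≤ t := by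
      calc K * (100 * t0 * t0) ≤ K * (t0 * t0 * t0) := by gcongr
        _ = K * t0 ^ 3 := by ring
        _ = t0 ^ (27 * d + 11 + 3) := hKn 3
        _ ≤ t := htn _ (by omega)
    have hK1 : 1 ≤ K := hK ▸ Nat.one_le_pow _ _ h1
    have h8t : t0 ^ 8 ≤ t := htn _ (by omega)
    calc (K + 1) * (2 * (16 * t0 * t ^ 2 + t0 ^ 8) + 2) ≤
          (K + K) * (2 * (16 * t0 * t ^ 2 + t0 * t ^ 2) + t0 * t ^ 2) := by
            gcongr
            · calc t0 ^ 8 ≤ t := h8t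
                _ ≤ t ^ 2 := ht23
                _ ≤ t0 * t ^ 2 := Nat.le_mul_of_pos_left _ h1
            · calc 2 ≤ t0 * 1 := by omega
                _ ≤ t0 * t ^ 2 := by gcongr; omega
      _ = (K * (70 * t0)) * t ^ 2 := by ring
      _ ≤ t * t ^ 2 := by
          gcongr
          refine le_trans ?_ hKt
          refine Nat.mul_le_mul_left _ ?_
          calc 70 * t0 ≤ 100 * t0 := by omega
            _ ≤ 100 * t0 * t0 := Nat.le_mul_of_pos_right _ h1
      _ = t ^ 3 := by ring
  · have hKt : K * t0 ≤ t := by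
      have := hKn 1
      rw [pow_one] at this
      exact this ▸ htn _ (by omega)
    have h8t : t0 ^ 8 ≤ t := htn _ (by omega)
    calc K * (2 * t0 ^ 8 + 2 * t ^ 3 + 2) ≤ K * (t0 * t ^ 3) := by
          refine Nat.mul_le_mul_left _ ?_
          have : 100 * t ^ 3 ≤ t0 * t ^ 3 := by gcongr
          omega
      _ = (K * t0) * t ^ 3 := by ring
      _ ≤ t * t ^ 3 := by gcongr
      _ = _ := by ring
  · have : t0 ^ 1 ≤ t := htn _ (by omega)
    rw [pow_one] at this
    omega
  · have := hp ▸ hp1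
    exact_mod_cast this
  · have h8t : t0 ^ 8 ≤ t := htn _ (by omega)
    have : t0 ^ 1 ≤ t := htn _ (by omega)
    rw [pow_one] at this
    calc 2 * t0 ^ 8 ≤ t * t := by gcongr; omega
      _ = t ^ 2 := by ring
      _ ≤ _ := ht2
  · have : 2 * p ^ 8 ≤ t ^ 3 := by
      calc 2 * p ^ 8 ≤ p * p ^ 8 := by gcongr; linarith
        _ = p ^ 9 := by ring
        _ ≤ p ^ 100 := pow_le_pow_right₀ hp1 (by norm_num)
        _ ≤ t := hpt
        _ ≤ _ := le_self_pow₀ ht1' (by norm_num)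
    rw [hp] at this
    exact_mod_cast this
  · exact hhalf _ (by linarith)
  · refine hhalf _ ?_
    have : p ≤ p ^ 5 := hsp5
    linarith
  · exact hρ
  · calc C * (2 * Real.exp (-s ^ 6)) * (V * (8 * (V * Real.exp (s ^ 5)) ^ 2)) ≤
          Real.exp s * (2 * Real.exp (-s ^ 6)) * (Real.exp s * Real.exp (3 * s + 2 * s ^ 5)) := by
            gcongr
            exact hP _
      _ = 2 * Real.exp (5 * s + 2 * s ^ 5 - s ^ 6) := by
          have : 5 * s + 2 * s ^ 5 - s ^ 6 = s + -s ^ 6 + (s + (3 * s + 2 * s ^ 5)) := by ring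
          rw [this, Real.exp_add (s + -s ^ 6), Real.exp_add s (-s ^ 6), Real.exp_add s (3 * s + 2 * s ^ 5)]; ring
      _ ≤ Real.exp s * Real.exp (5 * s + 2 * s ^ 5 - s ^ 6) := by
          gcongr; exact hnum 2 (by norm_num)
      _ ≤ Real.exp (-1) := by rw [← Real.exp_add, Real.exp_le_exp]; linarith
      _ ≤ _ := hexp1
  · rw [lt_div_iff₀ (by norm_num)]
    calc V * (2 * Real.exp (-p)) * 9 = 18 * V * Real.exp (-p) := by ring
      _ ≤ Real.exp s * Real.exp s * Real.exp (-p) := by gcongr; exact hnum 18 (by norm_num)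
      _ < _ := by
          rw [← Real.exp_add, ← Real.exp_add, Real.exp_lt_exp]
          linarith [hrpw (show 7 ≤ 100 by norm_num)]
  · refine (hfac (4 * s + 2 * s ^ 5) _ ?_ (by positivity)).trans (Real.exp_le_exp.2 ?_)
    · refine le_trans ?_ (le_of_le_of_eq (hone (3 * s + 2 * s ^ 5) (by positivity)) (by ring_nf))
      gcongr
      exact hP _
    · have hb : (0:ℝ) ≤ b0 := Nat.cast_nonneg _
      calc (b0:ℝ) * (s + (4 * s + 2 * s ^ 5)) ≤ b0 * (s ^ 5 * 100) := by
            gcongr; linarith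
        _ = b0 * s ^ 5 * 100 := by ring
        _ ≤ p ^ 6 := hb05.trans hpp6
  · refine (hfac (4 * s + 2 * p ^ 5) _ ?_ (by positivity)).trans (Real.exp_le_exp.2 ?_)
    · refine le_trans ?_ (le_of_le_of_eq (hone (3 * s + 2 * p ^ 5) (by positivity)) (by ring_nf))
      have := hP (p ^ 5)
      have : 0 ≤ Real.exp (3 * s + 2 * p ^ 5) := by positivity
      linarith
    · have hb : (0:ℝ) ≤ b0 := Nat.cast_nonneg _
      calc (b0:ℝ) * (s + (4 * s + 2 * p ^ 5)) ≤ b0 * (p ^ 5 * 100) := by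
            gcongr; linarith
        _ = b0 * p ^ 5 * 100 := by ring
        _ ≤ p ^ 6 := hbp
  · have hb2 : ((b0 : ℕ) : ℝ) ^ 2 ≤ Real.exp (2 * s) := by
      calc ((b0 : ℕ) : ℝ) ^ 2 ≤ (Real.exp s) ^ 2 := by gcongr
        _ = _ := by rw [← Real.exp_nat_mul]; push_cast; ring_nf
    have h2P : 2 * (8 * (V * Real.exp (s ^ 5)) ^ 2) ≤ Real.exp (4 * s + 2 * s ^ 5) := by
      calc _ ≤ Real.exp s * Real.exp (3 * s + 2 * s ^ 5) := by
            gcongr; exacts [hnum 2 (by norm_num), hP _]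
        _ = _ := by rw [← Real.exp_add]; ring_nf
    have hp60 : 0 ≤ p ^ 6 := by positivity
    have hmain : 12 * s + 4 * s ^ 5 + p ^ 6 + 16 * t * p ^ 6 ≤ t ^ 2 := by
      have a1 : (t:ℝ) * (100 * p ^ 6) ≤ t * t := by gcongr
      have a2 : p ^ 6 ≤ t * p ^ 6 := le_mul_of_one_le_left hp60 ht1'
      have a3 : s ^ 5 ≤ s ^ 100 := hrpw (by norm_num)
      have a4 := e5 12 (by norm_num)
      have a5 : (t:ℝ) * 1 ≤ t * p ^ 6 := by gcongr; exact one_le_pow₀ hp1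
      linarith
    calc _ ≤ Real.exp (4 * s + 2 * s ^ 5) + Real.exp (2 * s) * (Real.exp (4 * s + 2 * s ^ 5) *
            (Real.exp (p ^ 6) * Real.exp (16 * t * p ^ 6)) * Real.exp (4 * s + 2 * s ^ 5)) := by
          gcongr
      _ = Real.exp (4 * s + 2 * s ^ 5) + Real.exp (10 * s + 4 * s ^ 5 + p ^ 6 + 16 * t * p ^ 6) := by
          rw [← Real.exp_add, ← Real.exp_add, ← Real.exp_add, ← Real.exp_add]; ring_nf
      _ ≤ 2 * Real.exp (10 * s + 4 * s ^ 5 + p ^ 6 + 16 * t * p ^ 6) := by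
          have : Real.exp (4 * s + 2 * s ^ 5) ≤
              Real.exp (10 * s + 4 * s ^ 5 + p ^ 6 + 16 * t * p ^ 6) := by
            rw [Real.exp_le_exp]
            have : 0 ≤ (t:ℝ) * p ^ 6 := by positivity
            linarith
          linarith
      _ ≤ Real.exp s * Real.exp (10 * s + 4 * s ^ 5 + p ^ 6 + 16 * t * p ^ 6) := by
          gcongr; exact hnum 2 (by norm_num)
      _ ≤ _ := by
          rw [← Real.exp_add, Real.exp_le_exp]
          linarith
  · have ht3s : (t:ℝ) ^ 3 ≤ Real.exp s := (pow_le_pow_right₀ ht1' (by omega)).trans hE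
    calc (1 + V * ((t:ℝ) ^ 3 + 1)) * (100 * Real.exp (-((16 * t - 5) / 8))) ≤
          Real.exp (s + (s + (s + s))) * (Real.exp s * Real.exp (-((16 * t - 5) / 8))) := by
          gcongr
          · calc 1 + V * ((t:ℝ) ^ 3 + 1) ≤ 1 + Real.exp s * (Real.exp s + Real.exp s) := by
                  gcongr; exact Real.one_le_exp (by linarith)
              _ ≤ 1 + 2 * Real.exp (s + (s + s)) := by
                  rw [Real.exp_add s (s + s), Real.exp_add s s]
                  have : 1 ≤ Real.exp s := Real.one_le_exp (by linarith)
                  nlinarith only [this]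
              _ ≤ _ := hone _ (by linarith)
          · exact hnum 100 (by norm_num)
      _ < _ := by
          rw [← Real.exp_add, ← Real.exp_add, Real.exp_lt_exp]
          linarith

/-- All the largeness requirements on a scale. -/
structure AtScale (d : ℕ) {f : ℝ → ℝ} (X : Ext f) (M : ℝ) (A t : ℕ) : Prop where
  large : 100 ≤ t
  hC : X.C ≤ Real.exp t
  hρ : 2 * Real.exp (-t ^ 6) ≤ X.ρ
  hE : (t : ℝ) ^ (A ^ 6) ≤ Real.exp t
  happrox : ∃ T : ℝ → ℝ, (fun s => (T s : ℂ)) ∈ TrigPoly (t ^ 10) ∧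
    ∀ x, |f x - T x| ≤ Real.exp (-t ^ 9)
  hnum : (2 * (t : ℝ) ^ 8 + 1) ^ d * (2 * (100 * Real.exp (-((t ^ 2 / M - 5) / 8)))) < Real.exp (-t)

lemma eventually_atScale (d : ℕ) {f : ℝ → ℝ} (X : Ext f) (hfc : Continuous f)
    (hfper : ∀ x, f (x + 1) = f x) (hper : ∀ z, X.F (z + 1) = X.F z) {M : ℝ} (hM : 1 ≤ M) (A : ℕ) :
    ∀ᶠ t : ℕ in atTop, AtScale d X M A t := by
  have hcast := tendsto_natCast_atTop_atTop (R := ℝ)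
  obtain ⟨C', hC', a, ha, happ⟩ := exists_trig_approx f X.F X.ρ X.C X.hρ hfc hfper X.diff X.real
    hper X.bdd
  have hpoly : ∀ n : ℕ, ∀ᶠ s : ℝ in atTop, s ^ n ≤ Real.exp s := fun n => by
    have h1 := (Real.isLittleO_pow_exp_atTop (n := n)).bound one_pos
    filter_upwards [h1] with s hs
    simpa using (le_abs_self _).trans hs
  have h2 : ∀ᶠ s : ℝ in atTop, 2 * Real.exp (-s ^ 6) ≤ X.ρ := by
    have : Tendsto (fun s : ℝ => 2 * Real.exp (-s ^ 6)) atTop (nhds (2 * 0)) :=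
      (Real.tendsto_exp_neg_atTop_nhds_zero.comp (tendsto_pow_atTop (by norm_num))).const_mul 2
    rw [mul_zero] at this
    exact this.eventually_le_const X.hρ
  filter_upwards [eventually_ge_atTop 100, hcast.eventually (eventually_ge_atTop X.C),
    hcast.eventually h2, hcast.eventually (hpoly (A ^ 6)), hcast.eventually (hpoly (9 * d)),
    hcast.eventually (eventually_ge_atTop (Real.log C')),
    hcast.eventually (eventually_ge_atTop (2 / a)),
    hcast.eventually (eventually_ge_atTop (100 * M))] with t h100 hC hρ hE hd hC'' haa hMM
  have ht : (100:ℝ) ≤ t := by exact_mod_cast h100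
  refine ⟨h100, hC.trans (by linarith [Real.add_one_le_exp (t:ℝ)]), hρ, hE, ?_, ?_⟩
  · obtain ⟨T, hT, hfT⟩ := happ (t ^ 10)
    refine ⟨T, hT, fun x => (hfT x).trans ?_⟩
    rw [← Real.exp_log hC', ← Real.exp_add, Real.exp_le_exp]
    have h3 : 2 ≤ a * t := by rwa [div_le_iff₀' ha] at haa
    have h4 : (t:ℝ) ≤ t ^ 9 := le_self_pow₀ (by linarith) (by norm_num)
    have h5 : 2 * (t:ℝ) ^ 9 ≤ a * t * t ^ 9 := by gcongr
    push_cast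
    have h6 : a * (t:ℝ) ^ 10 = a * t * t ^ 9 := by ring
    rw [h6]; linarith
  · have h9 : (2 * (t : ℝ) ^ 8 + 1) ^ d ≤ Real.exp t := by
      refine le_trans ?_ hd
      rw [pow_mul]
      gcongr
      have : (1:ℝ) ≤ t ^ 8 := one_le_pow₀ (by linarith)
      have : 100 * (t:ℝ) ^ 8 ≤ t * t ^ 8 := by gcongr
      have e : (t:ℝ) ^ 9 = t * t ^ 8 := by ring
      rw [e]; linarith
    have h200 : (200:ℝ) ≤ Real.exp t := by nlinarith [Real.quadratic_le_exp_of_nonneg (show (0:ℝ) ≤ t by linarith)]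
    calc _ ≤ Real.exp t * (Real.exp t * Real.exp (-((t ^ 2 / M - 5) / 8))) := by
          have h0 := Real.exp_nonneg (-(((t:ℝ) ^ 2 / M - 5) / 8))
          refine mul_le_mul h9 ?_ (by positivity) (Real.exp_nonneg _)
          nlinarith only [h0, h200]
      _ < _ := by
          rw [← Real.exp_add, ← Real.exp_add, Real.exp_lt_exp]
          have : 100 * (t:ℝ) ≤ t ^ 2 / M := by
            rw [le_div_iff₀ (by linarith)]; nlinarith
          linarith

section scales

variable {f : ℝ → ℝ} {X : Ext f} {M : ℝ} {A : ℕ}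

lemma AtScale.box_le {t : ℕ} (h : AtScale d X M A t) (hA : 100 * (d + 1) ≤ A) :
    (2 * (t : ℝ) ^ 8 + 1) ^ d ≤ Real.exp t := by
  have ht : (100:ℝ) ≤ t := by exact_mod_cast h.large
  refine le_trans ?_ h.hE
  calc (2 * (t : ℝ) ^ 8 + 1) ^ d ≤ ((t:ℝ) ^ 9) ^ d := by
        gcongr
        have : (1:ℝ) ≤ t ^ 8 := one_le_pow₀ (by linarith)
        have : 100 * (t:ℝ) ^ 8 ≤ t * t ^ 8 := by gcongr
        have e : (t:ℝ) ^ 9 = t * t ^ 8 := by ring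
        rw [e]; linarith
    _ = (t:ℝ) ^ (9 * d) := by rw [pow_mul]
    _ ≤ _ := pow_le_pow_right₀ (by linarith) (by
        have : A ≤ A ^ 6 := Nat.le_self_pow (by norm_num) A
        omega)

lemma AtScale.ldtc {t : ℕ} (h : AtScale d X M A t) (hA : 100 * (d + 1) ≤ A) {δ : ℝ} (hδ : 0 ≤ δ)
    {ω : Fin d → ℝ} (hm : LDTm δ f ω t) : LDTc δ f ω t (t ^ (27 * d + 11)) := by
  obtain ⟨T, hT, hfT⟩ := h.happrox
  have h100 := h.large
  have ht : (100:ℝ) ≤ t := by exact_mod_cast h.large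
  have hV := h.box_le hA
  obtain ⟨V, hVV⟩ : ∃ V : ℝ, V = (2 * (t : ℝ) ^ 8 + 1) ^ d := ⟨_, rfl⟩
  rw [← hVV] at hV
  have hV0 : 0 ≤ V := hVV ▸ by positivity
  have hst : ∀ n : ℕ, 100 * (t:ℝ) ^ n ≤ t ^ (n + 1) := fun n => by
    rw [pow_succ']; gcongr
  have h01 := hst 0
  have h12 := hst 1
  have h23 := hst 2
  have h34 := hst 3
  have h45 := hst 4
  have h56 := hst 5
  have h67 := hst 6
  have h78 := hst 7
  have h89 := hst 8
  norm_num at h01 h12 h23 h34 h45 h56 h67 h78 h89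
  have hexp1 : Real.exp (-1) ≤ 1 / 2 := by
    rw [Real.exp_neg, one_div]
    exact inv_anti₀ two_pos (by linarith [Real.add_one_le_exp 1])
  refine ldtc_of_ldtm hδ (by omega) hT hfT hm ?_ ?_ ?_
  · have h1 : 1 ≤ t ^ 8 := Nat.one_le_pow _ _ (by omega)
    have h9 : 2 * t ^ 8 + 1 ≤ t ^ 9 := by
      calc 2 * t ^ 8 + 1 ≤ 100 * t ^ 8 := by omega
        _ ≤ t * t ^ 8 := by gcongr
        _ = _ := by ring
    have h9d : 1 ≤ t ^ (9 * d + 10) := Nat.one_le_pow _ _ (by omega)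
    calc ((2 * t ^ 8 + 1) ^ d) ^ 2 * (4 * ((2 * t ^ 8 + 1) ^ d * t ^ 10) + 1) ≤
          ((t ^ 9) ^ d) ^ 2 * (4 * ((t ^ 9) ^ d * t ^ 10) + 1) := by gcongr
      _ = t ^ (18 * d) * (4 * t ^ (9 * d + 10) + 1) := by
          ring
      _ ≤ t ^ (18 * d) * (t * t ^ (9 * d + 10)) := by
          refine Nat.mul_le_mul_left _ ?_
          have : 100 * t ^ (9 * d + 10) ≤ t * t ^ (9 * d + 10) := by gcongr
          omega
      _ = _ := by rw [← pow_succ', ← pow_add]; congr 1; ring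
  · rw [← hVV]
    calc _ ≤ Real.exp (-t ^ 9) * (Real.exp t * Real.exp (t ^ 5)) := by gcongr
      _ = Real.exp (-t ^ 9 + (t + t ^ 5)) := by rw [← Real.exp_add, ← Real.exp_add]
      _ ≤ Real.exp (-1) := Real.exp_le_exp.2 (by linarith)
      _ ≤ _ := hexp1
  · rw [← hVV]
    have h4 : (4:ℝ) ≤ Real.exp t := by linarith [Real.add_one_le_exp (t:ℝ)]
    have : 4 * V * Real.exp (t ^ 5) ^ 2 * Real.exp (-t ^ 9) < Real.exp (t ^ 5 - 1 - 4 * t ^ 8) := by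
      calc _ ≤ Real.exp t * Real.exp t * Real.exp (t ^ 5) ^ 2 * Real.exp (-t ^ 9) := by gcongr
        _ = Real.exp (2 * t + 2 * t ^ 5 - t ^ 9) := by
            rw [← Real.exp_nat_mul, ← Real.exp_add, ← Real.exp_add, ← Real.exp_add]
            push_cast; ring_nf
        _ < _ := Real.exp_lt_exp.2 (by linarith)
    linarith

/-- The `k`-th scale. -/
def sca (A T k : ℕ) : ℕ := T ^ (A ^ k)

lemma sca_succ (A T k : ℕ) : sca A T (k + 1) = sca A T k ^ A := by
  rw [sca, sca, ← pow_mul, pow_succ]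

lemma sca_zero (A T : ℕ) : sca A T 0 = T := by simp [sca]

lemma le_sca {A T : ℕ} (hA : 1 ≤ A) (k : ℕ) : T ≤ sca A T k :=
  Nat.le_self_pow (pow_ne_zero _ (by omega)) T

/-- Diophantine condition at scale `t`. -/
def SepAt (ω : Fin d → ℝ) (t : ℕ) (c : ℝ) : Prop := Sep ω (t ^ 9) (c / t ^ (9 * (d + 2)))

lemma AtScale.pow_le {t : ℕ} (h : AtScale d X M A t) {n : ℕ} (hn : n ≤ A ^ 6) :
    (t : ℝ) ^ n ≤ Real.exp t := by
  have ht : (100:ℝ) ≤ t := by exact_mod_cast h.large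
  exact (pow_le_pow_right₀ (by linarith) hn).trans h.hE

lemma AtScale.stepScales {t0 t1 t : ℕ} (h : AtScale d X M A t0) (hA : 100 * (d + 1) ≤ A)
    (ht1 : t1 = t0 ^ A) (ht : t = t1 ^ A) :
    StepScales d X.ρ X.C t0 t1 t (t0 ^ (27 * d + 11)) := by
  refine stepScales_of hA h.large ht1 ht h.hC h.hρ ?_
  have : (t : ℝ) ^ (10 * (d + 2)) = t0 ^ (A * A * (10 * (d + 2))) := by
    rw [ht, ht1]; push_cast; rw [← pow_mul, ← pow_mul, mul_assoc]
  rw [this]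
  refine h.pow_le ?_
  calc A * A * (10 * (d + 2)) ≤ A * A * A ^ 4 := by
        refine Nat.mul_le_mul_left _ ?_
        have : A ≤ A ^ 4 := Nat.le_self_pow (by norm_num) A
        omega
    _ = A ^ 6 := by ring

lemma AtScale.sep {t0 t : ℕ} (h : AtScale d X M A t0) (hA : 100 * (d + 1) ≤ A)
    {m : ℕ} (hm : m ≤ 4) (ht : t = t0 ^ (A ^ m)) {ω : Fin d → ℝ} {c : ℝ} (hc : 1 ≤ c)
    (hs : SepAt ω t c) : Sep ω (t ^ 9) (Real.exp (-t0)) := by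
  have ht0 : (100:ℝ) ≤ t0 := by exact_mod_cast h.large
  have htp : (0:ℝ) < t := by rw [ht]; push_cast; positivity
  refine Sep.mono hs le_rfl ?_
  rw [Real.exp_neg, ← one_div]
  refine (one_div_le_one_div_of_le (b := Real.exp t0) (a := (t:ℝ) ^ (9 * (d + 2))) (by positivity)
    ?_).trans (by gcongr)
  rw [ht]
  push_cast
  rw [← pow_mul]
  refine h.pow_le ?_
  calc A ^ m * (9 * (d + 2)) ≤ A ^ 4 * A ^ 2 := by
        have h1 : 1 ≤ A := by omega
        have : A ≤ A ^ 2 := Nat.le_self_pow (by norm_num) A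
        have h2 : A ^ m ≤ A ^ 4 := Nat.pow_le_pow_right h1 hm
        have h3 : 9 * (d + 2) ≤ A ^ 2 := by omega
        gcongr
    _ = A ^ 6 := by ring

lemma mul_three_pow_le_one {t : ℕ} {δ : ℝ}
    (hδt : δ * 3 ^ d * Real.exp 2 ≤ Real.exp (-(t ^ 2)) / 2) (hδ : 0 ≤ δ) : δ * 3 ^ d ≤ 1 := by
  have h1 : Real.exp (-((t:ℝ) ^ 2)) ≤ 1 := Real.exp_le_one_iff.2 (by nlinarith)
  have h2 : 1 ≤ Real.exp 2 := Real.one_le_exp (by norm_num)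
  have h3 : 0 ≤ δ * 3 ^ d := by positivity
  nlinarith

/-- The large deviation estimates on all scales. -/
lemma ldt_all (hf : ∀ x, f (x + 1) = f x) (hM : 1 ≤ M) (hA : 100 * (d + 1) ≤ A)
    (hsub : ∀ E S : ℝ, 0 ≤ S →
      volume {x : ℝ | x ∈ Set.Icc (0:ℝ) 1 ∧ |f x - E| < Real.exp (-(S * M))} ≤
        ENNReal.ofReal (100 * Real.exp (-((S - 5) / 8)))) {T : ℕ}
    (hT : ∀ t, T ≤ t → AtScale d X M A t) {δ : ℝ} (hδ : 0 ≤ δ)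
    (hδT : δ * 3 ^ d * Real.exp 2 ≤ Real.exp (-((sca A T 1 : ℕ) ^ 2)) / 2)
    {ω : Fin d → ℝ} {k : ℕ} (hsep : ∀ i ≤ k, SepAt ω (sca A T i) 1) :
    ∀ i ≤ k, LDTm δ f ω (sca A T i) ∧ LDTc δ f ω (sca A T i) (sca A T i ^ (27 * d + 11)) := by
  have hA1 : 1 ≤ A := by omega
  have hat : ∀ i, AtScale d X M A (sca A T i) := fun i => hT _ (le_sca hA1 i)
  have hδ1 := mul_three_pow_le_one hδT hδ
  have hbase : ∀ i ≤ 1, LDTm δ f ω (sca A T i) := by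
    intro i hi
    refine ldtm_base hf hM hsub (by have := (hat i).large; omega) hδ (hδT.trans ?_) (hat i).hnum ω
    have : sca A T i ≤ sca A T 1 := Nat.pow_le_pow_right (by
      have := (hat 0).large; rw [sca_zero] at this; omega) (Nat.pow_le_pow_right hA1 hi)
    gcongr
  suffices h : ∀ i ≤ k, LDTm δ f ω (sca A T i) from
    fun i hi => ⟨h i hi, (hat i).ldtc hA hδ (h i hi)⟩
  intro i
  induction i using Nat.strong_induction_on with
  | _ i ih =>
    intro hi
    match i, ih, hi with
    | 0, _, _ => exact hbase 0 (by norm_num)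
    | 1, _, _ => exact hbase 1 le_rfl
    | i + 2, ih, hi =>
      refine ldtm_step hf X hδ hδ1 ((hat i).stepScales hA (sca_succ A T i) (sca_succ A T (i + 1)))
        ((hat i).ldtc hA hδ (ih i (by omega) (by omega))) (ih (i + 1) (by omega) (by omega)) ?_
      refine (hat i).sep hA (m := 2) (by norm_num) ?_ le_rfl (hsep _ hi)
      rw [sca, sca, ← pow_mul, ← pow_add]

end scales

section steep

/-- Heights at which a thin set is met by many cells are controlled by the number of zeros. -/
lemma crossing_count {g : ℝ → ℝ → ℝ} (hg : Continuous fun p : ℝ × ℝ => g p.1 p.2) {u h ℓ τ : ℝ}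
    {M m : ℕ} (hu0 : 0 ≤ u) (hh : 0 < h) (hu1 : u + M * h ≤ 1) (hτ : 0 ≤ τ)
    (hz : ∀ y, (∃ s, g s y ≠ 0) → ∀ Z : Finset ℝ,
      (∀ s ∈ Z, s ∈ Set.Ico (0:ℝ) 1 ∧ g s y = 0) → Z.card ≤ m)
    (hthin : ∀ s ∈ Set.Icc u (u + M * h),
      volume {y : ℝ | y ∈ Set.Icc (0:ℝ) 1 ∧ 0 ≤ g s y} ≤ ENNReal.ofReal τ)
    (F : Finset ℕ) (hF : ∀ j ∈ F, j < M ∧ ∃ a, 0 ≤ a ∧ a + ℓ ≤ 1 ∧ ∀ y ∈ Set.Icc a (a + ℓ),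
      ∃ s ∈ Set.Ico (u + j * h) (u + (j + 1) * h), 0 ≤ g s y) :
    F.card * ℓ ≤ 2 * (m + 1) + M * (M * τ) := by
  classical
  set S : Set (ℝ × ℝ) := {p | p.1 ∈ Set.Icc u (u + M * h) ∧ p.2 ∈ Set.Icc (0:ℝ) 1 ∧ 0 ≤ g p.1 p.2}
    with hS
  have hSm : MeasurableSet S := by
    refine IsClosed.measurableSet ?_
    refine (isClosed_Icc.preimage continuous_fst).inter ((isClosed_Icc.preimage continuous_snd).inter ?_)
    exact isClosed_le continuous_const hg
  set sec : ℝ → ENNReal := fun y => volume ((fun s => (s, y)) ⁻¹' S) with hsec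
  have hsecm : Measurable sec := measurable_measure_prodMk_right hSm
  have hvolS : (volume.prod volume) S ≤ ENNReal.ofReal (M * h) * ENNReal.ofReal τ := by
    rw [Measure.prod_apply hSm]
    calc ∫⁻ s, volume (Prod.mk s ⁻¹' S) ≤
          ∫⁻ s, (Set.Icc u (u + M * h)).indicator (fun _ => ENNReal.ofReal τ) s := by
          refine lintegral_mono fun s => ?_
          by_cases hs : s ∈ Set.Icc u (u + M * h)
          · rw [Set.indicator_of_mem hs]
            refine (measure_mono ?_).trans (hthin s hs)
            rintro y ⟨-, h2⟩
            exact h2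
          · rw [Set.indicator_of_notMem hs]
            have : Prod.mk s ⁻¹' S = ∅ := by
              ext y
              simp only [Set.mem_empty_iff_false, iff_false]
              rintro ⟨h1, -⟩
              exact hs h1
            rw [this, measure_empty]
      _ = _ := by
          rw [lintegral_indicator measurableSet_Icc, setLIntegral_const, Real.volume_Icc, mul_comm]
          congr 2; ring
  set B : Set ℝ := {y | ENNReal.ofReal h ≤ sec y} with hB
  have hBm : MeasurableSet B := measurableSet_le measurable_const hsecm
  have hh0 : ENNReal.ofReal h ≠ 0 := by simpa using hh
  have hvolB : volume B ≤ ENNReal.ofReal (M * τ) := by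
    have h1 : ENNReal.ofReal h * volume B ≤ ENNReal.ofReal (M * h) * ENNReal.ofReal τ := by
      refine (mul_meas_ge_le_lintegral hsecm _).trans ?_
      rw [hsec, ← Measure.prod_apply_symm hSm]
      exact hvolS
    have h2 : ENNReal.ofReal (M * h) * ENNReal.ofReal τ = ENNReal.ofReal h * ENNReal.ofReal (M * τ) := by
      rw [← ENNReal.ofReal_mul (by positivity), ← ENNReal.ofReal_mul hh.le]; congr 1; ring
    rw [h2] at h1
    exact (ENNReal.mul_le_mul_iff_right hh0 ENNReal.ofReal_ne_top).1 h1
  have hF' : ∀ j ∈ F, j < M := fun j hj => (hF j hj).1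
  choose! a ha0 ha1 has using fun j hj => (hF j hj).2
  have hcount : ∀ y ∈ Set.Icc (0:ℝ) 1, y ∉ B →
      (F.filter fun j => y ∈ Set.Icc (a j) (a j + ℓ)).card ≤ 2 * (m + 1) := by
    intro y hy hyB
    set G := F.filter fun j => y ∈ Set.Icc (a j) (a j + ℓ) with hG
    have hGs : ∀ j ∈ G, ∃ s ∈ Set.Ico (u + j * h) (u + (j + 1) * h), 0 ≤ g s y := fun j hj =>
      has j (Finset.mem_filter.1 hj).1 y (Finset.mem_filter.1 hj).2
    choose! s hs1 hs2 using hGs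
    rcases G.eq_empty_or_nonempty with hemp | ⟨j0, hj0⟩
    · rw [hemp]; simp
    have hsU : ∀ j ∈ G, s j ∈ Set.Icc u (u + M * h) := by
      intro j hj
      have h1 := hs1 j hj
      have h2 : (j:ℝ) + 1 ≤ M := by exact_mod_cast hF' j (Finset.mem_filter.1 hj).1
      have h3 : (j + 1) * h ≤ M * h := by gcongr
      have h4 : 0 ≤ j * h := by positivity
      exact ⟨by linarith [h1.1], by linarith [h1.2]⟩
    have hyB' : sec y < ENNReal.ofReal h := not_le.1 hyB
    have hsecy : sec y = volume {s ∈ Set.Icc u (u + M * h) | 0 ≤ g s y} := by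
      simp only [hsec]
      congr 1
      ext s
      show (_ ∧ _ ∧ _) ↔ (_ ∧ _)
      tauto
    have hne : ∃ s, g s y ≠ 0 := by
      by_contra! hcon
      have : {s ∈ Set.Icc u (u + M * h) | 0 ≤ g s y} = Set.Icc u (u + M * h) := by
        ext s
        show _ ∧ _ ↔ _
        rw [hcon s]; simp
      rw [hsecy, this, Real.volume_Icc] at hyB'
      refine absurd hyB' (not_lt.2 (ENNReal.ofReal_le_ofReal ?_))
      have h2 : (1:ℝ) ≤ M := by exact_mod_cast (Nat.zero_le _).trans_lt (hF' j0 (Finset.mem_filter.1 hj0).1)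
      nlinarith
    have hpar : ∀ r : ℕ, (G.filter fun j => j % 2 = r).card ≤ m + 1 := by
      intro r
      have hlt : ∀ j ∈ G.filter (fun j => j % 2 = r), ∀ j' ∈ G.filter (fun j => j % 2 = r), j < j' →
          h ≤ s j' - s j := by
        intro j hj j' hj' hjj
        rw [Finset.mem_filter] at hj hj'
        have h1 : (j:ℝ) + 2 ≤ j' := by exact_mod_cast (by omega : j + 2 ≤ j')
        have h2 := (hs1 j hj.1).2
        have h3 := (hs1 j' hj'.1).1
        have h4 : (j + 2) * h ≤ j' * h := by gcongr
        linarith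
      have hinj : Set.InjOn s (G.filter fun j => j % 2 = r) := by
        intro j hj j' hj' hjj
        by_contra hne
        rcases lt_or_gt_of_ne hne with h1 | h1
        · have := hlt j hj j' hj' h1; linarith
        · have := hlt j' hj' j hj h1; linarith
      rw [← Finset.card_image_of_injOn hinj]
      refine card_separated_le (fun s => g s y) (hg.comp (by fun_prop : Continuous fun s => (s, y))) m h
        hu0 hu1 (hz y hne) (hsecy ▸ hyB') _ ?_ ?_
      · intro x hx
        obtain ⟨j, hj, rfl⟩ := Finset.mem_image.1 hx
        rw [Finset.mem_filter] at hj
        exact ⟨hsU j hj.1, hs2 j hj.1⟩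
      · intro x hx x' hx' hxx
        obtain ⟨j, hj, rfl⟩ := Finset.mem_image.1 hx
        obtain ⟨j', hj', rfl⟩ := Finset.mem_image.1 hx'
        rcases lt_trichotomy j j' with h1 | h1 | h1
        · exact hlt j hj j' hj' h1
        · rw [h1] at hxx; exact absurd hxx (lt_irrefl _)
        · have := hlt j' hj' j hj h1; linarith
    have h0 := hpar 0
    have h1 := hpar 1
    have h2 : G = (G.filter fun j => j % 2 = 0) ∪ (G.filter fun j => j % 2 = 1) := by
      ext j
      simp only [Finset.mem_union, Finset.mem_filter]
      have : j % 2 = 0 ∨ j % 2 = 1 := by omega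
      tauto
    rw [h2]
    exact (Finset.card_union_le _ _).trans (by omega)
  have hFM : F.card ≤ M := by
    calc F.card ≤ (Finset.range M).card :=
          Finset.card_le_card fun j hj => Finset.mem_range.2 (hF' j hj)
      _ = M := Finset.card_range M
  have hmain : (F.card : ENNReal) * ENNReal.ofReal ℓ ≤
      (2 * (m + 1) : ℕ) + (M : ℕ) * ENNReal.ofReal (M * τ) := by
    calc (F.card : ENNReal) * ENNReal.ofReal ℓ
        = ∑ j ∈ F, ∫⁻ y, (Set.Icc (a j) (a j + ℓ)).indicator (fun _ => (1:ENNReal)) y := by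
          rw [← nsmul_eq_mul, ← Finset.sum_const]
          refine Finset.sum_congr rfl fun j _ => ?_
          rw [lintegral_indicator measurableSet_Icc, setLIntegral_const, one_mul, Real.volume_Icc,
            add_sub_cancel_left]
      _ = ∫⁻ y, ∑ j ∈ F, (Set.Icc (a j) (a j + ℓ)).indicator (fun _ => (1:ENNReal)) y := by
          rw [lintegral_finsetSum]
          exact fun j _ => measurable_const.indicator measurableSet_Icc
      _ ≤ ∫⁻ y, ((Set.Icc (0:ℝ) 1).indicator (fun _ => ((2 * (m + 1) : ℕ) : ENNReal)) y +
            B.indicator (fun _ => (M : ENNReal)) y) := by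
          refine lintegral_mono fun y => ?_
          have e : ∑ j ∈ F, (Set.Icc (a j) (a j + ℓ)).indicator (fun _ => (1:ENNReal)) y =
              ((F.filter fun j => y ∈ Set.Icc (a j) (a j + ℓ)).card : ENNReal) := by
            simp only [Set.indicator_apply]
            rw [Finset.sum_boole]
          beta_reduce
          rw [e]
          by_cases hyB : y ∈ B
          · rw [Set.indicator_of_mem hyB]
            refine le_trans ?_ le_add_self
            exact_mod_cast (Finset.card_filter_le _ _).trans hFM
          · by_cases hy : y ∈ Set.Icc (0:ℝ) 1
            · rw [Set.indicator_of_mem hy]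
              refine le_trans ?_ le_self_add
              exact_mod_cast hcount y hy hyB
            · have : F.filter (fun j => y ∈ Set.Icc (a j) (a j + ℓ)) = ∅ := by
                refine Finset.filter_eq_empty_iff.2 fun j hj hy' => hy ?_
                exact ⟨(ha0 j hj).trans hy'.1, hy'.2.trans (ha1 j hj)⟩
              rw [this]; simp
      _ ≤ _ := by
          rw [lintegral_add_left (measurable_const.indicator measurableSet_Icc),
            lintegral_indicator measurableSet_Icc, setLIntegral_const, lintegral_indicator hBm,
            setLIntegral_const, Real.volume_Icc]
          simp only [sub_zero, ENNReal.ofReal_one, mul_one]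
          gcongr
  have h3 : ENNReal.ofReal (F.card * ℓ) ≤ ENNReal.ofReal (2 * (m + 1) + M * (M * τ)) := by
    rw [ENNReal.ofReal_mul (by positivity), ENNReal.ofReal_add (by positivity) (by positivity),
      ENNReal.ofReal_mul (p := (M:ℝ)) (by positivity), ENNReal.ofReal_natCast, ENNReal.ofReal_natCast]
    convert hmain using 2
    rw [← ENNReal.ofReal_natCast]; push_cast; rfl
  rwa [ENNReal.ofReal_le_ofReal_iff (by positivity)] at h3

/-- A unit interval contains a good part of a short segment. -/
lemma exists_sub_segment (y0 : ℝ) {L ℓ : ℝ} (hL : 0 < L) (hL1 : L ≤ 1) (hℓ : ℓ ≤ L / 4) :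
    ∃ (k : ℤ) (a : ℝ), 0 ≤ a ∧ a + ℓ ≤ 1 ∧
      ∀ y ∈ Set.Icc a (a + ℓ), y0 < y + k ∧ y + k < y0 + L := by
  have h1 := Int.floor_le y0
  have h2 := Int.lt_floor_add_one y0
  by_cases h : (⌊y0⌋ : ℝ) + 1 ≤ y0 + L / 2
  · refine ⟨⌊y0⌋ + 1, y0 + L / 2 - (⌊y0⌋ + 1), by linarith, by linarith, fun y hy => ?_⟩
    push_cast
    constructor <;> linarith [hy.1, hy.2]
  · refine ⟨⌊y0⌋, y0 + L / 8 - ⌊y0⌋, by linarith, by linarith, fun y hy => ?_⟩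
    constructor <;> linarith [hy.1, hy.2]

/-- A thin set, all of whose horizontal sections are simple, is met by steep lines over a small
set. -/
lemma steep_lines {g : ℝ → ℝ → ℝ} (hg : Continuous fun p : ℝ × ℝ => g p.1 p.2)
    (hper : ∀ s y, ∀ k : ℤ, g s (y + k) = g s y) {u h τ N : ℝ}
    {M m m' : ℕ} (hu0 : 0 ≤ u) (hh : 0 < h) (hu1 : u + M * h ≤ 1) (hτ : 0 ≤ τ) (hN : 0 < N)
    (hz : ∀ y, (∃ s, g s y ≠ 0) → ∀ Z : Finset ℝ,
      (∀ s ∈ Z, s ∈ Set.Ico (0:ℝ) 1 ∧ g s y = 0) → Z.card ≤ m)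
    (hthin : ∀ s ∈ Set.Icc u (u + M * h),
      volume {y : ℝ | y ∈ Set.Icc (0:ℝ) 1 ∧ 0 ≤ g s y} ≤ ENNReal.ofReal τ)
    {κ : Type*} (𝒩 : Finset κ) (c a : κ → ℝ) (haN : ∀ ν ∈ 𝒩, N ≤ |a ν|) (hah : ∀ ν ∈ 𝒩, |a ν| * h ≤ 1)
    (hz' : ∀ ν ∈ 𝒩, (∃ s, g s (c ν + a ν * s) ≠ 0) → ∀ Z : Finset ℝ,
      (∀ s ∈ Z, s ∈ Set.Ico (0:ℝ) 1 ∧ g s (c ν + a ν * s) = 0) → Z.card ≤ m') :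
    volume {s : ℝ | s ∈ Set.Ico u (u + M * h) ∧ ∃ ν ∈ 𝒩, 0 ≤ g s (c ν + a ν * s)} ≤
      ENNReal.ofReal (4 / N * (2 * (m + 1) + M * (M * τ)) + 𝒩.card * m' * h) := by
  classical
  set cell : ℕ → Set ℝ := fun j => Set.Ico (u + j * h) (u + (j + 1) * h) with hcell
  have hqc : ∀ ν, Continuous fun s => g s (c ν + a ν * s) := fun ν =>
    hg.comp (by fun_prop : Continuous fun s => (s, c ν + a ν * s))
  have hdisj : ∀ j j' : ℕ, ∀ s, s ∈ cell j → s ∈ cell j' → j = j' := by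
    have key : ∀ j j' : ℕ, ∀ s, s ∈ cell j → s ∈ cell j' → ¬ j < j' := by
      intro j j' s h1 h2 h3
      have h4 : (j:ℝ) + 1 ≤ j' := by exact_mod_cast h3
      have h5 : (j + 1) * h ≤ j' * h := by gcongr
      linarith [h1.2, h2.1]
    intro j j' s h1 h2
    have := key j j' s h1 h2
    have := key j' j s h2 h1
    omega
  set F := (Finset.range M).filter fun j => ∃ ν ∈ 𝒩, ∀ s ∈ cell j, 0 ≤ g s (c ν + a ν * s) with hFdef
  set T : κ → Finset ℕ := fun ν => (Finset.range M).filter fun j =>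
    (∃ s ∈ cell j, 0 ≤ g s (c ν + a ν * s)) ∧ ∃ s ∈ cell j, g s (c ν + a ν * s) < 0 with hTdef
  have hcell01 : ∀ j < M, ∀ s ∈ cell j, s ∈ Set.Ico (0:ℝ) 1 := by
    intro j hj s hs
    have h4 : (j:ℝ) + 1 ≤ M := by exact_mod_cast hj
    have h5 : (j + 1) * h ≤ M * h := by gcongr
    have h6 : 0 ≤ j * h := by positivity
    exact ⟨by linarith [hs.1], by linarith [hs.2]⟩
  have hT : ∀ ν ∈ 𝒩, (T ν).card ≤ m' := by
    intro ν hν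
    rcases (T ν).eq_empty_or_nonempty with he | ⟨j0, hj0⟩
    · rw [he]; simp
    have hne : ∃ s, g s (c ν + a ν * s) ≠ 0 := by
      obtain ⟨-, -, s, -, hs⟩ := Finset.mem_filter.1 hj0
      exact ⟨s, hs.ne⟩
    have hzero : ∀ j ∈ T ν, ∃ s ∈ cell j, g s (c ν + a ν * s) = 0 := by
      intro j hj
      obtain ⟨-, ⟨s1, h1, h1'⟩, s2, h2, h2'⟩ := Finset.mem_filter.1 hj
      obtain ⟨s, hs, hs'⟩ := isPreconnected_Ico.intermediate_value h2 h1 (hqc ν).continuousOn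
        (⟨h2'.le, h1'⟩ : (0:ℝ) ∈ Set.Icc _ _)
      exact ⟨s, hs, hs'⟩
    choose! s hs hs' using hzero
    have hinj : Set.InjOn s (T ν) := fun j hj j' hj' hjj =>
      hdisj j j' (s j) (hs j hj) (hjj ▸ hs j' hj')
    rw [← Finset.card_image_of_injOn hinj]
    refine hz' ν hν hne _ fun x hx => ?_
    obtain ⟨j, hj, rfl⟩ := Finset.mem_image.1 hx
    exact ⟨hcell01 j (Finset.mem_range.1 (Finset.mem_filter.1 hj).1) _ (hs j hj), hs' j hj⟩
  have hFc : F.card * (N * h / 4) ≤ 2 * (m + 1) + M * (M * τ) := by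
    refine crossing_count hg hu0 hh hu1 hτ hz hthin F fun j hj => ?_
    obtain ⟨hjM, ν, hν, hfull⟩ := Finset.mem_filter.1 hj
    refine ⟨Finset.mem_range.1 hjM, ?_⟩
    have ha := haN ν hν
    have ha0 : 0 < |a ν| := hN.trans_le ha
    have hL : N * h / 4 ≤ |a ν| * h / 4 := by gcongr
    obtain ⟨k, x, hx0, hx1, hx⟩ := exists_sub_segment
      (min (c ν + a ν * (u + j * h)) (c ν + a ν * (u + (j + 1) * h))) (by positivity) (hah ν hν) hL
    refine ⟨x, hx0, hx1, fun y hy => ?_⟩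
    obtain ⟨h1, h2⟩ := hx y hy
    have hane : a ν ≠ 0 := abs_pos.1 ha0
    obtain ⟨s, hs⟩ : ∃ s, y + k = c ν + a ν * s := ⟨(y + k - c ν) / a ν, by field_simp; ring⟩
    have hscell : s ∈ cell j := by
      rw [hs] at h1 h2
      rcases lt_or_gt_of_ne hane with hneg | hpos
      · rw [abs_of_neg hneg] at h2
        rw [min_eq_right (by nlinarith)] at h1 h2
        have e1 : a ν * (u + (j + 1) * h) < a ν * s := by linarith
        have e2 : a ν * s < a ν * (u + j * h) := by linarith
        exact ⟨((mul_lt_mul_left_of_neg hneg).1 e2).le, (mul_lt_mul_left_of_neg hneg).1 e1⟩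
      · rw [abs_of_pos hpos] at h2
        rw [min_eq_left (by nlinarith)] at h1 h2
        have e1 : a ν * (u + j * h) < a ν * s := by linarith
        have e2 : a ν * s < a ν * (u + (j + 1) * h) := by linarith
        exact ⟨((mul_lt_mul_iff_right₀ hpos).1 e1).le, (mul_lt_mul_iff_right₀ hpos).1 e2⟩
    refine ⟨s, hscell, ?_⟩
    rw [← hper s y k, hs]
    exact hfull s hscell
  have hcover : {s : ℝ | s ∈ Set.Ico u (u + M * h) ∧ ∃ ν ∈ 𝒩, 0 ≤ g s (c ν + a ν * s)} ⊆
      ⋃ j ∈ F ∪ 𝒩.biUnion T, cell j := by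
    rintro s ⟨hs, ν, hν, hq⟩
    have h0 : 0 ≤ (s - u) / h := div_nonneg (by linarith [hs.1]) hh.le
    have hj1 := Nat.floor_le h0
    have hj2 := Nat.lt_floor_add_one ((s - u) / h)
    rw [le_div_iff₀ hh] at hj1
    rw [div_lt_iff₀ hh] at hj2
    have hsj : s ∈ cell ⌊(s - u) / h⌋₊ := ⟨by linarith, by linarith⟩
    have hjM : ⌊(s - u) / h⌋₊ < M := by
      have : (⌊(s - u) / h⌋₊ : ℝ) * h < M * h := by linarith [hs.2]
      exact_mod_cast (mul_lt_mul_iff_left₀ hh).1 this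
    generalize ⌊(s - u) / h⌋₊ = j at hsj hjM
    refine Set.mem_biUnion (x := j) ?_ hsj
    show _ ∈ F ∪ 𝒩.biUnion T
    rw [Finset.mem_union, Finset.mem_biUnion]
    by_cases hfull : ∀ s ∈ cell j, 0 ≤ g s (c ν + a ν * s)
    · left
      rw [hFdef, Finset.mem_filter]
      exact ⟨Finset.mem_range.2 hjM, ν, hν, hfull⟩
    · push Not at hfull
      refine Or.inr ⟨ν, hν, ?_⟩
      rw [hTdef, Finset.mem_filter]
      exact ⟨Finset.mem_range.2 hjM, ⟨s, hsj, hq⟩, hfull⟩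
  have hcard : ((F ∪ 𝒩.biUnion T).card : ℝ) ≤ F.card + 𝒩.card * m' := by
    have : (F ∪ 𝒩.biUnion T).card ≤ F.card + 𝒩.card * m' :=
      (Finset.card_union_le _ _).trans (Nat.add_le_add_left (Finset.card_biUnion_le_card_mul _ _ _ hT) _)
    exact_mod_cast this
  calc _ ≤ ∑ j ∈ F ∪ 𝒩.biUnion T, volume (cell j) :=
        (measure_mono hcover).trans (measure_biUnion_finset_le _ _)
    _ = ENNReal.ofReal ((F ∪ 𝒩.biUnion T).card * h) := by
        have : ∀ j, volume (cell j) = ENNReal.ofReal h := fun j => by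
          rw [hcell, Real.volume_Ico]; congr 1; ring
        simp only [this, Finset.sum_const, nsmul_eq_mul]
        rw [ENNReal.ofReal_mul (by positivity), ENNReal.ofReal_natCast]
    _ ≤ _ := by
        refine ENNReal.ofReal_le_ofReal ?_
        have h1 : ((F ∪ 𝒩.biUnion T).card : ℝ) * h ≤ (F.card + 𝒩.card * m') * h := by gcongr
        have h2 : (F.card : ℝ) * h = 4 / N * (F.card * (N * h / 4)) := by field_simp
        have h3 : (F.card : ℝ) * h ≤ 4 / N * (2 * (m + 1) + M * (M * τ)) := by
          rw [h2]; gcongr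
        linarith

end steep

section sylvester

open scoped Kronecker

variable {ι κ : Type*} [Fintype ι] [DecidableEq ι] [Fintype κ] [DecidableEq κ]

/-- The Sylvester operator `X ↦ H X - X K`. -/
def sylv (H : Matrix ι ι ℂ) (K : Matrix κ κ ℂ) : Matrix (ι × κ) (ι × κ) ℂ :=
  H ⊗ₖ 1 - 1 ⊗ₖ K

lemma sylv_apply (H : Matrix ι ι ℂ) (K : Matrix κ κ ℂ) (p q : ι × κ) :
    sylv H K p q = H p.1 q.1 * (if p.2 = q.2 then 1 else 0) -
      (if p.1 = q.1 then 1 else 0) * K p.2 q.2 := by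
  simp [sylv, Matrix.kroneckerMap_apply, Matrix.one_apply]

lemma sum_norm_eigenvector_le {K : Matrix κ κ ℂ} (hK : K.IsHermitian) (a : κ) :
    ∑ j, ‖hK.eigenvectorBasis j a‖ ^ 2 = 1 := by
  have h1 := congr_fun (congr_fun (Unitary.coe_mul_star_self hK.eigenvectorUnitary) a) a
  rw [Unitary.coe_star, Matrix.mul_apply, Matrix.one_apply_eq] at h1
  have h2 : ∀ j, (hK.eigenvectorUnitary : Matrix κ κ ℂ) a j *
      (star (hK.eigenvectorUnitary : Matrix κ κ ℂ)) j a = ((‖hK.eigenvectorBasis j a‖ ^ 2 : ℝ) : ℂ) := by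
    intro j
    rw [Matrix.star_apply, Matrix.IsHermitian.eigenvectorUnitary_apply, RCLike.star_def,
      Complex.mul_conj']
    push_cast; rfl
  simp only [h2] at h1
  exact_mod_cast h1

lemma sylv_inv {H : Matrix ι ι ℂ} {K : Matrix κ κ ℂ} (hK : K.IsHermitian) {β : ℝ}
    (h : ∀ j, (H - (hK.eigenvalues j : ℂ) • (1 : Matrix ι ι ℂ)).det ≠ 0 ∧
      ∀ n k, ‖(H - (hK.eigenvalues j : ℂ) • (1 : Matrix ι ι ℂ))⁻¹ n k‖ ≤ β) :
    (sylv H K).det ≠ 0 ∧ ∀ p q, ‖(sylv H K)⁻¹ p q‖ ≤ β := by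
  set G : κ → Matrix ι ι ℂ := fun j => (H - (hK.eigenvalues j : ℂ) • (1 : Matrix ι ι ℂ))⁻¹ with hG
  set P : κ → Matrix κ κ ℂ := fun j =>
    Matrix.vecMulVec (fun a => hK.eigenvectorBasis j a) (fun a => star (hK.eigenvectorBasis j a)) with hP
  have hHG : ∀ j, H * G j = 1 + (hK.eigenvalues j : ℂ) • G j := by
    intro j
    have h1 := Matrix.mul_nonsing_inv _ (isUnit_iff_ne_zero.2 (h j).1)
    rw [Matrix.sub_mul, Matrix.smul_mul, Matrix.one_mul, sub_eq_iff_eq_add] at h1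
    exact h1
  have hKP : ∀ j, K * P j = (hK.eigenvalues j : ℂ) • P j := by
    intro j
    rw [hP]
    simp only
    rw [Matrix.mul_vecMulVec]
    have := hK.mulVec_eigenvectorBasis j
    have e : K.mulVec (fun a => hK.eigenvectorBasis j a) =
        (hK.eigenvalues j : ℂ) • fun a => hK.eigenvectorBasis j a := by
      ext a
      have := congr_fun this a
      simpa using this
    rw [e, Matrix.smul_vecMulVec]
  have hP1 : ∑ j, P j = 1 := by
    have h1 := Unitary.coe_mul_star_self hK.eigenvectorUnitary
    rw [Unitary.coe_star] at h1
    rw [← h1]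
    ext a b
    rw [Matrix.mul_apply, Matrix.sum_apply]
    refine Finset.sum_congr rfl fun j _ => ?_
    rw [Matrix.star_apply, Matrix.IsHermitian.eigenvectorUnitary_apply,
      Matrix.IsHermitian.eigenvectorUnitary_apply]
    rfl
  have hmul : sylv H K * ∑ j, G j ⊗ₖ P j = 1 := by
    rw [sylv, Matrix.sub_mul, Finset.mul_sum, Finset.mul_sum, ← Finset.sum_sub_distrib]
    have : ∀ j, H ⊗ₖ (1 : Matrix κ κ ℂ) * (G j ⊗ₖ P j) - (1 : Matrix ι ι ℂ) ⊗ₖ K * (G j ⊗ₖ P j) =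
        (1 : Matrix ι ι ℂ) ⊗ₖ P j := by
      intro j
      rw [← Matrix.mul_kronecker_mul, ← Matrix.mul_kronecker_mul, Matrix.one_mul, Matrix.one_mul, hHG,
        hKP, Matrix.add_kronecker, Matrix.smul_kronecker, Matrix.kronecker_smul, add_sub_cancel_right]
    simp only [this]
    rw [← Matrix.one_kronecker_one, ← hP1]
    ext p q
    simp only [Matrix.sum_apply, Matrix.kroneckerMap_apply, Finset.mul_sum]
  have hdet : (sylv H K).det ≠ 0 := by
    intro h0
    have := congr_arg Matrix.det hmul
    rw [Matrix.det_mul, h0, zero_mul, Matrix.det_one] at this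
    exact zero_ne_one this
  refine ⟨hdet, fun p q => ?_⟩
  rw [Matrix.inv_eq_right_inv hmul, Matrix.sum_apply]
  have hβ : ∀ j, ‖(G j ⊗ₖ P j) p q‖ ≤
      β * ((‖hK.eigenvectorBasis j p.2‖ ^ 2 + ‖hK.eigenvectorBasis j q.2‖ ^ 2) / 2) := by
    intro j
    have h1 := (h j).2 p.1 q.1
    have hβ0 := (norm_nonneg _).trans h1
    rw [Matrix.kroneckerMap_apply, norm_mul]
    have h2 : ‖P j p.2 q.2‖ = ‖hK.eigenvectorBasis j p.2‖ * ‖hK.eigenvectorBasis j q.2‖ := by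
      simp [hP, Matrix.vecMulVec_apply]
    rw [h2]
    refine mul_le_mul h1 ?_ (by positivity) hβ0
    nlinarith [sq_nonneg (‖hK.eigenvectorBasis j p.2‖ - ‖hK.eigenvectorBasis j q.2‖)]
  refine (norm_sum_le _ _).trans ((Finset.sum_le_sum fun j _ => hβ j).trans (le_of_eq ?_))
  rw [← Finset.mul_sum, ← Finset.sum_div, Finset.sum_add_distrib, sum_norm_eigenvector_le,
    sum_norm_eigenvector_le]
  norm_num

/-- A quasimode of `K` of energy `E` makes `H - E` invertible, when the Sylvester operator is
invertible. -/
lemma norm_le_of_quasimode {H : Matrix ι ι ℂ} {K : Matrix κ κ ℂ} {b s μ c : ℝ} {E : ℂ}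
    (hdet : (sylv H K).det ≠ 0) (hinv : ∀ p q, ‖(sylv H K)⁻¹ p q‖ ≤ b) {u : κ → ℂ} {v : ι → ℂ}
    (hu : ∀ a, ‖K.mulVec u a - E * u a‖ ≤ s) (hμ : ∀ a, ‖u a‖ ≤ μ) (hμ' : ∃ a, ‖u a‖ = μ) (hμ0 : 0 < μ)
    (hs : b * (Fintype.card ι * Fintype.card κ) * s ≤ μ / 2)
    (hv : ∀ n, ‖H.mulVec v n - E * v n‖ ≤ c) (n : ι) :
    ‖v n‖ ≤ 2 * b * (Fintype.card ι * Fintype.card κ) * c := by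
  obtain ⟨a, ha⟩ := hμ'
  have hb0 : 0 ≤ b := (norm_nonneg _).trans (hinv (n, a) (n, a))
  obtain ⟨n0, hn0⟩ : ∃ n0, ∀ n, ‖v n‖ ≤ ‖v n0‖ := by
    obtain ⟨n0, -, h⟩ := Finset.exists_max_image Finset.univ (fun n => ‖v n‖) ⟨n, Finset.mem_univ _⟩
    exact ⟨n0, fun n => h n (Finset.mem_univ _)⟩
  set w : ι × κ → ℂ := fun p => v p.1 * u p.2 with hw
  have hAw : ∀ p, (sylv H K).mulVec w p = (H.mulVec v p.1 - E * v p.1) * u p.2 -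
      v p.1 * (K.mulVec u p.2 - E * u p.2) := by
    rintro ⟨n, a⟩
    simp only [Matrix.mulVec, dotProduct, sylv_apply, hw, Fintype.sum_prod_type, sub_mul,
      Finset.sum_sub_distrib]
    have e1 : ∑ x, ∑ y, H n x * (if a = y then 1 else 0) * (v x * u y) = (∑ x, H n x * v x) * u a := by
      rw [Finset.sum_mul]
      refine Finset.sum_congr rfl fun x _ => ?_
      rw [Finset.sum_eq_single a]
      · simp; ring
      · intro y _ hy; simp [hy.symm]
      · simp
    have e2 : ∑ x, ∑ y, (if n = x then 1 else 0) * K a y * (v x * u y) = v n * ∑ y, K a y * u y := by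
      rw [Finset.sum_eq_single n]
      · rw [Finset.mul_sum]
        refine Finset.sum_congr rfl fun y _ => ?_
        simp; ring
      · intro x _ hx; simp [hx.symm]
      · simp
    rw [e1, e2]; ring
  have hw' : w (n0, a) = ∑ q, (sylv H K)⁻¹ (n0, a) q * (sylv H K).mulVec w q := by
    have h1 : (sylv H K)⁻¹.mulVec ((sylv H K).mulVec w) = w := by
      rw [Matrix.mulVec_mulVec, Matrix.nonsing_inv_mul _ (isUnit_iff_ne_zero.2 hdet), Matrix.one_mulVec]
    exact (congr_fun h1 (n0, a)).symm
  set V := ‖v n0‖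
  have hV0 : 0 ≤ V := norm_nonneg _
  have hmain : V * μ ≤ b * (Fintype.card ι * Fintype.card κ) * (c * μ + V * s) := by
    calc V * μ = ‖w (n0, a)‖ := by rw [hw, norm_mul, ha]
      _ ≤ ∑ q : ι × κ, b * (c * μ + V * s) := by
          rw [hw']
          refine norm_sum_le_of_le _ fun q _ => ?_
          rw [norm_mul, hAw]
          refine mul_le_mul (hinv _ _) ((norm_sub_le _ _).trans ?_) (norm_nonneg _) hb0
          rw [norm_mul, norm_mul]
          have := hv q.1; have := hμ q.2; have := hn0 q.1; have := hu q.2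
          have hc0 : 0 ≤ c := (norm_nonneg _).trans (hv q.1)
          gcongr
      _ = _ := by
          rw [Finset.sum_const, Finset.card_univ, Fintype.card_prod, nsmul_eq_mul]; push_cast; ring
  refine (hn0 n).trans ?_
  have h2 : b * (Fintype.card ι * Fintype.card κ) * s * V ≤ μ / 2 * V := by gcongr
  have h3 : V * μ ≤ (2 * b * (Fintype.card ι * Fintype.card κ) * c) * μ := by nlinarith only [hmain, h2]
  exact le_of_mul_le_mul_right h3 hμ0

end sylvester

lemma mat_isHermitian (δ : ℝ) (v : (Fin d → ℤ) → ℝ) (Λ : Finset (Fin d → ℤ)) :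
    (mat δ (fun n => (v n : ℂ)) Λ).IsHermitian := by
  ext n k
  simp only [Matrix.conjTranspose_apply, mat, Matrix.of_apply, star_add, RCLike.star_def,
    Complex.conj_ofReal, hop_comm k.1 n.1]
  by_cases h : n = k
  · subst h; simp
  · simp [h, Ne.symm h]

lemma mat_pot_sub (δ : ℝ) (f : ℝ → ℝ) (ω : Fin d → ℝ) (E x : ℝ) (Λ : Finset (Fin d → ℤ)) :
    mat δ (fun n => (pot f ω E x n : ℂ)) Λ =
      mat δ (fun n => (pot f ω 0 x n : ℂ)) Λ - (E : ℂ) • (1 : Matrix Λ Λ ℂ) := by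
  ext n k
  simp only [mat, Matrix.of_apply, Matrix.sub_apply, Matrix.smul_apply, Matrix.one_apply, pot, smul_eq_mul]
  by_cases h : n = k
  · simp [h]; ring
  · simp [h]

/-- The matrix whose inverse controls the simultaneous resonances of `R` and of `Q 0 r`. -/
def elimA (δ : ℝ) (T : ℝ → ℝ) (ω : Fin d → ℝ) (R : Finset (Fin d → ℤ)) (r : ℕ) (y : ℝ) :
    Matrix (R × (Q (0 : Fin d → ℤ) r)) (R × (Q (0 : Fin d → ℤ) r)) ℂ :=
  sylv (mat δ (fun n => (pot T ω 0 y n : ℂ)) R) (mat δ (fun n => (pot T ω 0 0 n : ℂ)) (Q 0 r))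

lemma elim_thin {f T : ℝ → ℝ} {δ e b b' τ : ℝ} (hδ : 0 ≤ δ) (hb : 0 ≤ b)
    (hfT : ∀ x, |f x - T x| ≤ e) {ω : Fin d → ℝ} {R : Finset (Fin d → ℤ)} {r : ℕ}
    (hτ : ∀ E : ℝ, volume {x : ℝ | x ∈ Set.Icc (0:ℝ) 1 ∧
      ¬ Inv δ (fun n => (pot f ω E x n : ℂ)) R (fun _ _ => b)} ≤ ENNReal.ofReal τ)
    (h1 : e * (R.card * b) ≤ 1 / 2) (h2 : b + 2 * R.card * b ^ 2 * e < b') (p q) :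
    volume {y : ℝ | y ∈ Set.Icc (0:ℝ) 1 ∧ 0 ≤ minorFn (elimA δ T ω R r y) b' p q} ≤
      ENNReal.ofReal ((2 * r + 1 : ℕ) ^ d * τ) := by
  set K := mat δ (fun n => (pot T ω 0 0 n : ℂ)) (Q (0 : Fin d → ℤ) r) with hKdef
  have hK : K.IsHermitian := mat_isHermitian δ _ _
  have hsub : {y : ℝ | y ∈ Set.Icc (0:ℝ) 1 ∧ 0 ≤ minorFn (elimA δ T ω R r y) b' p q} ⊆
      ⋃ j : Q (0 : Fin d → ℤ) r, {x : ℝ | x ∈ Set.Icc (0:ℝ) 1 ∧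
      ¬ Inv δ (fun n => (pot f ω (hK.eigenvalues j) x n : ℂ)) R (fun _ _ => b)} := by
    rintro y ⟨hy, hy'⟩
    by_contra hcon
    simp only [Set.mem_iUnion, not_exists] at hcon
    have hinv : ∀ j, Inv δ (fun n => (pot f ω (hK.eigenvalues j) y n : ℂ)) R (fun _ _ => b) := by
      intro j
      by_contra h
      exact hcon j ⟨hy, h⟩
    have hinv' : ∀ j, Inv δ (fun n => (pot T ω (hK.eigenvalues j) y n : ℂ)) R
        (fun _ _ => b + 2 * R.card * b ^ 2 * e) := by
      intro j
      refine (hinv j).perturb hδ (P := b) (e := e) (fun _ _ _ _ => le_rfl) hb (fun n _ => ?_) h1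
      rw [← Complex.ofReal_sub, Complex.norm_real, Real.norm_eq_abs, abs_sub_comm]
      simpa [pot] using hfT (y + dotw ω n)
    have := sylv_inv (H := mat δ (fun n => (pot T ω 0 y n : ℂ)) R) hK
      (β := b + 2 * R.card * b ^ 2 * e) (fun j => by rw [← mat_pot_sub]; exact hinv' j)
    exact absurd (minorFn_neg this.1 ((this.2 p q).trans_lt h2)) (not_lt.2 hy')
  refine (measure_mono hsub).trans ((measure_iUnion_fintype_le _ _).trans
    ((Finset.sum_le_sum fun j _ => hτ _).trans (le_of_eq ?_)))
  rw [Finset.sum_const, Finset.card_univ, card_attach_Q, nsmul_eq_mul,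
    ENNReal.ofReal_mul (by positivity)]
  congr 1
  rw [← Nat.cast_pow, ENNReal.ofReal_natCast]

lemma elim_use {f T : ℝ → ℝ} {δ e b s μ : ℝ} (hδ : 0 ≤ δ) (hb : 0 ≤ b) (he : 0 ≤ e)
    (hfT : ∀ x, |f x - T x| ≤ e) {ω : Fin d → ℝ} {R : Finset (Fin d → ℤ)} {r : ℕ} {y E : ℝ}
    (hneg : ∀ p q, minorFn (elimA δ T ω R r y) b p q < 0) {u : (Fin d → ℤ) → ℂ}
    (hu : ∀ n ∈ Q (0 : Fin d → ℤ) r, ‖∑ k ∈ Q (0 : Fin d → ℤ) r, ((δ * hop n k : ℝ) : ℂ) * u k +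
      (pot f ω E 0 n : ℂ) * u n‖ ≤ s) (hμ : ∀ n ∈ Q (0 : Fin d → ℤ) r, ‖u n‖ ≤ μ)
    (hμ' : ∃ n ∈ Q (0 : Fin d → ℤ) r, ‖u n‖ = μ) (hμ0 : 0 < μ)
    (hs : b * (R.card * (2 * r + 1 : ℕ) ^ d) * (s + e * μ) ≤ μ / 2)
    (he' : e * (R.card * (2 * b * (R.card * (2 * r + 1 : ℕ) ^ d))) ≤ 1 / 2) :
    Inv δ (fun n => (pot f ω E y n : ℂ)) R (fun _ _ => 2 * b * (R.card * (2 * r + 1 : ℕ) ^ d) +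
      2 * R.card * (2 * b * (R.card * (2 * r + 1 : ℕ) ^ d)) ^ 2 * e) := by
  have hT : Inv δ (fun n => (pot T ω E y n : ℂ)) R
      (fun _ _ => 2 * b * (R.card * (2 * r + 1 : ℕ) ^ d)) := by
    refine inv_of_apriori fun k hk φ c hφ n hn => ?_
    obtain ⟨a, ha, ha'⟩ := hμ'
    have hdet := det_ne_zero_of_minorFn_neg (hneg (⟨k, hk⟩, ⟨a, ha⟩) (⟨k, hk⟩, ⟨a, ha⟩))
    have := norm_le_of_quasimode (E := (E : ℂ)) (b := b) (s := s + e * μ) (μ := μ) (c := ‖c‖) hdet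
      (fun p q => norm_inv_le_of_minorFn_neg hb (hneg p q))
      (u := fun a => u a.1) (v := fun n => φ n.1) ?_ (fun a => hμ a.1 a.2) ⟨⟨a, ha⟩, ha'⟩ hμ0 ?_ ?_ ⟨n, hn⟩
    · rw [card_attach_Q, Fintype.card_coe] at this
      push_cast at this ⊢
      exact this
    · rintro ⟨n, hn⟩
      rw [mat_mulVec]
      have e1 : ∑ k ∈ Q (0 : Fin d → ℤ) r, ((δ * hop n k : ℝ) : ℂ) * u k + (pot T ω 0 0 n : ℂ) * u n -
          E * u n = (∑ k ∈ Q (0 : Fin d → ℤ) r, ((δ * hop n k : ℝ) : ℂ) * u k +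
            (pot f ω E 0 n : ℂ) * u n) - ((f (0 + dotw ω n) - T (0 + dotw ω n) : ℝ) : ℂ) * u n := by
        simp only [pot]; push_cast; ring
      rw [e1]
      refine (norm_sub_le _ _).trans (add_le_add (hu n hn) ?_)
      rw [norm_mul, Complex.norm_real, Real.norm_eq_abs]
      exact mul_le_mul (hfT _) (hμ n hn) (norm_nonneg _) he
    · rw [card_attach_Q, Fintype.card_coe]
      push_cast at hs ⊢
      exact hs
    · rintro ⟨n, hn⟩
      rw [mat_mulVec]
      have h1 := hφ n hn
      unfold Eqn at h1
      beta_reduce at h1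
      have e1 : ∑ k ∈ R, ((δ * hop n k : ℝ) : ℂ) * φ k + (pot T ω 0 y n : ℂ) * φ n - E * φ n =
          if n = k then c else 0 := by
        rw [← h1]; simp only [pot]; push_cast; ring
      rw [e1]
      split_ifs
      · exact le_rfl
      · simp
  refine hT.perturb hδ (fun _ _ _ _ => le_rfl) (by positivity) (fun n _ => ?_) he'
  rw [← Complex.ofReal_sub, Complex.norm_real, Real.norm_eq_abs]
  simpa [pot] using hfT (y + dotw ω n)

lemma update_mem_Icc_iff {ω : Fin d → ℝ} {i : Fin d} (s : ℝ) :
    Function.update ω i s ∈ Set.Icc (0 : Fin d → ℝ) 1 ↔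
      s ∈ Set.Icc (0:ℝ) 1 ∧ Function.update ω i 0 ∈ Set.Icc (0 : Fin d → ℝ) 1 := by
  simp only [Set.mem_Icc, le_update_iff, update_le_iff, Pi.zero_apply, Pi.one_apply,
    le_refl, zero_le_one, true_and]
  tauto

/-- Fubini: a set with small slices in one direction is small. -/
lemma volume_le_of_slices {S : Set (Fin d → ℝ)} (hS : MeasurableSet S) (i : Fin d) {c : ENNReal}
    (h : ∀ ω, Function.update ω i 0 ∈ Set.Icc (0 : Fin d → ℝ) 1 →
      volume {s : ℝ | s ∈ Set.Icc (0:ℝ) 1 ∧ Function.update ω i s ∈ S} ≤ c) :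
    volume (Set.Icc (0 : Fin d → ℝ) 1 ∩ S) ≤ c := by
  have hI : MeasurableSet (Set.Icc (0 : Fin d → ℝ) 1) := measurableSet_Icc
  have hup : ∀ ω : Fin d → ℝ, Measurable fun s : ℝ => Function.update ω i s := fun ω =>
    measurable_update ω
  have key := lintegral_le_of_lmarginal_le (μ := fun _ : Fin d => (volume : Measure ℝ)) {i}
    (f := (Set.Icc (0 : Fin d → ℝ) 1 ∩ S).indicator 1)
    (g := (Set.Icc (0 : Fin d → ℝ) 1).indicator fun _ => c)
    (measurable_one.indicator (hI.inter hS)) (measurable_const.indicator hI) ?_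
  · rw [← volume_pi, lintegral_indicator_one (hI.inter hS), lintegral_indicator_const hI] at key
    refine key.trans ?_
    rw [← Set.pi_univ_Icc, volume_pi_pi]
    simp
  · intro ω
    rw [lmarginal_singleton, lmarginal_singleton]
    by_cases hω : Function.update ω i 0 ∈ Set.Icc (0 : Fin d → ℝ) 1
    · have hT : MeasurableSet {s : ℝ | s ∈ Set.Icc (0:ℝ) 1 ∧ Function.update ω i s ∈ S} :=
        measurableSet_Icc.inter (hup ω hS)
      have e1 : ∀ s, (Set.Icc (0 : Fin d → ℝ) 1 ∩ S).indicator (1 : (Fin d → ℝ) → ENNReal)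
          (Function.update ω i s) =
          {s : ℝ | s ∈ Set.Icc (0:ℝ) 1 ∧ Function.update ω i s ∈ S}.indicator 1 s := by
        intro s
        by_cases hs : s ∈ Set.Icc (0:ℝ) 1 ∧ Function.update ω i s ∈ S
        · rw [Set.indicator_of_mem (show s ∈ {s : ℝ | s ∈ Set.Icc (0:ℝ) 1 ∧ Function.update ω i s ∈ S} from hs), Set.indicator_of_mem]
          · rfl
          · exact ⟨(update_mem_Icc_iff s).2 ⟨hs.1, hω⟩, hs.2⟩
        · rw [Set.indicator_of_notMem (show s ∉ {s : ℝ | s ∈ Set.Icc (0:ℝ) 1 ∧ Function.update ω i s ∈ S} from hs), Set.indicator_of_notMem]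
          exact fun h => hs ⟨((update_mem_Icc_iff s).1 h.1).1, h.2⟩
      have e2 : ∀ s, (Set.Icc (0 : Fin d → ℝ) 1).indicator (fun _ => c) (Function.update ω i s) =
          (Set.Icc (0:ℝ) 1).indicator (fun _ => c) s := by
        intro s
        by_cases hs : s ∈ Set.Icc (0:ℝ) 1
        · rw [Set.indicator_of_mem hs, Set.indicator_of_mem]
          exact (update_mem_Icc_iff s).2 ⟨hs, hω⟩
        · rw [Set.indicator_of_notMem hs, Set.indicator_of_notMem]
          exact fun h => hs ((update_mem_Icc_iff s).1 h).1
      simp only [e1, e2]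
      rw [lintegral_indicator_one hT, lintegral_indicator_const measurableSet_Icc]
      simpa using h ω hω
    · have e1 : ∀ s, (Set.Icc (0 : Fin d → ℝ) 1 ∩ S).indicator (1 : (Fin d → ℝ) → ENNReal)
          (Function.update ω i s) = 0 := by
        intro s
        rw [Set.indicator_of_notMem]
        rintro ⟨h1, -⟩
        exact hω ((update_mem_Icc_iff s).1 h1).2
      simp only [e1, lintegral_zero]
      exact bot_le

lemma dotw_update (ω : Fin d → ℝ) (i : Fin d) (s : ℝ) (n : Fin d → ℤ) :
    dotw (Function.update ω i s) n = dotw (Function.update ω i 0) n + n i * s := by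
  simp only [dotw]
  rw [← Finset.add_sum_erase _ _ (Finset.mem_univ i), ← Finset.add_sum_erase _ _ (Finset.mem_univ i)]
  simp only [Function.update_self]
  rw [Finset.sum_congr rfl fun j hj => by
    rw [Function.update_of_ne (Finset.ne_of_mem_erase hj) s ω,
      ← Function.update_of_ne (Finset.ne_of_mem_erase hj) 0 ω]]
  ring

lemma continuous_dotw (n : Fin d → ℤ) : Continuous fun ω : Fin d → ℝ => dotw ω n := by
  unfold dotw; fun_prop

lemma volume_near_int (c : ℝ) {a : ℤ} (ha : a ≠ 0) {η : ℝ} (hη : 0 ≤ η) (hη1 : η ≤ 1) :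
    volume {s : ℝ | s ∈ Set.Icc (0:ℝ) 1 ∧ ∃ m : ℤ, |c + a * s - m| < η} ≤ ENNReal.ofReal (16 * η) := by
  have ha1 : (1:ℝ) ≤ |(a:ℝ)| := by exact_mod_cast Int.one_le_abs ha
  have ha0 : (a:ℝ) ≠ 0 := by exact_mod_cast ha
  obtain ⟨F, hF⟩ : ∃ F : Finset ℤ, F = Finset.Icc (⌊c⌋ - |a| - 2) (⌊c⌋ + |a| + 2) := ⟨_, rfl⟩
  have hsub : {s : ℝ | s ∈ Set.Icc (0:ℝ) 1 ∧ ∃ m : ℤ, |c + a * s - m| < η} ⊆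
      ⋃ m ∈ F, Metric.ball ((m - c) / a) (η / |(a:ℝ)|) := by
    rintro s ⟨⟨hs0, hs1⟩, m, hm⟩
    have h1 : |(a:ℝ) * s| ≤ |(a:ℝ)| := by
      rw [abs_mul, abs_of_nonneg hs0]; nlinarith
    rw [Set.mem_iUnion₂]
    refine ⟨m, ?_, ?_⟩
    · obtain ⟨h2, h3⟩ := abs_le.1 h1
      obtain ⟨h4, h5⟩ := abs_lt.1 hm
      have h6 := Int.floor_le c
      have h7 := Int.lt_floor_add_one c
      rw [hF, Finset.mem_Icc]
      constructor
      · have : ((⌊c⌋ - |a| - 2 : ℤ) : ℝ) ≤ m := by push_cast; linarith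
        exact_mod_cast this
      · have : (m:ℝ) ≤ ((⌊c⌋ + |a| + 2 : ℤ) : ℝ) := by push_cast; linarith
        exact_mod_cast this
    · rw [Metric.mem_ball, Real.dist_eq, lt_div_iff₀ (by linarith), ← abs_mul]
      have : (s - (m - c) / a) * (a:ℝ) = c + a * s - m := by field_simp; ring
      rwa [this]
  refine (measure_mono hsub).trans ((measure_biUnion_finset_le _ _).trans ?_)
  simp only [Real.volume_ball, Finset.sum_const, nsmul_eq_mul]
  rw [← ENNReal.ofReal_natCast, ← ENNReal.ofReal_mul (by positivity)]
  refine ENNReal.ofReal_le_ofReal ?_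
  have hc : (F.card : ℝ) ≤ 8 * |(a:ℝ)| := by
    rw [hF, Int.card_Icc]
    have : 1 ≤ |a| := Int.one_le_abs ha
    have h2 : ((⌊c⌋ + |a| + 2 + 1 - (⌊c⌋ - |a| - 2)).toNat : ℤ) ≤ 8 * |a| := by omega
    exact_mod_cast h2
  calc _ ≤ 8 * |(a:ℝ)| * (2 * (η / |(a:ℝ)|)) := by gcongr
    _ = _ := by field_simp; ring

lemma isClosed_sep (N : ℕ) (η : ℝ) : IsClosed {ω : Fin d → ℝ | Sep ω N η} := by
  have : {ω : Fin d → ℝ | Sep ω N η} = ⋂ (n : Fin d → ℤ) (_ : n ≠ 0) (_ : sd n 0 ≤ N) (m : ℤ),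
      {ω | η ≤ |dotw ω n - m|} := by
    ext ω; simp [Sep]
  rw [this]
  refine isClosed_iInter fun n => isClosed_iInter fun _ => isClosed_iInter fun _ =>
    isClosed_iInter fun m => isClosed_le continuous_const ?_
  have := continuous_dotw n
  fun_prop

lemma volume_not_sep {N : ℕ} {η : ℝ} (hη : 0 ≤ η) (hη1 : η ≤ 1) :
    volume (Set.Icc (0 : Fin d → ℝ) 1 ∩ {ω | ¬ Sep ω N η}) ≤
      ENNReal.ofReal ((2 * N + 1 : ℕ) ^ d * (16 * η)) := by
  classical
  have hsub : Set.Icc (0 : Fin d → ℝ) 1 ∩ {ω | ¬ Sep ω N η} ⊆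
      ⋃ n ∈ (Q (0 : Fin d → ℤ) N).filter (· ≠ 0),
        Set.Icc (0 : Fin d → ℝ) 1 ∩ {ω | ∃ m : ℤ, |dotw ω n - m| < η} := by
    rintro ω ⟨hω, hs⟩
    have hs' : ¬ Sep ω N η := hs
    simp only [Sep, not_forall, not_le] at hs'
    obtain ⟨n, h0, h1, m, hm⟩ := hs'
    rw [Set.mem_iUnion₂]
    exact ⟨n, Finset.mem_filter.2 ⟨mem_Q.2 h1, h0⟩, hω, m, hm⟩
  refine (measure_mono hsub).trans ((measure_biUnion_finset_le _ _).trans ?_)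
  have hb : ∀ n ∈ (Q (0 : Fin d → ℤ) N).filter (· ≠ 0),
      volume (Set.Icc (0 : Fin d → ℝ) 1 ∩ {ω | ∃ m : ℤ, |dotw ω n - m| < η}) ≤
        ENNReal.ofReal (16 * η) := by
    intro n hn
    obtain ⟨i, hi⟩ := Function.ne_iff.1 (Finset.mem_filter.1 hn).2
    refine volume_le_of_slices (i := i) ?_ ?_
    · have : {ω : Fin d → ℝ | ∃ m : ℤ, |dotw ω n - m| < η} = ⋃ m : ℤ, {ω | |dotw ω n - m| < η} := by
        ext; simp
      rw [this]
      refine MeasurableSet.iUnion fun m => (isOpen_lt ?_ continuous_const).measurableSet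
      have := continuous_dotw n
      fun_prop
    · intro ω _
      refine le_trans (measure_mono ?_) (volume_near_int (dotw (Function.update ω i 0) n)
        (a := n i) hi hη hη1)
      rintro s ⟨hs, m, hm⟩
      exact ⟨hs, m, by rwa [dotw_update] at hm⟩
  refine (Finset.sum_le_card_nsmul _ _ _ hb).trans ?_
  rw [nsmul_eq_mul, ← ENNReal.ofReal_natCast, ← ENNReal.ofReal_mul (by positivity)]
  refine ENNReal.ofReal_le_ofReal ?_
  gcongr
  have := (Finset.card_filter_le (Q (0 : Fin d → ℤ) N) (· ≠ 0)).trans_eq (card_Q _ _)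
  exact_mod_cast this

lemma SepAt.update {t T : ℕ} (ht : 1 ≤ t) (htT : t ≤ T) {ω : Fin d → ℝ} {i : Fin d} {s s' : ℝ}
    (h : SepAt (Function.update ω i s) t 2) (hs : |s' - s| ≤ 1 / T ^ (9 * (d + 4))) :
    SepAt (Function.update ω i s') t 1 := by
  intro n h0 hn m
  have h1 := h n h0 hn m
  rw [dotw_update] at h1 ⊢
  have hni : |((n i : ℤ) : ℝ)| ≤ t ^ 9 := by
    have := natAbs_le_sd n 0 i
    simp only [Pi.zero_apply, sub_zero] at this
    rw [← Int.cast_abs, Int.abs_eq_natAbs]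
    exact_mod_cast this.trans hn
  have ht' : (1:ℝ) ≤ t := by exact_mod_cast ht
  have hT' : (t:ℝ) ≤ T := by exact_mod_cast htT
  have h2 : |(n i : ℝ) * (s' - s)| ≤ 1 / t ^ (9 * (d + 2)) := by
    rw [abs_mul]
    calc _ ≤ (t:ℝ) ^ 9 * (1 / T ^ (9 * (d + 4))) := by gcongr
      _ ≤ (t:ℝ) ^ 9 * (1 / t ^ (9 * (d + 4))) := by gcongr
      _ = 1 / t ^ (9 * (d + 3)) := by
        rw [mul_one_div, div_eq_div_iff (by positivity) (by positivity)]; ring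
      _ ≤ _ := one_div_le_one_div_of_le (by positivity) (pow_le_pow_right₀ ht' (by omega))
  have h3 : dotw (Function.update ω i 0) n + n i * s - m =
    (dotw (Function.update ω i 0) n + n i * s' - m) - n i * (s' - s) := by ring
  have h4 := abs_sub (dotw (Function.update ω i 0) n + n i * s' - m) (n i * (s' - s))
  rw [h3] at h1
  have : (2:ℝ) / t ^ (9 * (d + 2)) = 1 / t ^ (9 * (d + 2)) + 1 / t ^ (9 * (d + 2)) := by ring
  rw [this] at h1
  linarith

lemma TrigPoly.add_int {m : ℕ} {g : ℝ → ℂ} (hg : g ∈ TrigPoly m) (x : ℝ) (k : ℤ) :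
    g (x + k) = g x := by
  induction hg using Submodule.span_induction with
  | mem x hx =>
    obtain ⟨j, -, rfl⟩ := hx
    rw [ech_add_right]
    have : ech j (k : ℝ) = 1 := by
      simp only [ech]
      rw [Complex.exp_eq_one_iff]
      exact ⟨j * k, by push_cast; ring⟩
    rw [this, mul_one]
  | zero => rfl
  | add _ _ _ _ h1 h2 => simp only [Pi.add_apply, h1, h2]
  | smul _ _ _ h1 => simp only [Pi.smul_apply, h1]

section elim

variable {T : ℝ → ℝ} {m₀ : ℕ} {δ b : ℝ} {i : Fin d} {R : Finset (Fin d → ℤ)} {r : ℕ}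

lemma elimA_add_int (hT : (fun t => (T t : ℂ)) ∈ TrigPoly m₀) (ω : Fin d → ℝ) (y : ℝ) (k : ℤ) :
    elimA δ T ω R r (y + k) = elimA δ T ω R r y := by
  have h : ∀ x : ℝ, T (x + k) = T x := fun x => by exact_mod_cast TrigPoly.add_int hT x k
  have h2 : ∀ n, pot T ω 0 (y + k) n = pot T ω 0 y n := fun n => by
    simp only [pot]; rw [add_right_comm, h]
  simp only [elimA, h2]

lemma continuous_minorFn_elimA (hT : Continuous T) (p q) :
    Continuous fun z : (Fin d → ℝ) × ℝ => minorFn (elimA δ T z.1 R r z.2) b p q := by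
  have h1 : Continuous fun z : (Fin d → ℝ) × ℝ => elimA δ T z.1 R r z.2 := by
    refine continuous_pi fun p => continuous_pi fun q => ?_
    have hd : ∀ n : Fin d → ℤ, Continuous fun z : (Fin d → ℝ) × ℝ => dotw z.1 n := fun n =>
      (continuous_dotw n).comp continuous_fst
    have e1 : ∀ (Λ : Finset (Fin d → ℤ)) (n k : Λ), Continuous fun z : (Fin d → ℝ) × ℝ =>
        mat δ (fun n => (pot T z.1 0 z.2 n : ℂ)) Λ n k := by
      intro Λ n k
      simp only [mat, Matrix.of_apply, pot]
      by_cases h : n = k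
      · have := hd n
        simp only [h, if_true]
        have := hd k
        fun_prop
      · simp only [h, if_false]; fun_prop
    have e2 : ∀ (Λ : Finset (Fin d → ℤ)) (n k : Λ), Continuous fun z : (Fin d → ℝ) × ℝ =>
        mat δ (fun n => (pot T z.1 0 0 n : ℂ)) Λ n k := by
      intro Λ n k
      exact (e1 Λ n k).comp (by fun_prop : Continuous fun z : (Fin d → ℝ) × ℝ => (z.1, (0:ℝ)))
    simp only [elimA, sylv_apply]
    exact ((e1 _ _ _).mul continuous_const).sub (continuous_const.mul (e2 _ _ _))
  have h2 : Continuous fun z : (Fin d → ℝ) × ℝ => (elimA δ T z.1 R r z.2).adjugate :=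
    h1.matrix_adjugate
  have h3 := h1.matrix_det
  have h4 : Continuous fun z : (Fin d → ℝ) × ℝ => (elimA δ T z.1 R r z.2).adjugate p q :=
    h2.matrix_elem p q
  unfold minorFn
  fun_prop

lemma continuous_minorFn_update (hT : Continuous T) (ω : Fin d → ℝ) (p q) :
    Continuous fun z : ℝ × ℝ => minorFn (elimA δ T (Function.update ω i z.1) R r z.2) b p q := by
  have h2 : Continuous fun z : ℝ × ℝ => ((Function.update ω i z.1 : Fin d → ℝ), z.2) :=
    ((continuous_const (y := ω)).update i (continuous_fst (X := ℝ) (Y := ℝ))).prodMk continuous_snd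
  generalize hF : (fun z : (Fin d → ℝ) × ℝ => minorFn (elimA δ T z.1 R r z.2) b p q) = F
  have hFc : Continuous F := hF ▸ continuous_minorFn_elimA hT p q
  have h3 : (fun z : ℝ × ℝ => minorFn (elimA δ T (Function.update ω i z.1) R r z.2) b p q) =
      fun z => F (Function.update ω i z.1, z.2) := by
    rw [← hF]
  rw [h3]
  exact hFc.comp h2

lemma minorFn_elimA_line (hT : (fun t => (T t : ℂ)) ∈ TrigPoly m₀) (ω : Fin d → ℝ) (a : ℤ) (c : ℝ)
    {D : ℕ} (hD : ∀ k ∈ R, (a + k i).natAbs ≤ D) (hr : r ≤ D) (p q) :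
    (fun s : ℝ => (minorFn (elimA δ T (Function.update ω i s) R r (c + a * s)) b p q : ℂ)) ∈
      TrigPoly (2 * (R.card * (2 * r + 1) ^ d * (D * m₀))) := by
  have hc : Fintype.card (R × (Q (0 : Fin d → ℤ) r)) = R.card * (2 * r + 1) ^ d := by
    rw [Fintype.card_prod, Fintype.card_coe, Fintype.card_coe, card_Q]
  rw [← hc]
  have e1 : ∀ (Λ : Finset (Fin d → ℤ)) (c : ℝ) (a : ℤ), (∀ k ∈ Λ, (a + k i).natAbs ≤ D) →
      ∀ n k : Λ, (fun s : ℝ => mat δ (fun n =>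
        (pot T (Function.update ω i s) 0 (c + a * s) n : ℂ)) Λ n k) ∈ TrigPoly (D * m₀) := by
    intro Λ c a ha n k
    simp only [mat, Matrix.of_apply]
    refine Submodule.add_mem _ (TrigPoly.const_mem _ _) ?_
    by_cases h : n = k
    · simp only [h, if_true, pot, sub_zero]
      have h1 := TrigPoly.comp_affine hT (a + k.1 i) (c + dotw (Function.update ω i 0) k)
      refine TrigPoly.mono (Nat.mul_le_mul_right _ (ha k k.2)) ?_
      convert h1 using 4 with s
      rw [dotw_update]; push_cast; ring
    · simp only [h, if_false]
      exact Submodule.zero_mem _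
  refine minorFn_mem (fun p q => ?_) b p q
  simp only [elimA, sylv_apply]
  have hK := e1 (Q (0 : Fin d → ℤ) r) 0 0 (fun k hk => by
    have := (natAbs_le_sd k 0 i).trans (mem_Q.1 hk)
    simp only [Pi.zero_apply, sub_zero] at this
    omega) p.2 q.2
  simp only [Int.cast_zero, zero_mul, add_zero] at hK
  refine Submodule.sub_mem _ ?_ ?_
  · simp only [mul_comm _ (ite _ _ _)]
    exact Submodule.smul_mem _ _ (e1 R c a hD p.1 q.1)
  · exact Submodule.smul_mem _ _ hK

lemma elim_cells (hT : (fun t => (T t : ℂ)) ∈ TrigPoly m₀) (ω : Fin d → ℝ) (p q) {P M D₀ D₁ : ℕ}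
    (hP : 0 < P) (hM : 0 < M) {τ N : ℝ} (hτ : 0 ≤ τ) (hN : 0 < N) {S : Set ℝ}
    (hthin : ∀ s ∈ S, ∀ s' ∈ Set.Icc (0:ℝ) 1, |s' - s| ≤ 1 / P → volume {y : ℝ | y ∈ Set.Icc (0:ℝ) 1 ∧
      0 ≤ minorFn (elimA δ T (Function.update ω i s') R r y) b p q} ≤ ENNReal.ofReal τ)
    (hMτ : M * (M * τ) ≤ 1) (𝒩 : Finset (Fin d → ℤ)) (hN1 : ∀ n ∈ 𝒩, N ≤ |(n i : ℝ)|)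
    (hN2 : ∀ n ∈ 𝒩, (n i).natAbs ≤ D₁) (hD1 : D₁ ≤ P * M)
    (hR : ∀ k ∈ R, (k i).natAbs ≤ D₀) (hr : r ≤ D₀) :
    volume {s : ℝ | s ∈ Set.Icc (0:ℝ) 1 ∧ s ∈ S ∧ ∃ n ∈ 𝒩,
      0 ≤ minorFn (elimA δ T (Function.update ω i s) R r (dotw (Function.update ω i s) n)) b p q} ≤
      ENNReal.ofReal (P * (4 / N * (2 * ((4 * (R.card * (2 * r + 1) ^ d * (D₀ * m₀)) : ℕ) + 1) + 1)) +
        𝒩.card * (4 * (R.card * (2 * r + 1) ^ d * ((D₀ + D₁) * m₀)) : ℕ) / M) := by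
  have hP0 : (0:ℝ) < P := by exact_mod_cast hP
  have hM0 : (0:ℝ) < M := by exact_mod_cast hM
  obtain ⟨m, hm⟩ : ∃ m, m = 4 * (R.card * (2 * r + 1) ^ d * (D₀ * m₀)) := ⟨_, rfl⟩
  obtain ⟨m', hm'⟩ : ∃ m, m = 4 * (R.card * (2 * r + 1) ^ d * ((D₀ + D₁) * m₀)) := ⟨_, rfl⟩
  rw [← hm, ← hm']
  obtain ⟨h, hh⟩ : ∃ h : ℝ, h = 1 / (P * M) := ⟨_, rfl⟩
  have hh0 : 0 < h := hh ▸ by positivity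
  have hMh : M * h = 1 / P := by rw [hh]; field_simp
  have hTc : Continuous T := by
    have := Complex.continuous_re.comp (TrigPoly.continuous hT)
    simpa [Function.comp_def] using this
  obtain ⟨g, hg⟩ : ∃ g : ℝ → ℝ → ℝ, g = fun s y =>
    minorFn (elimA δ T (Function.update ω i s) R r y) b p q := ⟨_, rfl⟩
  have hgc : Continuous fun z : ℝ × ℝ => g z.1 z.2 := by
    rw [hg]
    exact continuous_minorFn_update hTc ω p q
  set cell : ℕ → Set ℝ := fun j => {s : ℝ | s ∈ Set.Ico ((j:ℝ) / P) (j / P + M * h) ∧ s ∈ S ∧ ∃ n ∈ 𝒩,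
      0 ≤ g s (dotw (Function.update ω i 0) n + n i * s)} with hcell
  have hsub : {s : ℝ | s ∈ Set.Icc (0:ℝ) 1 ∧ s ∈ S ∧ ∃ n ∈ 𝒩,
      0 ≤ minorFn (elimA δ T (Function.update ω i s) R r (dotw (Function.update ω i s) n)) b p q} ⊆
      {1} ∪ ⋃ j ∈ Finset.range P, cell j := by
    rintro s ⟨⟨hs0, hs1⟩, hs, n, hn, hneg⟩
    rcases hs1.eq_or_lt with h1 | h1
    · exact Or.inl h1
    · right
      rw [Set.mem_iUnion₂]
      have hf1 := Nat.floor_le (show 0 ≤ P * s by positivity)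
      have hf2 := Nat.lt_floor_add_one (P * s)
      refine ⟨⌊P * s⌋₊, ?_, ⟨?_, ?_⟩, hs, n, hn, ?_⟩
      · rw [Finset.mem_range, Nat.floor_lt (by positivity)]
        nlinarith
      · rw [div_le_iff₀ hP0, mul_comm s]; exact hf1
      · rw [hMh, ← add_div, lt_div_iff₀ hP0, mul_comm s]; exact hf2
      · rw [hg]; rw [dotw_update] at hneg; exact hneg
  have hone : ∀ j ∈ Finset.range P, volume (cell j) ≤
      ENNReal.ofReal (4 / N * (2 * (m + 1) + 1) + 𝒩.card * m' * h) := by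
    intro j hj
    have hj : j + 1 ≤ P := Finset.mem_range.1 hj
    by_cases hne : ∃ s₀ ∈ S, s₀ ∈ Set.Ico ((j:ℝ) / P) (j / P + M * h)
    swap
    · have : cell j = ∅ := by
        ext s
        simp only [Set.mem_empty_iff_false, iff_false]
        rintro ⟨h1, h2, -⟩
        exact hne ⟨s, h2, h1⟩
      rw [this]; simp
    obtain ⟨s₀, hs₀, hs₀'⟩ := hne
    have hu1 : (j:ℝ) / P + M * h ≤ 1 := by
      rw [hMh, ← add_div, div_le_one hP0]; exact_mod_cast hj
    refine le_trans (measure_mono ?_) ((steep_lines (g := g) hgc ?_ (u := (j:ℝ) / P) (h := h) (τ := τ)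
      (N := N) (M := M) (m := m) (m' := m') (by positivity) hh0 hu1 hτ hN ?_ ?_ 𝒩
      (fun n => dotw (Function.update ω i 0) n) (fun n => n i) hN1 ?_ ?_).trans ?_)
    · rintro s ⟨h1, -, h2⟩
      exact ⟨h1, h2⟩
    · intro s y k
      simp only [hg, elimA_add_int hT]
    · intro y hy Z hZ
      have := minorFn_elimA_line (δ := δ) (b := b) (i := i) (R := R) hT ω 0 y (D := D₀) (by simpa using hR) hr p q
      simp only [Int.cast_zero, zero_mul, add_zero] at this
      refine (TrigPoly.card_zeros_le this ?_ Z fun t ht => ⟨(hZ t ht).1, ?_⟩).trans (le_of_eq ?_)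
      · obtain ⟨s, hs⟩ := hy
        exact ⟨s, by rw [hg] at hs; exact_mod_cast hs⟩
      · have := (hZ t ht).2
        rw [hg] at this; exact_mod_cast this
      · rw [hm]; ring
    · intro s hs
      simp only [hg]
      refine hthin s₀ hs₀ s ⟨le_trans (by positivity) hs.1, hs.2.trans hu1⟩ ?_
      rw [abs_le, ← hMh]
      constructor <;> linarith [hs.1, hs.2, hs₀'.1, hs₀'.2]
    · intro n hn
      have h1 : |((n i : ℤ) : ℝ)| ≤ P * M := by
        rw [← Int.cast_abs, Int.abs_eq_natAbs]
        exact_mod_cast (hN2 n hn).trans hD1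
      rw [hh, mul_one_div]
      exact (div_le_one (by positivity)).2 h1
    · intro n hn hy Z hZ
      have := minorFn_elimA_line (δ := δ) (b := b) (i := i) (R := R) (r := r) hT ω (n i)
        (dotw (Function.update ω i 0) n) (D := D₀ + D₁)
        (fun k hk => by have := hR k hk; have := hN2 n hn; omega) (by omega) p q
      refine (TrigPoly.card_zeros_le this ?_ Z fun t ht => ⟨(hZ t ht).1, ?_⟩).trans (le_of_eq ?_)
      · obtain ⟨s, hs⟩ := hy
        exact ⟨s, by rw [hg] at hs; exact_mod_cast hs⟩
      · have := (hZ t ht).2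
        rw [hg] at this; exact_mod_cast this
      · rw [hm']; ring
    · refine ENNReal.ofReal_le_ofReal ?_
      gcongr
  refine (measure_mono hsub).trans ((measure_union_le _ _).trans ?_)
  rw [Real.volume_singleton, zero_add]
  refine (measure_biUnion_finset_le _ _).trans ((Finset.sum_le_card_nsmul _ _ _ hone).trans ?_)
  rw [Finset.card_range, nsmul_eq_mul, ← ENNReal.ofReal_natCast, ← ENNReal.ofReal_mul (by positivity)]
  refine ENNReal.ofReal_le_ofReal (le_of_eq ?_)
  rw [mul_add, hh]
  congr 1
  field_simp

end elim

/-- The frequencies with a resonance between a large box and a far away rectangle. -/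
def elimBad (δ : ℝ) (T : ℝ → ℝ) (A t : ℕ) : Set (Fin d → ℝ) :=
  {ω | ∃ r ≤ t ^ (27 * d + 30), ∃ a b : Fin d → ℤ, Finset.Icc a b ⊆ Q 0 (2 * t ^ 3) ∧
    (∀ i, a i + t ^ 3 ≤ b i) ∧ ∃ p q : (Finset.Icc a b) × (Q (0 : Fin d → ℤ) r), ∃ n : Fin d → ℤ,
      t ^ A ≤ sd n 0 ∧ sd n 0 ≤ 4 * t ^ (A * A) ∧
      0 ≤ minorFn (elimA δ T ω (Finset.Icc a b) r (dotw ω n)) (Real.exp (2 * t ^ 2)) p q}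

lemma mul_pow_le {t : ℕ} (ht : 100 ≤ t) {c n : ℕ} (hc : c ≤ 100) : c * t ^ n ≤ t ^ (n + 1) := by
  rw [pow_succ']; gcongr; omega

lemma exists_natAbs_eq_sd (hd : 1 ≤ d) (n : Fin d → ℤ) : ∃ i, (n i).natAbs = sd n 0 := by
  obtain ⟨i, -, hi⟩ := Finset.exists_max_image Finset.univ (fun i => (n i).natAbs) ⟨⟨0, hd⟩, Finset.mem_univ _⟩
  refine ⟨i, le_antisymm ?_ ((sd_le_iff).2 fun j => ?_)⟩
  · simpa using natAbs_le_sd n 0 i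
  · simpa using hi j (Finset.mem_univ _)

section elim

variable {f : ℝ → ℝ} {X : Ext f} {M : ℝ} {A t : ℕ} {δ : ℝ} {Tr : ℝ → ℝ} {r : ℕ}

lemma card_le_of_subset_Q (ht : 100 ≤ t) {R : Finset (Fin d → ℤ)} (hR : R ⊆ Q 0 (2 * t ^ 3)) :
    R.card ≤ t ^ (4 * d) := by
  refine (Finset.card_le_card hR).trans ?_
  rw [card_Q, pow_mul]
  gcongr
  have : 1 ≤ t ^ 3 := Nat.one_le_pow _ _ (by omega)
  have : 5 * t ^ 3 ≤ t ^ 4 := mul_pow_le ht (by norm_num)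
  omega

lemma box_card_le (ht : 100 ≤ t) (hr : r ≤ t ^ (27 * d + 30)) :
    (2 * r + 1) ^ d ≤ t ^ ((27 * d + 31) * d) := by
  rw [pow_mul]
  gcongr
  have : 1 ≤ t ^ (27 * d + 30) := Nat.one_le_pow _ _ (by omega)
  have : 3 * t ^ (27 * d + 30) ≤ t ^ (27 * d + 31) := mul_pow_le ht (by norm_num)
  omega

lemma isClosed_minorFn {b : ℝ} {R : Finset (Fin d → ℤ)} (hT : Continuous Tr) (n : Fin d → ℤ) (p q) :
    IsClosed {ω : Fin d → ℝ | 0 ≤ minorFn (elimA δ Tr ω R r (dotw ω n)) b p q} := by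
  generalize hF : (fun z : (Fin d → ℝ) × ℝ => minorFn (elimA δ Tr z.1 R r z.2) b p q) = F
  have hFc : Continuous F := hF ▸ continuous_minorFn_elimA hT p q
  have h3 : {ω : Fin d → ℝ | 0 ≤ minorFn (elimA δ Tr ω R r (dotw ω n)) b p q} =
      {ω | 0 ≤ F (ω, dotw ω n)} := by
    rw [← hF]
  rw [h3]
  exact isClosed_le continuous_const (hFc.comp (continuous_id.prodMk (continuous_dotw n)))

/-- The measure bound for a single choice of the parameters. -/
lemma elim_one (hd : 1 ≤ d) (hA : 1000 * (d + 1) ^ 2 ≤ A) (h : AtScale d X M A t)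
    (hT : (fun s => (Tr s : ℂ)) ∈ TrigPoly (t ^ 10)) (hr : r ≤ t ^ (27 * d + 30))
    {R : Finset (Fin d → ℤ)} (hR : R ⊆ Q 0 (2 * t ^ 3)) (i : Fin d) (p q) {S : Set (Fin d → ℝ)}
    (hS : MeasurableSet S)
    (hthin : ∀ ω s, Function.update ω i s ∈ S → ∀ s', |s' - s| ≤ 1 / t ^ (9 * (d + 4)) →
      volume {y : ℝ | y ∈ Set.Icc (0:ℝ) 1 ∧
        0 ≤ minorFn (elimA δ Tr (Function.update ω i s') R r y) (Real.exp (2 * t ^ 2)) p q} ≤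
        ENNReal.ofReal ((2 * r + 1 : ℕ) ^ d * (100 * Real.exp (-((16 * t - 5) / 8))))) :
    volume (Set.Icc 0 1 ∩ {ω | ω ∈ S ∧ ∃ n : Fin d → ℤ,
      (t ^ A ≤ sd n 0 ∧ sd n 0 ≤ 4 * t ^ (A * A)) ∧ (n i).natAbs = sd n 0 ∧
      0 ≤ minorFn (elimA δ Tr ω R r (dotw ω n)) (Real.exp (2 * t ^ 2)) p q}) ≤
      ENNReal.ofReal (2 / t ^ (54 * d ^ 2 + 105 * d + 34)) := by
  classical
  have ht := h.large
  have ht' : (100:ℝ) ≤ t := by exact_mod_cast ht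
  have ht0 : 0 < t := by omega
  obtain ⟨𝒩, h𝒩⟩ : ∃ 𝒩 : Finset (Fin d → ℤ), 𝒩 = (Q 0 (4 * t ^ (A * A))).filter
    fun n => t ^ A ≤ sd n 0 ∧ (n i).natAbs = sd n 0 := ⟨_, rfl⟩
  have hmem : ∀ n, n ∈ 𝒩 ↔ sd n 0 ≤ 4 * t ^ (A * A) ∧ t ^ A ≤ sd n 0 ∧ (n i).natAbs = sd n 0 := by
    intro n; rw [h𝒩, Finset.mem_filter, mem_Q]
  have hcN : 𝒩.card ≤ t ^ ((A * A + 1) * d) := by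
    rw [h𝒩]
    refine (Finset.card_filter_le _ _).trans ?_
    rw [card_Q, pow_mul t (A * A + 1) d]
    gcongr
    have : 1 ≤ t ^ (A * A) := Nat.one_le_pow _ _ ht0
    have : 9 * t ^ (A * A) ≤ t ^ (A * A + 1) := mul_pow_le ht (by norm_num)
    linarith
  obtain ⟨V, hV⟩ : ∃ V, V = R.card * (2 * r + 1) ^ d := ⟨_, rfl⟩
  have hVle : V ≤ t ^ ((27 * d + 35) * d) := by
    rw [hV]
    calc _ ≤ t ^ (4 * d) * t ^ ((27 * d + 31) * d) :=
          Nat.mul_le_mul (card_le_of_subset_Q ht hR) (box_card_le ht hr)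
      _ = _ := by rw [← pow_add]; congr 1; ring
  have hTc : Continuous Tr := by
    have := Complex.continuous_re.comp (TrigPoly.continuous hT)
    simpa [Function.comp_def] using this
  have hset : {ω | ω ∈ S ∧ ∃ n : Fin d → ℤ,
      (t ^ A ≤ sd n 0 ∧ sd n 0 ≤ 4 * t ^ (A * A)) ∧ (n i).natAbs = sd n 0 ∧
      0 ≤ minorFn (elimA δ Tr ω R r (dotw ω n)) (Real.exp (2 * t ^ 2)) p q} =
      S ∩ ⋃ n ∈ 𝒩, {ω | 0 ≤ minorFn (elimA δ Tr ω R r (dotw ω n)) (Real.exp (2 * t ^ 2)) p q} := by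
    ext ω
    constructor
    · rintro ⟨h1, n, h2, h3, h4⟩
      exact ⟨h1, Set.mem_iUnion₂.2 ⟨n, (hmem n).2 ⟨h2.2, h2.1, h3⟩, h4⟩⟩
    · rintro ⟨h1, h2⟩
      obtain ⟨n, h3, h4⟩ := Set.mem_iUnion₂.1 h2
      have := (hmem n).1 h3
      exact ⟨h1, n, ⟨this.2.1, this.1⟩, this.2.2, h4⟩
  rw [hset]
  have hA2 : 81 * d ^ 2 + 176 * d + 120 ≤ A := by nlinarith
  have h16 : ∀ n : ℕ, n ≤ A ^ 6 → (t:ℝ) ^ n ≤ Real.exp t := fun n hn => h.pow_le hn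
  refine volume_le_of_slices (hS.inter (Finset.measurableSet_biUnion _ fun n _ =>
    (isClosed_minorFn hTc n p q).measurableSet)) i fun ω _ => ?_
  refine le_trans (measure_mono ?_) ((elim_cells (i := i) (δ := δ) (b := Real.exp (2 * t ^ 2)) hT ω p q
    (P := t ^ (9 * (d + 4))) (M := t ^ (A ^ 3)) (D₀ := t ^ (27 * d + 30)) (D₁ := 4 * t ^ (A * A))
    (τ := (2 * r + 1 : ℕ) ^ d * (100 * Real.exp (-((16 * t - 5) / 8)))) (N := (t:ℝ) ^ A)
    (S := {s | Function.update ω i s ∈ S}) (by positivity) (by positivity) (by positivity)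
    (by positivity) ?_ ?_ 𝒩 ?_ ?_ ?_ ?_ hr).trans (ENNReal.ofReal_le_ofReal ?_))
  · rintro s ⟨h1, h2, h3⟩
    obtain ⟨n, h4, h5⟩ := Set.mem_iUnion₂.1 h3
    exact ⟨h1, h2, n, h4, h5⟩
  · intro s hs s' _ hss
    exact hthin ω s hs s' (by push_cast at hss; exact hss)
  · have h1 : ((2 * r + 1 : ℕ) ^ d : ℝ) ≤ t ^ ((27 * d + 31) * d) := by exact_mod_cast box_card_le ht hr
    have h2 : Real.exp (-((16 * t - 5) / 8)) = Real.exp (5 / 8) * Real.exp (-t) * Real.exp (-t) := by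
      rw [← Real.exp_add, ← Real.exp_add]; congr 1; ring
    have h3 : Real.exp (5 / 8) ≤ t := by
      have := Real.exp_le_exp.2 (show (5:ℝ) / 8 ≤ 1 by norm_num)
      linarith [Real.exp_one_lt_d9]
    have h4 : (t:ℝ) ^ (2 * A ^ 3 + (27 * d + 31) * d + 2) ≤ Real.exp t := by
      refine h16 _ ?_
      have h5 : A ^ 6 = A ^ 3 * A ^ 3 := by ring
      have h6 : A ≤ A ^ 3 := Nat.le_self_pow (by norm_num) A
      have h7 : (27 * d + 31) * d + 2 ≤ A := by nlinarith
      rw [h5]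
      nlinarith
    push_cast at h1 ⊢
    have he0 := Real.exp_pos (-(t:ℝ))
    calc _ ≤ (t:ℝ) ^ A ^ 3 * ((t:ℝ) ^ A ^ 3 * ((t:ℝ) ^ ((27 * d + 31) * d) * (t * (t * Real.exp (-t) * Real.exp (-t))))) := by
          rw [h2]; gcongr
      _ = (t:ℝ) ^ (2 * A ^ 3 + (27 * d + 31) * d + 2) * Real.exp (-t) * Real.exp (-t) := by
          ring
      _ ≤ Real.exp t * Real.exp (-t) * Real.exp (-t) := by gcongr
      _ = Real.exp (-t) := by rw [← Real.exp_add]; simp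
      _ ≤ 1 := Real.exp_le_one_iff.2 (by linarith)
  · intro n hn
    have := (hmem n).1 hn
    rw [← Int.cast_abs, Int.abs_eq_natAbs, this.2.2]
    exact_mod_cast this.2.1
  · intro n hn
    have := (hmem n).1 hn
    omega
  · calc 4 * t ^ (A * A) ≤ t ^ (A * A + 1) := mul_pow_le ht (by norm_num)
      _ ≤ t ^ (9 * (d + 4) + A ^ 3) := Nat.pow_le_pow_right ht0 (by nlinarith [sq_nonneg A])
      _ = _ := by rw [pow_add]
  · intro k hk
    have h1 := mem_Q.1 (hR hk)
    have h2 := natAbs_le_sd k 0 i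
    simp only [Pi.zero_apply, sub_zero] at h2
    have h3 : 2 * t ^ 3 ≤ t ^ (3 + 1) := mul_pow_le ht (by norm_num)
    have h4 : t ^ (3 + 1) ≤ t ^ (27 * d + 30) := Nat.pow_le_pow_right ht0 (by omega)
    omega
  · rw [← hV]
    have e1 : (t:ℝ) ^ (9 * (d + 4)) * (4 / (t:ℝ) ^ A * (2 * ((4 * (V * (t ^ (27 * d + 30) * t ^ 10)) : ℕ) + 1) + 1)) ≤
        1 / t ^ (54 * d ^ 2 + 105 * d + 34) := by
      have h1 : 2 * (4 * (V * (t ^ (27 * d + 30) * t ^ 10)) + 1) + 1 ≤ 11 * t ^ ((27 * d + 35) * d + (27 * d + 40)) := by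
        have h2 : V * (t ^ (27 * d + 30) * t ^ 10) ≤ t ^ ((27 * d + 35) * d + (27 * d + 40)) := by
          calc _ ≤ t ^ ((27 * d + 35) * d) * (t ^ (27 * d + 30) * t ^ 10) := Nat.mul_le_mul_right _ hVle
            _ = _ := by rw [← pow_add, ← pow_add]
        have h3 : 1 ≤ t ^ ((27 * d + 35) * d + (27 * d + 40)) := Nat.one_le_pow _ _ ht0
        omega
      have h1' : (2 * (((4 * (V * (t ^ (27 * d + 30) * t ^ 10)) : ℕ) : ℝ) + 1) + 1) ≤
          11 * t ^ ((27 * d + 35) * d + (27 * d + 40)) := by exact_mod_cast h1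
      calc _ ≤ (t:ℝ) ^ (9 * (d + 4)) * (4 / (t:ℝ) ^ A * (11 * t ^ ((27 * d + 35) * d + (27 * d + 40)))) := by gcongr
        _ = 44 * (t:ℝ) ^ (27 * d ^ 2 + 71 * d + 76) / t ^ A := by
            ring
        _ ≤ t * (t:ℝ) ^ (27 * d ^ 2 + 71 * d + 76) / t ^ A := by gcongr; linarith
        _ ≤ _ := by
            rw [div_le_div_iff₀ (by positivity) (by positivity), ← pow_succ', ← pow_add, one_mul]
            exact pow_le_pow_right₀ (by linarith) (by nlinarith)
    have e2 : 𝒩.card * ((4 * (V * ((t ^ (27 * d + 30) + 4 * t ^ (A * A)) * t ^ 10)) : ℕ) : ℝ) / (t ^ (A ^ 3) : ℕ) ≤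
        1 / t ^ (54 * d ^ 2 + 105 * d + 34) := by
      have h1 : 𝒩.card * (4 * (V * ((t ^ (27 * d + 30) + 4 * t ^ (A * A)) * t ^ 10))) ≤
          t ^ ((A * A + 1) * d + (27 * d + 35) * d + A * A + 12) := by
        have h2 : t ^ (27 * d + 30) ≤ t ^ (A * A) := Nat.pow_le_pow_right ht0 (by nlinarith)
        calc _ ≤ t ^ ((A * A + 1) * d) * (4 * (t ^ ((27 * d + 35) * d) * ((t ^ (A * A) + 4 * t ^ (A * A)) * t ^ 10))) := by
              gcongr
          _ = 20 * t ^ ((A * A + 1) * d + (27 * d + 35) * d + A * A + 10) := by ring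
          _ ≤ t ^ ((A * A + 1) * d + (27 * d + 35) * d + A * A + 10 + 1) := mul_pow_le ht (by norm_num)
          _ ≤ _ := Nat.pow_le_pow_right ht0 (by omega)
      have h1' : (𝒩.card * ((4 * (V * ((t ^ (27 * d + 30) + 4 * t ^ (A * A)) * t ^ 10)) : ℕ) : ℝ)) ≤
          t ^ ((A * A + 1) * d + (27 * d + 35) * d + A * A + 12) := by exact_mod_cast h1
      push_cast at h1' ⊢
      rw [div_le_div_iff₀ (by positivity) (by positivity), one_mul]
      calc _ ≤ (t:ℝ) ^ ((A * A + 1) * d + (27 * d + 35) * d + A * A + 12) * t ^ (54 * d ^ 2 + 105 * d + 34) := by gcongr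
        _ = (t:ℝ) ^ ((A * A + 1) * d + (27 * d + 35) * d + A * A + 12 + (54 * d ^ 2 + 105 * d + 34)) := by
            rw [← pow_add]
        _ ≤ _ := pow_le_pow_right₀ (by linarith) (by
            have h3 : A ^ 3 = A * (A * A) := by ring
            have h4 : d + 2 ≤ A := by nlinarith
            have h5 : (d + 2) * (A * A) ≤ A * (A * A) := Nat.mul_le_mul_right _ h4
            have h6 : A ≤ A * A := Nat.le_mul_self A
            rw [h3]
            nlinarith)
    have e3 : (2:ℝ) / t ^ (54 * d ^ 2 + 105 * d + 34) = 1 / t ^ (54 * d ^ 2 + 105 * d + 34) +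
      1 / t ^ (54 * d ^ 2 + 105 * d + 34) := by ring
    rw [e3]
    refine add_le_add ?_ e2
    push_cast at e1 ⊢
    exact e1

end elim

/-- The standing assumptions: `T` is a large initial scale and the hopping `δ` is small. -/
structure Setup (d : ℕ) {f : ℝ → ℝ} (X : Ext f) (M : ℝ) (A T : ℕ) (δ : ℝ) : Prop where
  hd : 1 ≤ d
  hf : ∀ x, f (x + 1) = f x
  hM : 1 ≤ M
  hA : 1000 * (d + 1) ^ 2 ≤ A
  hsub : ∀ E S : ℝ, 0 ≤ S →
      volume {x : ℝ | x ∈ Set.Icc (0:ℝ) 1 ∧ |f x - E| < Real.exp (-(S * M))} ≤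
        ENNReal.ofReal (100 * Real.exp (-((S - 5) / 8)))
  h3 : 3 ^ d ≤ T
  hT : ∀ t, T ≤ t → AtScale d X M A t
  hδ : 0 < δ
  hδT : δ * 3 ^ d * Real.exp 2 ≤ Real.exp (-((sca A T 1 : ℕ) ^ 2)) / 2

variable {f : ℝ → ℝ} {X : Ext f} {M : ℝ} {A T : ℕ} {δ : ℝ}

lemma Setup.hA' (S : Setup d X M A T δ) : 100 * (d + 1) ≤ A := by have := S.hA; nlinarith

lemma Setup.at (S : Setup d X M A T δ) (k : ℕ) : AtScale d X M A (sca A T k) :=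
  S.hT _ (le_sca (by have := S.hA'; omega) k)

lemma Setup.sca_mono (S : Setup d X M A T δ) {j k : ℕ} (h : j ≤ k) : sca A T j ≤ sca A T k := by
  have h0 := (S.at 0).large
  have h1 := S.hA'
  rw [sca_zero] at h0
  exact Nat.pow_le_pow_right (by omega) (Nat.pow_le_pow_right (by omega) h)

lemma Setup.hδ1 (S : Setup d X M A T δ) : δ * 3 ^ d ≤ 1 := mul_three_pow_le_one S.hδT S.hδ.le

lemma Setup.ldt (S : Setup d X M A T δ) {ω : Fin d → ℝ} {k : ℕ}
    (hsep : ∀ i ≤ k, SepAt ω (sca A T i) 1) :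
    LDTm δ f ω (sca A T k) ∧ LDTc δ f ω (sca A T k) (sca A T k ^ (27 * d + 11)) :=
  ldt_all S.hf S.hM S.hA' S.hsub S.hT S.hδ.le S.hδT hsep k le_rfl

lemma Setup.stepScales (S : Setup d X M A T δ) (k : ℕ) :
    StepScales d X.ρ X.C (sca A T k) (sca A T (k + 1)) (sca A T (k + 2))
      (sca A T k ^ (27 * d + 11)) :=
  (S.at k).stepScales S.hA' (sca_succ ..) (sca_succ ..)

lemma sca_add (A T k m : ℕ) : sca A T (k + m) = sca A T k ^ (A ^ m) := by
  rw [sca, sca, ← pow_mul, pow_add]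

lemma Setup.sep (S : Setup d X M A T δ) {k m : ℕ} (hm : m ≤ 4) {c : ℝ} (hc : 1 ≤ c)
    {ω : Fin d → ℝ} (h : SepAt ω (sca A T (k + m)) c) :
    Sep ω (sca A T (k + m) ^ 9) (Real.exp (-(sca A T k : ℕ))) :=
  (S.at k).sep S.hA' hm (sca_add ..) hc h

lemma AtScale.pow_six_le {t : ℕ} (h : AtScale d X M A t) : A ^ 6 ≤ t := by
  have ht : (100:ℝ) ≤ t := by exact_mod_cast h.large
  have h1 : Real.exp 1 ≤ t := by linarith [Real.exp_one_lt_d9]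
  have h2 : Real.exp ((A ^ 6 : ℕ) : ℝ) ≤ Real.exp t := by
    rw [← mul_one ((A ^ 6 : ℕ) : ℝ), Real.exp_nat_mul]
    exact (pow_le_pow_left₀ (Real.exp_pos _).le h1 _).trans h.hE
  exact_mod_cast Real.exp_le_exp.1 h2

lemma measure_biUnion_finset_le_card_mul {α ι : Type*} [MeasurableSpace α] {μ : Measure α}
    (s : Finset ι) {U : ι → Set α} {c : ℝ} {N : ℕ} (hN : s.card ≤ N)
    (h : ∀ i ∈ s, μ (U i) ≤ ENNReal.ofReal c) : μ (⋃ i ∈ s, U i) ≤ ENNReal.ofReal (N * c) := by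
  refine (measure_biUnion_finset_le s U).trans ((Finset.sum_le_card_nsmul s _ _ h).trans ?_)
  rw [nsmul_eq_mul, ENNReal.ofReal_mul (by positivity), ENNReal.ofReal_natCast]
  gcongr

/-- Eliminating the energy: the rectangle `Icc a b` is rarely resonant with a box, uniformly. -/
lemma Setup.elim_thin (S : Setup d X M A T δ) {k : ℕ} {Tr : ℝ → ℝ}
    (hTr : ∀ x, |f x - Tr x| ≤ Real.exp (-(sca A T (k + 2) : ℕ) ^ 9))
    {ω : Fin d → ℝ} (hsep : ∀ i ≤ k + 2, SepAt ω (sca A T i) 1) {a b : Fin d → ℤ} {r : ℕ}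
    (hR : Finset.Icc a b ⊆ Q 0 (2 * sca A T (k + 2) ^ 3))
    (hab : ∀ i, a i + (sca A T (k + 2) : ℕ) ^ 3 ≤ b i) (p q) :
    volume {y : ℝ | y ∈ Set.Icc (0:ℝ) 1 ∧ 0 ≤ minorFn (elimA δ Tr ω (Finset.Icc a b) r y)
      (Real.exp (2 * (sca A T (k + 2) : ℕ) ^ 2)) p q} ≤
        ENNReal.ofReal ((2 * r + 1 : ℕ) ^ d *
          (100 * Real.exp (-((16 * (sca A T (k + 2) : ℕ) - 5) / 8)))) := by
  have hat := S.at (k + 2)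
  have hs2 : Sep ω (2 * sca A T (k + 2) ^ 8) (Real.exp (-(sca A T k : ℕ))) :=
    (S.sep (by norm_num) le_rfl (hsep (k + 2) le_rfl)).mono (by
      have h100 := hat.large
      have : 2 * sca A T (k + 2) ^ 8 ≤ sca A T (k + 2) ^ 9 := mul_pow_le h100 (by norm_num)
      exact this) le_rfl
  have hst := S.stepScales k
  have hc := (S.ldt fun i (hi : i ≤ k) => hsep i (by omega)).2
  have hm := (S.ldt fun i (hi : i ≤ k + 1) => hsep i (by omega)).1
  obtain ⟨t, ht⟩ : ∃ t, t = sca A T (k + 2) := ⟨_, rfl⟩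
  rw [← ht] at hTr hR hab hat hs2 hst ⊢
  have h100 := hat.large
  have h100' : (100:ℝ) ≤ t := by exact_mod_cast h100
  have hcard : ((Finset.Icc a b).card : ℝ) ≤ Real.exp t := by
    refine le_trans ?_ (hat.pow_le (n := 4 * d) ?_)
    · exact_mod_cast card_le_of_subset_Q h100 hR
    · have := S.hA'
      have : A ≤ A ^ 6 := Nat.le_self_pow (by norm_num) A
      omega
  have h0t : (0:ℝ) ≤ t := by linarith
  have hp : (100:ℝ) * t ^ 2 ≤ t ^ 9 := by
    calc (100:ℝ) * t ^ 2 ≤ t ^ 7 * t ^ 2 := by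
          gcongr
          exact h100'.trans (le_self_pow₀ (by linarith) (by norm_num))
      _ = _ := by ring
  have htt : 100 * (t:ℝ) ≤ t ^ 2 := by rw [sq]; gcongr
  have hbnd : Real.exp (-(t:ℝ) ^ 9) * (Real.exp t * Real.exp (t ^ 2)) ≤ Real.exp (-1) := by
    rw [← Real.exp_add, ← Real.exp_add]
    exact Real.exp_le_exp.2 (by linarith)
  have he1 : Real.exp (-1) ≤ 1 / 2 := by
    rw [Real.exp_neg, ← one_div]
    exact one_div_le_one_div_of_le (by norm_num) (by linarith [Real.exp_one_gt_d9])
  refine AL.elim_thin S.hδ.le (Real.exp_pos _).le hTr (fun E => ?_) (b := Real.exp (t ^ 2)) ?_ ?_ p q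
  · refine rect_measure_scales S.hf X S.hδ.le S.hδ1 E hst hc hm hs2 hab fun i => ?_
    have hai := mem_Q.1 (hR (Finset.mem_Icc.2 ⟨le_rfl, fun j => by have := hab j; linarith [show (0:ℤ) ≤ (t:ℤ) ^ 3 by positivity]⟩))
    have hbi := mem_Q.1 (hR (Finset.mem_Icc.2 ⟨fun j => by have := hab j; linarith [show (0:ℤ) ≤ (t:ℤ) ^ 3 by positivity], le_rfl⟩))
    have h1 := natAbs_le_sd a 0 i
    have h2 := natAbs_le_sd b 0 i
    simp only [Pi.zero_apply, sub_zero] at h1 h2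
    have h3 : 2 * t ^ 3 ≤ t ^ (3 + 1) := mul_pow_le h100 (by norm_num)
    have h4 : t ^ (3 + 1) ≤ t ^ 8 := Nat.pow_le_pow_right (by omega) (by norm_num)
    omega
  · refine le_trans ?_ he1
    refine le_trans ?_ hbnd
    gcongr
  · have : 2 * ((Finset.Icc a b).card : ℝ) * Real.exp (t ^ 2) ^ 2 * Real.exp (-(t:ℝ) ^ 9) ≤
        Real.exp (t ^ 2) := by
      have h2 : (2:ℝ) ≤ Real.exp t := by linarith [Real.add_one_le_exp (t:ℝ)]
      calc _ ≤ Real.exp t * Real.exp t * Real.exp (t ^ 2) ^ 2 * Real.exp (-(t:ℝ) ^ 9) := by gcongr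
        _ = Real.exp (t + t + (t ^ 2 + t ^ 2) - t ^ 9) := by
            rw [sub_eq_add_neg, Real.exp_add, Real.exp_add, Real.exp_add, Real.exp_add, sq (Real.exp _)]
        _ ≤ _ := Real.exp_le_exp.2 (by nlinarith only [hp, htt, h100'])
    have h3 : Real.exp (2 * t ^ 2) = Real.exp (t ^ 2) * Real.exp (t ^ 2) := by
      rw [← Real.exp_add]; congr 1; ring
    have h4 : (2:ℝ) < Real.exp (t ^ 2) := by
      have := Real.add_one_le_exp ((t:ℝ) ^ 2)
      nlinarith only [this, h100']
    have h5 := Real.exp_pos ((t:ℝ) ^ 2)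
    rw [h3]
    nlinarith only [this, h4, h5]

lemma Setup.elim_measure (S : Setup d X M A T δ) {k : ℕ} {Tr : ℝ → ℝ}
    (hTp : (fun s => (Tr s : ℂ)) ∈ TrigPoly (sca A T (k + 2) ^ 10))
    (hTr : ∀ x, |f x - Tr x| ≤ Real.exp (-(sca A T (k + 2) : ℕ) ^ 9)) :
    volume (Set.Icc (0 : Fin d → ℝ) 1 ∩ ({ω | ∀ i ≤ k + 2, SepAt ω (sca A T i) 2} ∩
      elimBad δ Tr A (sca A T (k + 2)))) ≤ ENNReal.ofReal (1 / (sca A T (k + 2) : ℕ)) := by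
  classical
  have hat := S.at (k + 2)
  obtain ⟨W, hW⟩ : ∃ W : Set (Fin d → ℝ), W = {ω | ∀ i ≤ k + 2, SepAt ω (sca A T i) 2} := ⟨_, rfl⟩
  have hWm : MeasurableSet W := by
    have : W = ⋂ i ∈ Finset.range (k + 3), {ω | SepAt ω (sca A T i) 2} := by
      rw [hW]; ext ω; simp [Nat.lt_succ_iff]
    rw [this]
    exact Finset.measurableSet_biInter _ fun i _ => (isClosed_sep _ _).measurableSet
  have hthin : ∀ (a b : Fin d → ℤ) (r : ℕ), Finset.Icc a b ⊆ Q 0 (2 * sca A T (k + 2) ^ 3) →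
      (∀ i, a i + (sca A T (k + 2) : ℕ) ^ 3 ≤ b i) → ∀ p q, ∀ (i : Fin d) ω s,
      Function.update ω i s ∈ W → ∀ s', |s' - s| ≤ 1 / (sca A T (k + 2) : ℕ) ^ (9 * (d + 4)) →
      volume {y : ℝ | y ∈ Set.Icc (0:ℝ) 1 ∧ 0 ≤ minorFn (elimA δ Tr (Function.update ω i s')
        (Finset.Icc a b) r y) (Real.exp (2 * (sca A T (k + 2) : ℕ) ^ 2)) p q} ≤
        ENNReal.ofReal ((2 * r + 1 : ℕ) ^ d *
          (100 * Real.exp (-((16 * (sca A T (k + 2) : ℕ) - 5) / 8)))) := by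
    intro a b r hR hab p q i ω s hs s' hss
    rw [hW] at hs
    exact S.elim_thin hTr (fun j hj => SepAt.update (by have := (S.at j).large; omega)
      (S.sca_mono hj) (hs j hj) hss) hR hab p q
  rw [← hW]
  obtain ⟨t, ht⟩ : ∃ t, t = sca A T (k + 2) := ⟨_, rfl⟩
  rw [← ht] at hTp hat ⊢
  simp only [← ht] at hthin
  have h100 := hat.large
  have h100' : (100:ℝ) ≤ t := by exact_mod_cast h100
  obtain ⟨𝒥, h𝒥⟩ : ∃ 𝒥 : Finset (ℕ × (Fin d → ℤ) × (Fin d → ℤ)), 𝒥 =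
    (Finset.range (t ^ (27 * d + 30) + 1) ×ˢ Q 0 (2 * t ^ 3) ×ˢ Q 0 (2 * t ^ 3)).filter
      fun j => Finset.Icc j.2.1 j.2.2 ⊆ Q 0 (2 * t ^ 3) ∧ ∀ i, j.2.1 i + (t : ℤ) ^ 3 ≤ j.2.2 i := ⟨_, rfl⟩
  have hQc : (Q (0 : Fin d → ℤ) (2 * t ^ 3)).card ≤ t ^ (4 * d) := card_le_of_subset_Q h100 subset_rfl
  have hJc : 𝒥.card ≤ 2 * t ^ (27 * d + 30) * (t ^ (4 * d) * t ^ (4 * d)) := by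
    rw [h𝒥]
    refine (Finset.card_filter_le _ _).trans ?_
    rw [Finset.card_product, Finset.card_product, Finset.card_range]
    gcongr
    have : 1 ≤ t ^ (27 * d + 30) := Nat.one_le_pow _ _ (by omega)
    omega
  have hpc : ∀ j ∈ 𝒥, (Finset.univ : Finset ((Finset.Icc j.2.1 j.2.2) × (Q (0 : Fin d → ℤ) j.1))).card ≤
      t ^ (4 * d) * t ^ ((27 * d + 31) * d) := by
    intro j hj
    rw [h𝒥, Finset.mem_filter] at hj
    have h1 := Finset.mem_range.1 (Finset.mem_product.1 hj.1).1
    rw [Finset.card_univ, Fintype.card_prod, Fintype.card_coe, Fintype.card_coe, card_Q]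
    exact Nat.mul_le_mul (card_le_of_subset_Q h100 hj.2.1) (box_card_le h100 (by omega))
  obtain ⟨c, hc⟩ : ∃ c : ℝ, c = 2 / t ^ (54 * d ^ 2 + 105 * d + 34) := ⟨_, rfl⟩
  have hc0 : 0 ≤ c := by rw [hc]; positivity
  obtain ⟨N, hN⟩ : ∃ N, N = t ^ (4 * d) * t ^ ((27 * d + 31) * d) := ⟨_, rfl⟩
  rw [← hN] at hpc
  have hmain : volume (⋃ i ∈ (Finset.univ : Finset (Fin d)), ⋃ j ∈ 𝒥,
      ⋃ p ∈ (Finset.univ : Finset ((Finset.Icc j.2.1 j.2.2) × (Q (0 : Fin d → ℤ) j.1))),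
      ⋃ q ∈ (Finset.univ : Finset ((Finset.Icc j.2.1 j.2.2) × (Q (0 : Fin d → ℤ) j.1))),
      Set.Icc (0 : Fin d → ℝ) 1 ∩ {ω | ω ∈ W ∧ ∃ n : Fin d → ℤ,
        (t ^ A ≤ sd n 0 ∧ sd n 0 ≤ 4 * t ^ (A * A)) ∧ (n i).natAbs = sd n 0 ∧
        0 ≤ minorFn (elimA δ Tr ω (Finset.Icc j.2.1 j.2.2) j.1 (dotw ω n)) (Real.exp (2 * t ^ 2)) p q}) ≤
      ENNReal.ofReal (d * ((2 * t ^ (27 * d + 30) * (t ^ (4 * d) * t ^ (4 * d)) : ℕ) * (N * (N * c)))) := by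
    refine measure_biUnion_finset_le_card_mul _ (by simp) fun i _ => ?_
    refine measure_biUnion_finset_le_card_mul _ hJc fun j hj => ?_
    refine measure_biUnion_finset_le_card_mul _ (hpc j hj) fun p _ => ?_
    refine measure_biUnion_finset_le_card_mul _ (hpc j hj) fun q _ => ?_
    rw [h𝒥, Finset.mem_filter] at hj
    have h1 := Finset.mem_range.1 (Finset.mem_product.1 hj.1).1
    rw [hc]
    exact elim_one S.hd S.hA hat hTp (by omega) hj.2.1 i p q hWm (hthin _ _ _ hj.2.1 hj.2.2 p q i)
  refine (measure_mono ?_).trans (hmain.trans (ENNReal.ofReal_le_ofReal ?_))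
  · rintro ω ⟨hω, hωW, r, hr, a, b, hR, hab, p, q, n, hn1, hn2, hn⟩
    obtain ⟨i, hi⟩ := exists_natAbs_eq_sd S.hd n
    have hab' : a ≤ b := fun j => by have := hab j; linarith [show (0:ℤ) ≤ (t:ℤ) ^ 3 by positivity]
    simp only [Set.mem_iUnion]
    refine ⟨i, Finset.mem_univ _, (r, a, b), ?_, p, Finset.mem_univ _, q, Finset.mem_univ _, hω, hωW, n,
      ⟨hn1, hn2⟩, hi, hn⟩
    rw [h𝒥, Finset.mem_filter]
    refine ⟨?_, hR, hab⟩
    simp only [Finset.mem_product, Finset.mem_range]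
    exact ⟨by omega, hR (Finset.mem_Icc.2 ⟨le_rfl, hab'⟩), hR (Finset.mem_Icc.2 ⟨hab', le_rfl⟩)⟩
  · have hdt : (d:ℝ) ≤ t := by
      have h1 := hat.pow_six_le
      have h2 : A ≤ A ^ 6 := Nat.le_self_pow (by norm_num) A
      have h3 := S.hA'
      exact_mod_cast (by omega : d ≤ t)
    rw [hc, hN]
    push_cast
    calc _ = 4 * d * (t:ℝ) ^ (54 * d ^ 2 + 105 * d + 30) / t ^ (54 * d ^ 2 + 105 * d + 34) := by ring
      _ ≤ t * t * (t:ℝ) ^ (54 * d ^ 2 + 105 * d + 30) / t ^ (54 * d ^ 2 + 105 * d + 34) := by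
          gcongr; linarith
      _ = 1 / (t * t) := by
          have e : (t:ℝ) ^ (54 * d ^ 2 + 105 * d + 34) = t ^ (54 * d ^ 2 + 105 * d + 30) * (t * t * (t * t)) := by ring
          rw [e]; field_simp
      _ ≤ 1 / t := by
          apply one_div_le_one_div_of_le (by positivity); nlinarith

lemma Setup.mul_two_pow_le_sca (S : Setup d X M A T δ) (k : ℕ) : T * 2 ^ k ≤ sca A T k := by
  induction k with
  | zero => simp [sca_zero]
  | succ k ih =>
    have h := (S.at k).large
    have hA := S.hA'
    rw [sca_succ, pow_succ, ← mul_assoc]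
    calc T * 2 ^ k * 2 ≤ sca A T k * sca A T k := Nat.mul_le_mul ih (by omega)
      _ = sca A T k ^ 2 := (sq _).symm
      _ ≤ _ := Nat.pow_le_pow_right (by omega) (by omega)

lemma Setup.volume_not_sepAt (S : Setup d X M A T δ) (k : ℕ) :
    volume (Set.Icc (0 : Fin d → ℝ) 1 ∩ {ω | ¬ SepAt ω (sca A T k) 2}) ≤
      ENNReal.ofReal (1 / (sca A T k : ℕ)) := by
  have h100 := (S.at k).large
  have h3 := S.h3.trans (le_sca (A := A) (by have := S.hA'; omega) k)
  obtain ⟨t, ht⟩ : ∃ t, t = sca A T k := ⟨_, rfl⟩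
  rw [← ht] at h100 h3 ⊢
  have ht0 : (100:ℝ) ≤ t := by exact_mod_cast h100
  have h3' : (3:ℝ) ^ d ≤ t := by exact_mod_cast h3
  have hp : (2:ℝ) ≤ t ^ (9 * (d + 2)) :=
    le_trans (by linarith) (le_self_pow₀ (by linarith : (1:ℝ) ≤ t) (by omega))
  refine (volume_not_sep (by positivity) ((div_le_one (by positivity)).2 hp)).trans
    (ENNReal.ofReal_le_ofReal ?_)
  have h1 : (1:ℝ) ≤ t ^ 9 := one_le_pow₀ (by linarith)
  push_cast
  calc (2 * (t:ℝ) ^ 9 + 1) ^ d * (16 * (2 / t ^ (9 * (d + 2))))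
      ≤ (3 * (t:ℝ) ^ 9) ^ d * (16 * (2 / t ^ (9 * (d + 2)))) := by gcongr; linarith
    _ = 32 * 3 ^ d * (t:ℝ) ^ (9 * d) / t ^ (9 * (d + 2)) := by
        rw [mul_pow, ← pow_mul]; ring
    _ ≤ t * t * (t:ℝ) ^ (9 * d) / t ^ (9 * (d + 2)) := by gcongr; linarith
    _ = t ^ 2 / t ^ 18 := by
        have e : (t:ℝ) ^ (9 * (d + 2)) = t ^ (9 * d) * t ^ 18 := by ring
        rw [e]; field_simp
    _ ≤ 1 / t := by
        rw [div_le_div_iff₀ (by positivity) (by positivity), ← pow_succ, one_mul]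
        exact pow_le_pow_right₀ (by linarith) (by norm_num)

/-- The exceptional set of frequencies. -/
lemma Setup.exists_exceptional (S : Setup d X M A T δ) : ∃ (Tr : ℕ → ℝ → ℝ) (Ω : Set (Fin d → ℝ)),
    Ω ⊆ Set.Icc 0 1 ∧ volume Ω ≤ ENNReal.ofReal (4 / T) ∧
    (∀ k x, |f x - Tr k x| ≤ Real.exp (-(sca A T (k + 2) : ℕ) ^ 9)) ∧
    ∀ ω ∈ Set.Icc 0 1 \ Ω, (∀ k, SepAt ω (sca A T k) 2) ∧
      ∀ k, ω ∉ elimBad δ (Tr k) A (sca A T (k + 2)) := by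
  choose Tr hTp hTr using fun k => (S.at (k + 2)).happrox
  obtain ⟨U, hU⟩ : ∃ U : ℕ → Set (Fin d → ℝ), ∀ k, U k = Set.Icc (0 : Fin d → ℝ) 1 ∩
    {ω | ¬ SepAt ω (sca A T k) 2} := ⟨_, fun _ => rfl⟩
  obtain ⟨V, hV⟩ : ∃ V : ℕ → Set (Fin d → ℝ), ∀ k, V k = Set.Icc (0 : Fin d → ℝ) 1 ∩
    ({ω | ∀ i ≤ k + 2, SepAt ω (sca A T i) 2} ∩ elimBad δ (Tr k) A (sca A T (k + 2))) :=
    ⟨_, fun _ => rfl⟩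
  have hT0 : (0:ℝ) < T := by
    have := (S.at 0).large
    rw [sca_zero] at this
    exact_mod_cast (by omega : 0 < T)
  have hs : HasSum (fun k : ℕ => 1 / (T:ℝ) * (1 / 2) ^ k) (2 / T) := by
    have := hasSum_geometric_two.mul_left (1 / (T:ℝ))
    rwa [one_div_mul_eq_div] at this
  have hsum : ∀ W : ℕ → Set (Fin d → ℝ), (∀ k, volume (W k) ≤ ENNReal.ofReal (1 / T * (1 / 2) ^ k)) →
      volume (⋃ k, W k) ≤ ENNReal.ofReal (2 / T) := by
    intro W hW
    refine (measure_iUnion_le W).trans ((ENNReal.tsum_le_tsum hW).trans_eq ?_)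
    rw [← ENNReal.ofReal_tsum_of_nonneg (fun k => by positivity) hs.summable, hs.tsum_eq]
  have hsc : ∀ j k, k ≤ j → 1 / ((sca A T j : ℕ) : ℝ) ≤ 1 / T * (1 / 2) ^ k := by
    intro j k hkj
    have h1 : ((T * 2 ^ k : ℕ) : ℝ) ≤ (sca A T j : ℕ) := by
      exact_mod_cast (S.mul_two_pow_le_sca k).trans (S.sca_mono hkj)
    push_cast at h1
    calc _ ≤ 1 / ((T:ℝ) * 2 ^ k) := one_div_le_one_div_of_le (by positivity) h1
      _ = _ := by rw [one_div_pow, one_div_mul_one_div]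
  refine ⟨Tr, (⋃ k, U k) ∪ ⋃ k, V k, ?_, ?_, hTr, ?_⟩
  · refine Set.union_subset (Set.iUnion_subset fun k => ?_) (Set.iUnion_subset fun k => ?_)
    · rw [hU]; exact Set.inter_subset_left
    · rw [hV]; exact Set.inter_subset_left
  · refine (measure_union_le _ _).trans ((add_le_add (hsum U fun k => ?_) (hsum V fun k => ?_)).trans_eq ?_)
    · rw [hU]
      exact (S.volume_not_sepAt k).trans (ENNReal.ofReal_le_ofReal (hsc k k le_rfl))
    · rw [hV]
      exact (S.elim_measure (hTp k) (hTr k)).trans (ENNReal.ofReal_le_ofReal (hsc (k + 2) k (by omega)))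
    · rw [← ENNReal.ofReal_add (by positivity) (by positivity)]
      congr 1; ring
  · rintro ω ⟨hω, hn⟩
    have hsep : ∀ k, SepAt ω (sca A T k) 2 := fun k => by
      by_contra hcon
      exact hn (Or.inl (Set.mem_iUnion.2 ⟨k, by rw [hU]; exact ⟨hω, hcon⟩⟩))
    refine ⟨hsep, fun k hk => hn (Or.inr (Set.mem_iUnion.2 ⟨k, ?_⟩))⟩
    rw [hV]
    exact ⟨hω, fun i _ => hsep i, hk⟩

/-- Around the origin there is a box whose boundary layer carries little of any solution. -/
lemma exists_quasimode_box (hf : ∀ x, f (x + 1) = f x) {t : ℕ} (hat : AtScale d X M A t)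
    (hA : 100 * (d + 1) ≤ A) (hδ : 0 ≤ δ) (hδ1 : δ * 3 ^ d ≤ 1) {ω : Fin d → ℝ}
    (hc : LDTc δ f ω t (t ^ (27 * d + 11))) (hsep : Sep ω (2 * t ^ (27 * d + 22)) (Real.exp (-t)))
    {L : ℕ} (hL : t ^ (27 * d + 22) ≤ L) {E : ℝ} {φ : (Fin d → ℤ) → ℂ}
    (hφ : ∀ n ∈ Q 0 L, ‖φ n‖ ≤ 1)
    (heq : ∀ n ∈ Q 0 L, Eqn δ (fun n => (pot f ω E 0 n : ℂ)) (Q 0 L) φ 0 n) :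
    ∃ r, t ^ 8 ≤ r ∧ r ≤ t ^ (27 * d + 30) ∧ ∀ n ∈ Q (0 : Fin d → ℤ) r,
      ‖∑ k ∈ Q (0 : Fin d → ℤ) r, ((δ * hop n k : ℝ) : ℂ) * φ k + (pot f ω E 0 n : ℂ) * φ n‖ ≤
        Real.exp (-(t ^ 8 / 2)) := by
  classical
  have h100 := hat.large
  have ht : (100:ℝ) ≤ t := by exact_mod_cast h100
  obtain ⟨𝒞, h𝒞⟩ : ∃ 𝒞 : Finset (Fin d → ℤ), 𝒞 = (Q 0 (t ^ (27 * d + 22))).filter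
    fun c => ¬ Good δ f ω E t 0 (0 + dotw ω c) := ⟨_, rfl⟩
  have hK : 𝒞.card ≤ t ^ (27 * d + 11) := by
    refine hc.card_sites hf hsep E 0 𝒞 (fun c hc c' hc' => ?_) fun c hc => ?_
    · rw [h𝒞, Finset.mem_filter, mem_Q] at hc hc'
      have := sd_triangle c 0 c'
      rw [sd_comm 0 c'] at this
      omega
    · rw [h𝒞, Finset.mem_filter] at hc; exact hc.2
  obtain ⟨r, hr1, hr2, hr3⟩ := exists_free_radius 𝒞 hK 0 (t ^ 8) (t ^ 8 + 1)
  have h8 : t ^ 8 ≤ t ^ (27 * d + 20) := Nat.pow_le_pow_right (by omega) (by omega)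
  have h1 : 1 ≤ t ^ 8 := Nat.one_le_pow _ _ (by omega)
  have hr4 : r ≤ 7 * t ^ (27 * d + 20) := by
    have : t ^ (27 * d + 11) * (2 * (t ^ 8 + 1) + 2) ≤ t ^ (27 * d + 11) * (6 * t ^ 8) :=
      Nat.mul_le_mul_left _ (by omega)
    have h3 : t ^ (27 * d + 11) * (6 * t ^ 8) = 6 * t ^ (27 * d + 19) := by ring
    have h4 : t ^ (27 * d + 19) ≤ t ^ (27 * d + 20) := Nat.pow_le_pow_right (by omega) (by omega)
    omega
  have hr5 : r + 2 * t ^ 8 + 2 ≤ t ^ (27 * d + 22) := by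
    have h5 : 20 * t ^ (27 * d + 20) ≤ t ^ (27 * d + 20 + 1) := mul_pow_le h100 (by norm_num)
    have h6 : t ^ (27 * d + 20 + 1) ≤ t ^ (27 * d + 22) := Nat.pow_le_pow_right (by omega) (by omega)
    omega
  have hr6 : t ^ (27 * d + 22) ≤ t ^ (27 * d + 30) := Nat.pow_le_pow_right (by omega) (by omega)
  have hshell : ∀ n : Fin d → ℤ, sd n 0 = r + 1 → ‖φ n‖ ≤ Real.exp (-(t ^ 8 / 2)) := by
    intro n hn
    have hnC : Good δ f ω E t 0 (0 + dotw ω n) := by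
      by_contra hcon
      have hmem : n ∈ 𝒞 := by
        rw [h𝒞, Finset.mem_filter, mem_Q]; exact ⟨by omega, hcon⟩
      have := hr3 n hmem
      rw [sd_comm] at this
      omega
    have hinv := hnC.inv_Q
    have hsub : Q n (t ^ 8) ⊆ Q 0 L := fun k hk => by
      rw [mem_Q] at hk ⊢
      have := sd_triangle k n 0
      omega
    have hκ : 1 / (t:ℝ) ≤ 1 := by rw [div_le_one (by linarith)]; linarith
    have hκ0 : 0 ≤ 1 / (t:ℝ) := by positivity
    have := hinv.norm_le_exit hδ hδ1 (by linarith) (by linarith) hsub (fun k hk => heq k (hsub hk))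
      (mem_Q.2 (by rw [sd_self]; exact Nat.zero_le _)) ((Q n (t ^ 8 + 1)) \ (Q n (t ^ 8)))
      (fun k' _ hk' hk => by
        obtain ⟨k, hk1, hk2⟩ := hk
        rw [Finset.mem_sdiff]
        refine ⟨?_, hk'⟩
        rw [mem_Q] at hk1 ⊢
        have := sd_triangle k' k n
        rw [sd_comm k' k] at this
        omega)
    refine this.trans ?_
    simp only [Pi.zero_apply, norm_zero, mul_zero, Finset.sum_const_zero, zero_add]
    have h9 : (t:ℝ) ^ 9 = t * t ^ 8 := by ring
    have h88 : (1:ℝ) ≤ t ^ 8 := one_le_pow₀ (by linarith)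
    have hcard : ((2 * (t ^ 8 + 1) + 1 : ℕ) : ℝ) ^ d ≤ Real.exp t := by
      calc ((2 * (t ^ 8 + 1) + 1 : ℕ) : ℝ) ^ d ≤ ((t:ℝ) ^ 9) ^ d := by
            gcongr; push_cast; rw [h9]; nlinarith only [h88, ht]
        _ = (t:ℝ) ^ (9 * d) := by rw [pow_mul]
        _ ≤ _ := hat.pow_le (by
            have : A ≤ A ^ 6 := Nat.le_self_pow (by norm_num) A
            omega)
    calc _ ≤ ∑ k' ∈ Q n (t ^ 8 + 1) \ Q n (t ^ 8), Real.exp ((t:ℝ) ^ 5 + 2 - t ^ 8) := by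
          refine Finset.sum_le_sum fun k' hk' => ?_
          rw [Finset.mem_sdiff, mem_Q, mem_Q, sd_comm] at hk'
          have hk8 : (t:ℝ) ^ 8 ≤ sd n k' := by
            exact_mod_cast (by omega : t ^ 8 ≤ sd n k')
          have hk0 : k' ∈ Q 0 L := by
            rw [mem_Q]
            have := sd_triangle k' n 0
            rw [sd_comm k' n] at this
            omega
          refine (mul_le_of_le_one_right (Real.exp_pos _).le (hφ k' hk0)).trans ?_
          refine Real.exp_le_exp.2 ?_
          have : 0 ≤ 1 / (t:ℝ) * sd n k' := by positivity
          linarith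
      _ ≤ ((2 * (t ^ 8 + 1) + 1 : ℕ) : ℝ) ^ d * Real.exp ((t:ℝ) ^ 5 + 2 - t ^ 8) := by
          rw [Finset.sum_const, nsmul_eq_mul]
          gcongr
          refine le_trans (Nat.cast_le.2 (Finset.card_le_card Finset.sdiff_subset)) ?_
          rw [card_Q]; push_cast; exact le_rfl
      _ ≤ Real.exp t * Real.exp ((t:ℝ) ^ 5 + 2 - t ^ 8) := by gcongr
      _ ≤ _ := by
          rw [← Real.exp_add]
          refine Real.exp_le_exp.2 ?_
          have e5 : (t:ℝ) ≤ t ^ 5 := le_self_pow₀ (by linarith) (by norm_num)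
          have e8 : 100 * (t:ℝ) ^ 5 ≤ t ^ 8 := by
            calc 100 * (t:ℝ) ^ 5 ≤ t ^ 3 * t ^ 5 := by
                  gcongr; exact ht.trans (le_self_pow₀ (by linarith) (by norm_num))
              _ = _ := by ring
          linarith
  refine ⟨r, hr1, by omega, fun n hn => ?_⟩
  have hsub : Q (0 : Fin d → ℤ) r ⊆ Q 0 L := fun k hk => by rw [mem_Q] at hk ⊢; omega
  have h2 := heq n (hsub hn)
  rw [Eqn, ← Finset.sum_sdiff hsub, Pi.zero_apply, add_assoc] at h2
  rw [eq_neg_of_add_eq_zero_right h2, norm_neg]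
  refine (norm_sum_le _ _).trans ?_
  calc ∑ k ∈ Q 0 L \ Q 0 r, ‖((δ * hop n k : ℝ) : ℂ) * φ k‖
      ≤ ∑ k ∈ Q 0 L \ Q 0 r, hop n k * (δ * Real.exp (-((t:ℝ) ^ 8 / 2))) := by
        refine Finset.sum_le_sum fun k hk => ?_
        rw [norm_mul, Complex.norm_real, Real.norm_of_nonneg (mul_nonneg hδ (hop_nonneg n k))]
        by_cases h0 : hop n k = 0
        · simp [h0]
        · have hs := sd_le_one_of_hop h0
          rw [Finset.mem_sdiff, mem_Q, mem_Q] at hk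
          rw [mem_Q] at hn
          have := sd_triangle k n 0
          rw [sd_comm k n] at this
          have := hshell k (by omega)
          have h3 : 0 ≤ δ * hop n k := mul_nonneg hδ (hop_nonneg n k)
          calc _ ≤ δ * hop n k * Real.exp (-((t:ℝ) ^ 8 / 2)) := by gcongr
            _ = _ := by ring
    _ ≤ 3 ^ d * (δ * Real.exp (-((t:ℝ) ^ 8 / 2))) := by
        rw [← Finset.sum_mul]
        gcongr
        exact sum_hop_le _ _
    _ = δ * 3 ^ d * Real.exp (-((t:ℝ) ^ 8 / 2)) := by ring
    _ ≤ _ := mul_le_of_le_one_left (Real.exp_pos _).le hδ1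

/-- If a solution is not tiny near the origin, far away rectangles are nonresonant. -/
lemma inv_rect_of_quasimode (hd : 1 ≤ d) {t : ℕ} (hat : AtScale d X M A t)
    (hA : 1000 * (d + 1) ^ 2 ≤ A)
    (hδ : 0 ≤ δ) {ω : Fin d → ℝ} {Tr : ℝ → ℝ} (hTr : ∀ x, |f x - Tr x| ≤ Real.exp (-(t : ℝ) ^ 9))
    (hel : ω ∉ elimBad δ Tr A t) {E : ℝ} {φ : (Fin d → ℤ) → ℂ} {r : ℕ} (hr : r ≤ t ^ (27 * d + 30))
    (hu : ∀ n ∈ Q (0 : Fin d → ℤ) r,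
      ‖∑ k ∈ Q (0 : Fin d → ℤ) r, ((δ * hop n k : ℝ) : ℂ) * φ k + (pot f ω E 0 n : ℂ) * φ n‖ ≤
        Real.exp (-(t ^ 8 / 2)))
    (hp : ∃ p ∈ Q (0 : Fin d → ℤ) r, Real.exp (-(t ^ 8 / 4)) < ‖φ p‖) {a b : Fin d → ℤ}
    (hR : Finset.Icc a b ⊆ Q 0 (2 * t ^ 3)) (hab : ∀ i, a i + t ^ 3 ≤ b i) {n : Fin d → ℤ}
    (hn1 : t ^ A ≤ sd n 0) (hn2 : sd n 0 ≤ 4 * t ^ (A * A)) :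
    Inv δ (fun k => (pot f ω E (dotw ω n) k : ℂ)) (Finset.Icc a b)
      (fun _ _ => Real.exp (3 * t ^ 2)) := by
  classical
  have h100 := hat.large
  have ht : (100:ℝ) ≤ t := by exact_mod_cast h100
  have hneg : ∀ p q, minorFn (elimA δ Tr ω (Finset.Icc a b) r (dotw ω n)) (Real.exp (2 * t ^ 2)) p q < 0 := by
    intro p q
    by_contra! hcon
    exact hel ⟨r, hr, a, b, hR, hab, p, q, n, hn1, hn2, hcon⟩
  obtain ⟨p, hpr, hp⟩ := hp
  obtain ⟨m, hm, hmax⟩ := Finset.exists_max_image (Q (0 : Fin d → ℤ) r) (fun k => ‖φ k‖) ⟨p, hpr⟩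
  have hμ : Real.exp (-((t:ℝ) ^ 8 / 4)) < ‖φ m‖ := hp.trans_le (hmax p hpr)
  have hμ0 : 0 < ‖φ m‖ := (Real.exp_pos _).trans hμ
  obtain ⟨V, hV⟩ : ∃ V : ℝ, V = (Finset.Icc a b).card * (2 * r + 1 : ℕ) ^ d := ⟨_, rfl⟩
  have hVt : V ≤ Real.exp t := by
    refine le_trans ?_ (hat.pow_le (n := 4 * d + (27 * d + 31) * d) ?_)
    · rw [hV, pow_add]
      exact_mod_cast Nat.mul_le_mul (card_le_of_subset_Q h100 hR) (box_card_le h100 hr)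
    · have : A ≤ A ^ 6 := Nat.le_self_pow (by norm_num) A
      nlinarith
  have hct : ((Finset.Icc a b).card : ℝ) ≤ Real.exp t := by
    refine le_trans ?_ (hat.pow_le (n := 4 * d) ?_)
    · exact_mod_cast card_le_of_subset_Q h100 hR
    · have : A ≤ A ^ 6 := Nat.le_self_pow (by norm_num) A
      nlinarith
  have hV0 : 0 ≤ V := by rw [hV]; positivity
  have e1 : 100 * (t:ℝ) ≤ t ^ 2 := by rw [sq]; gcongr
  have e2 : 100 * (t:ℝ) ^ 2 ≤ t ^ 8 := by
    calc 100 * (t:ℝ) ^ 2 ≤ t ^ 6 * t ^ 2 := by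
          gcongr; exact ht.trans (le_self_pow₀ (by linarith) (by norm_num))
      _ = _ := by ring
  have e3 : (t:ℝ) ^ 8 ≤ t ^ 9 := pow_le_pow_right₀ (by linarith) (by norm_num)
  have h4 : (4:ℝ) ≤ Real.exp t := by linarith [Real.add_one_le_exp (t:ℝ)]
  have key : ∀ x : ℝ, 4 * t ^ 2 ≤ x → Real.exp (2 * t ^ 2) * V * Real.exp (-x) ≤ 1 / 4 := by
    intro x hx
    calc _ ≤ Real.exp (2 * t ^ 2) * Real.exp t * Real.exp (-x) := by gcongr
      _ = Real.exp (2 * t ^ 2 + t - x) := by rw [sub_eq_add_neg, Real.exp_add, Real.exp_add]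
      _ ≤ Real.exp (-t) := Real.exp_le_exp.2 (by linarith)
      _ ≤ 1 / 4 := by
          rw [Real.exp_neg, ← one_div]; exact one_div_le_one_div_of_le (by norm_num) h4
  have := elim_use hδ (Real.exp_pos _).le (Real.exp_pos _).le hTr hneg (E := E) hu hmax ⟨m, hm, rfl⟩ hμ0
    (by
      rw [← hV]
      have h5 : Real.exp (-((t:ℝ) ^ 8 / 2)) ≤ Real.exp (-((t:ℝ) ^ 8 / 4)) * ‖φ m‖ := by
        calc Real.exp (-((t:ℝ) ^ 8 / 2)) = Real.exp (-((t:ℝ) ^ 8 / 4)) * Real.exp (-((t:ℝ) ^ 8 / 4)) := by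
              rw [← Real.exp_add]; congr 1; ring
          _ ≤ _ := by gcongr
      have h6 := key (t ^ 8 / 4) (by linarith)
      have h7 := key (t ^ 9) (by linarith)
      calc _ ≤ Real.exp (2 * t ^ 2) * V * (Real.exp (-((t:ℝ) ^ 8 / 4)) * ‖φ m‖ + Real.exp (-(t:ℝ) ^ 9) * ‖φ m‖) := by
            gcongr
        _ = (Real.exp (2 * t ^ 2) * V * Real.exp (-((t:ℝ) ^ 8 / 4)) +
              Real.exp (2 * t ^ 2) * V * Real.exp (-(t:ℝ) ^ 9)) * ‖φ m‖ := by ring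
        _ ≤ (1 / 4 + 1 / 4) * ‖φ m‖ := by gcongr
        _ = _ := by ring)
    (by
      rw [← hV]
      calc _ ≤ Real.exp (-(t:ℝ) ^ 9) * (Real.exp t * (2 * Real.exp (2 * t ^ 2) * V)) := by gcongr
        _ = 2 * (Real.exp (2 * t ^ 2) * V * Real.exp (-(t ^ 9 - t))) := by
            rw [neg_sub, sub_eq_add_neg, Real.exp_add]; ring
        _ ≤ 2 * (1 / 4) := by gcongr; exact key _ (by linarith)
        _ ≤ _ := by norm_num)
  refine this.mono fun _ _ _ _ => ?_
  rw [← hV]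
  have h8 : 2 * Real.exp (2 * t ^ 2) * V ≤ Real.exp (2 * t ^ 2 + 2 * t) := by
    calc _ ≤ Real.exp t * Real.exp (2 * t ^ 2) * Real.exp t := by gcongr; linarith
      _ = _ := by rw [← Real.exp_add, ← Real.exp_add]; congr 1; ring
  have h9 : 2 * ((Finset.Icc a b).card : ℝ) * (2 * Real.exp (2 * t ^ 2) * V) ^ 2 * Real.exp (-(t:ℝ) ^ 9) ≤ 1 := by
    calc _ ≤ Real.exp t * Real.exp t * Real.exp (2 * t ^ 2 + 2 * t) ^ 2 * Real.exp (-(t:ℝ) ^ 9) := by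
          gcongr; linarith
      _ = Real.exp (t + t + (2 * t ^ 2 + 2 * t + (2 * t ^ 2 + 2 * t)) + -t ^ 9) := by
          simp only [Real.exp_add, sq]
      _ ≤ 1 := Real.exp_le_one_iff.2 (by linarith)
  have h10 : Real.exp (2 * t ^ 2 + 2 * t) ≤ Real.exp (3 * t ^ 2 - t) := Real.exp_le_exp.2 (by linarith)
  have h11 : Real.exp (3 * t ^ 2) = Real.exp (3 * t ^ 2 - t) * Real.exp t := by
    rw [← Real.exp_add]; congr 1; ring
  have h12 : 1 ≤ Real.exp (3 * (t:ℝ) ^ 2 - t) := Real.one_le_exp (by nlinarith only [e1, ht])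
  nlinarith only [h8, h9, h10, h11, h12, h4]

lemma SepAt.one {ω : Fin d → ℝ} {t : ℕ} (h : SepAt ω t 2) : SepAt ω t 1 :=
  Sep.mono h le_rfl (by gcongr; norm_num)

/-- An eigenfunction is either tiny near the origin or exponentially small in an annulus. -/
lemma Setup.dichotomy (S : Setup d X M A T δ) {k : ℕ} {ω : Fin d → ℝ}
    (hsep : ∀ i, SepAt ω (sca A T i) 2) {Tr : ℝ → ℝ}
    (hTr : ∀ x, |f x - Tr x| ≤ Real.exp (-(sca A T (k + 2) : ℕ) ^ 9))
    (hel : ω ∉ elimBad δ Tr A (sca A T (k + 2))) {L : ℕ} (hL : sca A T (k + 3) ≤ L) {E : ℝ}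
    {φ : (Fin d → ℤ) → ℂ} (hφ : ∀ n ∈ Q 0 L, ‖φ n‖ ≤ 1)
    (heq : ∀ n ∈ Q 0 L, Eqn δ (fun n => (pot f ω E 0 n : ℂ)) (Q 0 L) φ 0 n) :
    (∀ p ∈ Q 0 (sca A T (k + 2) ^ 8), ‖φ p‖ ≤ Real.exp (-((sca A T (k + 2) : ℕ) ^ 8 / 4))) ∨
    ∀ n ∈ Q 0 L, 2 * sca A T (k + 3) ≤ sd n 0 → sd n 0 ≤ 2 * sca A T (k + 4) →
      ‖φ n‖ ≤ Real.exp (-(sd n 0 / 4 : ℝ)) := by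
  have hldt := fun k => S.ldt (k := k) (fun i _ => (hsep i).one)
  have hat := S.at (k + 2)
  have hsc := (S.stepScales k).sc
  have h03 := (S.stepScales k).h03
  have s1 : Sep ω (sca A T (k + 3) ^ 9) (Real.exp (-(sca A T (k + 2) : ℕ))) :=
    S.sep (k := k + 2) (m := 1) (by norm_num) one_le_two (hsep _)
  have s4 : Sep ω (sca A T (k + 4) ^ 9) (Real.exp (-(sca A T k : ℕ))) :=
    S.sep (m := 4) (by norm_num) one_le_two (hsep _)
  have hc0 := (hldt k).2
  have hc := (hldt (k + 2)).2
  have e3 : sca A T (k + 3) = sca A T (k + 2) ^ A := sca_succ ..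
  have e4 : sca A T (k + 4) = sca A T (k + 2) ^ (A * A) := by
    rw [sca_succ, e3, ← pow_mul]
  rw [e3] at s1 hL ⊢
  rw [e4] at s4 ⊢
  obtain ⟨t, ht⟩ : ∃ t, t = sca A T (k + 2) := ⟨_, rfl⟩
  obtain ⟨t0, ht0⟩ : ∃ t0, t0 = sca A T k := ⟨_, rfl⟩
  rw [← ht] at hTr hel hat hsc h03 s1 s4 hc hL ⊢
  rw [← ht0] at hsc h03 s4 hc0
  have hA' := S.hA'
  have hA := S.hA
  have h100 := hat.large
  have htR : (100:ℝ) ≤ t := by exact_mod_cast h100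
  have hLt : t ^ (27 * d + 22) ≤ L := (Nat.pow_le_pow_right (by omega) (by omega)).trans hL
  have h3L : t ^ 3 ≤ L := (Nat.pow_le_pow_right (by omega) (by omega)).trans hL
  obtain ⟨r, hr1, hr2, hr3⟩ := exists_quasimode_box S.hf hat hA' S.hδ.le S.hδ1 hc
    (Sep.mono s1 (by
      rw [← pow_mul]
      exact (mul_pow_le h100 (c := 2) (by norm_num)).trans (Nat.pow_le_pow_right (by omega) (by omega))) le_rfl)
    hLt hφ heq
  by_cases hp : ∃ p ∈ Q (0 : Fin d → ℤ) r, Real.exp (-((t:ℝ) ^ 8 / 4)) < ‖φ p‖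
  swap
  · left
    intro p hp'
    by_contra! hcon
    exact hp ⟨p, mem_Q.2 ((mem_Q.1 hp').trans hr1), hcon⟩
  right
  intro z hz hz1 hz2
  have hLA : t ^ 100 ≤ t ^ A := Nat.pow_le_pow_right (by omega) (by omega)
  have hQ : Q (0 : Fin d → ℤ) L = Finset.Icc (fun _ => -(L:ℤ)) (fun _ => (L:ℤ)) := by
    simp [Q]
  have key := decay_box (R := sd z 0 / 2) (Mx := 1) (x := 0) (E := E) S.hf S.hδ.le S.hδ1 hsc hc0 s4
    (by
      have e1 : 4 * t ^ (A * A) ≤ t ^ (A * A + 1) := mul_pow_le h100 (by norm_num)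
      have e2 : t ^ 3 ≤ t ^ (A * A) := Nat.pow_le_pow_right (by omega) (by nlinarith only [hA'])
      have e3 : t ^ (A * A + 1) ≤ t ^ (A * A * 9) :=
        Nat.pow_le_pow_right (by omega) (by nlinarith only [hA'])
      rw [← pow_mul]
      omega)
    (a := fun _ => -(L:ℤ)) (b := fun _ => (L:ℤ)) (fun i => by
      have : (2 * t0 ^ 8 : ℕ) ≤ L := h03.trans h3L
      push_cast at this ⊢
      have h2 : ((2 * t0 ^ 8 : ℕ) : ℤ) ≤ L := by exact_mod_cast this
      push_cast at h2
      have : (0:ℤ) ≤ (t0:ℤ) ^ 8 := by positivity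
      omega) (z := z) (φ := φ)
    (by rw [← hQ]; exact hφ) (by rw [← hQ]; exact hz) (by rw [← hQ]; exact fun n hn _ => heq n hn)
    (by
      rw [← hQ]
      intro n hn hnz r' hr1' hr2'
      have hn0 : ∀ i, -(L:ℤ) ≤ n i ∧ n i ≤ L := by
        rw [hQ, Finset.mem_Icc] at hn
        exact fun i => ⟨hn.1 i, hn.2 i⟩
      obtain ⟨a, ha⟩ : ∃ a : Fin d → ℤ, a = (fun _ => -(L:ℤ)) ⊔ fun i => n i - r' := ⟨_, rfl⟩
      obtain ⟨b, hb⟩ : ∃ b : Fin d → ℤ, b = (fun _ => (L:ℤ)) ⊓ fun i => n i + r' := ⟨_, rfl⟩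
      have ha' : ∀ i, a i = max (-(L:ℤ)) (n i - r') := fun i => by rw [ha]; rfl
      have hb' : ∀ i, b i = min (L:ℤ) (n i + r') := fun i => by rw [hb]; rfl
      rw [← ha, ← hb]
      have hi := inv_rect_of_quasimode S.hd hat S.hA S.hδ.le hTr hel hr2 hr3 hp
        (a := a - n) (b := b - n) (fun m hm => by
          rw [mem_Q, sd_le_iff]
          rw [Finset.mem_Icc] at hm
          intro i
          have h1 : a i - n i ≤ m i := hm.1 i
          have h2 : m i ≤ b i - n i := hm.2 i
          have h3 := hn0 i
          rw [ha'] at h1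
          rw [hb'] at h2
          simp only [Pi.zero_apply]
          omega) (fun i => by
          have h3 := hn0 i
          have h4 : ((t ^ 3 : ℕ) : ℤ) ≤ r' := by exact_mod_cast hr1'
          have h5 : ((t ^ 3 : ℕ) : ℤ) ≤ L := by exact_mod_cast h3L
          rw [Pi.sub_apply, Pi.sub_apply, ha', hb']
          push_cast at h4 h5
          omega) (n := n)
        (by
          have := sd_triangle z n 0
          rw [sd_comm z n] at this
          omega)
        (by
          have := sd_triangle n z 0
          omega)
      have := hi.translate (Λ := Finset.Icc a b) (-n) (fun m => by
        rw [Finset.mem_Icc, Finset.mem_Icc, ← sub_eq_add_neg, sub_le_sub_iff_right,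
          sub_le_sub_iff_right])
      convert this using 3 with m
      have h := pot_add f ω E 0 (m + -n) n
      rw [neg_add_cancel_right, zero_add] at h
      exact h)
  refine key.trans ?_
  rw [one_mul]
  refine Real.exp_le_exp.2 (neg_le_neg ?_)
  have hR : (sd z 0 : ℝ) / 2 - 1 ≤ (sd z 0 / 2 : ℕ) := by
    have : (sd z 0 : ℝ) ≤ 2 * (sd z 0 / 2 : ℕ) + 1 := by exact_mod_cast (by omega)
    linarith
  have hbig : (2:ℝ) * t ^ 5 ≤ sd z 0 := by
    have : 2 * t ^ 5 ≤ sd z 0 :=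
      le_trans (Nat.mul_le_mul_left _ (Nat.pow_le_pow_right (by omega) (by omega))) hz1
    exact_mod_cast this
  have h4 : (100:ℝ) * t ^ 4 ≤ t ^ 5 := by
    rw [pow_succ (t:ℝ) 4, mul_comm]; gcongr
  have h2 : (1:ℝ) * t ^ 2 ≤ t ^ 4 := by
    rw [one_mul]; exact pow_le_pow_right₀ (by linarith) (by norm_num)
  have h1 : (1:ℝ) ≤ t ^ 4 := one_le_pow₀ (by linarith)
  have h5 : 0 ≤ 1 / (t:ℝ) * ((sd z 0 / 2 : ℕ) - (t:ℝ) ^ 4) := by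
    refine mul_nonneg (by positivity) ?_
    linarith
  nlinarith only [h5, hR, hbig, h4, h2, h1]

end AL

namespace AL

variable {d : ℕ}

lemma sum_le_sum_of_eq_zero {α : Type*} {Λ F : Finset α} {g : α → ℝ} (h0 : ∀ n, 0 ≤ g n)
    (h : ∀ n ∉ Λ, g n = 0) : ∑ n ∈ F, g n ≤ ∑ n ∈ Λ, g n := by
  classical
  rw [Finset.sum_subset (Finset.subset_union_right (s₁ := F)) fun n _ hn => h n hn]
  exact Finset.sum_le_sum_of_subset_of_nonneg Finset.subset_union_left fun n _ _ => h0 n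

/-- Orthonormal eigenfunctions of the restriction of the operator to a finite set. -/
lemma exists_eigenbasis (δ : ℝ) (v : (Fin d → ℤ) → ℝ) (Λ : Finset (Fin d → ℤ)) :
    ∃ (φ : Λ → (Fin d → ℤ) → ℂ) (E : Λ → ℝ), (∀ j, ∀ n ∉ Λ, φ j n = 0) ∧
      (∀ j, ∀ n ∈ Λ, Eqn δ (fun n => ((v n - E j : ℝ) : ℂ)) Λ (φ j) 0 n) ∧
      (∀ j, ∑ n ∈ Λ, ‖φ j n‖ ^ 2 = 1) ∧ (∀ n ∈ Λ, ∑ j, ‖φ j n‖ ^ 2 = 1) ∧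
      ∀ J : Finset Λ, ∀ p ∈ Λ, ∀ F : Finset (Fin d → ℤ),
        ∑ n ∈ F, ‖∑ j ∈ J, star (φ j p) * φ j n - if n = p then 1 else 0‖ ^ 2 ≤
          ∑ j ∈ Jᶜ, ‖φ j p‖ ^ 2 := by
  classical
  have hK := mat_isHermitian δ v Λ
  obtain ⟨b, hb⟩ : ∃ b, b = hK.eigenvectorBasis := ⟨_, rfl⟩
  obtain ⟨φ, hφ⟩ : ∃ φ : Λ → (Fin d → ℤ) → ℂ, φ = fun j n => if h : n ∈ Λ then b j ⟨n, h⟩ else 0 :=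
    ⟨_, rfl⟩
  have hφb : ∀ j (n : Λ), φ j n.1 = b j n := fun j n => by simp [hφ]
  have hφ0 : ∀ j, ∀ n ∉ Λ, φ j n = 0 := fun j n hn => by simp [hφ, hn]
  refine ⟨φ, hK.eigenvalues, hφ0, fun j n hn => ?_, fun j => ?_, fun n hn => ?_, fun J p hp F => ?_⟩
  · have h1 := congr_fun (hK.mulVec_eigenvectorBasis j) ⟨n, hn⟩
    have h2 := mat_mulVec δ (fun n => (v n : ℂ)) Λ (φ j) ⟨n, hn⟩
    simp only [hφb] at h2
    rw [← hb] at h1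
    rw [show (fun k => b j k) = (b j : Λ → ℂ) from rfl, h1] at h2
    simp only [Pi.smul_apply, Complex.real_smul] at h2
    rw [← hφb j ⟨n, hn⟩] at h2
    simp only [Eqn, Pi.zero_apply]
    push_cast at h2 ⊢
    linear_combination -h2
  · rw [← Finset.sum_coe_sort Λ (fun n => ‖φ j n‖ ^ 2)]
    simp only [hφb]
    rw [← EuclideanSpace.norm_sq_eq, b.norm_eq_one, one_pow]
  · have := sum_norm_eigenvector_le hK ⟨n, hn⟩
    rw [← this]
    exact Finset.sum_congr rfl fun j _ => by rw [← hb, hφb j ⟨n, hn⟩]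
  · have h1 : ∑ j, star (φ j p) • b j = EuclideanSpace.single ⟨p, hp⟩ (1:ℂ) := by
      rw [← b.sum_repr (EuclideanSpace.single ⟨p, hp⟩ (1:ℂ))]
      refine Finset.sum_congr rfl fun j _ => ?_
      rw [b.repr_apply_apply, EuclideanSpace.inner_single_right, ← hφb j ⟨p, hp⟩]
      simp
    have h2 : ∀ n : Λ, ∑ j ∈ J, star (φ j p) * φ j n - (if n.1 = p then 1 else 0) =
        (-∑ j ∈ Jᶜ, star (φ j p) • b j) n := by
      intro n
      have h3 := congr_arg (fun w : EuclideanSpace ℂ Λ => w n) h1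
      rw [← Finset.sum_add_sum_compl J] at h3
      simp only [PiLp.add_apply, WithLp.ofLp_sum, Finset.sum_apply, PiLp.smul_apply, smul_eq_mul,
        PiLp.single_apply, Subtype.ext_iff] at h3
      simp only [hφb]
      rw [← h3]
      simp
    calc _ ≤ ∑ n ∈ Λ, ‖∑ j ∈ J, star (φ j p) * φ j n - if n = p then 1 else 0‖ ^ 2 :=
          sum_le_sum_of_eq_zero (fun n => by positivity) fun n hn => by
            have : n ≠ p := fun h => hn (h ▸ hp)
            simp [hφ0 _ n hn, this]
      _ = ‖-∑ j ∈ Jᶜ, star (φ j p) • b j‖ ^ 2 := by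
          rw [← Finset.sum_coe_sort Λ, EuclideanSpace.norm_sq_eq]
          exact Finset.sum_congr rfl fun n _ => by rw [h2]
      _ = _ := by
          have := b.orthonormal.inner_sum (fun j => star (φ j p)) (fun j => star (φ j p)) Jᶜ
          rw [inner_self_eq_norm_sq_to_K] at this
          rw [norm_neg, ← Complex.ofReal_inj]
          push_cast
          refine this.trans (Finset.sum_congr rfl fun j _ => ?_)
          rw [Complex.conj_mul', norm_star]
      _ ≤ _ := le_rfl

/-- Compatibility of the radii and thresholds of the multiscale scheme. -/
structure Radii (d : ℕ) (m s : ℕ → ℕ) (τ : ℕ → ℝ) : Prop where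
  hm : Monotone m
  hs : Monotone s
  hτ : Antitone τ
  hτ0 : ∀ k, 0 ≤ τ k
  hq : ∀ k, 2 * ((2 * m (k + 1) + 1 : ℕ) : ℝ) ^ d * τ k ^ 2 ≤ (1 / 2) ^ (k + 2)
  hmτ : ∀ k, Real.exp (-(m k / 4 : ℝ)) ≤ τ k
  hsm : ∀ k, s k ≤ m (k + 1)

/-- A finite list of localized approximate eigenfunctions, almost resolving the unit vectors
of a neighbourhood of the origin. -/
def LocList (δ : ℝ) (v : (Fin d → ℤ) → ℝ) (m s : ℕ) (η Eb : ℝ) (N : ℕ) {B : ℕ}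
    (w : Fin B → ((Fin d → ℤ) → ℂ) × ℝ) : Prop :=
  (∀ i, ∀ F : Finset (Fin d → ℤ), ∑ n ∈ F, ‖(w i).1 n‖ ^ 2 ≤ 1) ∧ (∀ i, |(w i).2| ≤ Eb) ∧
    (∀ i n, m ≤ sd n 0 → ‖(w i).1 n‖ ≤ Real.exp (-(sd n 0 / 4 : ℝ))) ∧
    (∀ i n, sd n 0 < N → Eqn δ (fun n => ((v n - (w i).2 : ℝ) : ℂ)) (Q n 1) (w i).1 0 n) ∧
    ∀ p ∈ Q 0 s, ∀ F : Finset (Fin d → ℤ),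
      ∑ n ∈ F, ‖∑ i, star ((w i).1 p) * (w i).1 n - if n = p then 1 else 0‖ ^ 2 ≤ η

lemma sum_union_le {α : Type*} [DecidableEq α] {S S' : Finset α} {g : α → ℝ} (h0 : ∀ n, 0 ≤ g n) :
    ∑ n ∈ S ∪ S', g n ≤ ∑ n ∈ S, g n + ∑ n ∈ S', g n := by
  rw [← Finset.sum_union_inter]
  exact le_add_of_nonneg_right (Finset.sum_nonneg fun n _ => h0 n)

lemma le_half_pow_of_step {G : ℕ → ℝ} {K : ℕ} (h : G (K + 1) ≤ 0)
    (hs : ∀ k ≤ K, G k ≤ G (k + 1) + (1 / 2) ^ (k + 2)) {k : ℕ} (hk : k ≤ K) :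
    G k ≤ (1 / 2) ^ (k + 1) := by
  have key : ∀ D k, k + D = K + 1 → G k ≤ (1 / 2 : ℝ) ^ (k + 1) := by
    intro D
    induction D with
    | zero => intro k hk; rw [show k = K + 1 by omega]; exact h.trans (by positivity)
    | succ D ih =>
      intro k hk
      have h1 := hs k (by omega)
      have h2 := ih (k + 1) (by omega)
      have e : ∀ n, (1 / 2 : ℝ) ^ (n + 1) = (1 / 2) ^ n / 2 := fun n => by rw [pow_succ]; ring
      rw [e] at h1 h2 ⊢
      rw [e] at h1 h2
      linarith
  exact key (K + 1 - k) k (by omega)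

lemma eqn_zero_nhd {δ : ℝ} {v : (Fin d → ℤ) → ℂ} {φ : (Fin d → ℤ) → ℂ} {L : ℕ} {n : Fin d → ℤ}
    (h : Eqn δ v (Q 0 L) φ 0 n) (hn : sd n 0 < L) : Eqn δ v (Q n 1) φ 0 n := by
  rw [Eqn] at h ⊢
  rw [← h]
  congr 1
  refine Finset.sum_subset (fun k hk => ?_) fun k _ hk => ?_
  · rw [mem_Q] at hk ⊢
    have := sd_triangle k n 0
    omega
  · have : hop n k = 0 := by
      by_contra hne
      exact hk (mem_Q.2 (by rw [sd_comm]; exact sd_le_one_of_hop hne))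
    simp [this]

lemma abs_energy_le {δ Eb E : ℝ} (hδ : 0 ≤ δ) {v : (Fin d → ℤ) → ℝ}
    (hEb : ∀ n, δ * 3 ^ d + |v n| ≤ Eb) {φ : (Fin d → ℤ) → ℂ} {Λ : Finset (Fin d → ℤ)}
    (heq : ∀ n ∈ Λ, Eqn δ (fun n => ((v n - E : ℝ) : ℂ)) Λ φ 0 n)
    (h1 : ∑ n ∈ Λ, ‖φ n‖ ^ 2 = 1) : |E| ≤ Eb := by
  have hne : Λ.Nonempty := by
    by_contra h
    rw [Finset.not_nonempty_iff_eq_empty] at h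
    simp [h] at h1
  obtain ⟨m, hm, hmax⟩ := Finset.exists_max_image Λ (fun k => ‖φ k‖) hne
  have hμ : 0 < ‖φ m‖ := by
    by_contra! hcon
    have : ∑ n ∈ Λ, ‖φ n‖ ^ 2 = 0 := Finset.sum_eq_zero fun n hn => by
      rw [le_antisymm ((hmax n hn).trans hcon) (norm_nonneg _)]; norm_num
    linarith
  have h := heq m hm
  rw [Eqn, Pi.zero_apply] at h
  have e : (E : ℂ) * φ m = ∑ k ∈ Λ, ((δ * hop m k : ℝ) : ℂ) * φ k + (v m : ℂ) * φ m := by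
    push_cast at h ⊢; linear_combination -h
  have h2 : |E| * ‖φ m‖ ≤ Eb * ‖φ m‖ := by
    calc |E| * ‖φ m‖ = ‖(E : ℂ) * φ m‖ := by rw [norm_mul, Complex.norm_real, Real.norm_eq_abs]
      _ ≤ ∑ k ∈ Λ, δ * hop m k * ‖φ m‖ + |v m| * ‖φ m‖ := by
          rw [e]
          refine (norm_add_le _ _).trans (add_le_add ((norm_sum_le _ _).trans
            (Finset.sum_le_sum fun k hk => ?_)) ?_)
          · rw [norm_mul, Complex.norm_real, Real.norm_eq_abs,
              abs_of_nonneg (mul_nonneg hδ (hop_nonneg _ _))]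
            exact mul_le_mul_of_nonneg_left (hmax k hk) (mul_nonneg hδ (hop_nonneg _ _))
          · rw [norm_mul, Complex.norm_real, Real.norm_eq_abs]
      _ ≤ (δ * 3 ^ d + |v m|) * ‖φ m‖ := by
          rw [← Finset.sum_mul, ← Finset.mul_sum, add_mul]
          gcongr
          exact sum_hop_le _ _
      _ ≤ _ := by gcongr; exact hEb m
  exact le_of_mul_le_mul_right h2 hμ

/-- The eigenfunctions in a finite volume which are localized around the origin. -/
lemma exists_locList {m s : ℕ → ℕ} {τ : ℕ → ℝ} (R : Radii d m s τ) {δ Eb : ℝ} (hδ : 0 ≤ δ)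
    {v : (Fin d → ℤ) → ℝ} (hEb : ∀ n, δ * 3 ^ d + |v n| ≤ Eb) {K k : ℕ} (hk : k ≤ K)
    (hdich : ∀ k ≤ K, ∀ E φ, (∀ n ∈ Q 0 (m (K + 1)), ‖φ n‖ ≤ 1) →
      (∀ n ∈ Q 0 (m (K + 1)), Eqn δ (fun n => ((v n - E : ℝ) : ℂ)) (Q 0 (m (K + 1))) φ 0 n) →
      (∀ p ∈ Q 0 (s k), ‖φ p‖ ≤ τ k) ∨
      ∀ n ∈ Q 0 (m (K + 1)), m k ≤ sd n 0 → sd n 0 ≤ m (k + 1) →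
        ‖φ n‖ ≤ Real.exp (-(sd n 0 / 4 : ℝ))) :
    ∃ w : Fin (2 * (2 * m k + 1) ^ d) → ((Fin d → ℤ) → ℂ) × ℝ,
      LocList δ v (m k) (s k) ((1 / 2) ^ (k + 1)) Eb (m (K + 1)) w := by
  classical
  obtain ⟨φ, E, hφ0, heq, hn1, hc1, hres⟩ := exists_eigenbasis δ v (Q 0 (m (K + 1)))
  have hQΛ : ∀ k ≤ K + 1, Q 0 (m k) ⊆ Q (0 : Fin d → ℤ) (m (K + 1)) := fun k hk n hn =>
    mem_Q.2 ((mem_Q.1 hn).trans (R.hm hk))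
  have hle : ∀ j n, ‖φ j n‖ ≤ 1 := by
    intro j n
    by_cases hn : n ∈ Q 0 (m (K + 1))
    · have h : ‖φ j n‖ ^ 2 ≤ _ :=
        Finset.single_le_sum (f := fun n => ‖φ j n‖ ^ 2) (fun n _ => by positivity) hn
      rw [hn1] at h
      exact (sq_le_one_iff₀ (norm_nonneg _)).1 h
    · rw [hφ0 j n hn, norm_zero]; exact zero_le_one
  have hd1 := fun k hk j => hdich k hk (E j) (φ j) (fun n _ => hle j n) (heq j)
  obtain ⟨loc, hloc⟩ : ∃ loc : ℕ → _ → Prop, loc = fun k j => ∃ p ∈ Q 0 (s k), τ k < ‖φ j p‖ :=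
    ⟨_, rfl⟩
  have hmono : ∀ k j, loc k j → loc (k + 1) j := by
    rw [hloc]
    rintro k j ⟨p, hp, hp'⟩
    exact ⟨p, mem_Q.2 ((mem_Q.1 hp).trans (R.hs k.le_succ)), (R.hτ k.le_succ).trans_lt hp'⟩
  have hann : ∀ k ≤ K, ∀ j, loc k j → ∀ n ∈ Q 0 (m (K + 1)), m k ≤ sd n 0 → sd n 0 ≤ m (k + 1) →
      ‖φ j n‖ ≤ Real.exp (-(sd n 0 / 4 : ℝ)) := by
    intro k hk j hj
    rw [hloc] at hj
    obtain ⟨p, hp, hp'⟩ := hj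
    exact (hd1 k hk j).resolve_left fun h => (h p hp).not_gt hp'
  have hdec : ∀ D k, k + D = K → ∀ j, loc k j → ∀ n, m k ≤ sd n 0 →
      ‖φ j n‖ ≤ Real.exp (-(sd n 0 / 4 : ℝ)) := by
    intro D
    induction D with
    | zero =>
      intro k hk j hj n hn
      by_cases hn' : n ∈ Q 0 (m (K + 1))
      · refine hann k (by omega) j hj n hn' hn ?_
        rw [show k = K by omega]; exact mem_Q.1 hn'
      · rw [hφ0 j n hn', norm_zero]; positivity
    | succ D ih =>
      intro k hk j hj n hn
      by_cases hn' : n ∈ Q 0 (m (K + 1))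
      · rcases le_total (sd n 0) (m (k + 1)) with h | h
        · exact hann k (by omega) j hj n hn' hn h
        · exact ih (k + 1) (by omega) j (hmono k j hj) n h
      · rw [hφ0 j n hn', norm_zero]; positivity
  have htail : ∀ k ≤ K, ∀ j, loc k j →
      ∑ n ∈ Q 0 (m (K + 1)) \ Q 0 (m k), ‖φ j n‖ ^ 2 ≤ (1 / 2) ^ (k + 1) := by
    intro k hk j hj
    have hj' : ∀ k', k ≤ k' → loc k' j := fun k' h => Nat.le_induction hj (fun n _ => hmono n j) k' h
    obtain ⟨G, hG⟩ : ∃ G : ℕ → ℝ, G = fun k' => if k ≤ k' then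
      ∑ n ∈ Q 0 (m (K + 1)) \ Q 0 (m k'), ‖φ j n‖ ^ 2 else 0 := ⟨_, rfl⟩
    have h1 := le_half_pow_of_step (G := G) (K := K) (by rw [hG]; simp) (fun k' hk' => by
      rw [hG]
      beta_reduce
      by_cases hkk : k ≤ k'
      · rw [if_pos hkk, if_pos (by omega)]
        have hsub : Q 0 (m (K + 1)) \ Q 0 (m k') ⊆ (Q 0 (m (K + 1)) \ Q 0 (m (k' + 1))) ∪
            (Q (0 : Fin d → ℤ) (m (k' + 1)) \ Q 0 (m k')) := by
          intro n hn
          rw [Finset.mem_union, Finset.mem_sdiff, Finset.mem_sdiff]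
          rw [Finset.mem_sdiff] at hn
          tauto
        refine (Finset.sum_le_sum_of_subset_of_nonneg hsub fun _ _ _ => by positivity).trans ?_
        refine (sum_union_le fun _ => by positivity).trans ?_
        gcongr
        refine (Finset.sum_le_card_nsmul _ _ (τ k' ^ 2) fun n hn => ?_).trans ?_
        · rw [Finset.mem_sdiff, mem_Q, mem_Q] at hn
          gcongr
          refine (hdec (K - k') k' (by omega) j (hj' k' hkk) n (by omega)).trans
            (le_trans (Real.exp_le_exp.2 ?_) (R.hmτ k'))
          have : (m k' : ℝ) ≤ sd n 0 := by exact_mod_cast (by omega)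
          linarith
        · rw [nsmul_eq_mul]
          have hc : ((Q (0 : Fin d → ℤ) (m (k' + 1)) \ Q 0 (m k')).card : ℝ) ≤
              ((2 * m (k' + 1) + 1 : ℕ) : ℝ) ^ d := by
            have := (Finset.card_le_card (Finset.sdiff_subset
              (s := Q (0 : Fin d → ℤ) (m (k' + 1))) (t := Q 0 (m k')))).trans_eq (card_Q _ _)
            exact_mod_cast this
          have h0 : 0 ≤ ((2 * m (k' + 1) + 1 : ℕ) : ℝ) ^ d * τ k' ^ 2 := by positivity
          have := R.hq k'
          have h2 := mul_le_mul_of_nonneg_right hc (sq_nonneg (τ k'))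
          linarith
      · rw [if_neg hkk]
        split_ifs <;> positivity) hk
    rw [hG] at h1
    simpa using h1
  have hcard : ∀ k ≤ K, (Finset.univ.filter (loc k)).card ≤ 2 * (2 * m k + 1) ^ d := by
    intro k hk
    have h1 : ∀ j ∈ Finset.univ.filter (loc k), (1 / 2 : ℝ) ≤ ∑ n ∈ Q 0 (m k), ‖φ j n‖ ^ 2 := by
      intro j hj
      have h2 := htail k hk j (Finset.mem_filter.1 hj).2
      have h3 := Finset.sum_sdiff (f := fun n => ‖φ j n‖ ^ 2) (hQΛ k (by omega))
      rw [hn1] at h3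
      have h4 : (1 / 2 : ℝ) ^ (k + 1) ≤ 1 / 2 := by
        rw [pow_succ]
        have : (1 / 2 : ℝ) ^ k ≤ 1 := pow_le_one₀ (by norm_num) (by norm_num)
        linarith
      linarith
    have h2 := Finset.card_nsmul_le_sum _ _ _ h1
    rw [nsmul_eq_mul, Finset.sum_comm] at h2
    have h3 : ∑ n ∈ Q 0 (m k), ∑ j ∈ Finset.univ.filter (loc k), ‖φ j n‖ ^ 2 ≤
        ∑ n ∈ Q (0 : Fin d → ℤ) (m k), (1:ℝ) := Finset.sum_le_sum fun n hn => by
      rw [← hc1 n (hQΛ k (by omega) hn)]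
      exact Finset.sum_le_sum_of_subset_of_nonneg (Finset.filter_subset _ _)
        fun _ _ _ => by positivity
    rw [Finset.sum_const, card_Q, nsmul_eq_mul, mul_one] at h3
    have h4 : ((Finset.univ.filter (loc k)).card : ℝ) ≤ 2 * ((2 * m k + 1) ^ d : ℕ) := by linarith
    exact_mod_cast h4
  have hnl : ∀ p ∈ Q 0 (s k), ∑ j ∈ (Finset.univ.filter (loc k))ᶜ, ‖φ j p‖ ^ 2 ≤
      (1 / 2) ^ (k + 1) := by
    intro p hp
    obtain ⟨G, hG⟩ : ∃ G : ℕ → ℝ, G = fun k' => if k ≤ k' then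
      ∑ j ∈ Finset.univ.filter (fun j => ¬ loc k' j ∧ k' ≤ K), ‖φ j p‖ ^ 2 else 0 := ⟨_, rfl⟩
    have h1 := le_half_pow_of_step (G := G) (K := K) (by rw [hG]; simp) (fun k' hk' => by
      rw [hG]
      beta_reduce
      by_cases hkk : k ≤ k'
      · rw [if_pos hkk, if_pos (by omega)]
        have hsub : Finset.univ.filter (fun j => ¬ loc k' j ∧ k' ≤ K) ⊆
            Finset.univ.filter (fun j => ¬ loc (k' + 1) j ∧ k' + 1 ≤ K) ∪
            Finset.univ.filter (fun j => ¬ loc k' j ∧ (k' + 1 ≤ K → loc (k' + 1) j)) := by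
          intro j hj
          rw [Finset.mem_union, Finset.mem_filter, Finset.mem_filter]
          rw [Finset.mem_filter] at hj
          tauto
        refine (Finset.sum_le_sum_of_subset_of_nonneg hsub fun _ _ _ => by positivity).trans ?_
        refine (sum_union_le fun _ => by positivity).trans ?_
        gcongr
        refine (Finset.sum_le_card_nsmul _ _ (τ k' ^ 2) fun j hj => ?_).trans ?_
        · rw [Finset.mem_filter, hloc] at hj
          gcongr
          by_contra! hcon
          exact hj.2.1 ⟨p, mem_Q.2 ((mem_Q.1 hp).trans (R.hs hkk)), hcon⟩
        · rw [nsmul_eq_mul]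
          refine le_trans (mul_le_mul_of_nonneg_right ?_ (sq_nonneg _)) (R.hq k')
          rcases hk'.lt_or_eq with h | h
          · have := (Finset.card_le_card (s := Finset.univ.filter (fun j => ¬ loc k' j ∧
              (k' + 1 ≤ K → loc (k' + 1) j))) (t := Finset.univ.filter (loc (k' + 1)))
              fun j hj => Finset.mem_filter.2 ⟨Finset.mem_univ _, (Finset.mem_filter.1 hj).2.2 h⟩).trans
              (hcard (k' + 1) h)
            exact_mod_cast this
          · have := Finset.card_le_univ (Finset.univ.filter (fun j => ¬ loc k' j ∧
              (k' + 1 ≤ K → loc (k' + 1) j)))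
            rw [Fintype.card_coe, card_Q] at this
            rw [show m (k' + 1) = m (K + 1) by rw [h]]
            exact_mod_cast this.trans (Nat.le_mul_of_pos_left _ (by norm_num))
      · rw [if_neg hkk]
        split_ifs <;> positivity) hk
    rw [hG] at h1
    rw [Finset.compl_filter]
    simpa [hk] using h1
  obtain ⟨J, hJ⟩ : ∃ J, J = Finset.univ.filter (loc k) := ⟨_, rfl⟩
  rw [← hJ] at hnl
  obtain ⟨e⟩ : Nonempty (J ↪ Fin (2 * (2 * m k + 1) ^ d)) :=
    Function.Embedding.nonempty_of_card_le (by
      rw [Fintype.card_coe, Fintype.card_fin, hJ]; exact hcard k hk)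
  obtain ⟨w, hw⟩ : ∃ w : Fin (2 * (2 * m k + 1) ^ d) → ((Fin d → ℤ) → ℂ) × ℝ,
    w = Function.extend e (fun j => (φ j.1, E j.1)) 0 := ⟨_, rfl⟩
  have hw1 : ∀ j : J, w (e j) = (φ j.1, E j.1) := fun j => by
    rw [hw, e.injective.extend_apply]
  have hw0 : ∀ i, i ∉ Set.range e → w i = 0 := fun i hi => by
    rw [hw, Function.extend_apply' _ _ _ hi]; rfl
  have hEb0 : 0 ≤ Eb := le_trans (by positivity) (hEb 0)
  refine ⟨w, fun i F => ?_, fun i => ?_, fun i n hn => ?_, fun i n hn => ?_, fun p hp F => ?_⟩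
  · by_cases hi : i ∈ Set.range e
    · obtain ⟨j, rfl⟩ := hi
      rw [hw1, ← hn1 j]
      exact sum_le_sum_of_eq_zero (fun n => by positivity) fun n hn => by
        dsimp only; rw [hφ0 j.1 n hn]; simp
    · simp [hw0 i hi]
  · by_cases hi : i ∈ Set.range e
    · obtain ⟨j, rfl⟩ := hi
      rw [hw1]
      exact abs_energy_le hδ hEb (heq j) (hn1 j)
    · simpa [hw0 i hi] using hEb0
  · by_cases hi : i ∈ Set.range e
    · obtain ⟨j, rfl⟩ := hi
      rw [hw1]
      have hj : j.1 ∈ Finset.univ.filter (loc k) := hJ ▸ j.2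
      exact hdec (K - k) k (by omega) j (Finset.mem_filter.1 hj).2 n hn
    · simp [hw0 i hi, Real.exp_nonneg]
  · by_cases hi : i ∈ Set.range e
    · obtain ⟨j, rfl⟩ := hi
      rw [hw1]
      exact eqn_zero_nhd (heq j n (mem_Q.2 hn.le)) hn
    · simp [hw0 i hi, Eqn]
  · have hp' : p ∈ Q 0 (m (K + 1)) :=
      mem_Q.2 ((mem_Q.1 hp).trans ((R.hsm k).trans (R.hm (by omega))))
    refine le_trans (le_of_eq (Finset.sum_congr rfl fun n _ => ?_))
      ((hres J p hp' F).trans (hnl p hp))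
    rw [← Finset.sum_coe_sort J, Fintype.sum_of_injective e e.injective
      (fun j : J => star (φ j.1 p) * φ j.1 n) (fun i => star ((w i).1 p) * (w i).1 n)
      (fun i hi => by simp [hw0 i hi]) (fun j => by rw [hw1])]

lemma isClosed_locList (δ : ℝ) (v : (Fin d → ℤ) → ℝ) (m s : ℕ) (η Eb : ℝ) (N B : ℕ) :
    IsClosed {w : Fin B → ((Fin d → ℤ) → ℂ) × ℝ | LocList δ v m s η Eb N w} := by
  simp only [LocList, Eqn, Set.ofPred_and, Set.ofPred_forall]
  refine IsClosed.inter ?_ (IsClosed.inter ?_ (IsClosed.inter ?_ (IsClosed.inter ?_ ?_)))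
  · exact isClosed_iInter fun i => isClosed_iInter fun F => isClosed_le (by fun_prop) continuous_const
  · exact isClosed_iInter fun i => isClosed_le (by fun_prop) continuous_const
  · exact isClosed_iInter fun i => isClosed_iInter fun n => isClosed_iInter fun _ =>
      isClosed_le (by fun_prop) continuous_const
  · exact isClosed_iInter fun i => isClosed_iInter fun n => isClosed_iInter fun _ =>
      isClosed_eq (by fun_prop) continuous_const
  · exact isClosed_iInter fun p => isClosed_iInter fun _ => isClosed_iInter fun F =>
      isClosed_le (by fun_prop) continuous_const

lemma LocList.mono {δ : ℝ} {v : (Fin d → ℤ) → ℝ} {m s : ℕ} {η Eb : ℝ} {N N' B : ℕ}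
    {w : Fin B → ((Fin d → ℤ) → ℂ) × ℝ} (h : LocList δ v m s η Eb N w) (hN : N' ≤ N) :
    LocList δ v m s η Eb N' w :=
  ⟨h.1, h.2.1, h.2.2.1, fun i n hn => h.2.2.2.1 i n (hn.trans_le hN), h.2.2.2.2⟩

/-- Infinite volume limit of the lists of localized eigenfunctions. -/
lemma exists_limit_locList {δ : ℝ} {v : (Fin d → ℤ) → ℝ} {m s : ℕ} {η Eb : ℝ} {N : ℕ → ℕ}
    (hN : Monotone N) {B : ℕ}
    (h : ∀ i, ∃ w : Fin B → ((Fin d → ℤ) → ℂ) × ℝ, LocList δ v m s η Eb (N i) w) :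
    ∃ w : Fin B → ((Fin d → ℤ) → ℂ) × ℝ, ∀ i, LocList δ v m s η Eb (N i) w := by
  have hcpt : IsCompact (Set.univ.pi fun _ : Fin B =>
      (Set.univ.pi fun _ : Fin d → ℤ => Metric.closedBall (0:ℂ) 1) ×ˢ Set.Icc (-Eb) Eb) :=
    isCompact_univ_pi fun _ => (isCompact_univ_pi fun _ => isCompact_closedBall _ _).prod
      isCompact_Icc
  obtain ⟨w, hw⟩ := IsCompact.nonempty_iInter_of_sequence_nonempty_isCompact_isClosed
    (fun i => {w : Fin B → ((Fin d → ℤ) → ℂ) × ℝ | LocList δ v m s η Eb (N i) w})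
    (fun i w hw => LocList.mono hw (hN i.le_succ)) h
    (hcpt.of_isClosed_subset (isClosed_locList ..) fun w hw i _ => ⟨fun n _ => by
      have h1 : ‖(w i).1 n‖ ^ 2 ≤ 1 := by simpa using hw.1 i {n}
      rw [mem_closedBall_zero_iff]
      exact (sq_le_one_iff₀ (norm_nonneg _)).1 h1, abs_le.1 (hw.2.1 i)⟩)
    fun i => isClosed_locList ..
  exact ⟨w, fun i => Set.mem_iInter.1 hw i⟩

lemma update_add_eq (n : Fin d → ℤ) (i : Fin d) (a : ℤ) :
    Function.update n i (n i + a) = n + Pi.single i a := by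
  ext j
  rcases eq_or_ne j i with rfl | h <;> simp [*]

lemma natAbs_sum_eq_one_iff {n k : Fin d → ℤ} :
    ∑ i, (n i - k i).natAbs = 1 ↔ ∃ i, k = n + Pi.single i 1 ∨ k = n + Pi.single i (-1) := by
  constructor
  · intro h
    obtain ⟨i, hi⟩ : ∃ i, (n i - k i).natAbs ≠ 0 := by
      by_contra! h0
      simp [h0] at h
    rw [← Finset.add_sum_erase _ _ (Finset.mem_univ i)] at h
    have h1 : ∀ j ≠ i, (n j - k j).natAbs = 0 := fun j hj =>
      Finset.sum_eq_zero_iff.1 (by omega : ∑ j ∈ Finset.univ.erase i, (n j - k j).natAbs = 0) j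
        (by simp [hj])
    have h2 : k i = n i + 1 ∨ k i = n i + -1 := by omega
    refine ⟨i, h2.imp ?_ ?_⟩ <;> intro h3 <;> ext j <;> rcases eq_or_ne j i with rfl | hj
    · simp [h3]
    · have := h1 j hj; simp [hj]; omega
    · simp [h3]
    · have := h1 j hj; simp [hj]; omega
  · rintro ⟨i, rfl | rfl⟩ <;> rw [Finset.sum_eq_single i] <;> simp +contextual

lemma sum_hop (n : Fin d → ℤ) (ψ : (Fin d → ℤ) → ℂ) :
    ∑ k ∈ Q n 1, ((hop n k : ℝ) : ℂ) * ψ k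
      = ∑ i, (ψ (n + Pi.single i 1) + ψ (n + Pi.single i (-1))) := by
  have e : ∑ i : Fin d, (ψ (n + Pi.single i 1) + ψ (n + Pi.single i (-1)))
      = ∑ p : Fin d × Bool, ψ (n + Pi.single p.1 (if p.2 then 1 else -1)) := by
    simp [Fintype.sum_prod_type]
  rw [e]
  have hinj : Function.Injective
      (fun p : Fin d × Bool => n + Pi.single p.1 (if p.2 then (1:ℤ) else -1)) := by
    rintro ⟨i, a⟩ ⟨j, b⟩ h
    have h' := congrFun (add_left_cancel h) i
    rcases eq_or_ne i j with rfl | hij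
    · cases a <;> cases b <;> simp_all
    · cases a <;> simp [hij] at h'
  rw [← Finset.sum_image (f := ψ) (fun p _ q _ h => hinj h)]
  refine (Finset.sum_subset_zero_on_sdiff ?_ ?_ ?_).symm
  · intro k hk
    obtain ⟨⟨i, a⟩, -, rfl⟩ := Finset.mem_image.1 hk
    rw [mem_Q, sd_le_iff]
    intro j
    rcases eq_or_ne j i with rfl | hj <;> cases a <;> simp [*]
  · intro k hk
    rw [Finset.mem_sdiff] at hk
    rw [hop, if_neg, Complex.ofReal_zero, zero_mul]
    rw [natAbs_sum_eq_one_iff]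
    rintro ⟨i, h⟩
    refine hk.2 (Finset.mem_image.2 ?_)
    rcases h with h | h
    · exact ⟨(i, true), by simp, by simp [h]⟩
    · exact ⟨(i, false), by simp, by simp [h]⟩
  · intro k hk
    obtain ⟨⟨i, a⟩, -, rfl⟩ := Finset.mem_image.1 hk
    rw [hop, if_pos (natAbs_sum_eq_one_iff.2 ⟨i, by cases a <;> simp⟩), Complex.ofReal_one, one_mul]

lemma latticeEigenEq_iff {V : (Fin d → ℤ) → ℝ} {ψ : (Fin d → ℤ) → ℂ} {E : ℝ} :
    LatticeEigenEq d V ψ E ↔ ∀ n, ∑ i, (ψ (n + Pi.single i 1) + ψ (n + Pi.single i (-1)))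
      + ((V n : ℝ) : ℂ) * ψ n = (E : ℂ) * ψ n := by
  simp only [LatticeEigenEq, sub_eq_add_neg, update_add_eq]

lemma latticeEigenEq_of_eqn {δ : ℝ} (hδ : δ ≠ 0) {v : (Fin d → ℤ) → ℝ} {E : ℝ}
    {ψ : (Fin d → ℤ) → ℂ} (h : ∀ n, Eqn δ (fun n => ((v n - E : ℝ) : ℂ)) (Q n 1) ψ 0 n) :
    LatticeEigenEq d (fun n => δ⁻¹ * v n) ψ (δ⁻¹ * E) := by
  rw [latticeEigenEq_iff]
  intro n
  have h1 := h n
  simp only [Eqn, Complex.ofReal_mul, mul_assoc, ← Finset.mul_sum, sum_hop, Pi.zero_apply] at h1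
  have hδ' : (δ : ℂ) ≠ 0 := by exact_mod_cast hδ
  rw [← mul_right_inj' hδ']
  push_cast at h1 ⊢
  rw [mul_add, mul_assoc, mul_inv_cancel_left₀ hδ', mul_assoc, mul_inv_cancel_left₀ hδ']
  linear_combination h1

/-- The Hilbert space of square summable functions on the lattice. -/
abbrev L2 (d : ℕ) := lp (fun _ : Fin d → ℤ => ℂ) 2

lemma summable_sq (x : L2 d) : Summable fun n => ‖x n‖ ^ 2 := by
  simpa using (lp.memℓp x).summable (by norm_num)

lemma summable_star_mul_shift (x y : L2 d) (a : Fin d → ℤ) :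
    Summable fun n => star (x n) * y (n + a) := by
  refine Summable.of_norm_bounded
    ((summable_sq x).add ((Equiv.addRight a).summable_iff.2 (summable_sq y))) fun n => ?_
  simp only [norm_mul, norm_star, Function.comp, Equiv.coe_addRight]
  nlinarith [sq_nonneg (‖x n‖ - ‖y (n + a)‖), sq_nonneg (‖x n‖ + ‖y (n + a)‖)]

lemma inner_eq_zero_of_ne {V : (Fin d → ℤ) → ℝ} {x y : L2 d} {E E' : ℝ} (hE : E ≠ E')
    (hx : LatticeEigenEq d V x E) (hy : LatticeEigenEq d V y E') : inner ℂ x y = 0 := by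
  rw [latticeEigenEq_iff] at hx hy
  have hs := fun a => (summable_star_mul_shift x y a).hasSum
  have hs' : ∀ a, HasSum (fun n => star (x (n + a)) * y n) (∑' n, star (x n) * y (n + -a)) := by
    intro a
    have := (Equiv.addRight a).hasSum_iff.2 (hs (-a))
    simpa [Function.comp_def] using this
  have h1 : HasSum (fun n => ((E' - E : ℝ) : ℂ) * (star (x n) * y n)) 0 := by
    have h2 := hasSum_sum (s := Finset.univ) fun (i : Fin d) _ =>
      ((hs (Pi.single i 1)).add (hs (Pi.single i (-1)))).sub
        ((hs' (Pi.single i 1)).add (hs' (Pi.single i (-1))))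
    have e0 : ∑ i : Fin d, ((∑' n, star (x n) * y (n + Pi.single i 1)) +
        (∑' n, star (x n) * y (n + Pi.single i (-1))) -
        ((∑' n, star (x n) * y (n + -Pi.single i 1)) +
        ∑' n, star (x n) * y (n + -Pi.single i (-1)))) = 0 := by
      refine Finset.sum_eq_zero fun i _ => ?_
      simp only [← Pi.single_neg, neg_neg]
      ring
    rw [e0] at h2
    suffices efn : ∀ n, ((E' - E : ℝ) : ℂ) * (star (x n) * y n) =
        ∑ i : Fin d, (star (x n) * y (n + Pi.single i 1) +
        star (x n) * y (n + Pi.single i (-1)) - (star (x (n + Pi.single i 1)) * y n +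
        star (x (n + Pi.single i (-1))) * y n)) by
      simp only [efn]
      exact h2
    intro n
    have e1 := congrArg star (hx n)
    have e2 := hy n
    have e3 : ∑ i : Fin d, (star (x n) * y (n + Pi.single i 1) +
        star (x n) * y (n + Pi.single i (-1)) - (star (x (n + Pi.single i 1)) * y n +
        star (x (n + Pi.single i (-1))) * y n)) =
        star (x n) * ∑ i, (y (n + Pi.single i 1) + y (n + Pi.single i (-1))) -
        (∑ i, (star (x (n + Pi.single i 1)) + star (x (n + Pi.single i (-1))))) * y n := by
      rw [Finset.mul_sum, Finset.sum_mul, ← Finset.sum_sub_distrib]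
      exact Finset.sum_congr rfl fun i _ => by ring
    simp only [star_add, star_sum, star_mul', RCLike.star_def, Complex.conj_ofReal] at e1 e3 ⊢
    rw [e3]
    push_cast
    linear_combination (y n) * e1 - (starRingEnd ℂ (x n)) * e2
  have h3 : HasSum (fun n => star (x n) * y n) (inner ℂ x y) := by
    have := lp.hasSum_inner (𝕜 := ℂ) x y
    simpa [RCLike.inner_apply, mul_comm] using this
  have h4 := (h3.mul_left _).unique h1
  refine (mul_eq_zero.1 h4).resolve_left ?_
  rw [Complex.ofReal_eq_zero, sub_eq_zero]
  exact hE.symm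

/-- Square summable solutions of the eigenvalue equation decaying at a fixed rate. -/
def eigSub (V : (Fin d → ℤ) → ℝ) (α E : ℝ) : Submodule ℂ (L2 d) where
  carrier := {x | LatticeEigenEq d V x E ∧
    ∃ C : ℝ, 0 < C ∧ ∀ n, ‖x n‖ ≤ C * Real.exp (-α * ∑ i, |(n i : ℝ)|)}
  zero_mem' := ⟨fun n => by simp, 1, one_pos, fun n => by simp; positivity⟩
  add_mem' := by
    rintro x y ⟨hx, C, hC, hxC⟩ ⟨hy, D, hD, hyD⟩
    refine ⟨fun n => ?_, C + D, by positivity, fun n => ?_⟩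
    · have h1 := hx n
      have h2 := hy n
      simp only [lp.coeFn_add, Pi.add_apply, Finset.sum_add_distrib] at h1 h2 ⊢
      linear_combination h1 + h2
    · rw [lp.coeFn_add, Pi.add_apply, add_mul]
      exact (norm_add_le _ _).trans (add_le_add (hxC n) (hyD n))
  smul_mem' := by
    rintro c x ⟨hx, C, hC, hxC⟩
    refine ⟨fun n => ?_, (‖c‖ + 1) * C, by positivity, fun n => ?_⟩
    · simp only [lp.coeFn_smul, Pi.smul_apply, smul_eq_mul, ← mul_add, ← Finset.mul_sum]
      linear_combination c * hx n
    · rw [lp.coeFn_smul, Pi.smul_apply, norm_smul, mul_assoc]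
      exact mul_le_mul (by linarith) (hxC n) (norm_nonneg _) (by positivity)

lemma gramSchmidt_mem_eigSub {V : (Fin d → ℤ) → ℝ} {α : ℝ} {u : ℕ → L2 d} {E : ℕ → ℝ}
    (hu : ∀ n, u n ∈ eigSub V α (E n)) (n : ℕ) :
    InnerProductSpace.gramSchmidt ℂ u n ∈ eigSub V α (E n) := by
  induction n using Nat.strong_induction_on with
  | _ n ih =>
    rw [InnerProductSpace.gramSchmidt_def]
    refine Submodule.sub_mem _ (hu n) (Submodule.sum_mem _ fun i hi => ?_)
    have hi' := ih i (Finset.mem_Iio.1 hi)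
    rw [Submodule.starProjection_singleton]
    by_cases h : E i = E n
    · exact Submodule.smul_mem _ _ (h ▸ hi')
    · rw [inner_eq_zero_of_ne h hi'.1 (hu n).1]
      simp

/-- A total sequence of localized eigenfunctions yields an orthonormal eigenbasis. -/
lemma exists_hilbertBasis {V : (Fin d → ℤ) → ℝ} {α : ℝ} (hα : 0 < α) {u : ℕ → L2 d} {E : ℕ → ℝ}
    (hu : ∀ n, u n ∈ eigSub V α (E n)) (htot : ∀ x : L2 d, (∀ n, inner ℂ (u n) x = 0) → x = 0) :
    ∃ (ι : Type) (v : HilbertBasis ι ℂ (lp (fun _ : Fin d → ℤ => ℂ) 2)), ∀ i : ι,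
      ∃ E : ℝ, LatticeEigenEq d V (v i) E ∧ ExpDecayLattice d (v i) := by
  have ho := InnerProductSpace.gramSchmidtNormed_orthonormal' (𝕜 := ℂ) (f := u)
  refine ⟨_, HilbertBasis.mkOfOrthogonalEqBot ho ?_, fun i => ⟨E i, ?_⟩⟩
  · rw [Submodule.eq_bot_iff]
    intro x hx
    refine htot x fun n => ?_
    have h1 : u n ∈ Submodule.span ℂ (Set.range u) := Submodule.subset_span ⟨n, rfl⟩
    rw [← InnerProductSpace.span_gramSchmidt ℂ u,
      ← InnerProductSpace.span_gramSchmidtNormed_range] at h1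
    refine Submodule.mem_orthogonal _ _ |>.1 hx (u n) (Submodule.span_le.2 ?_ h1)
    rintro _ ⟨j, rfl⟩
    by_cases hj : InnerProductSpace.gramSchmidtNormed ℂ u j = 0
    · rw [hj]; exact Submodule.zero_mem _
    · exact Submodule.subset_span ⟨⟨j, hj⟩, rfl⟩
  · rw [HilbertBasis.coe_mkOfOrthogonalEqBot]
    have h : InnerProductSpace.gramSchmidtNormed ℂ u i ∈ eigSub V α (E i) :=
      Submodule.smul_mem _ _ (gramSchmidt_mem_eigSub hu i)
    obtain ⟨h1, C, hC, h2⟩ := h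
    exact ⟨h1, C, hC, α, hα, h2⟩

lemma sum_abs_le_sd (n : Fin d → ℤ) : ∑ i, |(n i : ℝ)| ≤ d * sd n 0 := by
  refine (Finset.sum_le_card_nsmul _ _ (sd n 0 : ℝ) fun i _ => ?_).trans_eq (by simp)
  have := natAbs_le_sd n 0 i
  simp only [Pi.zero_apply, sub_zero] at this
  rw [← Int.cast_abs, Int.abs_eq_natAbs]
  exact_mod_cast this

lemma exists_mem_eigSub (hd : 1 ≤ d) {V : (Fin d → ℤ) → ℝ} {E : ℝ} {ψ : (Fin d → ℤ) → ℂ} {m : ℕ}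
    (hψ : ∀ F : Finset (Fin d → ℤ), ∑ n ∈ F, ‖ψ n‖ ^ 2 ≤ 1)
    (hdec : ∀ n, m ≤ sd n 0 → ‖ψ n‖ ≤ Real.exp (-(sd n 0 / 4 : ℝ)))
    (hE : LatticeEigenEq d V ψ E) :
    ∃ x ∈ eigSub V (1 / (4 * d)) E, ∀ n, x n = ψ n := by
  have hmem : Memℓp ψ 2 := memℓp_gen' (C := 1) fun F => by simpa using hψ F
  have hd' : (0:ℝ) < d := by exact_mod_cast hd
  refine ⟨⟨ψ, hmem⟩, ⟨hE, Real.exp (m / 4), Real.exp_pos _, fun n => ?_⟩, fun n => rfl⟩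
  rw [← Real.exp_add]
  have h1 : 1 / (4 * (d:ℝ)) * ∑ i, |(n i : ℝ)| ≤ sd n 0 / 4 := by
    refine (mul_le_mul_of_nonneg_left (sum_abs_le_sd n) (by positivity)).trans_eq ?_
    field_simp
  change ‖ψ n‖ ≤ _
  rcases le_total m (sd n 0) with h | h
  · refine (hdec n h).trans (Real.exp_le_exp.2 ?_)
    have : (0:ℝ) ≤ m / 4 := by positivity
    linarith
  · have h2 := hψ {n}
    rw [Finset.sum_singleton] at h2
    have h3 : (sd n 0 : ℝ) ≤ m := by exact_mod_cast h
    refine (pow_le_one_iff_of_nonneg (norm_nonneg _) two_ne_zero |>.1 h2).trans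
      (Real.one_le_exp ?_)
    linarith

lemma eq_zero_of_resolution {x : L2 d} {η : ℕ → ℝ} (hη0 : ∀ k, 0 ≤ η k)
    (hη : Tendsto η atTop (nhds 0)) {B : ℕ → ℕ} {X : ∀ k, Fin (B k) → L2 d} {s : ℕ → ℕ}
    (hs : Tendsto s atTop atTop) (hX : ∀ k i, inner ℂ (X k i) x = 0)
    (hres : ∀ k, ∀ p ∈ Q 0 (s k), ∀ F : Finset (Fin d → ℤ),
      ∑ n ∈ F, ‖∑ i, star (X k i p) * X k i n - if n = p then 1 else 0‖ ^ 2 ≤ η k) : x = 0 := by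
  classical
  refine lp.ext (funext fun p => ?_)
  have hle : ∀ᶠ k in atTop, ‖x p‖ ≤ √(η k) * ‖x‖ := by
    filter_upwards [hs.eventually_ge_atTop (sd p 0)] with k hk
    obtain ⟨y, hy⟩ : ∃ y : L2 d, y = ∑ i, star (X k i p) • X k i - lp.single 2 p (1:ℂ) := ⟨_, rfl⟩
    have hyn : ‖y‖ ≤ √(η k) := by
      refine lp.norm_le_of_forall_sum_le (by norm_num) (Real.sqrt_nonneg _) fun F => ?_
      have h1 := hres k p (mem_Q.2 hk) F
      simp only [ENNReal.toReal_ofNat, Real.rpow_ofNat, Real.sq_sqrt (hη0 k)]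
      refine le_trans (le_of_eq (Finset.sum_congr rfl fun n _ => ?_)) h1
      rw [hy, lp.coeFn_sub, Pi.sub_apply, lp.coeFn_sum, Finset.sum_apply, lp.single_apply]
      simp [Pi.single_apply]
    have hyx : inner ℂ y x = - x p := by
      rw [hy, inner_sub_left, sum_inner, lp.inner_single_left]
      simp [inner_smul_left, hX]
    rw [← norm_neg, ← hyx]
    exact (norm_inner_le_norm y x).trans (by gcongr)
  have ht : Tendsto (fun k => √(η k) * ‖x‖) atTop (nhds 0) := by
    simpa using ((Real.continuous_sqrt.tendsto 0).comp hη).mul_const ‖x‖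
  simpa using ge_of_tendsto ht hle

/-- Complete families of localized eigenfunctions yield Anderson localization. -/
lemma exists_hilbertBasis_of_locList (hd : 1 ≤ d) {δ Eb : ℝ} (hδ : δ ≠ 0)
    {v : (Fin d → ℤ) → ℝ} {m s B : ℕ → ℕ} (hs : Tendsto s atTop atTop)
    {w : ∀ k, Fin (B k) → ((Fin d → ℤ) → ℂ) × ℝ}
    (hw : ∀ k N, LocList δ v (m k) (s k) ((1 / 2) ^ (k + 1)) Eb N (w k)) :
    ∃ (ι : Type) (b : HilbertBasis ι ℂ (lp (fun _ : Fin d → ℤ => ℂ) 2)), ∀ i : ι,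
      ∃ E : ℝ, LatticeEigenEq d (fun n => δ⁻¹ * v n) (b i) E ∧ ExpDecayLattice d (b i) := by
  have h := fun k i => exists_mem_eigSub hd (V := fun n => δ⁻¹ * v n) (E := δ⁻¹ * (w k i).2)
    ((hw k 0).1 i) ((hw k 0).2.2.1 i)
    (latticeEigenEq_of_eqn hδ fun n => (hw k (sd n 0 + 1)).2.2.2.1 i n (Nat.lt_succ_self _))
  choose X hX hXw using h
  obtain ⟨g, hg⟩ := exists_surjective_nat (Option (Σ k, Fin (B k)))
  refine exists_hilbertBasis (α := 1 / (4 * d)) (by positivity)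
    (u := fun n => (g n).elim 0 fun q => X q.1 q.2)
    (E := fun n => (g n).elim 0 fun q => δ⁻¹ * (w q.1 q.2).2) (fun n => ?_) fun x hx => ?_
  · rcases g n with _ | q
    · exact Submodule.zero_mem _
    · exact hX q.1 q.2
  · refine eq_zero_of_resolution (X := X) (η := fun k => (1 / 2) ^ (k + 1)) (fun k => by positivity)
      ((tendsto_pow_atTop_nhds_zero_of_lt_one (by norm_num) (by norm_num)).comp
        (tendsto_add_atTop_nat 1)) hs (fun k i => ?_) fun k p hp F => ?_
    · obtain ⟨n, hn⟩ := hg (some ⟨k, i⟩)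
      have := hx n
      simpa only [hn, Option.elim] using this
    · simpa only [hXw] using (hw k 0).2.2.2.2 p hp F

end AL

namespace AL

variable {d : ℕ} {f : ℝ → ℝ} {X : Ext f} {M : ℝ} {A T : ℕ} {δ : ℝ}

lemma Setup.radii (S : Setup d X M A T δ) : Radii d (fun k => 2 * sca A T (k + 3))
    (fun k => sca A T (k + 2) ^ 8) (fun k => Real.exp (-((sca A T (k + 2) : ℕ) ^ 8 / 4))) where
  hm := fun i j h => Nat.mul_le_mul_left 2 (S.sca_mono (by omega))
  hs := fun i j h => Nat.pow_le_pow_left (S.sca_mono (by omega)) 8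
  hτ := fun i j h => by
    have h1 : (sca A T (i + 2) : ℝ) ≤ sca A T (j + 2) := by exact_mod_cast S.sca_mono (by omega)
    refine Real.exp_le_exp.2 (neg_le_neg ?_)
    gcongr
  hτ0 := fun k => (Real.exp_pos _).le
  hq := fun k => by
    have hA := S.hA
    have hat := S.at (k + 2)
    have h100 := hat.large
    have hk := S.mul_two_pow_le_sca (k + 2)
    have e4 : sca A T (k + 1 + 3) = sca A T (k + 2) ^ (A ^ 2) := sca_add A T (k + 2) 2
    have hT1 : 1 ≤ T := (Nat.one_le_pow _ _ (by norm_num)).trans S.h3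
    rw [e4]
    obtain ⟨t, ht⟩ : ∃ t, t = sca A T (k + 2) := ⟨_, rfl⟩
    rw [← ht] at hat h100 hk ⊢
    have htr : (100:ℝ) ≤ t := by exact_mod_cast h100
    have hA8 : 1000 * (d + 1) ≤ A := 
      (Nat.mul_le_mul_left 1000 (Nat.le_self_pow two_ne_zero _)).trans hA
    have hexp : (A ^ 2 + 1) * d + 1 ≤ A ^ 6 := by
      have h1 : d + 1 ≤ A := by omega
      have h2 : A ^ 2 + 1 ≤ A ^ 5 := by
        have h3 : 1000 ≤ A := by omega
        calc A ^ 2 + 1 ≤ A ^ 2 * A ^ 1 := by nlinarith [sq_nonneg A]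
          _ = A ^ 3 := by ring
          _ ≤ A ^ 5 := Nat.pow_le_pow_right (by omega) (by omega)
      calc (A ^ 2 + 1) * d + 1 ≤ (A ^ 2 + 1) * (d + 1) := by nlinarith
        _ ≤ A ^ 5 * A := Nat.mul_le_mul h2 h1
        _ = A ^ 6 := by ring
    have hb : 2 * (2 * (2 * t ^ A ^ 2) + 1) ^ d ≤ t ^ ((A ^ 2 + 1) * d + 1) := by
      have h5 : 2 * (2 * t ^ A ^ 2) + 1 ≤ t ^ (A ^ 2 + 1) := by
        have h6 : 1 ≤ t ^ A ^ 2 := Nat.one_le_pow _ _ (by omega)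
        have h7 := Nat.mul_le_mul_left (t ^ A ^ 2) h100
        rw [pow_succ t]
        omega
      calc _ ≤ t * (t ^ (A ^ 2 + 1)) ^ d := Nat.mul_le_mul (by omega) (Nat.pow_le_pow_left h5 d)
        _ = _ := by rw [← pow_mul, pow_succ' t (_ * d)]
    have hb' : 2 * ((2 * (2 * t ^ A ^ 2) + 1 : ℕ) : ℝ) ^ d ≤ Real.exp t := by
      refine le_trans ?_ (hat.pow_le hexp)
      exact_mod_cast hb
    have h8 : 4 * (t:ℝ) ≤ t ^ 8 := by
      calc 4 * (t:ℝ) ≤ t ^ 1 * t := by rw [pow_one]; gcongr; linarith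
        _ = t ^ 2 := by ring
        _ ≤ t ^ 8 := pow_le_pow_right₀ (by linarith) (by norm_num)
    calc _ ≤ Real.exp t * Real.exp (-((t:ℝ) ^ 8 / 4)) ^ 2 := by gcongr
      _ = Real.exp (t - t ^ 8 / 2) := by
        rw [← Real.exp_nat_mul, ← Real.exp_add]; congr 1; push_cast; ring
      _ ≤ Real.exp (-t) := Real.exp_le_exp.2 (by linarith)
      _ ≤ (t:ℝ)⁻¹ := by
        rw [Real.exp_neg]
        exact inv_anti₀ (by linarith) (by linarith [Real.add_one_le_exp (t:ℝ)])
      _ ≤ (2 ^ (k + 2))⁻¹ := by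
        refine inv_anti₀ (by positivity) ?_
        exact_mod_cast (Nat.le_mul_of_pos_left _ hT1).trans hk
      _ = _ := by rw [one_div, inv_pow]
  hmτ := fun k => by
    have h1 : (sca A T (k + 2) : ℝ) ^ 8 ≤ sca A T (k + 3) := by
      have h100 := (S.at (k + 2)).large
      have := Nat.pow_le_pow_right (show 0 < sca A T (k + 2) by omega)
        (show 8 ≤ A by have := S.hA'; omega)
      rw [sca_succ A T (k + 2)]
      exact_mod_cast this
    refine Real.exp_le_exp.2 ?_
    have h0 : (0:ℝ) ≤ sca A T (k + 3) := Nat.cast_nonneg _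
    push_cast
    linarith
  hsm := fun k => by
    have h100 := (S.at (k + 2)).large
    have h1 := Nat.pow_le_pow_right (show 0 < sca A T (k + 2) by omega)
      (show 8 ≤ A by have := S.hA'; omega)
    rw [← sca_succ A T (k + 2)] at h1
    have h2 := S.sca_mono (show k + 2 + 1 ≤ k + 1 + 3 by omega)
    omega

lemma Setup.le_sca_self (S : Setup d X M A T δ) (k : ℕ) : k ≤ sca A T k := by
  have hT1 : 1 ≤ T := (Nat.one_le_pow _ _ (by norm_num)).trans S.h3
  exact (Nat.lt_two_pow_self.le.trans (Nat.le_mul_of_pos_left _ hT1)).trans (S.mul_two_pow_le_sca k)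

lemma Setup.exists_locLists (S : Setup d X M A T δ) {ω : Fin d → ℝ} {Tr : ℕ → ℝ → ℝ}
    (hTr : ∀ k x, |f x - Tr k x| ≤ Real.exp (-(sca A T (k + 2) : ℕ) ^ 9))
    (hsep : ∀ k, SepAt ω (sca A T k) 2)
    (hel : ∀ k, ω ∉ elimBad δ (Tr k) A (sca A T (k + 2))) (k : ℕ) :
    ∃ w : Fin (2 * (2 * (2 * sca A T (k + 3)) + 1) ^ d) → ((Fin d → ℤ) → ℂ) × ℝ,
      ∀ N, LocList δ (fun n => f (dotw ω n)) (2 * sca A T (k + 3)) (sca A T (k + 2) ^ 8)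
        ((1 / 2) ^ (k + 1)) (δ * 3 ^ d + X.C) N w := by
  have R := S.radii
  have hEb : ∀ n, δ * 3 ^ d + |f (dotw ω n)| ≤ δ * 3 ^ d + X.C := by
    intro n
    have h1 := X.bdd (dotw ω n : ℝ) (by simp [strip, X.hρ])
    rw [X.real, Complex.norm_real, Real.norm_eq_abs] at h1
    linarith
  obtain ⟨w, hw⟩ := exists_limit_locList (N := fun i => 2 * sca A T (k + i + 1 + 3))
    (fun i j h => Nat.mul_le_mul_left 2 (S.sca_mono (by omega)))
    fun i => exists_locList R S.hδ.le hEb (Nat.le_add_right k i) fun k' hk' E φ hφ heq => by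
      refine (S.dichotomy (k := k') hsep (hTr k') (hel k') (E := E)
        ((S.sca_mono (show k' + 3 ≤ k + i + 1 + 3 by omega)).trans
        (Nat.le_mul_of_pos_left _ two_pos)) hφ ?_)
      simpa only [pot, zero_add] using heq
  refine ⟨w, fun N => (hw N).mono ?_⟩
  have := S.le_sca_self (k + N + 1 + 3)
  omega

lemma Setup.localization (S : Setup d X M A T δ) : ∃ Ω : Set (Fin d → ℝ), Ω ⊆ Set.Icc 0 1 ∧
    volume Ω ≤ ENNReal.ofReal (4 / T) ∧ ∀ ω ∈ Set.Icc (0 : Fin d → ℝ) 1 \ Ω,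
      ∃ (ι : Type) (v : HilbertBasis ι ℂ (lp (fun _ : Fin d → ℤ => ℂ) 2)), ∀ i : ι, ∃ E : ℝ,
        LatticeEigenEq d (fun n => δ⁻¹ * f (dotw ω n)) (v i) E ∧ ExpDecayLattice d (v i) := by
  obtain ⟨Tr, Ω, hΩ, hvol, hTr, h⟩ := S.exists_exceptional
  refine ⟨Ω, hΩ, hvol, fun ω hω => ?_⟩
  choose w hw using S.exists_locLists hTr (h ω hω).1 (h ω hω).2
  refine exists_hilbertBasis_of_locList S.hd S.hδ.ne' (tendsto_atTop_mono (fun k => ?_) tendsto_id) hw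
  exact (show k ≤ k + 2 by omega).trans
    ((S.le_sca_self (k + 2)).trans (Nat.le_self_pow (by norm_num) _))

end AL

theorem anderson_localization_one_frequency_lattice
    (d : ℕ) (hd : 1 ≤ d) (f : ℝ → ℝ)
    (hf_an : ∀ x, AnalyticAt ℝ f x) (hf_per : ∀ x : ℝ, f (x + 1) = f x)
    (hf_nonconst : ∃ x y, f x ≠ f y)
    (ε : ℝ) (hε : 0 < ε) :
    ∃ lam₀ : ℝ, ∀ lam : ℝ, lam₀ < lam →
      ∃ Ω : Set (Fin d → ℝ), Ω ⊆ Set.Icc 0 1 ∧ volume Ω < ENNReal.ofReal ε ∧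
        ∀ ω ∈ Set.Icc (0 : Fin d → ℝ) 1 \ Ω,
          ∃ (ι : Type) (v : HilbertBasis ι ℂ (lp (fun _ : Fin d → ℤ => ℂ) 2)), ∀ i : ι,
            ∃ E : ℝ,
              LatticeEigenEq d (fun n => lam * f (∑ j, (n j : ℝ) * ω j)) (v i) E ∧
              ExpDecayLattice d (v i) := by
  obtain ⟨F, ρ, hρ, C, hC, hdiff, hreal, hper, hbdd, hlip⟩ :=
    AL.exists_strip_extension f hf_an hf_per
  obtain ⟨X, rfl⟩ : ∃ X : AL.Ext f, X.F = F := ⟨⟨F, ρ, C, hρ, hC, hdiff, hreal, hbdd, hlip⟩, rfl⟩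
  obtain ⟨M, hM, hsub⟩ := AL.exists_sublevel X hf_an hf_nonconst
  have hfc : Continuous f := continuous_iff_continuousAt.2 fun x => (hf_an x).continuousAt
  obtain ⟨T₀, hT₀⟩ := eventually_atTop.1
    (AL.eventually_atScale d X hfc hf_per hper hM (1000 * (d + 1) ^ 2))
  obtain ⟨N, hN⟩ := exists_nat_gt (4 / ε)
  obtain ⟨T, hT⟩ : ∃ T, T = max T₀ (max N (3 ^ d)) := ⟨_, rfl⟩
  have hc : 0 < Real.exp (-((AL.sca (1000 * (d + 1) ^ 2) T 1 : ℕ) ^ 2)) / 2 := by positivity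
  refine ⟨3 ^ d * Real.exp 2 / (Real.exp (-((AL.sca (1000 * (d + 1) ^ 2) T 1 : ℕ) ^ 2)) / 2),
    fun lam hlam => ?_⟩
  have hlam0 : 0 < lam := lt_trans (by positivity) hlam
  have S : AL.Setup d X M (1000 * (d + 1) ^ 2) T lam⁻¹ :=
    { hd := hd
      hf := hf_per
      hM := hM
      hA := le_rfl
      hsub := hsub
      h3 := by omega
      hT := fun t ht => hT₀ t (by omega)
      hδ := inv_pos.2 hlam0
      hδT := by
        rw [div_lt_iff₀ hc] at hlam
        rw [mul_assoc, inv_mul_le_iff₀ hlam0]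
        exact hlam.le }
  obtain ⟨Ω, hΩ, hvol, h⟩ := S.localization
  have hNT : (N:ℝ) ≤ T := by exact_mod_cast (show N ≤ T by omega)
  have hT0 : (0:ℝ) < T := lt_of_lt_of_le (lt_trans (by positivity) hN) hNT
  refine ⟨Ω, hΩ, hvol.trans_lt ((ENNReal.ofReal_lt_ofReal_iff hε).2 ?_), fun ω hω => ?_⟩
  · rw [div_lt_iff₀ hε] at hN
    rw [div_lt_iff₀ hT0]
    nlinarith
  · have h1 := h ω hω
    rw [inv_inv] at h1
    exact h1
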